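/- Let 1 < p, q ≤ ∞ be exponents, define r by 1/r = 1/p + 1/q, and assume 0 < 1/r < 3/2. Let Ψ be a Schwartz function on ℝ with ∫_ℝ Ψ(y) dy = 0 (i.e. Ψ̂(0) = 0). Then there exists a constant c = c(p, q, r, Ψ) such that for all Schwartz functions f, g on ℝ, ‖ ( Σ_{n∈ℤ} | ∫_ℝ f(x−y) g(x+y) Ψ(y/2^n) 2^{−n} dy |² )^{1/2} ‖_{L^r(ℝ)} ≤ c ‖f‖_{L^p(ℝ)} ‖g‖_{L^q(ℝ)}. -/

import Mathlib

open MeasureTheory Real Set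
open scoped ENNReal

namespace BSF

open scoped InnerProductSpace

/-- A time-frequency tile: spatial interval `[2^n m, 2^n (m+1))`, frequency about `2^{-n} k`. -/
structure Tile where
  n : ℤ
  m : ℤ
  k : ℤ

/-- The dyadic interval `[2^n m, 2^n (m+1))`. -/
def dya (n m : ℤ) : Set ℝ := Ico ((2 : ℝ) ^ n * m) ((2 : ℝ) ^ n * (m + 1))

namespace Tile

noncomputable def len (P : Tile) : ℝ := (2 : ℝ) ^ P.n

def I (P : Tile) : Set ℝ := dya P.n P.m

/-- The normalized distance weight of the spatial interval of a tile. -/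
noncomputable def rho (P : Tile) (x : ℝ) : ℝ := 1 + |x / (2 : ℝ) ^ P.n - P.m|

/-- The frequency of the tree whose top is the tile. -/
noncomputable def xi (T : Tile) : ℝ := (T.k + 5) / (2 : ℝ) ^ T.n

/-- The tile `P` belongs to the (fat) tree with top `T`. -/
def Fat (T P : Tile) : Prop := P.I ⊆ T.I ∧ |(2 : ℝ) ^ P.n * T.xi - P.k| ≤ 100

/-- The tile `P`, with frequency offset `c`, lies in the lacunary tree with top `T` on the side
given by the sign `ε`. -/
def Lac (c : ℤ) (ε : ℝ) (T P : Tile) : Prop :=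
  Fat T P ∧ 4 ≤ ε * ((2 : ℝ) ^ P.n * T.xi - P.k - c)

/-- The frequency of a tile with offset `c`. -/
noncomputable def zeta (c : ℤ) (P : Tile) : ℝ := (P.k + c) / (2 : ℝ) ^ P.n

lemma len_pos (P : Tile) : 0 < P.len := by unfold len; positivity

lemma one_le_rho (P : Tile) (x : ℝ) : 1 ≤ P.rho x := by
  unfold rho; linarith [abs_nonneg (x / (2 : ℝ) ^ P.n - P.m)]

lemma rho_pos (P : Tile) (x : ℝ) : 0 < P.rho x := lt_of_lt_of_le one_pos (P.one_le_rho x)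

end Tile

/-- Scales and frequencies in the collection are sparse. -/
def Thin (𝔓 : Finset Tile) : Prop :=
  ∀ P ∈ 𝔓, ∀ P' ∈ 𝔓, (P'.n < P.n → P'.n + 10 ≤ P.n) ∧ (P.n = P'.n → (4 : ℤ) ∣ P.k - P'.k)

lemma two_zpow_le {a b : ℤ} (h : a ≤ b) : (2 : ℝ) ^ a ≤ 2 ^ b :=
  zpow_le_zpow_right₀ (by norm_num) h

lemma mem_dya {n m : ℤ} {x : ℝ} : x ∈ dya n m ↔ ⌊x / (2 : ℝ) ^ n⌋ = m := by
  have h : (0 : ℝ) < 2 ^ n := by positivity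
  rw [dya, mem_Ico, Int.floor_eq_iff, le_div_iff₀ h, div_lt_iff₀ h, mul_comm (m : ℝ), mul_comm ((m : ℝ) + 1)]

lemma left_mem_dya (n m : ℤ) : (2 : ℝ) ^ n * m ∈ dya n m := by
  have h : (0 : ℝ) < 2 ^ n := by positivity
  constructor <;> nlinarith

/-- Dyadic intervals are nested or disjoint. -/
lemma dya_subset_of_le {n m n' m' : ℤ} (h : n' ≤ n) {x : ℝ} (hx : x ∈ dya n m)
    (hx' : x ∈ dya n' m') : dya n' m' ⊆ dya n m := by
  intro y hy
  rw [mem_dya] at *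
  obtain ⟨d, rfl⟩ : ∃ d : ℕ, n = n' + d := ⟨(n - n').toNat, by omega⟩
  have key : ∀ z : ℝ, z / (2 : ℝ) ^ (n' + d) = z / 2 ^ n' / ((2 ^ d : ℕ) : ℝ) := by
    intro z
    rw [zpow_add₀ (by norm_num), div_div]; push_cast; simp
  rw [key, Int.floor_div_natCast] at *
  rw [hy, ← hx', hx]

lemma dya_disjoint {n m m' : ℤ} (h : m ≠ m') : Disjoint (dya n m) (dya n m') := by
  rw [Set.disjoint_left]
  intro x hx hx'
  rw [mem_dya] at *
  exact h (hx.symm.trans hx')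

lemma volume_dya (n m : ℤ) : volume (dya n m) = ENNReal.ofReal ((2 : ℝ) ^ n) := by
  rw [dya, Real.volume_Ico]; congr 1; ring

open Classical in
/-- The greedy selection of trees. The order property makes the selected trees essentially
disjoint. -/
lemma exists_selection (lac fat : Tile → Tile → Prop) (hlf : ∀ T P, lac T P → fat T P)
    (key w thr : Tile → ℝ) (hthr : ∀ T, 0 ≤ thr T) (hw : ∀ P, 0 ≤ w P) (𝔓 : Finset Tile) (Q : Finset Tile) :
    ∃ (S : Finset Tile) (D : Tile → Finset Tile), S ⊆ 𝔓 ∧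
      (∀ T ∈ S, D T ⊆ Q ∧ (∀ P ∈ D T, lac T P) ∧ thr T < ∑ P ∈ D T, w P) ∧
      (∀ T ∈ S, ∀ T' ∈ S, T ≠ T' → Disjoint (D T) (D T')) ∧
      (∀ T ∈ S, ∀ T' ∈ S, T ≠ T' → (∀ P ∈ D T', ¬ fat T P) ∨ key T' ≤ key T) ∧
      (∀ T ∈ 𝔓, ∑ P ∈ Q with lac T P ∧ ∀ T' ∈ S, ¬ fat T' P, w P ≤ thr T) := by
  induction Q using Finset.strongInduction with
  | H Q ih =>
    by_cases hne : ∃ T ∈ 𝔓, thr T < ∑ P ∈ Q with lac T P, w P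
    swap
    · push Not at hne
      exact ⟨∅, fun _ => ∅, by simp, by simp, by simp, by simp, by simpa using hne⟩
    have hE : (𝔓.filter fun T => thr T < ∑ P ∈ Q with lac T P, w P).Nonempty := by
      obtain ⟨T, h1, h2⟩ := hne
      exact ⟨T, by simp [h1, h2]⟩
    obtain ⟨T₀, hT₀, hmin⟩ := Finset.exists_min_image _ key hE
    rw [Finset.mem_filter] at hT₀
    have hsub : Q.filter (fun P => ¬ fat T₀ P) ⊂ Q := by
      refine Finset.filter_ssubset.2 ?_
      by_contra hcon
      push Not at hcon
      have : (Q.filter fun P => lac T₀ P) = ∅ := by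
        ext P; simp only [Finset.mem_filter, Finset.notMem_empty, iff_false, not_and]
        exact fun hP hl => hcon P hP (hlf _ _ hl)
      rw [this, Finset.sum_empty] at hT₀
      exact absurd hT₀.2 (not_lt.2 (hthr T₀))
    obtain ⟨S, D, h1, h2, h3, h4, h5⟩ := ih _ hsub
    have hfat : ∀ T ∈ S, ∀ P ∈ D T, P ∈ Q ∧ ¬ fat T₀ P := fun T hT P hP => by
      simpa using (h2 T hT).1 hP
    have hnot : T₀ ∉ S := by
      intro hmem
      obtain ⟨-, b, c⟩ := h2 T₀ hmem
      have : D T₀ = ∅ := Finset.eq_empty_of_forall_notMem fun P hP =>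
        (hfat T₀ hmem P hP).2 (hlf _ _ (b P hP))
      rw [this, Finset.sum_empty] at c
      exact absurd c (not_lt.2 (hthr T₀))
    have hkey : ∀ T ∈ S, key T₀ ≤ key T := fun T hT => by
      refine hmin T (Finset.mem_filter.2 ⟨h1 hT, ((h2 T hT).2.2).trans_le ?_⟩)
      refine Finset.sum_le_sum_of_subset_of_nonneg (fun P hP => ?_) fun P _ _ => hw P
      exact Finset.mem_filter.2 ⟨(hfat T hT P hP).1, (h2 T hT).2.1 P hP⟩
    have hne' : ∀ T ∈ S, T ≠ T₀ := fun T hT h => hnot (h ▸ hT)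
    refine ⟨insert T₀ S, fun T => if T = T₀ then Q.filter (fun P => lac T₀ P) else D T,
      ?_, ?_, ?_, ?_, ?_⟩
    · exact Finset.insert_subset hT₀.1 h1
    · intro T hT
      rcases Finset.mem_insert.1 hT with rfl | hT
      · simp only [if_true]
        exact ⟨Finset.filter_subset _ _, fun P hP => (Finset.mem_filter.1 hP).2, hT₀.2⟩
      · simp only [hne' T hT, if_false]
        exact ⟨(h2 T hT).1.trans (Finset.filter_subset _ _), (h2 T hT).2⟩
    · have aux : ∀ T ∈ S, Disjoint (Q.filter fun P => lac T₀ P) (D T) := fun T hT => by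
        refine Finset.disjoint_left.2 fun P hP hP' => ?_
        exact (hfat T hT P hP').2 (hlf _ _ (Finset.mem_filter.1 hP).2)
      intro T hT T' hT' hTT'
      rcases Finset.mem_insert.1 hT with rfl | hT1
      · rcases Finset.mem_insert.1 hT' with rfl | hT'
        · exact absurd rfl hTT'
        · simpa [hne' T' hT'] using aux T' hT'
      · rcases Finset.mem_insert.1 hT' with rfl | hT'
        · simpa [hne' T hT1] using (aux T hT1).symm
        · simpa [hne' T hT1, hne' T' hT'] using h3 T hT1 T' hT' hTT'
    · intro T hT T' hT' hTT'
      rcases Finset.mem_insert.1 hT with rfl | hT1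
      · rcases Finset.mem_insert.1 hT' with rfl | hT'
        · exact absurd rfl hTT'
        · left
          simp only [hne' T' hT', if_false]
          exact fun P hP => (hfat T' hT' P hP).2
      · rcases Finset.mem_insert.1 hT' with rfl | hT'
        · exact Or.inr (hkey T hT1)
        · simpa [hne' T' hT'] using h4 T hT1 T' hT' hTT'
    · intro T hT
      refine le_trans (le_of_eq (Finset.sum_congr ?_ fun _ _ => rfl)) (h5 T hT)
      ext P
      simp only [Finset.mem_filter, Finset.mem_insert, forall_eq_or_imp]
      tauto

/-- A bound for the sums `∑ (1 + |y - m|)⁻²` over integers `m`. -/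
noncomputable def cZ : ℝ := 4 * ∑' j : ℤ, ((1 + |(j : ℝ)|) ^ 2)⁻¹

lemma summable_int_weight : Summable fun j : ℤ => ((1 + |(j : ℝ)|) ^ 2)⁻¹ := by
  have h : Summable fun j : ℤ => 1 / (j : ℝ) ^ 2 := Real.summable_one_div_int_pow.2 (by norm_num)
  refine Summable.of_norm_bounded_eventually (g := fun j : ℤ => 1 / (j : ℝ) ^ 2) h ?_
  rw [Filter.eventually_cofinite]
  refine (Set.finite_singleton (0 : ℤ)).subset fun j hj => ?_
  by_contra hne
  refine hj ?_
  have hj0 : (0 : ℝ) < |(j : ℝ)| := abs_pos.2 (by exact_mod_cast hne)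
  rw [Real.norm_of_nonneg (by positivity), one_div]
  rw [← sq_abs (j : ℝ)]
  apply inv_anti₀ (by positivity)
  nlinarith

lemma cZ_nonneg : 0 ≤ cZ := by
  exact mul_nonneg (by norm_num) (tsum_nonneg fun j => by positivity)

lemma sum_int_weight_le (M : Finset ℤ) (y : ℝ) : ∑ m ∈ M, ((1 + |y - m|) ^ 2)⁻¹ ≤ cZ := by
  have h1 : ∀ m ∈ M, ((1 + |y - m|) ^ 2)⁻¹ ≤ 4 * ((1 + |((m - ⌊y⌋ : ℤ) : ℝ)|) ^ 2)⁻¹ := by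
    intro m _
    have h0 : 1 + |((m - ⌊y⌋ : ℤ) : ℝ)| ≤ 2 * (1 + |y - m|) := by
      have h2 : |((m - ⌊y⌋ : ℤ) : ℝ)| ≤ |y - m| + 1 := by
        push_cast
        have : (m : ℝ) - ⌊y⌋ = (y - ⌊y⌋) - (y - m) := by ring
        rw [this]
        have h3 := abs_sub (y - ⌊y⌋) (y - m)
        have h4 : |y - ⌊y⌋| ≤ 1 := by
          rw [abs_le]; constructor <;> linarith [Int.floor_le y, Int.lt_floor_add_one y]
        linarith
      linarith [abs_nonneg (y - m)]
    rw [show (4 : ℝ) * ((1 + |((m - ⌊y⌋ : ℤ) : ℝ)|) ^ 2)⁻¹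
      = (((1 + |((m - ⌊y⌋ : ℤ) : ℝ)|) / 2) ^ 2)⁻¹ by field_simp; norm_num]
    apply inv_anti₀ (by positivity)
    apply pow_le_pow_left₀ (by positivity)
    linarith
  refine (Finset.sum_le_sum h1).trans ?_
  rw [← Finset.mul_sum, cZ]
  refine mul_le_mul_of_nonneg_left ?_ (by norm_num)
  have h2 : ∑ m ∈ M, ((1 + |((m - ⌊y⌋ : ℤ) : ℝ)|) ^ 2)⁻¹
      = ∑ j ∈ M.map (Equiv.subRight ⌊y⌋).toEmbedding, ((1 + |(j : ℝ)|) ^ 2)⁻¹ := by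
    rw [Finset.sum_map]; simp
  rw [h2]
  exact summable_int_weight.sum_le_tsum _ fun j _ => by positivity

open Classical in
/-- Tiles of a fixed scale in a fat tree: there are at most `201` frequencies per position. -/
lemma Tile.sum_fiber_le {T : Tile} {F : Finset Tile} (hF : ∀ P ∈ F, T.Fat P) (n : ℤ)
    {u : ℤ → ℝ} (hu : ∀ m, 0 ≤ u m) :
    ∑ P ∈ F with P.n = n, u P.m ≤ 201 * ∑ m ∈ (F.filter fun P => P.n = n).image Tile.m, u m := by
  set G := F.filter fun P => P.n = n
  set y : ℝ := (2 : ℝ) ^ n * T.xi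
  set K := Finset.Icc ⌈y - 100⌉ ⌊y + 100⌋
  have hK : (K.card : ℝ) ≤ 201 := by
    have : (K.card : ℤ) ≤ 201 := by
      have h1 : ⌊y + 100⌋ ≤ ⌈y - 100⌉ + 200 := by
        have := Int.floor_le (y + 100)
        have h2 := Int.le_ceil (y - 100)
        have : ((⌊y + 100⌋ : ℤ) : ℝ) ≤ ((⌈y - 100⌉ + 200 : ℤ) : ℝ) := by push_cast; linarith
        exact_mod_cast this
      rw [Int.card_Icc]; omega
    exact_mod_cast this
  have h1 : ∑ P ∈ G, u P.m ≤ ∑ q ∈ K ×ˢ G.image Tile.m, u q.2 := by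
    rw [← Finset.sum_image (f := fun q : ℤ × ℤ => u q.2) (g := fun P : Tile => (P.k, P.m))]
    · refine Finset.sum_le_sum_of_subset_of_nonneg ?_ fun _ _ _ => hu _
      intro q hq
      obtain ⟨P, hP, rfl⟩ := Finset.mem_image.1 hq
      refine Finset.mem_product.2 ⟨?_, Finset.mem_image_of_mem _ hP⟩
      obtain ⟨hPF, hn⟩ := Finset.mem_filter.1 hP
      have := (hF P hPF).2
      rw [hn, abs_le] at this
      refine Finset.mem_Icc.2 ⟨Int.ceil_le.2 ?_, Int.le_floor.2 ?_⟩ <;> linarith [this.1, this.2]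
    · intro P hP Q hQ h
      have e1 := (Finset.mem_filter.1 hP).2
      have e2 := (Finset.mem_filter.1 hQ).2
      cases P; cases Q; simp_all
  refine h1.trans ?_
  rw [Finset.sum_product]
  simp only [Finset.sum_const, nsmul_eq_mul]
  exact mul_le_mul_of_nonneg_right hK (Finset.sum_nonneg fun m _ => hu m)

lemma dya_subset_iff_le {n m n' m' : ℤ} (h : dya n' m' ⊆ dya n m) : n' ≤ n := by
  have h1 := measure_mono (μ := volume) h
  rw [volume_dya, volume_dya, ENNReal.ofReal_le_ofReal_iff (by positivity)] at h1
  exact (zpow_le_zpow_iff_right₀ (by norm_num)).1 h1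

lemma Tile.Fat.n_le {T P : Tile} (h : T.Fat P) : P.n ≤ T.n := dya_subset_iff_le h.1

open Classical in
lemma Tile.sum_rho_le {T : Tile} {F : Finset Tile} (hF : ∀ P ∈ F, T.Fat P) (x : ℝ)
    {γ : ℤ → ℝ} (hγ : ∀ n, 0 ≤ γ n) :
    ∑ P ∈ F, γ P.n * (P.rho x ^ 2)⁻¹ ≤ 201 * cZ * ∑ n ∈ F.image Tile.n, γ n := by
  rw [← Finset.sum_fiberwise_of_maps_to (g := Tile.n) (t := F.image Tile.n)
    (fun P hP => Finset.mem_image_of_mem _ hP), Finset.mul_sum]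
  refine Finset.sum_le_sum fun n _ => ?_
  have : ∑ P ∈ F with P.n = n, γ P.n * (P.rho x ^ 2)⁻¹
      = γ n * ∑ P ∈ F with P.n = n, ((1 + |x / (2 : ℝ) ^ n - P.m|) ^ 2)⁻¹ := by
    rw [Finset.mul_sum]
    refine Finset.sum_congr rfl fun P hP => ?_
    have := (Finset.mem_filter.1 hP).2
    rw [Tile.rho, this]
  rw [this]
  have h2 := Tile.sum_fiber_le hF n
    (u := fun m => ((1 + |x / (2 : ℝ) ^ n - m|) ^ 2)⁻¹) (fun m => by positivity)
  have h3 := sum_int_weight_le ((F.filter fun P => P.n = n).image Tile.m) (x / (2 : ℝ) ^ n)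
  have h4 := hγ n
  nlinarith

lemma sum_two_zpow_le {N : Finset ℤ} {n₀ : ℤ} (h : ∀ n ∈ N, n ≤ n₀) :
    ∑ n ∈ N, (2 : ℝ) ^ n ≤ 2 * 2 ^ n₀ := by
  have h1 : ∀ n ∈ N, (2 : ℝ) ^ n = 2 ^ n₀ * (1 / 2) ^ (n₀ - n).toNat := by
    intro n hn
    have : n = n₀ - ((n₀ - n).toNat : ℤ) := by have := h n hn; omega
    conv_lhs => rw [this]
    rw [zpow_sub₀ (by norm_num), zpow_natCast]; simp [div_eq_mul_inv]
  rw [Finset.sum_congr rfl h1, ← Finset.mul_sum, mul_comm]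
  refine mul_le_mul_of_nonneg_right ?_ (by positivity)
  rw [← Finset.sum_image (f := fun j : ℕ => (1 / 2 : ℝ) ^ j) (g := fun n : ℤ => (n₀ - n).toNat)]
  · have := (summable_geometric_two).sum_le_tsum (N.image fun n : ℤ => (n₀ - n).toNat)
      (fun _ _ => by positivity)
    rwa [tsum_geometric_two] at this
  · intro a ha b hb hab
    have := h a ha; have := h b hb
    simp only at hab
    omega

lemma sum_two_zpow_neg_le {N : Finset ℤ} {n₀ : ℤ} (h : ∀ n ∈ N, n₀ ≤ n) :
    ∑ n ∈ N, ((2 : ℝ) ^ n)⁻¹ ≤ 2 * (2 ^ n₀)⁻¹ := by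
  have h1 := sum_two_zpow_le (N := N.image fun n => -n) (n₀ := -n₀) (by
    intro n hn; obtain ⟨a, ha, rfl⟩ := Finset.mem_image.1 hn; have := h a ha; omega)
  rw [Finset.sum_image (fun a _ b _ hab => by simpa using hab)] at h1
  simpa [zpow_neg] using h1

open Classical in
/-- The number of tiles of each scale in a fat tree. -/
lemma Tile.sum_len_fiber_le {T : Tile} {F : Finset Tile} (hF : ∀ P ∈ F, T.Fat P) (n : ℤ) :
    ∑ P ∈ F with P.n = n, P.len ≤ 201 * T.len := by
  have h1 := Tile.sum_fiber_le hF n (u := fun _ => (2 : ℝ) ^ n) (fun _ => by positivity)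
  have h2 : ∑ P ∈ F with P.n = n, P.len = ∑ P ∈ F with P.n = n, (2 : ℝ) ^ n :=
    Finset.sum_congr rfl fun P hP => by rw [Tile.len, (Finset.mem_filter.1 hP).2]
  rw [h2]
  refine h1.trans (mul_le_mul_of_nonneg_left ?_ (by norm_num))
  set M := (F.filter fun P => P.n = n).image Tile.m
  have h3 : volume (⋃ m ∈ M, dya n m) = ∑ m ∈ M, volume (dya n m) :=
    measure_biUnion_finset (fun a _ b _ hab => dya_disjoint hab) fun _ _ => measurableSet_Ico
  have h4 : volume (⋃ m ∈ M, dya n m) ≤ volume T.I := by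
    refine measure_mono (iUnion₂_subset fun m hm => ?_)
    obtain ⟨P, hP, rfl⟩ := Finset.mem_image.1 hm
    obtain ⟨hPF, rfl⟩ := Finset.mem_filter.1 hP
    exact (hF P hPF).1
  rw [h3] at h4
  simp only [volume_dya, Tile.I] at h4
  rw [← ENNReal.ofReal_sum_of_nonneg (fun _ _ => by positivity),
    ENNReal.ofReal_le_ofReal_iff (by positivity)] at h4
  exact h4

/-- Comparison of weights at two points. -/
lemma Tile.rho_le_mul (P : Tile) (x t : ℝ) :
    P.rho t ≤ P.rho x * (1 + |x / (2 : ℝ) ^ P.n - t / (2 : ℝ) ^ P.n|) := by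
  have h : P.rho t ≤ P.rho x + |x / (2 : ℝ) ^ P.n - t / (2 : ℝ) ^ P.n| := by
    unfold rho
    have := abs_add_le (x / (2 : ℝ) ^ P.n - P.m) (-(x / (2 : ℝ) ^ P.n - t / (2 : ℝ) ^ P.n))
    rw [abs_neg] at this
    have e : x / (2 : ℝ) ^ P.n - P.m + -(x / (2 : ℝ) ^ P.n - t / (2 : ℝ) ^ P.n)
      = t / (2 : ℝ) ^ P.n - P.m := by ring
    rw [e] at this; linarith
  nlinarith [P.one_le_rho x, abs_nonneg (x / (2 : ℝ) ^ P.n - t / (2 : ℝ) ^ P.n)]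

lemma Tile.rho_le_add (P : Tile) (x t : ℝ) : P.rho t ≤ P.rho x + |x - t| / P.len := by
  unfold rho len
  have hp : (0 : ℝ) < 2 ^ P.n := by positivity
  have e : |x - t| / (2 : ℝ) ^ P.n = |x / (2 : ℝ) ^ P.n - t / (2 : ℝ) ^ P.n| := by
    rw [← sub_div, abs_div, abs_of_pos hp]
  rw [e]
  have := abs_add_le (x / (2 : ℝ) ^ P.n - P.m) (-(x / (2 : ℝ) ^ P.n - t / (2 : ℝ) ^ P.n))
  rw [abs_neg] at this
  have e : x / (2 : ℝ) ^ P.n - P.m + -(x / (2 : ℝ) ^ P.n - t / (2 : ℝ) ^ P.n)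
    = t / (2 : ℝ) ^ P.n - P.m := by ring
  rw [e] at this; linarith

/-- The mass of the weight `(1 + |x|)⁻²`. -/
noncomputable def cR : ℝ := ∫ x : ℝ, ((1 + |x|) ^ 2)⁻¹

lemma integrable_weight : Integrable fun x : ℝ => ((1 + |x|) ^ 2)⁻¹ := by
  have h := integrable_one_add_norm (E := ℝ) (μ := volume) (r := 2) (by simp)
  refine h.congr (Filter.Eventually.of_forall fun x => ?_)
  simp only [Real.norm_eq_abs]
  rw [rpow_neg (by positivity)]
  norm_cast

lemma cR_nonneg : 0 ≤ cR := integral_nonneg fun x => by positivity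

lemma integrable_weight_scaled {s : ℝ} (hs : 0 < s) (a : ℝ) :
    Integrable fun x : ℝ => ((1 + |x - a| / s) ^ 2)⁻¹ := by
  have h := (integrable_weight.comp_div hs.ne').comp_sub_right a
  refine h.congr (Filter.Eventually.of_forall fun x => ?_)
  simp [abs_div, abs_of_pos hs]

lemma integral_weight_scaled {s : ℝ} (hs : 0 < s) (a : ℝ) :
    ∫ x : ℝ, ((1 + |x - a| / s) ^ 2)⁻¹ = s * cR := by
  have h1 := integral_sub_right_eq_self (μ := volume) (fun x : ℝ => ((1 + |x| / s) ^ 2)⁻¹) a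
  rw [h1]
  have h2 := Measure.integral_comp_div (fun x : ℝ => ((1 + |x|) ^ 2)⁻¹) s
  simp only [abs_div, abs_of_pos hs, smul_eq_mul] at h2
  rw [h2, cR]

lemma lintegral_weight_scaled {s : ℝ} (hs : 0 < s) (a : ℝ) :
    ∫⁻ x : ℝ, ENNReal.ofReal ((1 + |x - a| / s) ^ 2)⁻¹ = ENNReal.ofReal (s * cR) := by
  rw [← ofReal_integral_eq_lintegral_ofReal (integrable_weight_scaled hs a)
    (Filter.Eventually.of_forall fun x => by positivity), integral_weight_scaled hs]

lemma Tile.measurable_rho (P : Tile) : Measurable P.rho := by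
  unfold rho; fun_prop

lemma Tile.left_mem (P : Tile) : P.len * P.m ∈ P.I := left_mem_dya _ _

lemma Tile.rho_eq (P : Tile) (x : ℝ) : P.rho x = 1 + |x - P.len * P.m| / P.len := by
  unfold rho len
  have hp : (0 : ℝ) < 2 ^ P.n := by positivity
  rw [← abs_of_pos hp, ← abs_div, abs_of_pos hp, sub_div, mul_div_cancel_left₀ _ hp.ne']

/-- The weights of a fat tree have small mass outside of the top interval. -/
lemma Tile.sum_lintegral_compl_le {T : Tile} {F : Finset Tile} (hF : ∀ P ∈ F, T.Fat P) :
    ∑ P ∈ F, ∫⁻ x in (T.I)ᶜ, ENNReal.ofReal (P.rho x ^ 4)⁻¹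
      ≤ ENNReal.ofReal (804 * cZ * cR * T.len) := by
  classical
  set a := T.len * T.m
  set b := T.len * (T.m + 1)
  set g : ℤ → ℝ → ℝ := fun n x => ((1 + |x - a| / 2 ^ n) ^ 2)⁻¹ + ((1 + |x - b| / 2 ^ n) ^ 2)⁻¹
  have hg : ∀ n x, 0 ≤ g n x := fun n x => by positivity
  have hgm : ∀ n, Measurable (g n) := fun n => by fun_prop
  have hgi : ∀ n, ∫⁻ x, ENNReal.ofReal (g n x) = ENNReal.ofReal (2 ^ n * (2 * cR)) := by
    intro n
    have hn : (0 : ℝ) < 2 ^ n := by positivity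
    have : ∀ x, ENNReal.ofReal (g n x) = ENNReal.ofReal ((1 + |x - a| / 2 ^ n) ^ 2)⁻¹
        + ENNReal.ofReal ((1 + |x - b| / 2 ^ n) ^ 2)⁻¹ := fun x =>
      ENNReal.ofReal_add (by positivity) (by positivity)
    simp_rw [this]
    rw [lintegral_add_left (by fun_prop), lintegral_weight_scaled hn, lintegral_weight_scaled hn,
      ← ENNReal.ofReal_add (mul_nonneg hn.le cR_nonneg) (mul_nonneg hn.le cR_nonneg)]
    congr 1; ring
  have hpt : ∀ x ∈ (T.I)ᶜ, ∀ P ∈ F, (P.rho x ^ 4)⁻¹ ≤ g P.n x * (P.rho x ^ 2)⁻¹ := by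
    intro x hx P hP
    have hl : P.len * P.m ∈ T.I := (hF P hP).1 P.left_mem
    have hp : 0 < P.len := P.len_pos
    rw [show (P.rho x ^ 4)⁻¹ = (P.rho x ^ 2)⁻¹ * (P.rho x ^ 2)⁻¹ by
      rw [← mul_inv]; ring_nf]
    refine mul_le_mul_of_nonneg_right ?_ (by positivity)
    have e1 : a ≤ P.len * P.m := hl.1
    have e2 : P.len * P.m < b := hl.2
    rcases lt_or_ge x a with h | h
    · refine le_trans ?_ (le_add_of_nonneg_right (by positivity))
      rw [P.rho_eq]
      apply inv_anti₀ (by positivity)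
      apply pow_le_pow_left₀ (by positivity)
      change 1 + |x - a| / P.len ≤ _
      have key : |x - a| ≤ |x - P.len * P.m| := by
        rw [abs_of_nonpos (by linarith), abs_of_nonpos (by linarith)]
        linarith
      linarith [div_le_div_of_nonneg_right key hp.le]
    · have h' : b ≤ x := by
        by_contra hlt
        exact hx ⟨h, not_le.1 hlt⟩
      refine le_trans ?_ (le_add_of_nonneg_left (by positivity))
      rw [P.rho_eq]
      apply inv_anti₀ (by positivity)
      apply pow_le_pow_left₀ (by positivity)
      change 1 + |x - b| / P.len ≤ _
      have key : |x - b| ≤ |x - P.len * P.m| := by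
        rw [abs_of_nonneg (by linarith), abs_of_nonneg (by linarith)]
        linarith
      linarith [div_le_div_of_nonneg_right key hp.le]
  have hmeas : ∀ P ∈ F, Measurable fun x => ENNReal.ofReal (P.rho x ^ 4)⁻¹ := fun P _ => by
    have := P.measurable_rho
    fun_prop
  rw [← lintegral_finsetSum _ hmeas]
  calc ∫⁻ x in (T.I)ᶜ, ∑ P ∈ F, ENNReal.ofReal (P.rho x ^ 4)⁻¹
      ≤ ∫⁻ x in (T.I)ᶜ, ENNReal.ofReal (201 * cZ) * ∑ n ∈ F.image Tile.n, ENNReal.ofReal (g n x) := by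
        refine setLIntegral_mono' measurableSet_Ico.compl fun x hx => ?_
        rw [← ENNReal.ofReal_sum_of_nonneg (fun _ _ => by have := Tile.rho_pos ‹_› x; positivity),
          ← ENNReal.ofReal_sum_of_nonneg (fun n _ => hg n x),
          ← ENNReal.ofReal_mul (by have := cZ_nonneg; positivity)]
        apply ENNReal.ofReal_le_ofReal
        exact (Finset.sum_le_sum (hpt x hx)).trans (Tile.sum_rho_le hF x (fun n => hg n x))
    _ ≤ ∫⁻ x, ENNReal.ofReal (201 * cZ) * ∑ n ∈ F.image Tile.n, ENNReal.ofReal (g n x) :=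
        setLIntegral_le_lintegral _ _
    _ = ENNReal.ofReal (201 * cZ) * ∑ n ∈ F.image Tile.n, ENNReal.ofReal (2 ^ n * (2 * cR)) := by
        rw [lintegral_const_mul _ (by fun_prop), lintegral_finsetSum _ (fun n _ => by fun_prop)]
        simp_rw [hgi]
    _ ≤ _ := by
        have hc := cR_nonneg
        have hz := cZ_nonneg
        rw [← ENNReal.ofReal_sum_of_nonneg (fun _ _ => by positivity),
          ← ENNReal.ofReal_mul (by positivity), ← Finset.sum_mul]
        apply ENNReal.ofReal_le_ofReal
        have h2 := sum_two_zpow_le (N := F.image Tile.n) (n₀ := T.n) (by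
          intro n hn
          obtain ⟨P, hP, rfl⟩ := Finset.mem_image.1 hn
          exact (hF P hP).n_le)
        have h3 : 0 ≤ 201 * cZ * (2 * cR) := by positivity
        have := mul_le_mul_of_nonneg_left h2 h3
        unfold len
        linarith

/-- Two tiles of different scales with comparable frequencies in selected trees: the smaller one
lies spatially outside of the tree of the larger one. -/
lemma disjoint_of_selected {𝔓 : Finset Tile} (h𝔓 : Thin 𝔓) {c : ℤ} (hc : |c| ≤ 66) {ε : ℝ}
    (hε : |ε| = 1) {S : Finset Tile} {D : Tile → Finset Tile}
    (hD : ∀ T ∈ S, D T ⊆ 𝔓 ∧ ∀ P ∈ D T, Tile.Lac c ε T P)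
    (hord : ∀ T ∈ S, ∀ T' ∈ S, T ≠ T' → (∀ P ∈ D T', ¬ T.Fat P) ∨ ε * T'.xi ≤ ε * T.xi)
    {T T' P P' : Tile} (hT : T ∈ S) (hT' : T' ∈ S) (hP : P ∈ D T) (hP' : P' ∈ D T')
    (hn : P'.n < P.n) (hz : |P.zeta c - P'.zeta c| ≤ 2 / 2 ^ P'.n) : Disjoint P'.I T.I := by
  rw [Set.disjoint_left]
  intro x hx hxT
  have hn10 := (h𝔓 P ((hD T hT).1 hP) P' ((hD T' hT').1 hP')).1 hn
  have hL := (hD T hT).2 P hP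
  have hL' := (hD T' hT').2 P' hP'
  have hsub : P'.I ⊆ T.I := dya_subset_of_le (hn.le.trans hL.1.n_le) hxT hx
  have hq : (0 : ℝ) < 2 ^ P'.n := by positivity
  have hr : (0 : ℝ) < 2 ^ P.n := by positivity
  have hqr : 1024 * (2 : ℝ) ^ P'.n ≤ 2 ^ P.n := by
    have := two_zpow_le hn10
    rw [zpow_add₀ (by norm_num)] at this
    norm_num at this; linarith
  have hcr : |(c : ℝ)| ≤ 66 := by exact_mod_cast hc
  have h1 : |T.xi - P.zeta c| ≤ 166 / 2 ^ P.n := by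
    rw [le_div_iff₀ hr]
    rw [show |T.xi - P.zeta c| * (2 : ℝ) ^ P.n = |T.xi - P.zeta c| * |(2 : ℝ) ^ P.n| by rw [abs_of_pos hr]]
    rw [← abs_mul]
    have e : (T.xi - P.zeta c) * 2 ^ P.n = (2 ^ P.n * T.xi - P.k) + -(c : ℝ) := by
      unfold Tile.zeta; field_simp; ring
    rw [e]
    refine (abs_add_le _ _).trans ?_
    rw [abs_neg]; linarith [hL.1.2]
  have h2 : |2 ^ P'.n * (T.xi - P'.zeta c)| ≤ 2.2 := by
    rw [abs_mul, abs_of_pos hq]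
    have h3 : |T.xi - P'.zeta c| ≤ 166 / 2 ^ P.n + 2 / 2 ^ P'.n := by
      have : T.xi - P'.zeta c = (T.xi - P.zeta c) + (P.zeta c - P'.zeta c) := by ring
      rw [this]; exact (abs_add_le _ _).trans (add_le_add h1 hz)
    have h4 := mul_le_mul_of_nonneg_left h3 hq.le
    have h5 : (2 : ℝ) ^ P'.n * (166 / 2 ^ P.n + 2 / 2 ^ P'.n)
      = 166 * (2 ^ P'.n / 2 ^ P.n) + 2 := by field_simp
    have h6 : (2 : ℝ) ^ P'.n / 2 ^ P.n ≤ 1 / 1024 := by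
      rw [div_le_div_iff₀ hr (by norm_num)]; linarith
    rw [h5] at h4; linarith
  have h2' : (2 : ℝ) ^ P'.n * (T.xi - P'.zeta c) = 2 ^ P'.n * T.xi - P'.k - c := by
    unfold Tile.zeta; field_simp; ring
  have hfat : T.Fat P' := by
    refine ⟨hsub, ?_⟩
    have : (2 : ℝ) ^ P'.n * T.xi - P'.k = 2 ^ P'.n * (T.xi - P'.zeta c) + c := by rw [h2']; ring
    rw [this]
    refine (abs_add_le _ _).trans ?_
    linarith
  have h7 : |ε * (2 ^ P'.n * T.xi - P'.k - c)| ≤ 2.2 := by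
    rw [abs_mul, hε, one_mul, ← h2']; exact h2
  rw [abs_le] at h7
  have h8 : 4 ≤ ε * (2 ^ P'.n * T'.xi - P'.k - c) := hL'.2
  by_cases hTT : T = T'
  · subst hTT
    linarith [h7.2]
  · rcases hord T hT T' hT' hTT with h9 | h9
    · exact h9 P' hP' hfat
    · have := mul_le_mul_of_nonneg_left h9 hq.le
      nlinarith [h7.2]

/-- The weight of the tile `P` at the position of the tile `P'`. -/
noncomputable def Tile.wt (P P' : Tile) : ℝ := (P.rho (P'.len * P'.m) ^ 4)⁻¹

lemma Tile.wt_nonneg (P P' : Tile) : 0 ≤ P.wt P' := by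
  have := P.rho_pos (P'.len * P'.m); unfold wt; positivity

/-- Interacting frequencies. -/
def Tile.Near (c : ℤ) (P P' : Tile) : Prop :=
  |P.zeta c - P'.zeta c| < (2 ^ P.n)⁻¹ + ((2 : ℝ) ^ P'.n)⁻¹

lemma Tile.Near.symm {c : ℤ} {P P' : Tile} (h : P.Near c P') : P'.Near c P := by
  unfold Near at *; rw [abs_sub_comm]; linarith

lemma Tile.Near.k_eq {𝔓 : Finset Tile} (h𝔓 : Thin 𝔓) {c : ℤ} {P P' : Tile} (hP : P ∈ 𝔓)
    (hP' : P' ∈ 𝔓) (hn : P.n = P'.n) (h : |P.zeta c - P'.zeta c| < 4 / 2 ^ P'.n) : P.k = P'.k := by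
  unfold Tile.zeta at h
  have hp : (0 : ℝ) < 2 ^ P'.n := by positivity
  rw [hn, ← sub_div, abs_div, abs_of_pos hp, div_lt_div_iff_of_pos_right hp] at h
  have h1 : |((P.k - P'.k : ℤ) : ℝ)| < 4 := by
    push_cast
    rw [show (P.k : ℝ) - P'.k = (P.k + c) - (P'.k + c) by ring]
    exact h
  have h2 : |P.k - P'.k| < 4 := by exact_mod_cast h1
  obtain ⟨d, hd⟩ := (h𝔓 P hP P' hP').2 hn
  rw [abs_lt] at h2
  omega

open Classical in
lemma sum_same_scale_le {𝔓 : Finset Tile} (h𝔓 : Thin 𝔓) (c : ℤ) {P : Tile} (hP : P ∈ 𝔓) :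
    ∑ P' ∈ 𝔓 with P'.n = P.n ∧ P.Near c P', P.wt P' ≤ cZ := by
  set G := 𝔓.filter fun P' => P'.n = P.n ∧ P.Near c P'
  have hG : ∀ P' ∈ G, P'.n = P.n ∧ P'.k = P.k := fun P' h' => by
    obtain ⟨h1, h2, h3⟩ := Finset.mem_filter.1 h'
    refine ⟨h2, (Tile.Near.k_eq (c := c) h𝔓 hP h1 h2.symm (h3.trans_le ?_)).symm⟩
    rw [h2]
    have : (0 : ℝ) < (2 ^ P.n)⁻¹ := by positivity
    rw [div_eq_mul_inv]; linarith
  have h1 : ∀ P' ∈ G, P.wt P' ≤ ((1 + |(P.m : ℝ) - P'.m|) ^ 2)⁻¹ := by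
    intro P' h'
    unfold Tile.wt
    have hp := P.len_pos
    have : P.rho (P'.len * P'.m) = 1 + |(P.m : ℝ) - P'.m| := by
      rw [P.rho_eq]
      have : P'.len = P.len := by unfold Tile.len; rw [(hG P' h').1]
      rw [this, ← mul_sub, abs_mul, abs_of_pos hp, mul_div_cancel_left₀ _ hp.ne', abs_sub_comm]
    rw [this]
    apply inv_anti₀ (by positivity)
    exact pow_le_pow_right₀ (by linarith [abs_nonneg ((P.m : ℝ) - P'.m)]) (by norm_num)
  refine (Finset.sum_le_sum h1).trans ?_
  rw [← Finset.sum_image (f := fun j : ℤ => ((1 + |(P.m : ℝ) - j|) ^ 2)⁻¹) (g := Tile.m)]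
  · exact sum_int_weight_le _ _
  · intro a ha b hb hab
    have h2 := hG a ha
    have h3 := hG b hb
    cases a; cases b; simp_all

open Classical in
lemma sum_off_scale_le {𝔓 : Finset Tile} (h𝔓 : Thin 𝔓) {c : ℤ} (hc : |c| ≤ 66) {ε : ℝ}
    (hε : |ε| = 1) {S : Finset Tile} {D : Tile → Finset Tile}
    (hD : ∀ T ∈ S, D T ⊆ 𝔓 ∧ ∀ P ∈ D T, Tile.Lac c ε T P)
    (hord : ∀ T ∈ S, ∀ T' ∈ S, T ≠ T' → (∀ P ∈ D T', ¬ T.Fat P) ∨ ε * T'.xi ≤ ε * T.xi)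
    {T P : Tile} (hT : T ∈ S) (hP : P ∈ D T) :
    ENNReal.ofReal (∑ P' ∈ S.biUnion D with P'.n < P.n ∧ P.Near c P', P'.len * P.wt P')
      ≤ 16 * ∫⁻ x in (T.I)ᶜ, ENNReal.ofReal (P.rho x ^ 4)⁻¹ := by
  set G := (S.biUnion D).filter fun P' => P'.n < P.n ∧ P.Near c P'
  have hmem : ∀ P' ∈ G, ∃ T' ∈ S, P' ∈ D T' := fun P' h' => by
    simpa using (Finset.mem_filter.1 h').1
  have hinv : ∀ P' ∈ G, ((2 : ℝ) ^ P.n)⁻¹ ≤ (1 / 1024) * (2 ^ P'.n)⁻¹ := by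
    intro P' h'
    obtain ⟨T', hT', hP'⟩ := hmem P' h'
    have h1 := (h𝔓 P ((hD T hT).1 hP) P' ((hD T' hT').1 hP')).1 (Finset.mem_filter.1 h').2.1
    have h2 := two_zpow_le h1
    rw [zpow_add₀ (by norm_num)] at h2
    have hq : (0 : ℝ) < 2 ^ P'.n := by positivity
    rw [one_div, ← mul_inv]
    apply inv_anti₀ (by positivity)
    norm_num at h2; linarith
  have hdT : ∀ P' ∈ G, P'.I ⊆ (T.I)ᶜ := by
    intro P' h'
    obtain ⟨T', hT', hP'⟩ := hmem P' h'
    obtain ⟨-, h1, h2⟩ := Finset.mem_filter.1 h'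
    refine Set.subset_compl_iff_disjoint_right.2
      (disjoint_of_selected h𝔓 hc hε hD hord hT hT' hP hP' h1 (h2.le.trans ?_))
    have := hinv P' h'
    have : (0 : ℝ) < (2 ^ P'.n)⁻¹ := by positivity
    rw [div_eq_mul_inv]; linarith
  have hlt : ∀ P' ∈ G, ∀ P'' ∈ G, P''.n < P'.n → Disjoint P''.I P'.I := by
    intro P' h' P'' h'' hn
    obtain ⟨T', hT', hP'⟩ := hmem P' h'
    obtain ⟨T'', hT'', hP''⟩ := hmem P'' h''
    refine (disjoint_of_selected h𝔓 hc hε hD hord hT' hT'' hP' hP'' hn ?_).mono_right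
      ((hD T' hT').2 P' hP').1.1
    have a1 := (Finset.mem_filter.1 h').2.2.symm
    have a2 := (Finset.mem_filter.1 h'').2.2
    unfold Tile.Near at a1 a2
    have b1 := hinv P' h'
    have b2 := hinv P'' h''
    have h1 := (h𝔓 P' ((hD T' hT').1 hP') P'' ((hD T'' hT'').1 hP'')).1 hn
    have h2 := two_zpow_le h1
    rw [zpow_add₀ (by norm_num)] at h2
    have hq : (0 : ℝ) < 2 ^ P''.n := by positivity
    have h3 : ((2 : ℝ) ^ P'.n)⁻¹ ≤ (1 / 1024) * (2 ^ P''.n)⁻¹ := by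
      rw [one_div, ← mul_inv]
      apply inv_anti₀ (by positivity)
      norm_num at h2; linarith
    have : P'.zeta c - P''.zeta c = (P'.zeta c - P.zeta c) + (P.zeta c - P''.zeta c) := by ring
    rw [this, div_eq_mul_inv]
    refine (abs_add_le _ _).trans ?_
    have : (0 : ℝ) < (2 ^ P''.n)⁻¹ := by positivity
    linarith
  have hdisj : ∀ P' ∈ G, ∀ P'' ∈ G, P' ≠ P'' → Disjoint P'.I P''.I := by
    intro P' h' P'' h'' hne
    rcases lt_trichotomy P'.n P''.n with h | h | h
    · exact hlt P'' h'' P' h' h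
    · have hm : P'.m ≠ P''.m := by
        intro hm
        obtain ⟨T', hT', hP'⟩ := hmem P' h'
        obtain ⟨T'', hT'', hP''⟩ := hmem P'' h''
        have a1 := (Finset.mem_filter.1 h').2.2.symm
        have a2 := (Finset.mem_filter.1 h'').2.2
        unfold Tile.Near at a1 a2
        have b1 := hinv P' h'
        rw [h] at a1 b1
        have hk := Tile.Near.k_eq (c := c) h𝔓 ((hD T' hT').1 hP') ((hD T'' hT'').1 hP'') h (by
          have : P'.zeta c - P''.zeta c
            = (P'.zeta c - P.zeta c) + (P.zeta c - P''.zeta c) := by ring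
          rw [this, div_eq_mul_inv]
          refine (abs_add_le _ _).trans_lt ?_
          have : (0 : ℝ) < (2 ^ P''.n)⁻¹ := by positivity
          linarith)
        apply hne
        cases P'; cases P''; simp_all
      unfold Tile.I
      rw [h]
      exact dya_disjoint hm
    · exact (hlt P' h' P'' h'' h).symm
  rw [ENNReal.ofReal_sum_of_nonneg fun P' _ => mul_nonneg P'.len_pos.le (P.wt_nonneg P')]
  have hterm : ∀ P' ∈ G, ENNReal.ofReal (P'.len * P.wt P')
      ≤ ∫⁻ x in P'.I, 16 * ENNReal.ofReal (P.rho x ^ 4)⁻¹ := by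
    intro P' h'
    have e : ENNReal.ofReal (P'.len * P.wt P') = ∫⁻ x in P'.I, ENNReal.ofReal (P.wt P') := by
      rw [lintegral_const, Measure.restrict_apply_univ, Tile.I, volume_dya, mul_comm,
        ENNReal.ofReal_mul (P.wt_nonneg P'), Tile.len]
    rw [e]
    refine setLIntegral_mono' measurableSet_Ico fun x hx => ?_
    rw [show (16 : ℝ≥0∞) = ENNReal.ofReal 16 by simp, ← ENNReal.ofReal_mul (by norm_num)]
    apply ENNReal.ofReal_le_ofReal
    have h1 : P.rho x ≤ 2 * P.rho (P'.len * P'.m) := by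
      have h2 := P.rho_le_add (P'.len * P'.m) x
      have h3 : |P'.len * P'.m - x| / P.len ≤ 1 := by
        rw [div_le_one P.len_pos, abs_sub_comm, abs_of_nonneg (by unfold Tile.len; linarith [hx.1])]
        have := two_zpow_le (Finset.mem_filter.1 h').2.1.le
        have hx2 := hx.2
        unfold Tile.len; nlinarith
      linarith [P.one_le_rho (P'.len * P'.m)]
    have h0 := P.rho_pos x
    unfold Tile.wt
    rw [show (16 : ℝ) * (P.rho x ^ 4)⁻¹ = ((P.rho x / 2) ^ 4)⁻¹ by field_simp; norm_num]
    apply inv_anti₀ (by positivity)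
    exact pow_le_pow_left₀ (by positivity) (by linarith) 4
  refine (Finset.sum_le_sum hterm).trans ?_
  rw [← lintegral_biUnion_finset (fun a ha b hb hab => hdisj a ha b hb hab)
    (fun _ _ => measurableSet_Ico), ← lintegral_const_mul' _ _ (by simp)]
  exact lintegral_mono_set (iUnion₂_subset hdT)

/-- Almost orthogonality of wave packets: the Gram matrix decays in space, and vanishes for
separated frequencies. -/
structure GramBound {H : Type*} [NormedAddCommGroup H] [InnerProductSpace ℂ H] (c : ℤ) (C : ℝ)
    (𝔓 : Finset Tile) (v : Tile → H) : Prop where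
  bound : ∀ P ∈ 𝔓, ∀ P' ∈ 𝔓, P'.n ≤ P.n → ‖⟪v P, v P'⟫_ℂ‖ ≤ C * P.len⁻¹ * P.wt P'
  zero : ∀ P ∈ 𝔓, ∀ P' ∈ 𝔓, ¬ P.Near c P' → ⟪v P, v P'⟫_ℂ = 0

lemma norm_sum_sq_le {H : Type*} [NormedAddCommGroup H] [InnerProductSpace ℂ H] {ι : Type*}
    (A : Finset ι) (u : ι → H) : ‖∑ i ∈ A, u i‖ ^ 2 ≤ ∑ i ∈ A, ∑ j ∈ A, ‖⟪u i, u j⟫_ℂ‖ := by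
  have h : ((‖∑ i ∈ A, u i‖ ^ 2 : ℝ) : ℂ) = ∑ i ∈ A, ∑ j ∈ A, ⟪u i, u j⟫_ℂ := by
    have h0 := inner_self_eq_norm_sq_to_K (𝕜 := ℂ) (∑ i ∈ A, u i)
    rw [sum_inner] at h0
    simp_rw [inner_sum] at h0
    rw [h0, Complex.ofReal_pow]
    rfl
  have h2 : ‖((‖∑ i ∈ A, u i‖ ^ 2 : ℝ) : ℂ)‖ ≤ _ := (congrArg norm h).le
  rw [Complex.norm_real, Real.norm_of_nonneg (by positivity)] at h2
  refine h2.trans ((norm_sum_le _ _).trans (Finset.sum_le_sum fun i _ => norm_sum_le _ _))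

open Classical in
lemma GramBound.norm_sum_sq_le {H : Type*} [NormedAddCommGroup H] [InnerProductSpace ℂ H] {c : ℤ}
    {C : ℝ} {𝔓 𝔔 : Finset Tile} {v : Tile → H} (h : GramBound c C 𝔓 v) (hC : 0 ≤ C)
    (h𝔓 : Thin 𝔓) (hs : 𝔔 ⊆ 𝔓) (z : Tile → ℂ) {B : ℝ} (hB : ∀ P ∈ 𝔔, ‖z P‖ ≤ B) :
    ‖∑ P ∈ 𝔔, ((P.len : ℂ) * z P) • v P‖ ^ 2 ≤ C * cZ * ∑ P ∈ 𝔔, P.len * ‖z P‖ ^ 2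
      + 2 * C * B ^ 2 * ∑ P ∈ 𝔔, ∑ P' ∈ 𝔔 with P'.n < P.n ∧ P.Near c P', P'.len * P.wt P' := by
  set e : Tile → Tile → ℝ := fun P P' => P.len * P'.len * ‖z P‖ * ‖z P'‖ * ‖⟪v P, v P'⟫_ℂ‖
  have he : ∀ P P', 0 ≤ e P P' := fun P P' => by
    have := P.len_pos; have := P'.len_pos; positivity
  have hsymm : ∀ P P', e P P' = e P' P := fun P P' => by
    simp only [e]; rw [norm_inner_symm (v P)]; ring
  have h1 := BSF.norm_sum_sq_le 𝔔 fun P => ((P.len : ℂ) * z P) • v P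
  have h2 : ∀ P P', ‖⟪((P.len : ℂ) * z P) • v P, ((P'.len : ℂ) * z P') • v P'⟫_ℂ‖ = e P P' := by
    intro P P'
    rw [inner_smul_left, inner_smul_right]
    simp only [norm_mul, RCLike.norm_conj, Complex.norm_real, Real.norm_of_nonneg P.len_pos.le,
      Real.norm_of_nonneg P'.len_pos.le, e]
    ring
  simp_rw [h2] at h1
  refine h1.trans ?_
  have hzero : ∀ P ∈ 𝔔, ∀ P' ∈ 𝔔, ¬ P.Near c P' → e P P' = 0 := fun P hP P' hP' hn => by
    simp [e, h.zero P (hs hP) P' (hs hP') hn]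
  have hoff : ∀ P ∈ 𝔔, ∑ P' ∈ 𝔔 with P'.n < P.n, e P P'
      ≤ C * B ^ 2 * ∑ P' ∈ 𝔔 with P'.n < P.n ∧ P.Near c P', P'.len * P.wt P' := by
    intro P hP
    rw [Finset.mul_sum, ← Finset.filter_filter]
    rw [← Finset.sum_filter_add_sum_filter_not (𝔔.filter fun P' => P'.n < P.n)
      (fun P' => P.Near c P') (e P)]
    rw [Finset.sum_eq_zero (s := ((𝔔.filter fun P' => P'.n < P.n).filter
      fun P' => ¬ P.Near c P')) fun P' hP' => by
        simp only [Finset.mem_filter] at hP'; exact hzero P hP P' hP'.1.1 hP'.2, add_zero]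
    refine Finset.sum_le_sum fun P' hP' => ?_
    simp only [Finset.mem_filter] at hP'
    have hl := P.len_pos
    have hl' := P'.len_pos
    have g := h.bound P (hs hP) P' (hs hP'.1.1) hP'.1.2.le
    have hB0 : 0 ≤ B := (norm_nonneg _).trans (hB P hP)
    calc e P P' ≤ P.len * P'.len * B * B * (C * P.len⁻¹ * P.wt P') := by
          simp only [e]
          gcongr
          · exact hB P hP
          · exact hB P' hP'.1.1
      _ = C * B ^ 2 * (P'.len * P.wt P') := by field_simp
  have hsame : ∑ P ∈ 𝔔, ∑ P' ∈ 𝔔 with P'.n = P.n, e P P'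
      ≤ C * cZ * ∑ P ∈ 𝔔, P.len * ‖z P‖ ^ 2 := by
    set d : Tile → Tile → ℝ := fun P P' => P.len * P'.len * ‖z P‖ ^ 2 * ‖⟪v P, v P'⟫_ℂ‖
    have hed : ∀ P P', e P P' ≤ (d P P' + d P' P) / 2 := by
      intro P P'
      simp only [e, d]
      rw [norm_inner_symm (v P')]
      have : 0 ≤ P.len * P'.len * ‖⟪v P, v P'⟫_ℂ‖ := by
        have := P.len_pos; have := P'.len_pos; positivity
      nlinarith [mul_nonneg this (sq_nonneg (‖z P‖ - ‖z P'‖))]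
    have hswap : ∑ P ∈ 𝔔, ∑ P' ∈ 𝔔 with P'.n = P.n, d P' P
        = ∑ P ∈ 𝔔, ∑ P' ∈ 𝔔 with P'.n = P.n, d P P' := by
      simp_rw [Finset.sum_filter]
      rw [Finset.sum_comm]
      refine Finset.sum_congr rfl fun P _ => Finset.sum_congr rfl fun P' _ => ?_
      simp [eq_comm]
    have hd : ∀ P ∈ 𝔔, ∑ P' ∈ 𝔔 with P'.n = P.n, d P P' ≤ C * cZ * (P.len * ‖z P‖ ^ 2) := by
      intro P hP
      have h3 : ∑ P' ∈ 𝔔 with P'.n = P.n, d P P'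
          ≤ ∑ P' ∈ 𝔔 with P'.n = P.n ∧ P.Near c P', C * (P.len * ‖z P‖ ^ 2) * P.wt P' := by
        rw [← Finset.filter_filter]
        rw [← Finset.sum_filter_add_sum_filter_not (𝔔.filter fun P' => P'.n = P.n)
          (fun P' => P.Near c P') (d P)]
        rw [Finset.sum_eq_zero (s := ((𝔔.filter fun P' => P'.n = P.n).filter
          fun P' => ¬ P.Near c P')) fun P' hP' => by
            simp only [Finset.mem_filter] at hP'
            simp [d, h.zero P (hs hP) P' (hs hP'.1.1) hP'.2], add_zero]
        refine Finset.sum_le_sum fun P' hP' => ?_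
        simp only [Finset.mem_filter] at hP'
        have g := h.bound P (hs hP) P' (hs hP'.1.1) hP'.1.2.le
        have hl := P.len_pos
        have e1 : P'.len = P.len := by unfold Tile.len; rw [hP'.1.2]
        simp only [d, e1]
        calc P.len * P.len * ‖z P‖ ^ 2 * ‖⟪v P, v P'⟫_ℂ‖
            ≤ P.len * P.len * ‖z P‖ ^ 2 * (C * P.len⁻¹ * P.wt P') := by gcongr
          _ = _ := by field_simp
      refine h3.trans ?_
      rw [← Finset.mul_sum]
      have h4 : ∑ P' ∈ 𝔔 with P'.n = P.n ∧ P.Near c P', P.wt P' ≤ cZ :=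
        (Finset.sum_le_sum_of_subset_of_nonneg (Finset.filter_subset_filter _ hs)
          fun P' _ _ => P.wt_nonneg P').trans (sum_same_scale_le h𝔓 c (hs hP))
      have hl := P.len_pos
      have : 0 ≤ C * (P.len * ‖z P‖ ^ 2) := by positivity
      nlinarith
    calc ∑ P ∈ 𝔔, ∑ P' ∈ 𝔔 with P'.n = P.n, e P P'
        ≤ ∑ P ∈ 𝔔, ∑ P' ∈ 𝔔 with P'.n = P.n, (d P P' + d P' P) / 2 :=
          Finset.sum_le_sum fun P _ => Finset.sum_le_sum fun P' _ => hed P P'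
      _ = ∑ P ∈ 𝔔, ∑ P' ∈ 𝔔 with P'.n = P.n, d P P' := by
          simp_rw [← Finset.sum_div, Finset.sum_add_distrib]
          rw [hswap]; ring
      _ ≤ _ := by rw [Finset.mul_sum]; exact Finset.sum_le_sum hd
  have hsplit : ∑ P ∈ 𝔔, ∑ P' ∈ 𝔔, e P P' = ∑ P ∈ 𝔔, ∑ P' ∈ 𝔔 with P'.n = P.n, e P P'
      + 2 * ∑ P ∈ 𝔔, ∑ P' ∈ 𝔔 with P'.n < P.n, e P P' := by
    have hgt : ∑ P ∈ 𝔔, ∑ P' ∈ 𝔔 with P.n < P'.n, e P P'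
        = ∑ P ∈ 𝔔, ∑ P' ∈ 𝔔 with P'.n < P.n, e P P' := by
      simp_rw [Finset.sum_filter]
      rw [Finset.sum_comm]
      refine Finset.sum_congr rfl fun P _ => Finset.sum_congr rfl fun P' _ => ?_
      rw [hsymm]
    rw [two_mul]
    nth_rw 2 [← hgt]
    rw [← Finset.sum_add_distrib, ← Finset.sum_add_distrib]
    refine Finset.sum_congr rfl fun P _ => ?_
    simp_rw [Finset.sum_filter]
    rw [← Finset.sum_add_distrib, ← Finset.sum_add_distrib]
    refine Finset.sum_congr rfl fun P' _ => ?_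
    rcases lt_trichotomy P.n P'.n with hlt | heq | hgt
    · simp [hlt, hlt.ne', not_lt.2 hlt.le]
    · simp [heq]
    · simp [hgt, hgt.ne, not_lt.2 hgt.le]
  rw [hsplit]
  have := Finset.sum_le_sum hoff
  rw [← Finset.mul_sum] at this
  linarith

section

variable {H : Type*} [NormedAddCommGroup H] [InnerProductSpace ℂ H]

lemma sum_sq_le_norm_mul (𝔔 : Finset Tile) (v : Tile → H) (F : H) :
    ∑ P ∈ 𝔔, P.len * ‖⟪v P, F⟫_ℂ‖ ^ 2
      ≤ ‖∑ P ∈ 𝔔, ((P.len : ℂ) * ⟪v P, F⟫_ℂ) • v P‖ * ‖F‖ := by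
  have h : ((∑ P ∈ 𝔔, P.len * ‖⟪v P, F⟫_ℂ‖ ^ 2 : ℝ) : ℂ)
      = ⟪∑ P ∈ 𝔔, ((P.len : ℂ) * ⟪v P, F⟫_ℂ) • v P, F⟫_ℂ := by
    rw [sum_inner, Complex.ofReal_sum]
    refine Finset.sum_congr rfl fun P _ => ?_
    rw [inner_smul_left, map_mul, Complex.conj_ofReal, Complex.ofReal_mul, mul_assoc,
      Complex.ofReal_pow, ← Complex.conj_mul']
  have h0 : 0 ≤ ∑ P ∈ 𝔔, P.len * ‖⟪v P, F⟫_ℂ‖ ^ 2 :=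
    Finset.sum_nonneg fun P _ => mul_nonneg P.len_pos.le (by positivity)
  calc _ = ‖((∑ P ∈ 𝔔, P.len * ‖⟪v P, F⟫_ℂ‖ ^ 2 : ℝ) : ℂ)‖ := by
        rw [Complex.norm_real, Real.norm_of_nonneg h0]
    _ ≤ _ := by rw [h]; exact norm_inner_le_norm _ _

/-- Almost orthogonality in a single lacunary tree. -/
lemma GramBound.norm_sum_sq_le_of_tree {c : ℤ} (hc : |c| ≤ 66) {ε : ℝ} (hε : |ε| = 1) {C : ℝ}
    {𝔓 𝔔 : Finset Tile} {v : Tile → H} (h : GramBound c C 𝔓 v) (hC : 0 ≤ C) (h𝔓 : Thin 𝔓)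
    (hs : 𝔔 ⊆ 𝔓) {T : Tile} (hT : ∀ P ∈ 𝔔, Tile.Lac c ε T P) (z : Tile → ℂ) :
    ‖∑ P ∈ 𝔔, ((P.len : ℂ) * z P) • v P‖ ^ 2 ≤ C * cZ * ∑ P ∈ 𝔔, P.len * ‖z P‖ ^ 2 := by
  classical
  have h1 := h.norm_sum_sq_le hC h𝔓 hs z (B := ∑ P ∈ 𝔔, ‖z P‖)
    fun P hP => Finset.single_le_sum (f := fun P => ‖z P‖) (fun _ _ => norm_nonneg _) hP
  have h2 : ∑ P ∈ 𝔔, ∑ P' ∈ 𝔔 with P'.n < P.n ∧ P.Near c P', P'.len * P.wt P' = 0 := by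
    refine Finset.sum_eq_zero fun P hP => ?_
    rw [Finset.filter_false_of_mem, Finset.sum_empty]
    rintro P' hP' ⟨hn, hnear⟩
    have hle : ((2 : ℝ) ^ P.n)⁻¹ ≤ (2 ^ P'.n)⁻¹ := inv_anti₀ (by positivity) (two_zpow_le hn.le)
    have h3 := disjoint_of_selected (S := {T}) (D := fun _ => 𝔔) h𝔓 hc hε
      (fun T' hT' => by rw [Finset.mem_singleton.1 hT']; exact ⟨hs, hT⟩)
      (fun T1 h1 T2 h2 hne => absurd ((Finset.mem_singleton.1 h1).trans
        (Finset.mem_singleton.1 h2).symm) hne) (Finset.mem_singleton_self T)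
      (Finset.mem_singleton_self T) hP hP' hn (by
        unfold Tile.Near at hnear
        rw [div_eq_mul_inv]; linarith)
    exact Set.disjoint_left.1 h3 P'.left_mem ((hT P' hP').1.1 P'.left_mem)
  rw [h2] at h1
  simpa using h1

/-- The total length of the tops of the selected trees is controlled by the energy. -/
lemma GramBound.sum_len_le {c : ℤ} (hc : |c| ≤ 66) {ε : ℝ} (hε : |ε| = 1) {C : ℝ}
    {𝔓 : Finset Tile} {v : Tile → H} (h : GramBound c C 𝔓 v) (hC : 0 ≤ C) (h𝔓 : Thin 𝔓)
    {S : Finset Tile} {D : Tile → Finset Tile}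
    (hD : ∀ T ∈ S, D T ⊆ 𝔓 ∧ ∀ P ∈ D T, Tile.Lac c ε T P)
    (hord : ∀ T ∈ S, ∀ T' ∈ S, T ≠ T' → (∀ P ∈ D T', ¬ T.Fat P) ∨ ε * T'.xi ≤ ε * T.xi)
    (hdis : ∀ T ∈ S, ∀ T' ∈ S, T ≠ T' → Disjoint (D T) (D T')) (F : H) {σ : ℝ}
    (hlow : ∀ T ∈ S, σ ^ 2 * T.len ≤ ∑ P ∈ D T, P.len * ‖⟪v P, F⟫_ℂ‖ ^ 2)
    {B : ℝ} (hup : ∀ T ∈ S, ∀ P ∈ D T, ‖⟪v P, F⟫_ℂ‖ ≤ B * σ) :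
    σ ^ 2 * ∑ T ∈ S, T.len ≤ (C * cZ + 25728 * C * B ^ 2 * cZ * cR) * ‖F‖ ^ 2 := by
  classical
  set 𝔔 := S.biUnion D
  set A := ∑ P ∈ 𝔔, P.len * ‖⟪v P, F⟫_ℂ‖ ^ 2 with hA
  set L := ∑ T ∈ S, T.len
  have hA0 : 0 ≤ A := Finset.sum_nonneg fun P _ => mul_nonneg P.len_pos.le (by positivity)
  have hL0 : 0 ≤ L := Finset.sum_nonneg fun T _ => T.len_pos.le
  have hsum : ∀ g : Tile → ℝ, ∑ P ∈ 𝔔, g P = ∑ T ∈ S, ∑ P ∈ D T, g P := fun g =>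
    Finset.sum_biUnion fun T hT T' hT' hne => hdis T hT T' hT' hne
  have hAL : σ ^ 2 * L ≤ A := by
    rw [hA, hsum, Finset.mul_sum]
    exact Finset.sum_le_sum hlow
  have hs : 𝔔 ⊆ 𝔓 := Finset.biUnion_subset.2 fun T hT => (hD T hT).1
  have h1 := h.norm_sum_sq_le hC h𝔓 hs (fun P => ⟪v P, F⟫_ℂ) (B := B * σ) (fun P hP => by
    obtain ⟨T, hT, hP⟩ := Finset.mem_biUnion.1 hP
    exact hup T hT P hP)
  have hoff : ∑ P ∈ 𝔔, ∑ P' ∈ 𝔔 with P'.n < P.n ∧ P.Near c P', P'.len * P.wt P'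
      ≤ 12864 * cZ * cR * L := by
    rw [hsum, Finset.mul_sum]
    refine Finset.sum_le_sum fun T hT => ?_
    have h3 : ENNReal.ofReal (∑ P ∈ D T, ∑ P' ∈ 𝔔 with P'.n < P.n ∧ P.Near c P', P'.len * P.wt P')
        ≤ ENNReal.ofReal (12864 * cZ * cR * T.len) := by
      rw [ENNReal.ofReal_sum_of_nonneg fun P _ => Finset.sum_nonneg fun P' _ =>
        mul_nonneg P'.len_pos.le (P.wt_nonneg P')]
      refine (Finset.sum_le_sum fun P hP => sum_off_scale_le h𝔓 hc hε hD hord hT hP).trans ?_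
      rw [← Finset.mul_sum]
      refine (mul_le_mul_right (Tile.sum_lintegral_compl_le fun P hP => ((hD T hT).2 P hP).1)
        16).trans ?_
      rw [show (16 : ℝ≥0∞) = ENNReal.ofReal 16 by simp, ← ENNReal.ofReal_mul (by norm_num)]
      apply ENNReal.ofReal_le_ofReal
      linarith
    have := T.len_pos
    exact (ENNReal.ofReal_le_ofReal_iff (by have := cZ_nonneg; have := cR_nonneg; positivity)).1 h3
  have h2 := sum_sq_le_norm_mul 𝔔 v F
  set V := ‖∑ P ∈ 𝔔, ((P.len : ℂ) * ⟪v P, F⟫_ℂ) • v P‖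
  set K := C * cZ + 25728 * C * B ^ 2 * cZ * cR
  have hV : V ^ 2 ≤ K * A := by
    refine h1.trans ?_
    have hc0 : 0 ≤ 2 * C * (B * σ) ^ 2 := by positivity
    have e1 := mul_le_mul_of_nonneg_left hoff hc0
    have e2 : 0 ≤ 25728 * C * B ^ 2 * cZ * cR := by
      have := cZ_nonneg; have := cR_nonneg; positivity
    have e3 := mul_le_mul_of_nonneg_left hAL e2
    simp only [K]
    nlinarith
  refine hAL.trans ?_
  change A ≤ V * ‖F‖ at h2
  rcases hA0.eq_or_lt with h0 | h0
  · rw [← h0]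
    have : 0 ≤ K := by have := cZ_nonneg; have := cR_nonneg; positivity
    positivity
  · have : A ^ 2 ≤ K * A * ‖F‖ ^ 2 := by
      calc A ^ 2 ≤ (V * ‖F‖) ^ 2 := pow_le_pow_left₀ hA0 h2 2
        _ = V ^ 2 * ‖F‖ ^ 2 := by ring
        _ ≤ _ := by gcongr
    nlinarith

end

/-- The averages of `u` over all intervals containing `dya n m` are at most `M`. -/
def AvgLE (n m : ℤ) (u : ℝ → ℝ) (M : ℝ) : Prop :=
  ∀ a b : ℝ, a ≤ 2 ^ n * m → 2 ^ n * (m + 1) ≤ b → ∫ x in Ico a b, u x ≤ M * (b - a)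

lemma inv_sq_le_sum (J : ℕ) {s : ℝ} (hs : 1 ≤ s) :
    (s ^ 2)⁻¹ ≤ ∑ j ∈ Finset.range J, (if s ≤ 2 ^ (j + 1) then ((4 : ℝ) ^ j)⁻¹ else 0)
      + ((4 : ℝ) ^ J)⁻¹ := by
  obtain ⟨i, hi1, hi2⟩ := exists_nat_pow_near hs (one_lt_two (α := ℝ))
  have h0 : (s ^ 2)⁻¹ ≤ ((4 : ℝ) ^ i)⁻¹ := by
    apply inv_anti₀ (by positivity)
    rw [show (4 : ℝ) = 2 ^ 2 by norm_num, ← pow_mul, mul_comm, pow_mul]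
    exact pow_le_pow_left₀ (by positivity) hi1 2
  have hnn : ∀ j ∈ Finset.range J, 0 ≤ (if s ≤ 2 ^ (j + 1) then ((4 : ℝ) ^ j)⁻¹ else 0) :=
    fun j _ => by split_ifs <;> positivity
  by_cases h : i < J
  · have h1 := Finset.single_le_sum hnn (Finset.mem_range.2 h)
    rw [if_pos hi2.le] at h1
    have : (0 : ℝ) ≤ ((4 : ℝ) ^ J)⁻¹ := by positivity
    linarith
  · have h1 := Finset.sum_nonneg hnn
    have : ((4 : ℝ) ^ i)⁻¹ ≤ ((4 : ℝ) ^ J)⁻¹ :=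
      inv_anti₀ (by positivity) (pow_le_pow_right₀ (by norm_num) (not_lt.1 h))
    linarith

lemma integrable_mul_inv_rho {u : ℝ → ℝ} (hu : Integrable u) (P : Tile) (k : ℕ) :
    Integrable fun x => u x * (P.rho x ^ k)⁻¹ := by
  refine hu.mul_bdd (c := 1) ?_ (Filter.Eventually.of_forall fun x => ?_)
  · exact ((P.measurable_rho.pow_const k).inv).aestronglyMeasurable
  · rw [Real.norm_of_nonneg (by have := P.rho_pos x; positivity)]
    exact inv_le_one_of_one_le₀ (one_le_pow₀ (P.one_le_rho x))

/-- Weighted averages are controlled by averages. -/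
lemma AvgLE.integral_mul_le {P : Tile} {u : ℝ → ℝ} {M : ℝ} (h : AvgLE P.n P.m u M)
    (hu : Integrable u) (h0 : ∀ x, 0 ≤ u x) :
    ∫ x, u x * (P.rho x ^ 2)⁻¹ ≤ 8 * M * P.len := by
  have hl := P.len_pos
  set a := P.len * P.m with ha
  set B : ℕ → Set ℝ := fun j => Ico (a - P.len * 2 ^ (j + 1)) (a + P.len * 2 ^ (j + 1))
  have hJ : ∀ J : ℕ, ∫ x, u x * (P.rho x ^ 2)⁻¹ ≤ 8 * M * P.len + ((4 : ℝ) ^ J)⁻¹ * ∫ x, u x := by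
    intro J
    have hint : ∀ j : ℕ, Integrable ((B j).indicator fun x => ((4 : ℝ) ^ j)⁻¹ * u x) :=
      fun j => (hu.const_mul _).indicator measurableSet_Ico
    have hpt : ∀ᵐ x, u x * (P.rho x ^ 2)⁻¹ ≤
        ∑ j ∈ Finset.range J, (B j).indicator (fun x => ((4 : ℝ) ^ j)⁻¹ * u x) x
          + ((4 : ℝ) ^ J)⁻¹ * u x := by
      have hne : ∀ᵐ x : ℝ, x ∉ ⋃ j : ℕ, {a + P.len * 2 ^ (j + 1)} := by
        rw [← measure_eq_zero_iff_ae_notMem]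
        exact (countable_iUnion fun j => countable_singleton _).measure_zero volume
      filter_upwards [hne] with x hx
      simp only [mem_iUnion, mem_singleton_iff, not_exists] at hx
      have h1 := mul_le_mul_of_nonneg_left (inv_sq_le_sum J (P.one_le_rho x)) (h0 x)
      refine h1.trans ?_
      rw [mul_add, Finset.mul_sum, mul_comm (u x) ((4 : ℝ) ^ J)⁻¹]
      gcongr with j hj
      split_ifs with hc
      · rw [indicator_of_mem, mul_comm]
        rw [P.rho_eq] at hc
        have h2 : |x - a| / P.len ≤ 2 ^ (j + 1) := by linarith
        rw [div_le_iff₀ hl, abs_le] at h2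
        refine ⟨by linarith, lt_of_le_of_ne (by linarith) (hx j)⟩
      · rw [mul_zero]
        exact indicator_nonneg (fun x _ => mul_nonneg (by positivity) (h0 x)) x
    refine (integral_mono_ae (integrable_mul_inv_rho hu P 2)
      ((integrable_finsetSum _ fun j _ => hint j).add (hu.const_mul _)) hpt).trans ?_
    simp only [Pi.add_apply]
    rw [integral_add (integrable_finsetSum _ fun j _ => hint j) (hu.const_mul _),
      integral_finsetSum _ fun j _ => hint j, integral_const_mul]
    gcongr
    have hM0 : 0 ≤ M := by
      have h1 := h _ _ le_rfl le_rfl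
      have h2 : 0 ≤ ∫ x in Ico ((2 : ℝ) ^ P.n * P.m) (2 ^ P.n * (P.m + 1)), u x :=
        integral_nonneg fun x => h0 x
      have h3 : (2 : ℝ) ^ P.n * (P.m + 1) - 2 ^ P.n * P.m = P.len := by unfold Tile.len; ring
      rw [h3] at h1
      nlinarith
    have hj : ∀ j ∈ Finset.range J, ∫ x, (B j).indicator (fun x => ((4 : ℝ) ^ j)⁻¹ * u x) x
        ≤ 4 * M * P.len * (1 / 2) ^ j := by
      intro j _
      rw [integral_indicator measurableSet_Ico, integral_const_mul]
      have h1 : (1 : ℝ) ≤ 2 ^ (j + 1) := one_le_pow₀ (by norm_num)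
      have h2 := h (a - P.len * 2 ^ (j + 1)) (a + P.len * 2 ^ (j + 1))
        (by simp only [a, Tile.len] at *; nlinarith) (by simp only [a, Tile.len] at *; nlinarith)
      calc ((4 : ℝ) ^ j)⁻¹ * ∫ x in B j, u x
          ≤ ((4 : ℝ) ^ j)⁻¹ * (M * (a + P.len * 2 ^ (j + 1) - (a - P.len * 2 ^ (j + 1)))) := by
            gcongr
        _ = 4 * M * P.len * (1 / 2) ^ j := by
            rw [show (4 : ℝ) = 2 * 2 by norm_num, mul_pow, one_div, inv_pow]
            field_simp
            ring
    refine (Finset.sum_le_sum hj).trans ?_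
    rw [← Finset.mul_sum]
    have := sum_geometric_two_le J
    have : 0 ≤ 4 * M * P.len := by positivity
    nlinarith
  refine le_of_tendsto_of_tendsto' (b := Filter.atTop) (f := fun _ : ℕ => _) tendsto_const_nhds
    (g := fun J : ℕ => 8 * M * P.len + ((4 : ℝ) ^ J)⁻¹ * ∫ x, u x) ?_ hJ
  have h1 : Filter.Tendsto (fun J : ℕ => ((4 : ℝ)⁻¹) ^ J) Filter.atTop (nhds 0) :=
    tendsto_pow_atTop_nhds_zero_of_lt_one (by norm_num) (by norm_num)
  simpa using (h1.mul_const (∫ x, u x)).const_add (8 * M * P.len)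

/-- The triple of a dyadic interval. -/
def tri (n m : ℤ) : Set ℝ := Ico ((2 : ℝ) ^ n * (m - 1)) ((2 : ℝ) ^ n * (m + 2))

lemma dya_split (n m : ℤ) : dya n m = dya (n - 1) (2 * m) ∪ dya (n - 1) (2 * m + 1) := by
  have e : (2 : ℝ) ^ n = 2 ^ (n - 1) * 2 := by
    rw [← zpow_add_one₀ (by norm_num)]; simp
  have hp : (0 : ℝ) < 2 ^ (n - 1) := by positivity
  unfold dya
  have h1 : (2 : ℝ) ^ (n - 1) * ((2 * m : ℤ) + 1) = 2 ^ (n - 1) * ((2 * m + 1 : ℤ) : ℝ) := by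
    push_cast; ring
  rw [h1, Ico_union_Ico_eq_Ico (by push_cast; nlinarith) (by push_cast; nlinarith), e]
  push_cast
  congr 1 <;> ring

lemma setIntegral_dya_split {g : ℝ → ℝ} (n m : ℤ) (h : IntegrableOn g (dya n m)) :
    ∫ x in dya n m, g x
      = (∫ x in dya (n - 1) (2 * m), g x) + ∫ x in dya (n - 1) (2 * m + 1), g x := by
  rw [dya_split] at h ⊢
  exact setIntegral_union (dya_disjoint (by omega)) measurableSet_Ico
    (h.mono_set subset_union_left) (h.mono_set subset_union_right)

/-- A Calderón–Zygmund stopping time argument, tested against a function that is almost constant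
on the stopping intervals. -/
lemma setIntegral_mul_le_of_stopping {D : Finset Tile} {u w : ℝ → ℝ} {M K : ℝ} (hK : 0 ≤ K)
    (hu : Integrable u) (hu0 : ∀ x, 0 ≤ u x) (hw : Continuous w) (hw0 : ∀ x, 0 ≤ w x)
    (huw : Integrable fun x => u x * w x)
    (havg : ∀ P ∈ D, AvgLE P.n P.m u M)
    (hleaf : ∀ n m, (∀ P ∈ D, ¬ P.I ⊆ tri n m) →
      ∀ t ∈ dya n m, ∀ t' ∈ dya n m, w t ≤ w t' + K) (n m : ℤ)
    (hnm : ∫ x in dya n m, u x ≤ 6 * M * 2 ^ n) :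
    ∫ x in dya n m, u x * w x ≤ 6 * M * (∫ x in dya n m, w x) + 6 * M * K * 2 ^ n := by
  have hwi : ∀ n m, IntegrableOn w (dya n m) := fun n m =>
    hw.integrableOn_Icc.mono_set Ico_subset_Icc_self
  have leaf : ∀ n m, (∀ P ∈ D, ¬ P.I ⊆ tri n m) → ∫ x in dya n m, u x ≤ 6 * M * 2 ^ n →
      ∫ x in dya n m, u x * w x ≤ 6 * M * (∫ x in dya n m, w x) + 6 * M * K * 2 ^ n := by
    intro n m hl hnm
    have hp : (0 : ℝ) < 2 ^ n := by positivity
    set W := ∫ x in dya n m, w x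
    have hW0 : 0 ≤ W := integral_nonneg fun x => hw0 x
    have hvol : volume.real (dya n m) = 2 ^ n := by
      rw [Measure.real, volume_dya, ENNReal.toReal_ofReal hp.le]
    have hpt : ∀ t ∈ dya n m, w t ≤ W / 2 ^ n + K := by
      intro t ht
      have h1 : ∫ x in dya n m, (w t - K) ≤ W :=
        setIntegral_mono_on (by simp [volume_dya]) (hwi n m)
          measurableSet_Ico fun x hx => by linarith [hleaf n m hl t ht x hx]
      rw [setIntegral_const, hvol, smul_eq_mul] at h1
      have : w t - K ≤ W / 2 ^ n := by rw [le_div_iff₀ hp]; linarith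
      linarith
    have h2 : ∫ x in dya n m, u x * w x ≤ ∫ x in dya n m, u x * (W / 2 ^ n + K) :=
      setIntegral_mono_on huw.integrableOn (hu.integrableOn.mul_const _) measurableSet_Ico
        fun x hx => mul_le_mul_of_nonneg_left (hpt x hx) (hu0 x)
    rw [integral_mul_const] at h2
    refine h2.trans ?_
    calc _ ≤ 6 * M * 2 ^ n * (W / 2 ^ n + K) := by gcongr
      _ = _ := by field_simp
  obtain ⟨n₀, hn₀⟩ : ∃ n₀ : ℤ, n₀ ≤ n ∧ ∀ P ∈ D, n₀ + 2 ≤ P.n := by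
    classical
    rcases D.eq_empty_or_nonempty with h | h
    · exact ⟨n, le_rfl, by simp [h]⟩
    · refine ⟨min n (D.inf' h Tile.n - 2), min_le_left _ _, fun P hP => ?_⟩
      have := Finset.inf'_le Tile.n hP
      have := min_le_right n (D.inf' h Tile.n - 2)
      omega
  obtain ⟨d, rfl⟩ : ∃ d : ℕ, n = n₀ + d := ⟨(n - n₀).toNat, by omega⟩
  induction d generalizing m with
  | zero =>
    refine leaf _ _ (fun P hP hsub => ?_) hnm
    have h1 := measure_mono (μ := volume) hsub
    rw [Tile.I, volume_dya, tri, Real.volume_Ico, ENNReal.ofReal_le_ofReal_iff'] at h1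
    have h2 := two_zpow_le (hn₀.2 P hP)
    rw [zpow_add₀ (by norm_num)] at h2
    have hp : (0 : ℝ) < 2 ^ n₀ := by positivity
    have hp' : (0 : ℝ) < 2 ^ P.n := by positivity
    rcases h1 with h1 | h1
    · simp only [Nat.cast_zero, add_zero] at h1
      norm_num at h2; nlinarith
    · linarith
  | succ d ih =>
    by_cases hl : ∀ P ∈ D, ¬ P.I ⊆ tri (n₀ + (d + 1 : ℕ)) m
    · exact leaf _ _ hl hnm
    push Not at hl
    obtain ⟨P, hP, hsub⟩ := hl
    set n := n₀ + ((d + 1 : ℕ) : ℤ) with hn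
    have hn1 : n - 1 = n₀ + (d : ℤ) := by rw [hn]; push_cast; ring
    have hp : (0 : ℝ) < 2 ^ (n - 1) := by positivity
    have e : (2 : ℝ) ^ n = 2 ^ (n - 1) * 2 := by
      rw [← zpow_add_one₀ (by norm_num)]; simp
    have htri : ∫ x in tri n m, u x ≤ 6 * M * 2 ^ (n - 1) := by
      have h1 := (Ico_subset_Ico_iff (by
        have : (0 : ℝ) < 2 ^ P.n := by positivity
        nlinarith)).1 hsub
      refine (havg P hP _ _ h1.1 h1.2).trans (le_of_eq ?_)
      rw [e]; ring
    have hdt : dya n m ⊆ tri n m := Ico_subset_Ico (by nlinarith) (by nlinarith)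
    have hchild : ∀ m', dya (n - 1) m' ⊆ dya n m →
        ∫ x in dya (n - 1) m', u x ≤ 6 * M * 2 ^ (n - 1) := fun m' hm' =>
      (setIntegral_mono_set hu.integrableOn (Filter.Eventually.of_forall hu0)
        (hm'.trans hdt).eventuallyLE).trans htri
    have c1 := hchild (2 * m) (by rw [dya_split n m]; exact subset_union_left)
    have c2 := hchild (2 * m + 1) (by rw [dya_split n m]; exact subset_union_right)
    rw [hn1] at c1 c2
    have i1 := ih (2 * m) c1 ⟨by omega, hn₀.2⟩
    have i2 := ih (2 * m + 1) c2 ⟨by omega, hn₀.2⟩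
    rw [setIntegral_dya_split n m huw.integrableOn, setIntegral_dya_split n m (hwi n m), e, hn1]
    linarith

/-- The character `x ↦ exp (2πix)`. -/
noncomputable def ex (x : ℝ) : ℂ := Complex.exp (2 * π * x * Complex.I)

lemma ex_eq (x : ℝ) : ex x = Complex.exp (((2 * π * x : ℝ) : ℂ) * Complex.I) := by
  unfold ex; push_cast; rfl

@[simp] lemma norm_ex (x : ℝ) : ‖ex x‖ = 1 := by
  rw [ex_eq, Complex.norm_exp_ofReal_mul_I]

lemma ex_add (x y : ℝ) : ex (x + y) = ex x * ex y := by
  unfold ex; rw [← Complex.exp_add]; congr 1; push_cast; ring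

@[simp] lemma ex_zero : ex 0 = 1 := by simp [ex]

lemma continuous_ex : Continuous ex := by unfold ex; fun_prop

lemma norm_ex_sub_le (x y : ℝ) : ‖ex x - ex y‖ ≤ 2 * π * |x - y| := by
  have h1 : ex x - ex y = ex y * (ex (x - y) - 1) := by
    rw [mul_sub, ← ex_add]; simp
  rw [h1, norm_mul, norm_ex, one_mul, ex_eq, mul_comm]
  refine (Real.norm_exp_I_mul_ofReal_sub_one_le).trans ?_
  rw [Real.norm_eq_abs, abs_mul, abs_of_pos (by positivity)]

/-- A family of wave packets adapted to tiles, with frequency offset `c`. -/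
structure Packets (c : ℤ) (𝔓 : Finset Tile) (φ : Tile → ℝ → ℂ) : Prop where
  cont : ∀ P ∈ 𝔓, Continuous (φ P)
  bound : ∀ P ∈ 𝔓, ∀ t, ‖φ P t‖ ≤ P.len⁻¹ * (P.rho t ^ 8)⁻¹
  smooth : ∀ P ∈ 𝔓, ∀ t t', |t - t'| ≤ P.len →
    ‖ex (P.zeta c * t) * φ P t - ex (P.zeta c * t') * φ P t'‖
      ≤ |t - t'| * P.len⁻¹ * P.len⁻¹ * (P.rho t ^ 2)⁻¹
  orth : ∀ P ∈ 𝔓, ∀ P' ∈ 𝔓, ¬ P.Near c P' → ∀ a β : ℝ,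
    ∫ t, φ P t * (starRingEnd ℂ) (φ P' t) * (((1 + β * (t - a) ^ 2) ^ 2 : ℝ) : ℂ) = 0

/-- The class in `L²` of a function, if it is square integrable. -/
noncomputable def lp2 (g : ℝ → ℂ) : Lp ℂ 2 (volume : Measure ℝ) :=
  open Classical in if h : MemLp g 2 volume then h.toLp g else 0

lemma inner_lp2 {g h : ℝ → ℂ} (hg : MemLp g 2 volume) (hh : MemLp h 2 volume) :
    ⟪lp2 g, lp2 h⟫_ℂ = ∫ t, (starRingEnd ℂ) (g t) * h t := by
  rw [L2.inner_def, lp2, lp2, dif_pos hg, dif_pos hh]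
  refine integral_congr_ae ?_
  filter_upwards [hg.coeFn_toLp, hh.coeFn_toLp] with t h1 h2
  rw [h1, h2, RCLike.inner_apply, mul_comm]

lemma norm_lp2_sq {g : ℝ → ℂ} (hg : MemLp g 2 volume) : ‖lp2 g‖ ^ 2 = ∫ t, ‖g t‖ ^ 2 := by
  have h1 := inner_self_eq_norm_sq_to_K (𝕜 := ℂ) (lp2 g)
  rw [inner_lp2 hg hg] at h1
  simp_rw [Complex.conj_mul'] at h1
  have h2 : ∫ t, ((‖g t‖ : ℂ)) ^ 2 = ((∫ t, ‖g t‖ ^ 2 : ℝ) : ℂ) := by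
    rw [← integral_complex_ofReal]; push_cast; rfl
  rw [h2] at h1
  have h3 : ((∫ t, ‖g t‖ ^ 2 : ℝ) : ℂ) = ((‖lp2 g‖ ^ 2 : ℝ) : ℂ) := by
    rw [h1, Complex.ofReal_pow]; rfl
  exact (Complex.ofReal_injective h3).symm

lemma Tile.integrable_inv_rho (P : Tile) : Integrable fun x => (P.rho x ^ 2)⁻¹ := by
  simp_rw [P.rho_eq]; exact integrable_weight_scaled P.len_pos _

lemma Tile.integral_inv_rho (P : Tile) : ∫ x, (P.rho x ^ 2)⁻¹ = P.len * cR := by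
  simp_rw [P.rho_eq]; exact integral_weight_scaled P.len_pos _

lemma inv_rho_pow_le (P : Tile) (x : ℝ) {i j : ℕ} (h : i ≤ j) :
    (P.rho x ^ j)⁻¹ ≤ (P.rho x ^ i)⁻¹ :=
  inv_anti₀ (by have := P.rho_pos x; positivity) (pow_le_pow_right₀ (P.one_le_rho x) h)

lemma inv_rho_pow_le_one (P : Tile) (x : ℝ) (j : ℕ) : (P.rho x ^ j)⁻¹ ≤ 1 := by
  simpa using inv_rho_pow_le P x (Nat.zero_le j)

lemma memLp_of_bound {g : ℝ → ℂ} (hg : AEStronglyMeasurable g volume) (P : Tile) {C : ℝ}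
    (h : ∀ t, ‖g t‖ ≤ C * (P.rho t ^ 2)⁻¹) : MemLp g 2 volume := by
  rw [memLp_two_iff_integrable_sq_norm hg]
  refine (P.integrable_inv_rho.const_mul (C ^ 2)).mono' (hg.norm.pow 2)
    (Filter.Eventually.of_forall fun t => ?_)
  rw [Real.norm_of_nonneg (by positivity)]
  have h0 := P.rho_pos t
  calc ‖g t‖ ^ 2 ≤ (C * (P.rho t ^ 2)⁻¹) ^ 2 := pow_le_pow_left₀ (norm_nonneg _) (h t) 2
    _ = C ^ 2 * (P.rho t ^ 4)⁻¹ := by rw [mul_pow, inv_pow, ← pow_mul]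
    _ ≤ _ := by gcongr ?_ * ?_; exact inv_rho_pow_le P t (by norm_num)

namespace Packets

variable {c : ℤ} {𝔓 : Finset Tile} {φ : Tile → ℝ → ℂ}

/-- The conjugates of the packets, multiplied with a quadratic weight. -/
noncomputable def vec (φ : Tile → ℝ → ℂ) (β a : ℝ) (P : Tile) (t : ℝ) : ℂ :=
  (starRingEnd ℂ) (φ P t) * ((1 + β * (t - a) ^ 2 : ℝ) : ℂ)

lemma norm_vec_le (h : Packets c 𝔓 φ) {β a : ℝ} (hβ : 0 ≤ β) {P : Tile} (hP : P ∈ 𝔓)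
    (hq : ∀ t, 1 + β * (t - a) ^ 2 ≤ 4 * P.rho t ^ 2) (t : ℝ) :
    ‖vec φ β a P t‖ ≤ 4 * P.len⁻¹ * (P.rho t ^ 6)⁻¹ := by
  have h0 := P.rho_pos t
  have hl := P.len_pos
  rw [vec, norm_mul, RCLike.norm_conj, Complex.norm_real, Real.norm_of_nonneg (by positivity)]
  calc _ ≤ P.len⁻¹ * (P.rho t ^ 8)⁻¹ * (4 * P.rho t ^ 2) := by
        gcongr
        · exact h.bound P hP t
        · exact hq t
    _ = _ := by field_simp

lemma memLp_vec (h : Packets c 𝔓 φ) {β a : ℝ} (hβ : 0 ≤ β) {P : Tile} (hP : P ∈ 𝔓)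
    (hq : ∀ t, 1 + β * (t - a) ^ 2 ≤ 4 * P.rho t ^ 2) : MemLp (vec φ β a P) 2 volume := by
  have hc := h.cont P hP
  refine memLp_of_bound (C := 4 * P.len⁻¹) ?_ P fun t => (h.norm_vec_le hβ hP hq t).trans ?_
  · have : Continuous (vec φ β a P) := by
      unfold vec
      exact (Complex.continuous_conj.comp hc).mul (Complex.continuous_ofReal.comp (by fun_prop))
    exact this.aestronglyMeasurable
  · have := P.len_pos
    gcongr ?_ * ?_
    exact inv_rho_pow_le P t (by norm_num)

lemma gramBound (h : Packets c 𝔓 φ) {β a : ℝ} (hβ : 0 ≤ β)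
    (hq : ∀ P ∈ 𝔓, ∀ t, 1 + β * (t - a) ^ 2 ≤ 4 * P.rho t ^ 2) :
    GramBound c (16 * cR) 𝔓 fun P => lp2 (vec φ β a P) where
  bound := by
    intro P hP P' hP' hn
    rw [inner_lp2 (h.memLp_vec hβ hP (hq P hP)) (h.memLp_vec hβ hP' (hq P' hP'))]
    have hl := P.len_pos
    have hl' := P'.len_pos
    have hpt : ∀ t, ‖(starRingEnd ℂ) (vec φ β a P t) * vec φ β a P' t‖
        ≤ 16 * P.len⁻¹ * P'.len⁻¹ * P.wt P' * (P'.rho t ^ 2)⁻¹ := by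
      intro t
      have h0 := P.rho_pos t
      have h0' := P'.rho_pos t
      have hc0 := P.rho_pos (P'.len * P'.m)
      rw [norm_mul, RCLike.norm_conj]
      have e1 := h.norm_vec_le hβ hP (hq P hP) t
      have e2 := h.norm_vec_le hβ hP' (hq P' hP') t
      have e3 : P.rho (P'.len * P'.m) ≤ P.rho t * P'.rho t := by
        refine (P.rho_le_mul t _).trans ?_
        gcongr
        rw [P'.rho_eq, ← sub_div, abs_div, abs_of_pos (by positivity : (0 : ℝ) < 2 ^ P.n)]
        gcongr 1 + _ / ?_
        exact two_zpow_le hn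
      have e4 : (P.rho t ^ 4)⁻¹ * (P'.rho t ^ 4)⁻¹ ≤ P.wt P' := by
        rw [← mul_inv, ← mul_pow, Tile.wt]
        exact inv_anti₀ (by positivity) (pow_le_pow_left₀ hc0.le e3 4)
      have e5 : (P.rho t ^ 6)⁻¹ ≤ (P.rho t ^ 4)⁻¹ := inv_rho_pow_le P t (by norm_num)
      calc _ ≤ (4 * P.len⁻¹ * (P.rho t ^ 6)⁻¹) * (4 * P'.len⁻¹ * (P'.rho t ^ 6)⁻¹) := by gcongr
        _ ≤ (4 * P.len⁻¹ * (P.rho t ^ 4)⁻¹) * (4 * P'.len⁻¹ * (P'.rho t ^ 6)⁻¹) := by gcongr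
        _ = 16 * P.len⁻¹ * P'.len⁻¹ * ((P.rho t ^ 4)⁻¹ * (P'.rho t ^ 4)⁻¹) * (P'.rho t ^ 2)⁻¹ := by
            field_simp; norm_num
        _ ≤ _ := by gcongr
    refine (norm_integral_le_of_norm_le (P'.integrable_inv_rho.const_mul _)
      (Filter.Eventually.of_forall hpt)).trans (le_of_eq ?_)
    rw [integral_const_mul, P'.integral_inv_rho]
    field_simp
  zero := by
    intro P hP P' hP' hn
    rw [inner_lp2 (h.memLp_vec hβ hP (hq P hP)) (h.memLp_vec hβ hP' (hq P' hP')),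
      ← h.orth P hP P' hP' hn a β]
    refine integral_congr_ae (Filter.Eventually.of_forall fun t => ?_)
    simp only [vec, map_mul, Complex.conj_conj, Complex.conj_ofReal]
    push_cast
    ring

lemma demod_sub_le (h : Packets c 𝔓 φ) (hc : |c| ≤ 66) {T P : Tile} (hP : P ∈ 𝔓) (hF : T.Fat P)
    {t t' : ℝ} (htt : |t - t'| ≤ P.len) :
    ‖ex (T.xi * t) * φ P t - ex (T.xi * t') * φ P t'‖
      ≤ 1400 * (|t - t'| * P.len⁻¹ * P.len⁻¹ * (P.rho t ^ 2)⁻¹) := by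
  have hl := P.len_pos
  have h0 := P.rho_pos t
  set δ := T.xi - P.zeta c with hδ
  have hδ1 : |δ| ≤ 166 * P.len⁻¹ := by
    have e : P.len * δ = (2 ^ P.n * T.xi - P.k) - c := by
      rw [hδ, Tile.zeta, Tile.len, mul_sub, mul_div_cancel₀ _ (by positivity)]; ring
    have h2 := abs_sub (2 ^ P.n * T.xi - P.k) (c : ℝ)
    have h3 : |(c : ℝ)| ≤ 66 := by exact_mod_cast hc
    rw [← e, abs_mul, abs_of_pos hl] at h2
    rw [mul_comm, ← div_eq_inv_mul, le_div_iff₀ hl]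
    linarith [hF.2]
  have e1 : ∀ s, ex (T.xi * s) = ex (δ * s) * ex (P.zeta c * s) := fun s => by
    rw [← ex_add, hδ]; ring_nf
  rw [e1, e1]
  have e2 : ex (δ * t) * ex (P.zeta c * t) * φ P t - ex (δ * t') * ex (P.zeta c * t') * φ P t'
    = ex (δ * t') * (ex (P.zeta c * t) * φ P t - ex (P.zeta c * t') * φ P t')
      + (ex (δ * t) - ex (δ * t')) * (ex (P.zeta c * t) * φ P t) := by ring
  rw [e2]
  refine (norm_add_le _ _).trans ?_
  rw [norm_mul, norm_ex, one_mul, norm_mul, norm_mul, norm_ex, one_mul]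
  have a1 := h.smooth P hP t t' htt
  have a2 : ‖ex (δ * t) - ex (δ * t')‖ ≤ 1100 * (|t - t'| * P.len⁻¹) := by
    refine (norm_ex_sub_le _ _).trans ?_
    rw [← mul_sub, abs_mul]
    have hπ := Real.pi_lt_d2
    calc 2 * π * (|δ| * |t - t'|) ≤ 2 * 3.15 * (166 * P.len⁻¹ * |t - t'|) := by gcongr
      _ ≤ 1100 * (|t - t'| * P.len⁻¹) := by
        have : 0 ≤ |t - t'| * P.len⁻¹ := by positivity
        nlinarith
  have a3 : ‖φ P t‖ ≤ P.len⁻¹ * (P.rho t ^ 2)⁻¹ := (h.bound P hP t).trans (by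
    gcongr ?_ * ?_; exact inv_rho_pow_le P t (by norm_num))
  calc _ ≤ |t - t'| * P.len⁻¹ * P.len⁻¹ * (P.rho t ^ 2)⁻¹
      + 1100 * (|t - t'| * P.len⁻¹) * (P.len⁻¹ * (P.rho t ^ 2)⁻¹) := by gcongr
    _ = 1101 * (|t - t'| * P.len⁻¹ * P.len⁻¹ * (P.rho t ^ 2)⁻¹) := by ring
    _ ≤ _ := by gcongr; norm_num

end Packets

lemma integrable_mul_packet {f g : ℝ → ℂ} (hf : Integrable f) (hg : Continuous g) {C : ℝ}
    (h : ∀ t, ‖g t‖ ≤ C) : Integrable fun t => f t * g t :=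
  hf.mul_bdd (c := C) hg.aestronglyMeasurable (Filter.Eventually.of_forall h)

lemma exists_mem_tri_dya {n m : ℤ} {x : ℝ} (h : x ∈ tri n m) :
    ∃ i : ℤ, dya n i ⊆ tri n m ∧ x ∈ dya n i := by
  refine ⟨⌊x / 2 ^ n⌋, ?_, mem_dya.2 rfl⟩
  have hp : (0 : ℝ) < 2 ^ n := by positivity
  have h1 : m - 1 ≤ ⌊x / (2 : ℝ) ^ n⌋ := by
    rw [Int.le_floor, le_div_iff₀ hp]; push_cast; linarith [h.1]
  have h2 : ⌊x / (2 : ℝ) ^ n⌋ < m + 2 := by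
    rw [Int.floor_lt, div_lt_iff₀ hp]; push_cast; linarith [h.2]
  have h2' : ⌊x / (2 : ℝ) ^ n⌋ + 1 ≤ m + 2 := h2
  have h1' : (m : ℝ) - 1 ≤ ⌊x / (2 : ℝ) ^ n⌋ := by exact_mod_cast h1
  have h3' : (⌊x / (2 : ℝ) ^ n⌋ : ℝ) + 1 ≤ m + 2 := by exact_mod_cast h2'
  exact Ico_subset_Ico (mul_le_mul_of_nonneg_left h1' hp.le)
    (mul_le_mul_of_nonneg_left h3' hp.le)

/-- Points of `dya n m` are far from the complement of `tri n m`. -/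
lemma le_abs_sub_of_notMem_tri {n m : ℤ} {t x : ℝ} (ht : t ∈ dya n m) (hx : x ∉ tri n m) :
    2 ^ n ≤ |t - x| := by
  have hp : (0 : ℝ) < 2 ^ n := by positivity
  simp only [tri, mem_Ico, not_and_or, not_le, not_lt] at hx
  have h1 := ht.1
  have h2 := ht.2
  rcases hx with hx | hx
  · rw [abs_of_pos (by nlinarith)]; nlinarith
  · rw [abs_sub_comm, abs_of_pos (by nlinarith)]; nlinarith

lemma Tile.le_rho_of_le {P : Tile} {t d : ℝ} (h : d ≤ |t - P.len * P.m|) :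
    d / P.len ≤ P.rho t := by
  rw [P.rho_eq]
  have : d / P.len ≤ |t - P.len * P.m| / P.len := div_le_div_of_nonneg_right h P.len_pos.le
  linarith

lemma Tile.inv_rho_pow_le_of_le {P : Tile} {t d : ℝ} (hd : 0 < d) (h : d ≤ |t - P.len * P.m|) :
    (P.rho t ^ 8)⁻¹ ≤ P.len / d * (P.rho t ^ 2)⁻¹ := by
  have hl := P.len_pos
  have h0 := P.rho_pos t
  have h1 := Tile.le_rho_of_le h
  have h2 : (P.rho t)⁻¹ ≤ P.len / d := by
    rw [← inv_div]; exact inv_anti₀ (by positivity) h1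
  calc (P.rho t ^ 8)⁻¹ ≤ (P.rho t ^ 3)⁻¹ := inv_rho_pow_le P t (by norm_num)
    _ = (P.rho t)⁻¹ * (P.rho t ^ 2)⁻¹ := by rw [← mul_inv]; ring_nf
    _ ≤ _ := by gcongr

namespace Packets

variable {c : ℤ} {𝔓 : Finset Tile} {φ : Tile → ℝ → ℂ}

lemma bound_le (h : Packets c 𝔓 φ) {P : Tile} (hP : P ∈ 𝔓) (t : ℝ) :
    ‖φ P t‖ ≤ P.len⁻¹ * (P.rho t ^ 2)⁻¹ :=
  (h.bound P hP t).trans (by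
    have := P.len_pos; gcongr ?_ * ?_; exact inv_rho_pow_le P t (by norm_num))

lemma bound_le_inv (h : Packets c 𝔓 φ) {P : Tile} (hP : P ∈ 𝔓) (t : ℝ) :
    ‖φ P t‖ ≤ P.len⁻¹ :=
  (h.bound P hP t).trans (mul_le_of_le_one_right (inv_nonneg.2 P.len_pos.le)
    (inv_rho_pow_le_one P t 8))

lemma norm_integral_le (h : Packets c 𝔓 φ) {f : ℝ → ℂ} (hf : Integrable f) {P : Tile}
    (hP : P ∈ 𝔓) {M : ℝ} (hM : AvgLE P.n P.m (fun x => ‖f x‖) M) :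
    ‖∫ t, f t * φ P t‖ ≤ 8 * M := by
  have hl := P.len_pos
  have h1 := hM.integral_mul_le hf.norm fun x => norm_nonneg _
  have h2 : ‖∫ t, f t * φ P t‖ ≤ ∫ t, P.len⁻¹ * (‖f t‖ * (P.rho t ^ 2)⁻¹) := by
    refine norm_integral_le_of_norm_le ((integrable_mul_inv_rho hf.norm P 2).const_mul _)
      (Filter.Eventually.of_forall fun t => ?_)
    rw [norm_mul]
    calc ‖f t‖ * ‖φ P t‖ ≤ ‖f t‖ * (P.len⁻¹ * (P.rho t ^ 2)⁻¹) := by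
          gcongr; exact h.bound_le hP t
      _ = _ := by ring
  rw [integral_const_mul] at h2
  refine h2.trans ?_
  rw [inv_mul_le_iff₀ hl]
  linarith

lemma leaf_osc_le (h : Packets c 𝔓 φ) (hc : |c| ≤ 66) {T : Tile} {D : Finset Tile} (hD : D ⊆ 𝔓)
    (hT : ∀ P ∈ D, T.Fat P) {z : Tile → ℂ} {B : ℝ} (hB0 : 0 ≤ B) (hB : ∀ P ∈ D, ‖z P‖ ≤ B) {n m : ℤ}
    (hl : ∀ P ∈ D, ¬ P.I ⊆ tri n m) {t t' : ℝ} (ht : t ∈ dya n m) (ht' : t' ∈ dya n m) :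
    ‖∑ P ∈ D, (P.len : ℂ) * z P * φ P t‖
      ≤ ‖∑ P ∈ D, (P.len : ℂ) * z P * φ P t'‖ + 570000 * cZ * B := by
  classical
  have hp : (0 : ℝ) < 2 ^ n := by positivity
  have e : ∀ s, ‖∑ P ∈ D, (P.len : ℂ) * z P * φ P s‖
      = ‖∑ P ∈ D, (P.len : ℂ) * z P * (ex (T.xi * s) * φ P s)‖ := fun s => by
    have : ∑ P ∈ D, (P.len : ℂ) * z P * (ex (T.xi * s) * φ P s)
        = ex (T.xi * s) * ∑ P ∈ D, (P.len : ℂ) * z P * φ P s := by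
      rw [Finset.mul_sum]; exact Finset.sum_congr rfl fun P _ => by ring
    rw [this, norm_mul, norm_ex, one_mul]
  rw [e, e]
  have h1 := norm_sub_norm_le (∑ P ∈ D, (P.len : ℂ) * z P * (ex (T.xi * t) * φ P t))
    (∑ P ∈ D, (P.len : ℂ) * z P * (ex (T.xi * t') * φ P t'))
  rw [← Finset.sum_sub_distrib] at h1
  have htt : |t - t'| ≤ 2 ^ n := by
    rw [abs_le]; constructor <;> nlinarith [ht.1, ht.2, ht'.1, ht'.2]
  have hterm : ∀ P ∈ D, ‖(P.len : ℂ) * z P * (ex (T.xi * t) * φ P t)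
      - (P.len : ℂ) * z P * (ex (T.xi * t') * φ P t')‖
      ≤ B * (if n ≤ P.n then 1400 * (2 ^ n * ((2 ^ P.n)⁻¹ * (P.rho t ^ 2)⁻¹))
        else (2 ^ n)⁻¹ * (2 ^ P.n * (P.rho t ^ 2)⁻¹ + 2 ^ P.n * (P.rho t' ^ 2)⁻¹)) := by
    intro P hP
    have hlp := P.len_pos
    rw [← mul_sub, norm_mul, norm_mul, Complex.norm_real, Real.norm_of_nonneg hlp.le]
    split_ifs with hn
    · have h2 := h.demod_sub_le hc (hD hP) (hT P hP) (htt.trans (two_zpow_le hn))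
      have h0 := P.rho_pos t
      calc _ ≤ P.len * B * (1400 * (2 ^ n * P.len⁻¹ * P.len⁻¹ * (P.rho t ^ 2)⁻¹)) := by
            gcongr
            · exact hB P hP
            · refine h2.trans ?_
              gcongr
        _ = _ := by rw [← Tile.len]; field_simp
    · push Not at hn
      have hfar : ∀ s ∈ dya n m, ‖φ P s‖ ≤ P.len⁻¹ * (P.len / 2 ^ n * (P.rho s ^ 2)⁻¹) := by
        intro s hs
        refine (h.bound P (hD hP) s).trans ?_
        gcongr ?_ * ?_
        refine Tile.inv_rho_pow_le_of_le hp (le_abs_sub_of_notMem_tri hs fun hmem => ?_)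
        obtain ⟨i, hi1, hi2⟩ := exists_mem_tri_dya hmem
        exact hl P hP ((dya_subset_of_le hn.le hi2 P.left_mem).trans hi1)
      have h2 : ‖ex (T.xi * t) * φ P t - ex (T.xi * t') * φ P t'‖ ≤ ‖φ P t‖ + ‖φ P t'‖ := by
        refine (norm_sub_le _ _).trans ?_
        simp
      calc _ ≤ P.len * B * (P.len⁻¹ * (P.len / 2 ^ n * (P.rho t ^ 2)⁻¹)
            + P.len⁻¹ * (P.len / 2 ^ n * (P.rho t' ^ 2)⁻¹)) := by
            gcongr
            · exact hB P hP
            · exact h2.trans (add_le_add (hfar t ht) (hfar t' ht'))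
        _ = _ := by rw [← Tile.len]; field_simp
  have h2 := (norm_sum_le _ _).trans (Finset.sum_le_sum hterm)
  rw [← Finset.mul_sum, Finset.sum_ite] at h2
  simp_rw [← Finset.mul_sum, Finset.sum_add_distrib] at h2
  set D1 := D.filter fun P => n ≤ P.n
  set D2 := D.filter fun P => ¬ n ≤ P.n
  have s1 := Tile.sum_rho_le (F := D1) (fun P hP => hT P (Finset.mem_filter.1 hP).1) t
    (γ := fun n => ((2 : ℝ) ^ n)⁻¹) (fun _ => by positivity)
  have s2 := fun s => Tile.sum_rho_le (F := D2) (fun P hP => hT P (Finset.mem_filter.1 hP).1) s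
    (γ := fun n => (2 : ℝ) ^ n) (fun _ => by positivity)
  have g1 := sum_two_zpow_neg_le (N := D1.image Tile.n) (n₀ := n) (by
    intro i hi; obtain ⟨P, hP, rfl⟩ := Finset.mem_image.1 hi; exact (Finset.mem_filter.1 hP).2)
  have g2 := sum_two_zpow_le (N := D2.image Tile.n) (n₀ := n) (by
    intro i hi; obtain ⟨P, hP, rfl⟩ := Finset.mem_image.1 hi
    exact (not_le.1 (Finset.mem_filter.1 hP).2).le)
  have hz := cZ_nonneg
  have k1 : (2 : ℝ) ^ n * ∑ P ∈ D1, ((2 : ℝ) ^ P.n)⁻¹ * (P.rho t ^ 2)⁻¹ ≤ 402 * cZ := by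
    calc _ ≤ (2 : ℝ) ^ n * (201 * cZ * (2 * (2 ^ n)⁻¹)) := by
          gcongr; exact s1.trans (by gcongr)
      _ = _ := by field_simp; ring
  have k2 : ∀ s, ((2 : ℝ) ^ n)⁻¹ * ∑ P ∈ D2, (2 : ℝ) ^ P.n * (P.rho s ^ 2)⁻¹ ≤ 402 * cZ := by
    intro s
    calc _ ≤ ((2 : ℝ) ^ n)⁻¹ * (201 * cZ * (2 * 2 ^ n)) := by
          gcongr; exact (s2 s).trans (by gcongr)
      _ = _ := by field_simp; ring
  have k3 := k2 t
  have k4 := k2 t'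
  have : B * (1400 * ((2 : ℝ) ^ n * ∑ P ∈ D1, ((2 : ℝ) ^ P.n)⁻¹ * (P.rho t ^ 2)⁻¹)
      + ((2 : ℝ) ^ n)⁻¹ * (∑ P ∈ D2, (2 : ℝ) ^ P.n * (P.rho t ^ 2)⁻¹
        + ∑ P ∈ D2, (2 : ℝ) ^ P.n * (P.rho t' ^ 2)⁻¹)) ≤ B * (570000 * cZ) := by
    gcongr
    rw [mul_add]
    linarith
  linarith

end Packets

lemma memLp_sum_mul {D : Finset Tile} {g : Tile → ℝ → ℂ} (z : Tile → ℂ)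
    (hg : ∀ P ∈ D, MemLp (g P) 2 volume) : MemLp (fun t => ∑ P ∈ D, z P * g P t) 2 volume :=
  memLp_finsetSum D fun P hP => (hg P hP).const_mul (z P)

lemma lp2_sum {D : Finset Tile} {g : Tile → ℝ → ℂ} (z : Tile → ℂ)
    (hg : ∀ P ∈ D, MemLp (g P) 2 volume) :
    ∑ P ∈ D, z P • lp2 (g P) = lp2 fun t => ∑ P ∈ D, z P * g P t := by
  classical
  induction D using Finset.induction_on with
  | empty =>
    have h : MemLp (fun _ : ℝ => (0 : ℂ)) 2 volume := MemLp.zero'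
    simp only [Finset.sum_empty]
    rw [lp2, dif_pos h]
    exact (MemLp.toLp_zero h).symm
  | insert P D hP ih =>
    have h1 := hg P (Finset.mem_insert_self P D)
    have h2 : ∀ P ∈ D, MemLp (g P) 2 volume := fun Q hQ => hg Q (Finset.mem_insert_of_mem hQ)
    rw [Finset.sum_insert hP, ih h2]
    simp_rw [Finset.sum_insert hP]
    have h3 := memLp_sum_mul z h2
    have h4 := h1.const_mul (z P)
    have h5 : MemLp (fun t => z P * g P t + ∑ P ∈ D, z P * g P t) 2 volume := h4.add h3
    rw [lp2, lp2, lp2, dif_pos h1, dif_pos h3, dif_pos h5]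
    rfl

lemma sq_setIntegral_le {w : ℝ → ℝ} (hw : Continuous w) {a b : ℝ} (hab : a < b)
    (hw2 : Integrable fun x => w x ^ 2) :
    (∫ x in Ico a b, w x) ^ 2 ≤ (b - a) * ∫ x, w x ^ 2 := by
  have hV : 0 < b - a := sub_pos.2 hab
  set X := ∫ x in Ico a b, w x with hX
  have hi : IntegrableOn w (Ico a b) := hw.integrableOn_Icc.mono_set Ico_subset_Icc_self
  have hi2 : IntegrableOn (fun x => w x ^ 2) (Ico a b) := hw2.integrableOn
  have h1 : 0 ≤ ∫ x in Ico a b, (w x - X / (b - a)) ^ 2 :=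
    integral_nonneg fun x => sq_nonneg _
  have h2 : ∫ x in Ico a b, (w x - X / (b - a)) ^ 2
      = (∫ x in Ico a b, w x ^ 2) - 2 * (X / (b - a)) * X + (X / (b - a)) ^ 2 * (b - a) := by
    have e : ∀ x, (w x - X / (b - a)) ^ 2
        = w x ^ 2 - 2 * (X / (b - a)) * w x + (X / (b - a)) ^ 2 := fun x => by ring
    simp_rw [e]
    have hc : IntegrableOn (fun _ : ℝ => (X / (b - a)) ^ 2) (Ico a b) :=
      integrableOn_const (by simp)
    have hm : IntegrableOn (fun x => 2 * (X / (b - a)) * w x) (Ico a b) := hi.const_mul _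
    have hs : IntegrableOn (fun x => w x ^ 2 - 2 * (X / (b - a)) * w x) (Ico a b) := hi2.sub hm
    rw [integral_add hs hc, integral_sub hi2 hm, integral_const_mul, ← hX]
    simp [max_eq_left hV.le, mul_comm]
  have h3 : ∫ x in Ico a b, w x ^ 2 ≤ ∫ x, w x ^ 2 :=
    setIntegral_le_integral hw2 (Filter.Eventually.of_forall fun x => sq_nonneg _)
  have h4 : - 2 * (X / (b - a)) * X + (X / (b - a)) ^ 2 * (b - a) = -(X ^ 2 / (b - a)) := by
    field_simp; ring
  have h5 : X ^ 2 / (b - a) ≤ ∫ x, w x ^ 2 := by linarith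
  rw [div_le_iff₀ hV] at h5
  linarith

lemma measurableSet_dya (n m : ℤ) : MeasurableSet (dya n m) := measurableSet_Ico

lemma measurableSet_tri (n m : ℤ) : MeasurableSet (tri n m) := measurableSet_Ico

lemma setIntegral_tri {g : ℝ → ℝ} (n m : ℤ) (hg : Integrable g) :
    ∫ x in tri n m, g x = (∫ x in dya n (m - 1), g x) + (∫ x in dya n m, g x)
      + ∫ x in dya n (m + 1), g x := by
  have hp : (0 : ℝ) < 2 ^ n := by positivity
  have e : tri n m = dya n (m - 1) ∪ dya n m ∪ dya n (m + 1) := by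
    unfold tri dya
    push_cast
    rw [sub_add_cancel, Ico_union_Ico_eq_Ico (by nlinarith) (by nlinarith),
      Ico_union_Ico_eq_Ico (by nlinarith) (by nlinarith)]
    congr 1; ring
  rw [e, setIntegral_union ?_ (measurableSet_dya _ _) hg.integrableOn hg.integrableOn,
    setIntegral_union (dya_disjoint (by omega)) (measurableSet_dya _ _) hg.integrableOn hg.integrableOn]
  exact Disjoint.union_left (dya_disjoint (by omega)) (dya_disjoint (by omega))

open Classical in
lemma sum_len_sq_le {T : Tile} {D : Finset Tile} (hT : ∀ P ∈ D, T.Fat P) :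
    ∑ P ∈ D, P.len * P.len ≤ 402 * T.len * T.len := by
  have hl := T.len_pos
  rw [← Finset.sum_fiberwise_of_maps_to (g := Tile.n) (t := D.image Tile.n)
    (fun P hP => Finset.mem_image_of_mem _ hP)]
  have h1 : ∀ n ∈ D.image Tile.n, ∑ P ∈ D with P.n = n, P.len * P.len
      ≤ 201 * T.len * 2 ^ n := by
    intro n _
    have : ∑ P ∈ D with P.n = n, P.len * P.len = (∑ P ∈ D with P.n = n, P.len) * 2 ^ n := by
      rw [Finset.sum_mul]
      refine Finset.sum_congr rfl fun P hP => ?_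
      rw [← (Finset.mem_filter.1 hP).2]; rfl
    rw [this]
    exact mul_le_mul_of_nonneg_right (Tile.sum_len_fiber_le hT n) (by positivity)
  refine (Finset.sum_le_sum h1).trans ?_
  rw [← Finset.mul_sum]
  have h2 := sum_two_zpow_le (N := D.image Tile.n) (n₀ := T.n) (by
    intro n hn
    obtain ⟨P, hP, rfl⟩ := Finset.mem_image.1 hn
    exact (hT P hP).n_le)
  calc _ ≤ 201 * T.len * (2 * 2 ^ T.n) := by gcongr
    _ = _ := by rw [← Tile.len]; ring

/-- The constant in the Carleson-type estimate for the wave packet coefficients in a tree. -/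
noncomputable def cT : ℝ := 36 * (3 * (16 * cR * cZ)) + 2 * (18 * (570000 * cZ * 8) + 25728)

lemma cT_pos : 0 < cT := by
  have := cZ_nonneg; have := cR_nonneg; unfold cT; positivity

namespace Packets

variable {c : ℤ} {𝔓 : Finset Tile} {φ : Tile → ℝ → ℂ}

lemma integrable_mul (h : Packets c 𝔓 φ) {f : ℝ → ℂ} (hf : Integrable f) {P : Tile}
    (hP : P ∈ 𝔓) : Integrable fun t => f t * φ P t :=
  integrable_mul_packet hf (h.cont P hP) (h.bound_le_inv hP)

lemma setIntegral_compl_tri_le (h : Packets c 𝔓 φ) {T P : Tile} (hP : P ∈ 𝔓) (hT : T.Fat P)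
    {u : ℝ → ℝ} (hu : Integrable u) (hu0 : ∀ x, 0 ≤ u x) {M : ℝ} (hM : AvgLE P.n P.m u M) :
    ∫ t in (tri T.n T.m)ᶜ, u t * ‖φ P t‖ ≤ 8 * M * P.len * T.len⁻¹ := by
  have hl := P.len_pos
  have hL := T.len_pos
  have hi := (integrable_mul_inv_rho hu P 2).const_mul T.len⁻¹
  have hb : Integrable fun t => u t * ‖φ P t‖ :=
    hu.mul_bdd (c := P.len⁻¹) (h.cont P hP).norm.aestronglyMeasurable
      (Filter.Eventually.of_forall fun t => by simpa using h.bound_le_inv hP t)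
  calc ∫ t in (tri T.n T.m)ᶜ, u t * ‖φ P t‖
      ≤ ∫ t in (tri T.n T.m)ᶜ, T.len⁻¹ * (u t * (P.rho t ^ 2)⁻¹) := by
        refine setIntegral_mono_on hb.integrableOn hi.integrableOn
          measurableSet_Ico.compl fun t ht => ?_
        have hPm : P.len * P.m ∈ dya T.n T.m := hT.1 P.left_mem
        have h1 : T.len ≤ |t - P.len * P.m| := by
          rw [abs_sub_comm]; exact le_abs_sub_of_notMem_tri hPm ht
        have h2 : ‖φ P t‖ ≤ P.len⁻¹ * (P.len / T.len * (P.rho t ^ 2)⁻¹) := by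
          refine (h.bound P hP t).trans ?_
          gcongr
          exact Tile.inv_rho_pow_le_of_le hL h1
        calc u t * ‖φ P t‖ ≤ u t * (P.len⁻¹ * (P.len / T.len * (P.rho t ^ 2)⁻¹)) :=
              mul_le_mul_of_nonneg_left h2 (hu0 t)
          _ = _ := by field_simp
    _ ≤ ∫ t, T.len⁻¹ * (u t * (P.rho t ^ 2)⁻¹) :=
        setIntegral_le_integral hi (Filter.Eventually.of_forall fun t => by
          have := P.rho_pos t
          have := hu0 t
          positivity)
    _ ≤ _ := by
        rw [integral_const_mul, mul_comm]
        gcongr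
        exact hM.integral_mul_le hu hu0

/-- The Carleson-type estimate for wave packet coefficients in a lacunary tree. -/
lemma tree_le (h : Packets c 𝔓 φ) (h𝔓 : Thin 𝔓) (hc : |c| ≤ 66) {ε : ℝ} (hε : |ε| = 1) {T : Tile}
    {D : Finset Tile} (hD : D ⊆ 𝔓) (hT : ∀ P ∈ D, Tile.Lac c ε T P) {f : ℝ → ℂ}
    (hf : Integrable f) {M : ℝ} (hM : 0 ≤ M)
    (havg : ∀ P ∈ D, AvgLE P.n P.m (fun x => ‖f x‖) M) :
    ∑ P ∈ D, P.len * ‖∫ t, f t * φ P t‖ ^ 2 ≤ cT * M ^ 2 * T.len := by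
  have hL := T.len_pos
  have hz := cZ_nonneg
  have hr := cR_nonneg
  rcases D.eq_empty_or_nonempty with rfl | ⟨P₀, hP₀⟩
  · have := cT_pos; simp only [Finset.sum_empty]; positivity
  have hF : ∀ P ∈ D, T.Fat P := fun P hP => (hT P hP).1
  set A := ∑ P ∈ D, P.len * ‖∫ t, f t * φ P t‖ ^ 2 with hA
  have hA0 : 0 ≤ A := Finset.sum_nonneg fun P _ => mul_nonneg P.len_pos.le (sq_nonneg _)
  set z : Tile → ℂ := fun P => (starRingEnd ℂ) (∫ t, f t * φ P t) with hzdef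
  have hzB : ∀ P ∈ D, ‖z P‖ ≤ 8 * M := fun P hP => by
    rw [hzdef]; simp only [RCLike.norm_conj]
    exact h.norm_integral_le hf (hD hP) (havg P hP)
  set F : ℝ → ℂ := fun t => ∑ P ∈ D, (P.len : ℂ) * z P * φ P t with hFdef
  set w : ℝ → ℝ := fun t => ‖F t‖ with hw
  set u : ℝ → ℝ := fun t => ‖f t‖ with hu
  have hFc : Continuous F :=
    continuous_finsetSum D fun P hP => continuous_const.mul (h.cont P (hD hP))
  have hwc : Continuous w := hFc.norm
  have hwB : ∀ t, w t ≤ ∑ P ∈ D, 8 * M := fun t => by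
    refine (norm_sum_le _ _).trans (Finset.sum_le_sum fun P hP => ?_)
    have hl := P.len_pos
    rw [norm_mul, norm_mul, Complex.norm_real, Real.norm_of_nonneg hl.le]
    calc _ ≤ P.len * (8 * M) * P.len⁻¹ := by
          gcongr
          · exact hzB P hP
          · exact h.bound_le_inv (hD hP) t
      _ = _ := by field_simp
  have hui : Integrable u := hf.norm
  have huw : Integrable fun t => u t * w t :=
    hui.mul_bdd (c := ∑ P ∈ D, 8 * M) hwc.aestronglyMeasurable
      (Filter.Eventually.of_forall fun t => by
        rw [Real.norm_of_nonneg (norm_nonneg _)]; exact hwB t)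
  -- the square function of the coefficients as a pairing
  have hAF : (A : ℂ) = ∫ t, f t * F t := by
    have e : ∀ t, f t * F t = ∑ P ∈ D, ((P.len : ℂ) * z P) * (f t * φ P t) := fun t => by
      rw [hFdef, Finset.mul_sum]; exact Finset.sum_congr rfl fun P _ => by ring
    simp_rw [e]
    rw [integral_finsetSum _ fun P hP => (h.integrable_mul hf (hD hP)).const_mul _, hA,
      Complex.ofReal_sum]
    refine Finset.sum_congr rfl fun P _ => ?_
    rw [integral_const_mul, mul_assoc, hzdef, Complex.conj_mul', Complex.ofReal_mul,
      Complex.ofReal_pow]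
  have hA1 : A ≤ ∫ t, u t * w t := by
    have h1 : ‖(A : ℂ)‖ ≤ ∫ t, ‖f t * F t‖ := by rw [hAF]; exact norm_integral_le_integral_norm _
    rw [Complex.norm_real, Real.norm_of_nonneg hA0] at h1
    simpa only [norm_mul] using h1
  -- almost orthogonality
  have hq : ∀ P ∈ 𝔓, ∀ t, 1 + (0 : ℝ) * (t - 0) ^ 2 ≤ 4 * P.rho t ^ 2 := fun P _ t => by
    have := P.one_le_rho t
    nlinarith
  have hmem : ∀ P ∈ D, MemLp (vec φ 0 0 P) 2 volume := fun P hP =>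
    h.memLp_vec le_rfl (hD hP) (hq P (hD hP))
  have hvec : (fun t => ∑ P ∈ D, ((P.len : ℂ) * (starRingEnd ℂ) (z P)) * vec φ 0 0 P t)
      = fun t => (starRingEnd ℂ) (F t) := by
    funext t
    rw [hFdef, map_sum]
    refine Finset.sum_congr rfl fun P _ => ?_
    simp [vec]
  have hF2 := memLp_sum_mul (fun P => (P.len : ℂ) * (starRingEnd ℂ) (z P)) hmem
  have hw2 : ∫ t, w t ^ 2 ≤ 16 * cR * cZ * A := by
    have h1 := (h.gramBound le_rfl hq).norm_sum_sq_le_of_tree hc hε (by positivity) h𝔓 hD hT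
      fun P => (starRingEnd ℂ) (z P)
    rw [lp2_sum _ hmem, norm_lp2_sq hF2] at h1
    have h2 : ∀ t, ‖∑ P ∈ D, (P.len : ℂ) * (starRingEnd ℂ) (z P) * vec φ 0 0 P t‖ = w t :=
      fun t => by rw [congrFun hvec t, RCLike.norm_conj]
    simp_rw [h2, RCLike.norm_conj] at h1
    refine h1.trans (le_of_eq ?_)
    rw [hA]
    congr 1
    refine Finset.sum_congr rfl fun P _ => ?_
    rw [hzdef, RCLike.norm_conj]
  have hw2i : Integrable fun t => w t ^ 2 := by
    rw [hvec] at hF2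
    have := (memLp_two_iff_integrable_sq_norm hF2.1).1 hF2
    simpa only [RCLike.norm_conj] using this
  -- the local part
  set K := 570000 * cZ * (8 * M) with hK
  have hloc : ∫ t in tri T.n T.m, u t * w t
      ≤ 6 * M * (∫ t in tri T.n T.m, w t) + 18 * M * K * T.len := by
    have hdy : ∀ i : ℤ, dya T.n i ⊆ tri T.n T.m →
        ∫ t in dya T.n i, u t * w t
          ≤ 6 * M * (∫ t in dya T.n i, w t) + 6 * M * K * 2 ^ T.n := by
      intro i hi
      refine setIntegral_mul_le_of_stopping (D := D) (by positivity) hui (fun _ => norm_nonneg _)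
        hwc (fun _ => norm_nonneg _) huw havg ?_ _ _ ?_
      · intro n m hl t ht t' ht'
        exact h.leaf_osc_le hc hD hF (by positivity) hzB hl ht ht'
      · have h1 : ∫ t in dya T.n i, u t ≤ ∫ t in tri T.n T.m, u t :=
          setIntegral_mono_set hui.integrableOn (Filter.Eventually.of_forall fun _ => norm_nonneg _)
            hi.eventuallyLE
        have hsub := (hF P₀ hP₀).1
        have hs2 : P₀.len * P₀.m ∈ dya T.n T.m := hsub P₀.left_mem
        have hs3 : ∀ x ∈ dya P₀.n P₀.m, x ∈ dya T.n T.m := hsub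
        have hle : 2 ^ P₀.n * ((P₀.m : ℝ) + 1) ≤ 2 ^ T.n * (T.m + 1) := by
          have hp : (0 : ℝ) < 2 ^ P₀.n := by positivity
          unfold dya at hs3
          have := (Ico_subset_Ico_iff (by nlinarith)).1 hs3
          exact this.2
        have h2 := havg P₀ hP₀ (2 ^ T.n * (T.m - 1)) (2 ^ T.n * (T.m + 2)) (by
          have := hs2.1
          rw [Tile.len] at this
          have hp : (0 : ℝ) < 2 ^ T.n := by positivity
          nlinarith) (by
          have hp : (0 : ℝ) < 2 ^ T.n := by positivity
          nlinarith)
        have hp : (0 : ℝ) < 2 ^ T.n := by positivity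
        change ∫ t in tri T.n T.m, u t ≤ _ at h2
        have : 0 ≤ M * 2 ^ T.n := by positivity
        nlinarith
    have hp : (0 : ℝ) < 2 ^ T.n := by positivity
    have e1 := hdy (T.m - 1) (by
      unfold dya tri; push_cast; apply Ico_subset_Ico <;> nlinarith)
    have e2 := hdy T.m (by
      unfold dya tri; apply Ico_subset_Ico <;> nlinarith)
    have e3 := hdy (T.m + 1) (by
      unfold dya tri; push_cast; apply Ico_subset_Ico <;> nlinarith)
    rw [setIntegral_tri _ _ huw]
    have hwt : ∫ t in tri T.n T.m, w t = (∫ x in dya T.n (T.m - 1), w x)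
        + (∫ x in dya T.n T.m, w x) + ∫ x in dya T.n (T.m + 1), w x := by
      have := setIntegral_tri (g := (tri T.n T.m).indicator w) T.n T.m
        ((integrable_indicator_iff measurableSet_Ico).2
          (hwc.integrableOn_Icc.mono_set Ico_subset_Icc_self))
      have e : ∀ s ⊆ tri T.n T.m, MeasurableSet s →
          ∫ x in s, (tri T.n T.m).indicator w x = ∫ x in s, w x := fun s hs hms =>
        setIntegral_congr_fun hms fun x hx => indicator_of_mem (hs hx) w
      rw [e _ subset_rfl (measurableSet_tri _ _), e _ _ (measurableSet_dya _ _),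
        e _ _ (measurableSet_dya _ _), e _ _ (measurableSet_dya _ _)] at this
      · exact this
      all_goals unfold dya tri; push_cast; apply Ico_subset_Ico <;> nlinarith
    rw [hwt]
    change _ ≤ _ + 18 * M * K * 2 ^ T.n
    linarith
  have hX : (∫ t in tri T.n T.m, w t) ^ 2 ≤ 3 * T.len * (16 * cR * cZ * A) := by
    have hp : (0 : ℝ) < 2 ^ T.n := by positivity
    refine (sq_setIntegral_le hwc (by nlinarith) hw2i).trans ?_
    rw [← mul_sub, show ((T.m : ℝ) + 2 - (T.m - 1)) = 3 by ring, mul_comm _ (3 : ℝ)]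
    gcongr
    exact le_rfl
  -- the tail
  have htail : ∫ t in (tri T.n T.m)ᶜ, u t * w t ≤ 25728 * M ^ 2 * T.len := by
    have hbi : ∀ P ∈ D, Integrable fun t => u t * ‖φ P t‖ := fun P hP => by
      simpa only [norm_mul] using (h.integrable_mul hf (hD hP)).norm
    calc ∫ t in (tri T.n T.m)ᶜ, u t * w t
        ≤ ∫ t in (tri T.n T.m)ᶜ, ∑ P ∈ D, P.len * (8 * M) * (u t * ‖φ P t‖) := by
          refine setIntegral_mono huw.integrableOn
            (integrable_finsetSum _ fun P hP => ((hbi P hP).const_mul _).integrableOn) fun t => ?_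
          have : w t ≤ ∑ P ∈ D, P.len * (8 * M) * ‖φ P t‖ := by
            refine (norm_sum_le _ _).trans (Finset.sum_le_sum fun P hP => ?_)
            have hl := P.len_pos
            rw [norm_mul, norm_mul, Complex.norm_real, Real.norm_of_nonneg hl.le]
            gcongr
            exact hzB P hP
          calc u t * w t ≤ u t * ∑ P ∈ D, P.len * (8 * M) * ‖φ P t‖ := by gcongr
            _ = _ := by rw [Finset.mul_sum]; exact Finset.sum_congr rfl fun P _ => by ring
      _ = ∑ P ∈ D, P.len * (8 * M) * ∫ t in (tri T.n T.m)ᶜ, u t * ‖φ P t‖ := by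
          rw [integral_finsetSum _ fun P hP => ((hbi P hP).const_mul _).integrableOn]
          exact Finset.sum_congr rfl fun P _ => integral_const_mul _ _
      _ ≤ ∑ P ∈ D, P.len * (8 * M) * (8 * M * P.len * T.len⁻¹) := by
          refine Finset.sum_le_sum fun P hP => ?_
          have hl := P.len_pos
          gcongr
          exact h.setIntegral_compl_tri_le (hD hP) (hF P hP) hui (fun _ => norm_nonneg _)
            (havg P hP)
      _ = 64 * M ^ 2 * T.len⁻¹ * ∑ P ∈ D, P.len * P.len := by
          rw [Finset.mul_sum]; exact Finset.sum_congr rfl fun P _ => by ring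
      _ ≤ 64 * M ^ 2 * T.len⁻¹ * (402 * T.len * T.len) := by
          gcongr; exact sum_len_sq_le hF
      _ = _ := by field_simp; ring
  have hsplit : ∫ t, u t * w t
      = (∫ t in tri T.n T.m, u t * w t) + ∫ t in (tri T.n T.m)ᶜ, u t * w t :=
    (integral_add_compl measurableSet_Ico huw).symm
  set X := ∫ t in tri T.n T.m, w t
  set E := 3 * (16 * cR * cZ) * T.len with hE
  have hE0 : 0 ≤ E := by positivity
  have hX' : X ^ 2 ≤ E * A := by rw [hE]; linarith
  have hkey : 6 * M * X ≤ A / 2 + 18 * M ^ 2 * E := by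
    rcases hE0.eq_or_lt with h0 | h0
    · rw [← h0] at hX' ⊢
      have : X = 0 := by nlinarith [sq_nonneg X]
      rw [this]; nlinarith
    · have h1 : 0 ≤ (X - 6 * M * E) ^ 2 := sq_nonneg _
      have : 12 * M * X * E ≤ E * A + 36 * M ^ 2 * E * E := by nlinarith
      have : E * (6 * M * X) ≤ E * (A / 2 + 18 * M ^ 2 * E) := by linarith
      exact le_of_mul_le_mul_left this h0
  have hfin : A ≤ 36 * M ^ 2 * E + 2 * (18 * M * K * T.len + 25728 * M ^ 2 * T.len) := by linarith
  refine hfin.trans (le_of_eq ?_)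
  rw [hE, hK, cT]; ring

end Packets

open Classical in
/-- The size of the coefficients `a` over the collection `𝒬` is at most `σ`. -/
def SizeLE (c : ℤ) (𝔓 : Finset Tile) (a : Tile → ℝ) (𝒬 : Finset Tile) (σ : ℝ) : Prop :=
  ∀ T ∈ 𝔓, ∀ ε : ℝ, |ε| = 1 → ∑ P ∈ 𝒬 with Tile.Lac c ε T P, P.len * a P ^ 2 ≤ σ ^ 2 * T.len

/-- A function whose averages, raised to the power `s`, are under control near all tiles of a
collection which is localized to the interval `dya n₀ m₀`. -/
structure LocalData (c : ℤ) (𝔓 : Finset Tile) (n₀ m₀ : ℤ) (φ : Tile → ℝ → ℂ) (f : ℝ → ℂ)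
    (s : ℝ) : Prop where
  packets : Packets c 𝔓 φ
  thin : Thin 𝔓
  le : |c| ≤ 66
  offset : c = 0 ∨ 14 ≤ |c|
  sub : ∀ P ∈ 𝔓, P.I ⊆ dya n₀ m₀
  int : Integrable f
  int_rpow : Integrable fun t => ‖f t‖ ^ s
  avg : ∀ P ∈ 𝔓, AvgLE P.n P.m (fun t => ‖f t‖ ^ s) 1
  one_lt : 1 < s
  le_two : s ≤ 2

lemma Tile.exists_lac_self {c : ℤ} (h : c = 0 ∨ 14 ≤ |c|) (P : Tile) :
    ∃ ε : ℝ, |ε| = 1 ∧ Tile.Lac c ε P P := by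
  have e : (2 : ℝ) ^ P.n * P.xi = P.k + 5 := by
    rw [Tile.xi, mul_div_cancel₀ _ (by positivity)]
  have hF : P.Fat P := ⟨subset_rfl, by rw [e, add_sub_cancel_left]; norm_num⟩
  rcases le_or_gt c 0 with hc | hc
  · refine ⟨1, by simp, hF, ?_⟩
    have : (c : ℝ) ≤ 0 := by exact_mod_cast hc
    rw [e]; linarith
  · refine ⟨-1, by simp, hF, ?_⟩
    have : 14 ≤ c := by rcases h with h | h <;> [omega; rwa [abs_of_pos hc] at h]
    have : (14 : ℝ) ≤ c := by exact_mod_cast this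
    rw [e]; linarith

lemma SizeLE.le {c : ℤ} (hc : c = 0 ∨ 14 ≤ |c|) {𝔓 𝒬 : Finset Tile} {a : Tile → ℝ} {σ : ℝ}
    (h : SizeLE c 𝔓 a 𝒬 σ) (h𝒬 : 𝒬 ⊆ 𝔓) (hσ : 0 ≤ σ) {P : Tile} (hP : P ∈ 𝒬) : a P ≤ σ := by
  classical
  obtain ⟨ε, hε, hL⟩ := Tile.exists_lac_self hc P
  have h1 := h P (h𝒬 hP) ε hε
  have h2 : P.len * a P ^ 2 ≤ ∑ P' ∈ 𝒬 with Tile.Lac c ε P P', P'.len * a P' ^ 2 :=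
    Finset.single_le_sum (f := fun P' : Tile => P'.len * a P' ^ 2)
      (fun P' _ => mul_nonneg P'.len_pos.le (sq_nonneg _)) (Finset.mem_filter.2 ⟨hP, hL⟩)
  have hl := P.len_pos
  exact (le_abs_self _).trans (abs_le_of_sq_le_sq
    (le_of_mul_le_mul_left (by linarith) hl) hσ)

open Classical in
lemma SizeLE.mono {c : ℤ} {𝔓 𝒬 𝒬' : Finset Tile} {a : Tile → ℝ} {σ σ' : ℝ}
    (h : SizeLE c 𝔓 a 𝒬 σ) (hs : 𝒬' ⊆ 𝒬) (hσ : 0 ≤ σ) (hσ' : σ ≤ σ') :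
    SizeLE c 𝔓 a 𝒬' σ' := by
  intro T hT ε hε
  refine (Finset.sum_le_sum_of_subset_of_nonneg (Finset.filter_subset_filter _ hs)
    fun P _ _ => mul_nonneg P.len_pos.le (sq_nonneg _)).trans ((h T hT ε hε).trans ?_)
  have := T.len_pos
  gcongr

lemma AvgLE.mono_fun {n m : ℤ} {u v : ℝ → ℝ} {M C : ℝ} (h : AvgLE n m u M) (hu : Integrable u)
    (hv : Integrable v) (hle : ∀ t, v t ≤ C * u t) (hC : 0 ≤ C) : AvgLE n m v (C * M) := by
  intro a b ha hb
  calc ∫ x in Ico a b, v x ≤ ∫ x in Ico a b, C * u x :=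
        setIntegral_mono hv.integrableOn (hu.const_mul C).integrableOn hle
    _ = C * ∫ x in Ico a b, u x := integral_const_mul _ _
    _ ≤ C * (M * (b - a)) := by gcongr; exact h a b ha hb
    _ = _ := by ring

lemma dya_subset_dya_iff {n m n' m' : ℤ} (h : dya n m ⊆ dya n' m') :
    (2 : ℝ) ^ n' * m' ≤ 2 ^ n * m ∧ (2 : ℝ) ^ n * (m + 1) ≤ 2 ^ n' * (m' + 1) := by
  have hp : (0 : ℝ) < 2 ^ n := by positivity
  exact (Ico_subset_Ico_iff (by nlinarith)).1 h

lemma AvgLE.of_subset {n m n' m' : ℤ} {u : ℝ → ℝ} {M : ℝ} (h : AvgLE n m u M)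
    (hs : dya n m ⊆ dya n' m') : AvgLE n' m' u M := fun a b ha hb =>
  h a b (ha.trans (dya_subset_dya_iff hs).1) ((dya_subset_dya_iff hs).2.trans hb)

namespace LocalData

variable {c : ℤ} {𝔓 : Finset Tile} {n₀ m₀ : ℤ} {φ : Tile → ℝ → ℂ} {f : ℝ → ℂ} {s : ℝ}

lemma avg_norm (h : LocalData c 𝔓 n₀ m₀ φ f s) {P : Tile} (hP : P ∈ 𝔓) :
    AvgLE P.n P.m (fun t => ‖f t‖) 2 := by
  intro a b ha hb
  have hab : a ≤ b := by
    have hp : (0 : ℝ) < 2 ^ P.n := by positivity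
    nlinarith
  have hi : IntegrableOn (fun _ : ℝ => (1 : ℝ)) (Ico a b) := integrableOn_const (by simp)
  calc ∫ x in Ico a b, ‖f x‖ ≤ ∫ x in Ico a b, (‖f x‖ ^ s + 1) := by
        refine setIntegral_mono h.int.norm.integrableOn (h.int_rpow.integrableOn.add hi)
          fun x => ?_
        rcases le_or_gt ‖f x‖ 1 with h1 | h1
        · have : 0 ≤ ‖f x‖ ^ s := by positivity
          simp only; linarith
        · have := Real.self_le_rpow_of_one_le h1.le h.one_lt.le
          simp only; linarith
    _ = (∫ x in Ico a b, ‖f x‖ ^ s) + (b - a) := by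
        rw [integral_add h.int_rpow.integrableOn hi]; simp [hab]
    _ ≤ 2 * (b - a) := by linarith [h.avg P hP a b ha hb]

open Classical in
lemma sizeLE (h : LocalData c 𝔓 n₀ m₀ φ f s) :
    SizeLE c 𝔓 (fun P => ‖∫ t, f t * φ P t‖) 𝔓 (2 * √cT) := by
  intro T _ ε hε
  refine (h.packets.tree_le h.thin h.le hε (Finset.filter_subset _ _)
    (fun P hP => (Finset.mem_filter.1 hP).2) h.int zero_le_two
    fun P hP => h.avg_norm (Finset.mem_filter.1 hP).1).trans (le_of_eq ?_)
  rw [mul_pow, Real.sq_sqrt cT_pos.le]; ring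

/-- The constant in the estimate of the number of trees. -/
noncomputable def cN : ℝ := 4 * (16 * cR * cZ + 25728 * (16 * cR) * 5 ^ 2 * cZ * cR) * 16

lemma cN_nonneg : 0 ≤ cN := by
  have := cZ_nonneg; have := cR_nonneg; unfold cN; positivity

/-- The quadratic weight adapted to an interval is comparable with the weight of the interval. -/
lemma _root_.BSF.Tile.quad_le (T : Tile) (t : ℝ) :
    1 + (T.len ^ 2)⁻¹ * (t - T.len * T.m) ^ 2 ≤ T.rho t ^ 2 ∧
      T.rho t ^ 2 ≤ 2 * (1 + (T.len ^ 2)⁻¹ * (t - T.len * T.m) ^ 2) := by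
  have hl := T.len_pos
  have e : (T.len ^ 2)⁻¹ * (t - T.len * T.m) ^ 2 = (|t - T.len * T.m| / T.len) ^ 2 := by
    rw [div_pow, sq_abs]; field_simp
  have h0 : 0 ≤ |t - T.len * T.m| / T.len := by positivity
  rw [e, T.rho_eq]
  constructor
  · nlinarith
  · nlinarith [sq_nonneg (|t - T.len * T.m| / T.len - 1)]

lemma _root_.BSF.Tile.rho_le_two_mul {T P : Tile} (h : P.I ⊆ T.I) (t : ℝ) :
    T.rho t ≤ 2 * P.rho t := by
  have hl := T.len_pos
  have hl' := P.len_pos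
  have hm : P.len * P.m ∈ dya T.n T.m := h P.left_mem
  have hle : P.len ≤ T.len := by
    have := dya_subset_dya_iff h
    unfold Tile.len; linarith
  rw [T.rho_eq, P.rho_eq]
  have h1 : |t - T.len * T.m| ≤ |t - P.len * P.m| + T.len := by
    have h2 : |P.len * P.m - T.len * T.m| ≤ T.len := by
      have h1 := hm.1
      change T.len * _ ≤ _ at h1
      rw [abs_of_nonneg (sub_nonneg.2 h1)]
      have := hm.2
      change _ < T.len * _ at this
      linarith
    have := abs_sub_le t (P.len * P.m) (T.len * T.m)
    linarith
  have h3 : |t - T.len * T.m| / T.len ≤ |t - P.len * P.m| / P.len + 1 := by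
    calc _ ≤ (|t - P.len * P.m| + T.len) / T.len := by gcongr
      _ = |t - P.len * P.m| / T.len + 1 := by field_simp
      _ ≤ _ := by gcongr
  have h4 : 0 ≤ |t - P.len * P.m| / P.len := by positivity
  linarith

open Classical in
/-- The trees of large size on one side. -/
lemma exists_trees_side (h : LocalData c 𝔓 n₀ m₀ φ f s) {𝒬 : Finset Tile} (h𝒬 : 𝒬 ⊆ 𝔓) {σ : ℝ}
    (hσ : 0 < σ) (hs : SizeLE c 𝔓 (fun P => ‖∫ t, f t * φ P t‖) 𝒬 (2 * σ)) {ε : ℝ}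
    (hε : |ε| = 1) :
    ∃ S : Finset Tile, S ⊆ 𝔓 ∧
      ∑ T ∈ S, T.len ≤ cN * (2 * √cT) ^ ((2 - s) / (s - 1)) * σ ^ (-(s / (s - 1))) * 2 ^ n₀ ∧
      ∀ T ∈ 𝔓, ∑ P ∈ 𝒬 with Tile.Lac c ε T P ∧ ∀ T' ∈ S, ¬ T'.Fat P,
        P.len * ‖∫ t, f t * φ P t‖ ^ 2 ≤ σ ^ 2 * T.len := by
  obtain ⟨S, D, hS, hD, hdis, hord, hleft⟩ := exists_selection (Tile.Lac c ε) Tile.Fat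
    (fun T P hTP => hTP.1) (fun T => ε * T.xi) (fun P => P.len * ‖∫ t, f t * φ P t‖ ^ 2)
    (fun T => σ ^ 2 * T.len) (fun T => mul_nonneg (sq_nonneg _) T.len_pos.le)
    (fun P => mul_nonneg P.len_pos.le (sq_nonneg _)) 𝔓 𝒬
  refine ⟨S, hS, ?_, hleft⟩
  have hcT := cT_pos
  have hsq : 0 < √cT := Real.sqrt_pos.2 hcT
  have hs1 : 0 < s - 1 := sub_pos.2 h.one_lt
  rcases 𝔓.eq_empty_or_nonempty with h𝔓 | ⟨P₀, hP₀⟩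
  · rw [h𝔓, Finset.subset_empty] at hS
    rw [hS, Finset.sum_empty]
    have := cN_nonneg
    positivity
  set lam : ℝ := (2 * √cT / σ) ^ (1 / (s - 1)) with hlam
  have hlam0 : 0 < lam := by positivity
  have hlam1 : lam ^ (s - 1) = 2 * √cT / σ := by
    rw [hlam, ← Real.rpow_mul (by positivity), one_div_mul_cancel hs1.ne', Real.rpow_one]
  set f1 : ℝ → ℂ := {t | ‖f t‖ ≤ lam}.indicator f with hf1
  set f2 : ℝ → ℂ := {t | ‖f t‖ ≤ lam}ᶜ.indicator f with hf2
  have hnull : NullMeasurableSet {t | ‖f t‖ ≤ lam} volume :=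
    nullMeasurableSet_le h.int.norm.aemeasurable aemeasurable_const
  have hi1 : Integrable f1 := h.int.indicator₀ hnull
  have hi2 : Integrable f2 := h.int.indicator₀ hnull.compl
  have hsum : ∀ t, f t = f1 t + f2 t := fun t =>
    (congrFun (indicator_self_add_compl {t | ‖f t‖ ≤ lam} f) t).symm
  set M2 := (lam ^ (s - 1))⁻¹ with hM2
  have hM20 : 0 < M2 := by positivity
  have hM2sq : cT * M2 ^ 2 = (σ / 2) ^ 2 := by
    rw [hM2, hlam1, inv_div, div_pow, mul_pow, Real.sq_sqrt hcT.le]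
    field_simp
  have hb2 : ∀ t, ‖f2 t‖ ≤ M2 * ‖f t‖ ^ s := by
    intro t
    by_cases ht : ‖f t‖ ≤ lam
    · have : f2 t = 0 := indicator_of_notMem (by simpa using ht) f
      rw [this, norm_zero]
      positivity
    · have : f2 t = f t := indicator_of_mem (by simpa using ht) f
      rw [this, hM2, inv_mul_eq_div, le_div_iff₀ (by positivity)]
      push Not at ht
      have h0 : 0 < ‖f t‖ := hlam0.trans ht
      calc ‖f t‖ * lam ^ (s - 1) ≤ ‖f t‖ ^ (1 : ℝ) * ‖f t‖ ^ (s - 1) := by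
            rw [Real.rpow_one]; gcongr
        _ = ‖f t‖ ^ s := by rw [← Real.rpow_add h0]; ring_nf
  have hb1 : ∀ t, ‖f1 t‖ ^ 2 ≤ lam ^ (2 - s) * ‖f t‖ ^ s := by
    intro t
    by_cases ht : ‖f t‖ ≤ lam
    · have : f1 t = f t := indicator_of_mem (by simpa using ht) f
      rw [this]
      rcases (norm_nonneg (f t)).eq_or_lt with h0 | h0
      · rw [← h0, zero_pow two_ne_zero]; positivity
      · calc ‖f t‖ ^ 2 = ‖f t‖ ^ (2 - s) * ‖f t‖ ^ s := by
              rw [← Real.rpow_add h0, sub_add_cancel]; norm_num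
          _ ≤ _ := by
              gcongr
              linarith [h.le_two]
    · have : f1 t = 0 := indicator_of_notMem (by simpa using ht) f
      rw [this, norm_zero, zero_pow two_ne_zero]
      positivity
  have havg2 : ∀ P ∈ 𝔓, AvgLE P.n P.m (fun t => ‖f2 t‖) M2 := fun P hP => by
    simpa using (h.avg P hP).mono_fun h.int_rpow hi2.norm hb2 hM20.le
  have hsplit : ∀ P ∈ 𝔓, ∫ t, f t * φ P t = (∫ t, f1 t * φ P t) + ∫ t, f2 t * φ P t :=
    fun P hP => by
      rw [← integral_add (h.packets.integrable_mul hi1 hP) (h.packets.integrable_mul hi2 hP)]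
      exact integral_congr_ae (Filter.Eventually.of_forall fun t => by
        change f t * φ P t = f1 t * φ P t + f2 t * φ P t
        rw [hsum t, add_mul])
  have htree2 : ∀ (ε' : ℝ), |ε'| = 1 → ∀ T D, D ⊆ 𝔓 → (∀ P ∈ D, Tile.Lac c ε' T P) →
      ∑ P ∈ D, P.len * ‖∫ t, f2 t * φ P t‖ ^ 2 ≤ (σ / 2) ^ 2 * T.len := by
    intro ε' hε' T D hD hT
    rw [← hM2sq]
    exact h.packets.tree_le h.thin h.le hε' hD hT hi2 hM20.le fun P hP => havg2 P (hD hP)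
  have hsmall2 : ∀ P ∈ 𝔓, ‖∫ t, f2 t * φ P t‖ ≤ σ / 2 := by
    intro P hP
    obtain ⟨ε', hε', hL⟩ := Tile.exists_lac_self h.offset P
    have h1 := htree2 ε' hε' P {P} (by simpa using hP) (by simpa using hL)
    rw [Finset.sum_singleton] at h1
    have hl := P.len_pos
    exact (le_abs_self _).trans (abs_le_of_sq_le_sq
      (le_of_mul_le_mul_left (by linarith) hl) (by positivity))
  set T₀ : Tile := ⟨n₀, m₀, 0⟩ with hT₀
  set β : ℝ := (T₀.len ^ 2)⁻¹ with hβ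
  set a : ℝ := T₀.len * T₀.m with ha
  have hβ0 : 0 ≤ β := by positivity
  have hq : ∀ P ∈ 𝔓, ∀ t, 1 + β * (t - a) ^ 2 ≤ 4 * P.rho t ^ 2 := fun P hP t => by
    have h1 := (T₀.quad_le t).1
    have h2 : T₀.rho t ≤ 2 * P.rho t := Tile.rho_le_two_mul (h.sub P hP) t
    have h3 := T₀.rho_pos t
    calc _ ≤ T₀.rho t ^ 2 := h1
      _ ≤ (2 * P.rho t) ^ 2 := by gcongr
      _ = _ := by ring
  set G : ℝ → ℂ := fun t => f1 t * (((1 + β * (t - a) ^ 2)⁻¹ : ℝ) : ℂ) with hG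
  have hGb : ∀ t, ‖G t‖ ^ 2 ≤ 2 * lam ^ (2 - s) * (‖f t‖ ^ s * (T₀.rho t ^ 2)⁻¹) := by
    intro t
    have hq0 : 1 ≤ 1 + β * (t - a) ^ 2 := by
      have : 0 ≤ β * (t - a) ^ 2 := by positivity
      linarith
    have h1 : ((1 + β * (t - a) ^ 2)⁻¹) ^ 2 ≤ 2 * (T₀.rho t ^ 2)⁻¹ := by
      have h2 := (T₀.quad_le t).2
      have h3 := T₀.rho_pos t
      calc ((1 + β * (t - a) ^ 2)⁻¹) ^ 2 ≤ (1 + β * (t - a) ^ 2)⁻¹ := by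
            rw [sq]; exact mul_le_of_le_one_left (by positivity) (inv_le_one_of_one_le₀ hq0)
        _ ≤ _ := by
            rw [inv_eq_one_div, div_le_iff₀ (by positivity), mul_right_comm, ← div_eq_mul_inv,
              le_div_iff₀ (by positivity), one_mul]
            exact h2
    rw [hG]
    simp only
    rw [norm_mul, mul_pow, Complex.norm_real, Real.norm_of_nonneg (by positivity)]
    calc _ ≤ (lam ^ (2 - s) * ‖f t‖ ^ s) * (2 * (T₀.rho t ^ 2)⁻¹) := by
          gcongr
          exact hb1 t
      _ = _ := by ring
  have hGi := (integrable_mul_inv_rho h.int_rpow T₀ 2).const_mul (2 * lam ^ (2 - s))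
  have hGm : AEStronglyMeasurable G volume := by
    refine hi1.aestronglyMeasurable.mul (Measurable.aestronglyMeasurable ?_)
    exact Complex.measurable_ofReal.comp (by fun_prop)
  have hG2 : MemLp G 2 volume := by
    rw [memLp_two_iff_integrable_sq_norm hGm]
    exact hGi.mono' (hGm.norm.pow 2) (Filter.Eventually.of_forall fun t => by
      rw [Real.norm_of_nonneg (by positivity)]; exact hGb t)
  have hGn : ‖lp2 G‖ ^ 2 ≤ 16 * lam ^ (2 - s) * 2 ^ n₀ := by
    rw [norm_lp2_sq hG2]
    refine (integral_mono ((memLp_two_iff_integrable_sq_norm hGm).1 hG2) hGi hGb).trans ?_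
    rw [integral_const_mul]
    have h1 : AvgLE T₀.n T₀.m (fun t => ‖f t‖ ^ s) 1 := (h.avg P₀ hP₀).of_subset (h.sub P₀ hP₀)
    have h2 := h1.integral_mul_le h.int_rpow fun t => by positivity
    calc _ ≤ 2 * lam ^ (2 - s) * (8 * 1 * T₀.len) := by gcongr
      _ = _ := by rw [hT₀, Tile.len]; ring
  have hinner : ∀ P ∈ 𝔓, ⟪lp2 (Packets.vec φ β a P), lp2 G⟫_ℂ = ∫ t, f1 t * φ P t := by
    intro P hP
    rw [inner_lp2 (h.packets.memLp_vec hβ0 hP (hq P hP)) hG2]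
    refine integral_congr_ae (Filter.Eventually.of_forall fun t => ?_)
    have hq0 : (1 + β * (t - a) ^ 2 : ℝ) ≠ 0 := by positivity
    have hq1 : (((1 + β * (t - a) ^ 2 : ℝ) : ℂ)) ≠ 0 := Complex.ofReal_ne_zero.2 hq0
    simp only [Packets.vec, hG, map_mul, Complex.conj_conj, Complex.conj_ofReal]
    rw [Complex.ofReal_inv]
    field_simp
  have hmain := (h.packets.gramBound hβ0 hq).sum_len_le h.le hε
    (by have := cR_nonneg; positivity) h.thin
    (fun T hT => ⟨(hD T hT).1.trans h𝒬, (hD T hT).2.1⟩) hord hdis (lp2 G) (σ := σ / 2) (by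
      intro T hT
      have h1 : ∑ P ∈ D T, P.len * ‖∫ t, f t * φ P t‖ ^ 2
          ≤ ∑ P ∈ D T, (2 * (P.len * ‖⟪lp2 (Packets.vec φ β a P), lp2 G⟫_ℂ‖ ^ 2)
            + 2 * (P.len * ‖∫ t, f2 t * φ P t‖ ^ 2)) := by
        refine Finset.sum_le_sum fun P hP => ?_
        have hP' := h𝒬 ((hD T hT).1 hP)
        have hl := P.len_pos
        rw [hinner P hP', hsplit P hP']
        have h2 := norm_add_le (∫ t, f1 t * φ P t) (∫ t, f2 t * φ P t)
        have h3 : ‖(∫ t, f1 t * φ P t) + ∫ t, f2 t * φ P t‖ ^ 2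
            ≤ 2 * ‖∫ t, f1 t * φ P t‖ ^ 2 + 2 * ‖∫ t, f2 t * φ P t‖ ^ 2 := by
          refine (pow_le_pow_left₀ (norm_nonneg _) h2 2).trans ?_
          nlinarith [sq_nonneg (‖∫ t, f1 t * φ P t‖ - ‖∫ t, f2 t * φ P t‖)]
        nlinarith
      rw [Finset.sum_add_distrib, ← Finset.mul_sum, ← Finset.mul_sum] at h1
      have h2 := htree2 ε hε T (D T) ((hD T hT).1.trans h𝒬) (hD T hT).2.1
      have h3 := (hD T hT).2.2
      nlinarith) (B := 5) (by
      intro T hT P hP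
      have hP' := h𝒬 ((hD T hT).1 hP)
      have h1 := hs.le h.offset h𝒬 (by positivity) ((hD T hT).1 hP)
      have h2 := hsmall2 P hP'
      have h3 : ∫ t, f1 t * φ P t = (∫ t, f t * φ P t) - ∫ t, f2 t * φ P t := by
        rw [hsplit P hP']; ring
      rw [hinner P hP', h3]
      refine (norm_sub_le _ _).trans ?_
      linarith)
  have hK0 : 0 ≤ 16 * cR * cZ + 25728 * (16 * cR) * 5 ^ 2 * cZ * cR := by
    have := cZ_nonneg; have := cR_nonneg; positivity
  have hfin := hmain.trans (mul_le_mul_of_nonneg_left hGn hK0)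
  have hlam2 : lam ^ (2 - s) = (2 * √cT) ^ ((2 - s) / (s - 1)) * σ ^ (-((2 - s) / (s - 1))) := by
    rw [hlam, ← Real.rpow_mul (by positivity), one_div_mul_eq_div,
      Real.div_rpow (by positivity) hσ.le, Real.rpow_neg hσ.le, div_eq_mul_inv]
  have hσs : σ ^ (-(s / (s - 1))) = σ ^ (-((2 - s) / (s - 1))) * (σ ^ 2)⁻¹ := by
    rw [← Real.rpow_natCast, ← Real.rpow_neg hσ.le, ← Real.rpow_add hσ]
    congr 1
    field_simp
    push_cast
    ring
  rw [hlam2] at hfin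
  rw [hσs, cN]
  have hσ2 : (0 : ℝ) < σ ^ 2 := by positivity
  have : ∑ T ∈ S, T.len ≤ ((σ / 2) ^ 2)⁻¹ * ((16 * cR * cZ + 25728 * (16 * cR) * 5 ^ 2 * cZ * cR) *
      (16 * ((2 * √cT) ^ ((2 - s) / (s - 1)) * σ ^ (-((2 - s) / (s - 1)))) * 2 ^ n₀)) := by
    rw [inv_mul_eq_div, le_div_iff₀ (by positivity), mul_comm]
    exact hfin
  refine this.trans (le_of_eq ?_)
  field_simp
  ring

/-- The constant in the estimate of the number of trees. -/
noncomputable def cS (s : ℝ) : ℝ := 2 * (cN * (2 * √cT) ^ ((2 - s) / (s - 1)))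

lemma cS_nonneg (s : ℝ) : 0 ≤ cS s := by
  have := cN_nonneg; unfold cS; positivity

open Classical in
/-- Halving the size by removing trees. -/
lemma exists_trees (h : LocalData c 𝔓 n₀ m₀ φ f s) {𝒬 : Finset Tile} (h𝒬 : 𝒬 ⊆ 𝔓) {σ : ℝ}
    (hσ : 0 < σ) (hs : SizeLE c 𝔓 (fun P => ‖∫ t, f t * φ P t‖) 𝒬 (2 * σ)) :
    ∃ S : Finset Tile, S ⊆ 𝔓 ∧
      ∑ T ∈ S, T.len ≤ cS s * σ ^ (-(s / (s - 1))) * 2 ^ n₀ ∧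
      SizeLE c 𝔓 (fun P => ‖∫ t, f t * φ P t‖) (𝒬.filter fun P => ∀ T ∈ S, ¬ T.Fat P) σ := by
  obtain ⟨S1, hS1, hl1, hb1⟩ := h.exists_trees_side h𝒬 hσ hs (ε := 1) (by simp)
  obtain ⟨S2, hS2, hl2, hb2⟩ := h.exists_trees_side h𝒬 hσ hs (ε := -1) (by simp)
  refine ⟨S1 ∪ S2, Finset.union_subset hS1 hS2, ?_, ?_⟩
  · have h1 : ∑ T ∈ S1 ∪ S2, T.len ≤ ∑ T ∈ S1, T.len + ∑ T ∈ S2, T.len := by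
      rw [← Finset.sum_union_inter]
      exact le_add_of_nonneg_right (Finset.sum_nonneg fun T _ => T.len_pos.le)
    refine h1.trans ((add_le_add hl1 hl2).trans (le_of_eq ?_))
    rw [cS]; ring
  · intro T hT ε hε
    rw [Finset.filter_filter]
    rcases eq_or_eq_neg_of_abs_eq hε with rfl | rfl
    · refine (Finset.sum_le_sum_of_subset_of_nonneg (fun P hP => ?_)
        fun P _ _ => mul_nonneg P.len_pos.le (sq_nonneg _)).trans (hb1 T hT)
      rw [Finset.mem_filter] at hP ⊢
      exact ⟨hP.1, hP.2.2, fun T' hT' => hP.2.1 T' (Finset.mem_union_left _ hT')⟩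
    · refine (Finset.sum_le_sum_of_subset_of_nonneg (fun P hP => ?_)
        fun P _ _ => mul_nonneg P.len_pos.le (sq_nonneg _)).trans (hb2 T hT)
      rw [Finset.mem_filter] at hP ⊢
      exact ⟨hP.1, hP.2.2, fun T' hT' => hP.2.1 T' (Finset.mem_union_right _ hT')⟩

end LocalData

/-- Minkowski's inequality. -/
lemma sum_sq_setIntegral_le {s : Set ℝ} (N : Finset ℤ) {u : ℤ → ℝ → ℝ}
    {v : ℝ → ℝ} (hu : ∀ n ∈ N, IntegrableOn (u n) s) (hv : IntegrableOn v s) (hv0 : ∀ x, 0 ≤ v x)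
    (huv : ∀ x, ∑ n ∈ N, u n x ^ 2 ≤ v x ^ 2) :
    ∑ n ∈ N, (∫ x in s, u n x) ^ 2 ≤ (∫ x in s, v x) ^ 2 := by
  set A : ℤ → ℝ := fun n => ∫ x in s, u n x
  set S := ∑ n ∈ N, A n ^ 2 with hS
  have hS0 : 0 ≤ S := Finset.sum_nonneg fun _ _ => sq_nonneg _
  have hX0 : 0 ≤ ∫ x in s, v x := integral_nonneg hv0
  have h1 : S = ∫ x in s, ∑ n ∈ N, A n * u n x := by
    rw [integral_finsetSum _ fun n hn => (hu n hn).const_mul _, hS]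
    exact Finset.sum_congr rfl fun n _ => by rw [integral_const_mul, sq]
  have h2 : S ≤ √S * ∫ x in s, v x := by
    conv_lhs => rw [h1]
    rw [← integral_const_mul]
    refine setIntegral_mono (integrable_finsetSum _ fun n hn => (hu n hn).const_mul _)
      (hv.const_mul _) fun x => ?_
    refine (Real.sum_mul_le_sqrt_mul_sqrt N A fun n => u n x).trans ?_
    gcongr
    exact Real.sqrt_le_iff.2 ⟨hv0 x, huv x⟩
  rcases hS0.eq_or_lt with h0 | h0
  · rw [← h0]; positivity
  · have h3 : 0 < √S := Real.sqrt_pos.2 h0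
    have h4 : √S ≤ ∫ x in s, v x := by
      rw [← Real.mul_self_sqrt hS0] at h2
      simp only [Real.sqrt_mul_self h3.le] at h2
      exact le_of_mul_le_mul_left h2 h3
    calc S = √S ^ 2 := (Real.sq_sqrt hS0).symm
      _ ≤ _ := by gcongr

open Classical in
/-- A Carleson estimate for vector-valued averages. -/
lemma sum_sq_avg_le (𝓘 : Finset (ℤ × ℤ)) (N : Finset ℤ) (hN : ∀ I ∈ 𝓘, I.1 ∈ N)
    {u : ℤ → ℝ → ℝ} {v : ℝ → ℝ} (hu : ∀ n ∈ N, Integrable (u n))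
    (hv : Integrable v) (hv0 : ∀ x, 0 ≤ v x) (huv : ∀ x, ∑ n ∈ N, u n x ^ 2 ≤ v x ^ 2) {M : ℝ}
    (havg : ∀ I ∈ 𝓘, AvgLE I.1 I.2 v M) (j l : ℤ)
    (hjl : ∫ x in dya j l, v x ≤ 2 * M * 2 ^ j) :
    ∑ I ∈ 𝓘 with dya I.1 I.2 ⊆ dya j l, ((2 : ℝ) ^ I.1)⁻¹ * (∫ x in dya I.1 I.2, u I.1 x) ^ 2
      + (2 ^ j)⁻¹ * ∑ n ∈ N with j < n, (∫ x in dya j l, u n x) ^ 2 ≤ 4 * M ^ 2 * 2 ^ j := by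
  have leaf : ∀ j l, (∀ I ∈ 𝓘, ¬ dya I.1 I.2 ⊆ dya j l) → ∫ x in dya j l, v x ≤ 2 * M * 2 ^ j →
      ∑ I ∈ 𝓘 with dya I.1 I.2 ⊆ dya j l, ((2 : ℝ) ^ I.1)⁻¹ * (∫ x in dya I.1 I.2, u I.1 x) ^ 2
      + (2 ^ j)⁻¹ * ∑ n ∈ N with j < n, (∫ x in dya j l, u n x) ^ 2 ≤ 4 * M ^ 2 * 2 ^ j := by
    intro j l hl hjl
    have hp : (0 : ℝ) < 2 ^ j := by positivity
    rw [Finset.filter_false_of_mem hl, Finset.sum_empty, zero_add, inv_mul_eq_div,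
      div_le_iff₀ hp]
    have h1 := sum_sq_setIntegral_le (s := dya j l) (N.filter fun n => j < n)
      (fun n hn => (hu n (Finset.mem_filter.1 hn).1).integrableOn) hv.integrableOn hv0
      (fun x => (Finset.sum_le_sum_of_subset_of_nonneg (Finset.filter_subset _ _)
        fun _ _ _ => sq_nonneg _).trans (huv x))
    have h2 : 0 ≤ ∫ x in dya j l, v x := integral_nonneg hv0
    calc _ ≤ _ := h1
      _ ≤ (2 * M * 2 ^ j) ^ 2 := by gcongr
      _ = _ := by ring
  obtain ⟨j₀, hj₀⟩ : ∃ j₀ : ℤ, ∀ I ∈ 𝓘, j₀ ≤ I.1 := by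
    obtain ⟨b, hb⟩ := (𝓘.image Prod.fst).bddBelow
    exact ⟨b, fun I hI => hb (Finset.mem_image_of_mem _ hI)⟩
  have main : ∀ d : ℕ, ∀ j l : ℤ, j < j₀ + d → ∫ x in dya j l, v x ≤ 2 * M * 2 ^ j →
      ∑ I ∈ 𝓘 with dya I.1 I.2 ⊆ dya j l, ((2 : ℝ) ^ I.1)⁻¹ * (∫ x in dya I.1 I.2, u I.1 x) ^ 2
      + (2 ^ j)⁻¹ * ∑ n ∈ N with j < n, (∫ x in dya j l, u n x) ^ 2 ≤ 4 * M ^ 2 * 2 ^ j := by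
    intro d
    induction d with
    | zero =>
      intro j l hj hjl
      refine leaf j l (fun I hI hs => ?_) hjl
      have := dya_subset_dya_iff hs
      have h2 : (2 : ℝ) ^ I.1 ≤ 2 ^ j := by linarith
      have := (zpow_le_zpow_iff_right₀ (one_lt_two (α := ℝ))).1 h2
      have := hj₀ I hI
      simp at hj
      omega
    | succ d ih =>
      intro j l hj hjl
      by_cases hl : ∀ I ∈ 𝓘, ¬ dya I.1 I.2 ⊆ dya j l
      · exact leaf j l hl hjl
      push Not at hl
      obtain ⟨I₀, hI₀, hs₀⟩ := hl
      have hp : (0 : ℝ) < 2 ^ (j - 1) := by positivity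
      have e2 : (2 : ℝ) ^ j = 2 * 2 ^ (j - 1) := by
        rw [← zpow_one_add₀ (by norm_num)]; congr 1; ring
      have hvJ : ∫ x in dya j l, v x ≤ M * 2 ^ j := by
        have := (havg I₀ hI₀).of_subset hs₀ (2 ^ j * l) (2 ^ j * (l + 1)) le_rfl le_rfl
        rw [← mul_sub, add_sub_cancel_left, mul_one] at this
        exact this
      have hsub : ∀ i : ℤ, dya (j - 1) i ⊆ dya j l → ∫ x in dya (j - 1) i, v x
          ≤ 2 * M * 2 ^ (j - 1) := fun i hi => by
        have : ∫ x in dya (j - 1) i, v x ≤ ∫ x in dya j l, v x :=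
          setIntegral_mono_set hv.integrableOn (Filter.Eventually.of_forall hv0) hi.eventuallyLE
        rw [e2] at hvJ
        linarith
      have hsp := dya_split j l
      have q1 := ih (j - 1) (2 * l) (by push_cast at hj; omega)
        (hsub _ (by rw [hsp]; exact subset_union_left))
      have q2 := ih (j - 1) (2 * l + 1) (by push_cast at hj; omega)
        (hsub _ (by rw [hsp]; exact subset_union_right))
      set g : ℤ × ℤ → ℝ := fun I => ((2 : ℝ) ^ I.1)⁻¹ * (∫ x in dya I.1 I.2, u I.1 x) ^ 2 with hg
      have hg0 : ∀ I, 0 ≤ g I := fun I => by positivity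
      have hconv : ∀ n ∈ N, ((2 : ℝ) ^ j)⁻¹ * (∫ x in dya j l, u n x) ^ 2
          ≤ (2 ^ (j - 1))⁻¹ * (∫ x in dya (j - 1) (2 * l), u n x) ^ 2
            + (2 ^ (j - 1))⁻¹ * (∫ x in dya (j - 1) (2 * l + 1), u n x) ^ 2 := by
        intro n hn
        rw [setIntegral_dya_split j l (hu n hn).integrableOn, e2, mul_inv]
        set a := ∫ x in dya (j - 1) (2 * l), u n x
        set b := ∫ x in dya (j - 1) (2 * l + 1), u n x
        have hi : (0 : ℝ) < (2 ^ (j - 1))⁻¹ := by positivity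
        nlinarith [mul_nonneg hi.le (sq_nonneg (a - b))]
      have hsum1 : ∑ I ∈ 𝓘 with dya I.1 I.2 ⊆ dya j l, g I
          ≤ ∑ I ∈ 𝓘 with dya I.1 I.2 ⊆ dya (j - 1) (2 * l), g I
            + ∑ I ∈ 𝓘 with dya I.1 I.2 ⊆ dya (j - 1) (2 * l + 1), g I
            + ∑ n ∈ N with n = j, ((2 : ℝ) ^ j)⁻¹ * (∫ x in dya j l, u n x) ^ 2 := by
        have h1 : 𝓘.filter (fun I => dya I.1 I.2 ⊆ dya j l)
            ⊆ (𝓘.filter fun I => dya I.1 I.2 ⊆ dya (j - 1) (2 * l))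
              ∪ (𝓘.filter fun I => dya I.1 I.2 ⊆ dya (j - 1) (2 * l + 1))
              ∪ 𝓘.filter fun I => I = (j, l) := by
          intro I hI
          obtain ⟨hI1, hI2⟩ := Finset.mem_filter.1 hI
          have h2 := dya_subset_dya_iff hI2
          have h3 : (2 : ℝ) ^ I.1 ≤ 2 ^ j := by linarith
          have h4 := (zpow_le_zpow_iff_right₀ (one_lt_two (α := ℝ))).1 h3
          rcases h4.eq_or_lt with h5 | h5
          · have h6 : I.2 = l := by
              by_contra hne
              have := dya_disjoint (n := j) hne
              rw [h5] at hI2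
              exact Set.disjoint_left.1 this (left_mem_dya j I.2) (hI2 (left_mem_dya j I.2))
            exact Finset.mem_union_right _ (Finset.mem_filter.2 ⟨hI1, Prod.ext h5 h6⟩)
          · have hx := hI2 (left_mem_dya I.1 I.2)
            rw [hsp] at hx
            refine Finset.mem_union_left _ ?_
            rcases hx with hx | hx
            · exact Finset.mem_union_left _ (Finset.mem_filter.2 ⟨hI1,
                dya_subset_of_le (by omega) hx (left_mem_dya I.1 I.2)⟩)
            · exact Finset.mem_union_right _ (Finset.mem_filter.2 ⟨hI1,
                dya_subset_of_le (by omega) hx (left_mem_dya I.1 I.2)⟩)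
        have hun : ∀ s t : Finset (ℤ × ℤ), ∑ I ∈ s ∪ t, g I ≤ ∑ I ∈ s, g I + ∑ I ∈ t, g I := by
          intro s t
          rw [← Finset.sum_union_inter]
          exact le_add_of_nonneg_right (Finset.sum_nonneg fun I _ => hg0 I)
        have h2 : ∑ I ∈ 𝓘 with I = (j, l), g I
            ≤ ∑ n ∈ N with n = j, ((2 : ℝ) ^ j)⁻¹ * (∫ x in dya j l, u n x) ^ 2 := by
          by_cases hjl : (j, l) ∈ 𝓘
          · rw [Finset.filter_eq' , if_pos hjl, Finset.filter_eq', if_pos (hN _ hjl)]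
            simp [hg]
          · rw [Finset.filter_eq', if_neg hjl, Finset.sum_empty]
            exact Finset.sum_nonneg fun n _ => by positivity
        refine (Finset.sum_le_sum_of_subset_of_nonneg h1 fun I _ _ => hg0 I).trans ?_
        refine (hun _ _).trans (add_le_add (hun _ _) h2)
      have hsum2 : ∑ n ∈ N with n = j, ((2 : ℝ) ^ j)⁻¹ * (∫ x in dya j l, u n x) ^ 2
          + (2 ^ j)⁻¹ * ∑ n ∈ N with j < n, (∫ x in dya j l, u n x) ^ 2
          ≤ (2 ^ (j - 1))⁻¹ * (∑ n ∈ N with j - 1 < n, (∫ x in dya (j - 1) (2 * l), u n x) ^ 2)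
            + (2 ^ (j - 1))⁻¹ * ∑ n ∈ N with j - 1 < n,
              (∫ x in dya (j - 1) (2 * l + 1), u n x) ^ 2 := by
        rw [Finset.mul_sum, Finset.mul_sum, Finset.mul_sum, ← Finset.sum_add_distrib,
          ← Finset.sum_union]
        · have : N.filter (fun n => n = j) ∪ N.filter (fun n => j < n)
              = N.filter fun n => j - 1 < n := by
            rw [← Finset.filter_or]
            refine Finset.filter_congr fun n _ => ?_
            omega
          rw [this]
          exact Finset.sum_le_sum fun n hn => hconv n (Finset.mem_filter.1 hn).1
        · rw [Finset.disjoint_filter]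
          intro n _ h1 h2
          omega
      have e3 : 4 * M ^ 2 * (2 : ℝ) ^ j = 4 * M ^ 2 * 2 ^ (j - 1) + 4 * M ^ 2 * 2 ^ (j - 1) := by
        rw [e2]; ring
      rw [e3]
      linarith
  exact main (j + 1 - j₀).toNat j l (by omega) hjl

open Classical in
/-- The data of a dualizing sequence of functions `h`, one for each scale, tested against the
functions `θ`. -/
structure DualData (𝔓 : Finset Tile) (n₀ m₀ : ℤ) (N : Finset ℤ) (h : ℤ → ℝ → ℂ) (v : ℝ → ℝ)
    (θ : Tile → ℝ → ℂ) (B s : ℝ) : Prop where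
  cont : ∀ P ∈ 𝔓, Continuous (θ P)
  bound : ∀ P ∈ 𝔓, ∀ t ∈ P.I, ‖θ P t‖ ≤ P.len⁻¹
  bessel : ∀ n m : ℤ, ∀ u : ℝ → ℂ, Integrable u → Integrable (fun t => ‖u t‖ ^ 2) →
    ∑ P ∈ 𝔓 with P.n = n ∧ P.m = m, P.len * ‖∫ t in P.I, u t * θ P t‖ ^ 2
      ≤ B * ∫ t in dya n m, ‖u t‖ ^ 2
  nonneg : 0 ≤ B
  mem : ∀ P ∈ 𝔓, P.n ∈ N
  sub : ∀ P ∈ 𝔓, P.I ⊆ dya n₀ m₀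
  int : ∀ n ∈ N, Integrable (h n)
  meas : Measurable v
  v_nonneg : ∀ x, 0 ≤ v x
  int_v : Integrable v
  int_rpow : Integrable fun x => v x ^ s
  sq_le : ∀ x, ∑ n ∈ N, ‖h n x‖ ^ 2 ≤ v x ^ 2
  avg : ∀ P ∈ 𝔓, AvgLE P.n P.m (fun x => v x ^ s) 1
  one_lt : 1 < s
  le_two : s ≤ 2

namespace DualData

variable {𝔓 : Finset Tile} {n₀ m₀ : ℤ} {N : Finset ℤ} {h : ℤ → ℝ → ℂ} {v : ℝ → ℝ}
    {θ : Tile → ℝ → ℂ} {B s : ℝ}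

lemma integrableOn_mul (H : DualData 𝔓 n₀ m₀ N h v θ B s) {u : ℝ → ℂ} (hu : Integrable u)
    {P : Tile} (hP : P ∈ 𝔓) : IntegrableOn (fun t => u t * θ P t) P.I := by
  have : IntegrableOn (fun t => θ P t * u t) P.I := by
    refine Integrable.bdd_mul (c := P.len⁻¹) hu.integrableOn
      (H.cont P hP).aestronglyMeasurable.restrict ?_
    exact (ae_restrict_iff' (measurableSet_dya _ _)).2
      (Filter.Eventually.of_forall fun t ht => H.bound P hP t ht)
  simpa only [mul_comm] using this

lemma norm_integral_le (H : DualData 𝔓 n₀ m₀ N h v θ B s) {u : ℝ → ℂ} (hu : Integrable u)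
    {P : Tile} (hP : P ∈ 𝔓) :
    ‖∫ t in P.I, u t * θ P t‖ ≤ P.len⁻¹ * ∫ t in P.I, ‖u t‖ := by
  rw [← integral_const_mul]
  refine norm_integral_le_of_norm_le (hu.norm.integrableOn.const_mul _) ?_
  refine (ae_restrict_iff' (measurableSet_dya _ _)).2 (Filter.Eventually.of_forall fun t ht => ?_)
  rw [norm_mul, mul_comm]
  exact mul_le_mul_of_nonneg_right (H.bound P hP t ht) (norm_nonneg _)

/-- The Carleson estimate for the coefficients of a vector-valued function over a tree. -/
lemma tree_le (H : DualData 𝔓 n₀ m₀ N h v θ B s) {T : Tile} {D : Finset Tile} (hD : D ⊆ 𝔓)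
    (hT : ∀ P ∈ D, T.Fat P) {u : ℤ → ℝ → ℂ} {w : ℝ → ℝ} (hu : ∀ n ∈ N, Integrable (u n))
    (hw : Integrable w) (hw0 : ∀ x, 0 ≤ w x) (huw : ∀ x, ∑ n ∈ N, ‖u n x‖ ^ 2 ≤ w x ^ 2) {M : ℝ}
    (hM : 0 ≤ M) (havg : ∀ P ∈ D, AvgLE P.n P.m w M) :
    ∑ P ∈ D, P.len * ‖∫ t in P.I, u P.n t * θ P t‖ ^ 2 ≤ 804 * M ^ 2 * T.len := by
  classical
  have hl := T.len_pos
  rcases D.eq_empty_or_nonempty with rfl | ⟨P₀, hP₀⟩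
  · simp; positivity
  set g : ℤ × ℤ → ℝ := fun I => ((2 : ℝ) ^ I.1)⁻¹ * (∫ x in dya I.1 I.2, ‖u I.1 x‖) ^ 2 with hg
  have hg0 : ∀ I, 0 ≤ g I := fun I => by positivity
  have h1 : ∀ P ∈ D, P.len * ‖∫ t in P.I, u P.n t * θ P t‖ ^ 2 ≤ g (P.n, P.m) := by
    intro P hP
    have hp := P.len_pos
    have := H.norm_integral_le (hu _ (H.mem P (hD hP))) (hD hP)
    calc P.len * ‖∫ t in P.I, u P.n t * θ P t‖ ^ 2
        ≤ P.len * (P.len⁻¹ * ∫ t in P.I, ‖u P.n t‖) ^ 2 := by gcongr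
      _ = g (P.n, P.m) := by
        rw [mul_pow, hg, Tile.len, Tile.I]
        have : (0 : ℝ) < 2 ^ P.n := by positivity
        field_simp
  set 𝓘 := D.image fun P => (P.n, P.m)
  have h2 : ∑ P ∈ D, g (P.n, P.m) ≤ 201 * ∑ I ∈ 𝓘, g I := by
    rw [← Finset.sum_fiberwise_of_maps_to (s := D) (t := D.image Tile.n) (g := Tile.n)
        fun P hP => Finset.mem_image_of_mem _ hP,
      ← Finset.sum_fiberwise_of_maps_to (s := 𝓘) (t := D.image Tile.n) (g := Prod.fst)
        (fun I hI => by
          obtain ⟨P, hP, rfl⟩ := Finset.mem_image.1 hI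
          exact Finset.mem_image_of_mem _ hP), Finset.mul_sum]
    refine Finset.sum_le_sum fun n _ => ?_
    have := Tile.sum_fiber_le hT n (u := fun m => g (n, m)) fun m => hg0 _
    calc ∑ P ∈ D with P.n = n, g (P.n, P.m) = ∑ P ∈ D with P.n = n, g (n, P.m) :=
          Finset.sum_congr rfl fun P hP => by rw [(Finset.mem_filter.1 hP).2]
      _ ≤ _ := this
      _ = 201 * ∑ I ∈ ((D.filter fun P => P.n = n).image Tile.m).image (fun m => (n, m)), g I := by
        rw [Finset.sum_image (fun a _ b _ hab => (Prod.ext_iff.1 hab).2)]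
      _ ≤ _ := by
        refine mul_le_mul_of_nonneg_left (Finset.sum_le_sum_of_subset_of_nonneg ?_
          fun I _ _ => hg0 I) (by norm_num)
        intro I hI
        simp only [Finset.mem_image, Finset.mem_filter] at hI
        obtain ⟨m, ⟨P, ⟨hP, hn⟩, rfl⟩, rfl⟩ := hI
        refine Finset.mem_filter.2 ⟨Finset.mem_image.2 ⟨P, hP, ?_⟩, rfl⟩
        rw [hn]
  have hjl : ∫ x in dya T.n T.m, w x ≤ 2 * M * 2 ^ T.n := by
    have := ((havg P₀ hP₀).of_subset (hT P₀ hP₀).1) (2 ^ T.n * T.m) (2 ^ T.n * (T.m + 1))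
      le_rfl le_rfl
    rw [← mul_sub, add_sub_cancel_left, mul_one] at this
    have h3 : 0 ≤ M * (2 : ℝ) ^ T.n := by positivity
    exact this.trans (by linarith)
  have h3 := sum_sq_avg_le 𝓘 N (fun I hI => by
      obtain ⟨P, hP, rfl⟩ := Finset.mem_image.1 hI
      exact H.mem P (hD hP)) (u := fun n x => ‖u n x‖) (fun n hn => (hu n hn).norm) hw hw0 huw
    (fun I hI => by
      obtain ⟨P, hP, rfl⟩ := Finset.mem_image.1 hI
      exact havg P hP) T.n T.m hjl
  rw [Finset.filter_true_of_mem (fun I hI => by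
      obtain ⟨P, hP, rfl⟩ := Finset.mem_image.1 hI
      exact (hT P hP).1)] at h3
  have h4 : 0 ≤ ((2 : ℝ) ^ T.n)⁻¹ * ∑ n ∈ N with T.n < n, (∫ x in dya T.n T.m, ‖u n x‖) ^ 2 := by
    positivity
  have h5 := Finset.sum_le_sum h1
  change _ ≤ 804 * M ^ 2 * 2 ^ T.n
  change ∑ I ∈ 𝓘, g I + _ ≤ _ at h3
  linarith

/-- The global Bessel inequality. -/
lemma bessel_le (H : DualData 𝔓 n₀ m₀ N h v θ B s) {u : ℤ → ℝ → ℂ} {w : ℝ → ℝ}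
    (hu : ∀ n ∈ N, Integrable (u n)) (hu2 : ∀ n ∈ N, Integrable fun t => ‖u n t‖ ^ 2)
    (hw : Integrable fun x => w x ^ 2) (huw : ∀ x, ∑ n ∈ N, ‖u n x‖ ^ 2 ≤ w x ^ 2) :
    ∑ P ∈ 𝔓, P.len * ‖∫ t in P.I, u P.n t * θ P t‖ ^ 2 ≤ B * ∫ t in dya n₀ m₀, w t ^ 2 := by
  classical
  have h1 : ∀ n ∈ N, ∑ P ∈ 𝔓 with P.n = n, P.len * ‖∫ t in P.I, u P.n t * θ P t‖ ^ 2
      ≤ B * ∫ t in dya n₀ m₀, ‖u n t‖ ^ 2 := by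
    intro n hn
    set F := 𝔓.filter fun P => P.n = n
    rw [← Finset.sum_fiberwise_of_maps_to (s := F) (t := F.image Tile.m) (g := Tile.m)
      fun P hP => Finset.mem_image_of_mem _ hP]
    calc _ ≤ ∑ m ∈ F.image Tile.m, B * ∫ t in dya n m, ‖u n t‖ ^ 2 := by
          refine Finset.sum_le_sum fun m _ => ?_
          rw [Finset.filter_filter]
          refine le_of_eq_of_le (Finset.sum_congr rfl fun P hP => ?_)
            (H.bessel n m (u n) (hu n hn) (hu2 n hn))
          rw [(Finset.mem_filter.1 hP).2.1]
      _ = B * ∫ t in ⋃ m ∈ F.image Tile.m, dya n m, ‖u n t‖ ^ 2 := by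
          rw [← Finset.mul_sum, integral_biUnion_finset _ (fun m _ => measurableSet_dya n m)
            (fun m _ m' _ hne => dya_disjoint hne) fun m _ => (hu2 n hn).integrableOn]
      _ ≤ _ := by
          refine mul_le_mul_of_nonneg_left (setIntegral_mono_set (hu2 n hn).integrableOn
            (Filter.Eventually.of_forall fun t => sq_nonneg _) ?_) H.nonneg
          refine (iUnion₂_subset fun m hm => ?_).eventuallyLE
          obtain ⟨P, hP, rfl⟩ := Finset.mem_image.1 hm
          obtain ⟨hP', rfl⟩ := Finset.mem_filter.1 hP
          exact H.sub P hP'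
  rw [← Finset.sum_fiberwise_of_maps_to (s := 𝔓) (t := N) (g := Tile.n) H.mem]
  calc _ ≤ ∑ n ∈ N, B * ∫ t in dya n₀ m₀, ‖u n t‖ ^ 2 := Finset.sum_le_sum h1
    _ = B * ∫ t in dya n₀ m₀, ∑ n ∈ N, ‖u n t‖ ^ 2 := by
      rw [integral_finsetSum _ fun n hn => (hu2 n hn).integrableOn, Finset.mul_sum]
    _ ≤ _ := mul_le_mul_of_nonneg_left (setIntegral_mono
      (integrable_finsetSum _ fun n hn => (hu2 n hn).integrableOn) hw.integrableOn huw) H.nonneg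

end DualData

section

variable {𝔓 : Finset Tile} {c : ℤ} {a b : Tile → ℝ} {σ τ : ℝ}

lemma SizeLE.sum_mul_sq_le {𝒬 D : Finset Tile} (hc : 14 ≤ |c|) (h𝒬 : 𝒬 ⊆ 𝔓)
    (ha0 : ∀ P, 0 ≤ a P) (hb0 : ∀ P, 0 ≤ b P) (hσ : 0 ≤ σ) (hτ : 0 ≤ τ) (ha : SizeLE 0 𝔓 a 𝒬 σ)
    (hb : SizeLE c 𝔓 b 𝒬 τ) {T : Tile} (hT : T ∈ 𝔓) (hD : D ⊆ 𝒬) (hF : ∀ P ∈ D, T.Fat P) :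
    ∑ P ∈ D, P.len * (a P * b P) ^ 2 ≤ (2 * σ * τ) ^ 2 * T.len := by
  classical
  have hle : ∀ P ∈ D, P.len * (a P * b P) ^ 2
      ≤ (if Tile.Lac 0 1 T P then τ ^ 2 * (P.len * a P ^ 2) else 0)
        + (if Tile.Lac 0 (-1) T P then τ ^ 2 * (P.len * a P ^ 2) else 0)
        + (if Tile.Lac c 1 T P then σ ^ 2 * (P.len * b P ^ 2) else 0)
        + (if Tile.Lac c (-1) T P then σ ^ 2 * (P.len * b P ^ 2) else 0) := by
    intro P hP
    have hl := P.len_pos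
    have h1 := ha.le (Or.inl rfl) h𝒬 hσ (hD hP)
    have h2 := hb.le (Or.inr hc) h𝒬 hτ (hD hP)
    have h3 : P.len * (a P * b P) ^ 2 ≤ τ ^ 2 * (P.len * a P ^ 2) := by
      have : b P ^ 2 ≤ τ ^ 2 := pow_le_pow_left₀ (hb0 P) h2 2
      calc P.len * (a P * b P) ^ 2 = b P ^ 2 * (P.len * a P ^ 2) := by ring
        _ ≤ _ := by gcongr
    have h4 : P.len * (a P * b P) ^ 2 ≤ σ ^ 2 * (P.len * b P ^ 2) := by
      have : a P ^ 2 ≤ σ ^ 2 := pow_le_pow_left₀ (ha0 P) h1 2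
      calc P.len * (a P * b P) ^ 2 = a P ^ 2 * (P.len * b P ^ 2) := by ring
        _ ≤ _ := by gcongr
    have p3 : 0 ≤ τ ^ 2 * (P.len * a P ^ 2) := by positivity
    have p4 : 0 ≤ σ ^ 2 * (P.len * b P ^ 2) := by positivity
    have hcase : Tile.Lac 0 1 T P ∨ Tile.Lac 0 (-1) T P ∨ Tile.Lac c 1 T P ∨ Tile.Lac c (-1) T P := by
      have hfat := hF P hP
      unfold Tile.Lac
      simp only [hfat, true_and, Int.cast_zero, sub_zero, one_mul, neg_mul]
      have hc' : (14 : ℝ) ≤ |(c : ℝ)| := by exact_mod_cast hc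
      set x := (2 : ℝ) ^ P.n * T.xi - P.k
      by_contra! hcon
      obtain ⟨k1, k2, k3, k4⟩ := hcon
      rcases abs_cases (c : ℝ) with ⟨e, _⟩ | ⟨e, _⟩ <;> linarith
    rcases hcase with h | h | h | h <;> rw [if_pos h] <;> split_ifs <;> linarith
  refine (Finset.sum_le_sum hle).trans ?_
  simp only [Finset.sum_add_distrib, ← Finset.sum_filter, ← Finset.mul_sum]
  have hsub : ∀ c' ε, D.filter (Tile.Lac c' ε T) ⊆ 𝒬.filter (Tile.Lac c' ε T) := fun c' ε =>
    Finset.filter_subset_filter _ hD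
  have key : ∀ (c' : ℤ) (ε : ℝ) (d : Tile → ℝ) (ρ : ℝ), |ε| = 1 → SizeLE c' 𝔓 d 𝒬 ρ →
      ∑ P ∈ D with Tile.Lac c' ε T P, P.len * d P ^ 2 ≤ ρ ^ 2 * T.len := fun c' ε d ρ hε hd =>
    (Finset.sum_le_sum_of_subset_of_nonneg (hsub c' ε)
      fun P _ _ => mul_nonneg P.len_pos.le (sq_nonneg _)).trans (hd T hT ε hε)
  have k1 := key 0 1 a σ (by simp) ha
  have k2 := key 0 (-1) a σ (by simp) ha
  have k3 := key c 1 b τ (by simp) hb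
  have k4 := key c (-1) b τ (by simp) hb
  have hτ2 := sq_nonneg τ
  have hσ2 := sq_nonneg σ
  calc _ ≤ τ ^ 2 * (σ ^ 2 * T.len) + τ ^ 2 * (σ ^ 2 * T.len) + σ ^ 2 * (τ ^ 2 * T.len)
        + σ ^ 2 * (τ ^ 2 * T.len) := by gcongr
    _ = _ := by ring

lemma SizeLE.sum_mul_le {𝒬 D : Finset Tile} (hc : 14 ≤ |c|) (h𝒬 : 𝒬 ⊆ 𝔓)
    (ha0 : ∀ P, 0 ≤ a P) (hb0 : ∀ P, 0 ≤ b P) (hσ : 0 ≤ σ) (hτ : 0 ≤ τ) (ha : SizeLE 0 𝔓 a 𝒬 σ)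
    (hb : SizeLE c 𝔓 b 𝒬 τ) {T : Tile} (hT : T ∈ 𝔓) (hD : D ⊆ 𝒬) (hF : ∀ P ∈ D, T.Fat P)
    (z : Tile → ℝ) :
    ∑ P ∈ D, P.len * a P * b P * z P
      ≤ 2 * σ * τ * (√T.len * √(∑ P ∈ D, P.len * z P ^ 2)) := by
  have h1 := Real.sum_mul_le_sqrt_mul_sqrt D (fun P => √P.len * (a P * b P))
    fun P => √P.len * z P
  have h2 := SizeLE.sum_mul_sq_le hc h𝒬 ha0 hb0 hσ hτ ha hb hT hD hF
  have e1 : ∀ P : Tile, ∀ x : ℝ, (√P.len * x) ^ 2 = P.len * x ^ 2 := fun P x => by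
    rw [mul_pow, Real.sq_sqrt P.len_pos.le]
  simp only [e1] at h1
  calc ∑ P ∈ D, P.len * a P * b P * z P
      = ∑ P ∈ D, √P.len * (a P * b P) * (√P.len * z P) := by
        refine Finset.sum_congr rfl fun P _ => ?_
        have := Real.mul_self_sqrt P.len_pos.le
        linear_combination (-(a P * b P * z P)) * this
    _ ≤ _ := h1
    _ ≤ √((2 * σ * τ) ^ 2 * T.len) * √(∑ P ∈ D, P.len * z P ^ 2) := by gcongr
    _ = _ := by
        rw [Real.sqrt_mul (sq_nonneg _), Real.sqrt_sq (by positivity)]; ring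

open Classical in
/-- The contribution of a collection which is covered by few trees. -/
lemma DualData.sum_covered_le {n₀ m₀ : ℤ} {N : Finset ℤ} {h : ℤ → ℝ → ℂ} {v : ℝ → ℝ}
    {θ : Tile → ℝ → ℂ} {B s : ℝ} (H : DualData 𝔓 n₀ m₀ N h v θ B s)
    {𝒬 S : Finset Tile} (hc : 14 ≤ |c|) (h𝒬 : 𝒬 ⊆ 𝔓)
    (ha0 : ∀ P, 0 ≤ a P) (hb0 : ∀ P, 0 ≤ b P) (hσ : 0 ≤ σ) (hτ : 0 ≤ τ) (ha : SizeLE 0 𝔓 a 𝒬 σ)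
    (hb : SizeLE c 𝔓 b 𝒬 τ) (hS : S ⊆ 𝔓) {K : ℝ} (hK : 0 < K)
    (hSK : ∑ T ∈ S, T.len ≤ K * 2 ^ n₀) (hcov : ∀ P ∈ 𝒬, ∃ T ∈ S, T.Fat P) :
    ∑ P ∈ 𝒬, P.len * a P * b P * ‖∫ t in P.I, h P.n t * θ P t‖
      ≤ 2 * σ * τ * ((√B + √804) * K ^ (1 / s) * 2 ^ n₀) := by
  have hs0 : 0 < s := by linarith [H.one_lt]
  rcases 𝒬.eq_empty_or_nonempty with rfl | ⟨P₀, hP₀⟩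
  · simp; positivity
  have hp0 : (0 : ℝ) < 2 ^ n₀ := by positivity
  choose! τ' hτ'S hτ'F using hcov
  set D : Tile → Finset Tile := fun T => 𝒬.filter fun P => τ' P = T
  have hDF : ∀ T, ∀ P ∈ D T, T.Fat P := fun T P hP => by
    obtain ⟨h1, rfl⟩ := Finset.mem_filter.1 hP
    exact hτ'F P h1
  have hDQ : ∀ T, D T ⊆ 𝒬 := fun T => Finset.filter_subset _ _
  set l : ℝ := K ^ (1 / s)
  have hl : 0 < l := by positivity
  have hls : l ^ s = K := by
    rw [← Real.rpow_mul hK.le, one_div, inv_mul_cancel₀ hs0.ne', Real.rpow_one]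
  set E : Set ℝ := {x | v x ≤ l} with hE
  have hEm : MeasurableSet E := H.meas measurableSet_Iic
  -- the bounded part
  set u₁ : ℤ → ℝ → ℂ := fun n => E.indicator (h n)
  set w₁ : ℝ → ℝ := E.indicator v
  have hu₁ : ∀ n ∈ N, Integrable (u₁ n) := fun n hn => (H.int n hn).indicator hEm
  have hind2 : ∀ (F : Set ℝ) (x : ℝ), ∑ n ∈ N, ‖F.indicator (h n) x‖ ^ 2 ≤ F.indicator v x ^ 2 := by
    intro F x
    by_cases hx : x ∈ F
    · simp only [indicator_of_mem hx]; exact H.sq_le x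
    · simp [indicator_of_notMem hx]
  have hw₁l : ∀ x, w₁ x ≤ l := by
    intro x
    by_cases hx : x ∈ E
    · simp only [w₁, indicator_of_mem hx]; exact hx
    · simp [w₁, indicator_of_notMem hx]; exact hl.le
  have hw₁0 : ∀ x, 0 ≤ w₁ x := fun x => indicator_nonneg (fun x _ => H.v_nonneg x) x
  have hw₁v : ∀ x, w₁ x ≤ v x := fun x => indicator_le_self' (fun x _ => H.v_nonneg x) x
  have hw₁sq : ∀ x, w₁ x ^ 2 ≤ l ^ (2 - s) * v x ^ s := by
    intro x
    rcases (hw₁0 x).eq_or_lt with h0 | h0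
    · rw [← h0]; have := H.v_nonneg x; simp; positivity
    · have e : w₁ x ^ 2 = w₁ x ^ (2 - s) * w₁ x ^ s := by
        rw [← Real.rpow_add h0, sub_add_cancel]; norm_cast
      rw [e]
      have := H.le_two
      have := H.v_nonneg x
      gcongr
      · exact hw₁l x
      · exact hw₁v x
  have hw₁i : Integrable fun x => w₁ x ^ 2 := by
    refine (H.int_rpow.const_mul (l ^ (2 - s))).mono'
      (((H.meas.indicator hEm).pow_const 2).aestronglyMeasurable)
      (Filter.Eventually.of_forall fun x => ?_)
    rw [Real.norm_of_nonneg (sq_nonneg _)]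
    exact hw₁sq x
  have hu₁2 : ∀ n ∈ N, Integrable fun t => ‖u₁ n t‖ ^ 2 := by
    intro n hn
    refine hw₁i.mono' ((hu₁ n hn).aestronglyMeasurable.norm.pow 2)
      (Filter.Eventually.of_forall fun x => ?_)
    rw [Real.norm_of_nonneg (sq_nonneg _)]
    exact (Finset.single_le_sum (f := fun n => ‖u₁ n x‖ ^ 2) (fun _ _ => sq_nonneg _) hn).trans
      (hind2 E x)
  have hI0 : ∫ t in dya n₀ m₀, v t ^ s ≤ 2 ^ n₀ := by
    have := ((H.avg P₀ (h𝒬 hP₀)).of_subset (H.sub P₀ (h𝒬 hP₀))) (2 ^ n₀ * m₀) (2 ^ n₀ * (m₀ + 1))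
      le_rfl le_rfl
    rw [← mul_sub, add_sub_cancel_left, mul_one, one_mul] at this
    exact this
  have hz₁ : ∑ P ∈ 𝔓, P.len * ‖∫ t in P.I, u₁ P.n t * θ P t‖ ^ 2 ≤ B * (l ^ (2 - s) * 2 ^ n₀) := by
    refine (H.bessel_le hu₁ hu₁2 hw₁i (hind2 E)).trans ?_
    have hB := H.nonneg
    gcongr
    calc ∫ t in dya n₀ m₀, w₁ t ^ 2 ≤ ∫ t in dya n₀ m₀, l ^ (2 - s) * v t ^ s :=
          setIntegral_mono hw₁i.integrableOn (H.int_rpow.const_mul _).integrableOn hw₁sq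
      _ = l ^ (2 - s) * ∫ t in dya n₀ m₀, v t ^ s := integral_const_mul _ _
      _ ≤ _ := by gcongr
  -- the large part
  set u₂ : ℤ → ℝ → ℂ := fun n => Eᶜ.indicator (h n)
  set w₂ : ℝ → ℝ := Eᶜ.indicator v
  have hu₂ : ∀ n ∈ N, Integrable (u₂ n) := fun n hn => (H.int n hn).indicator hEm.compl
  have hw₂ : Integrable w₂ := H.int_v.indicator hEm.compl
  have hw₂0 : ∀ x, 0 ≤ w₂ x := fun x => indicator_nonneg (fun x _ => H.v_nonneg x) x
  have hw₂le : ∀ x, w₂ x ≤ l ^ (1 - s) * v x ^ s := by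
    intro x
    have hv := H.v_nonneg x
    by_cases hx : x ∈ E
    · simp only [w₂, indicator_of_notMem (notMem_compl_iff.2 hx)]; positivity
    · simp only [w₂, indicator_of_mem (mem_compl hx)]
      have hx' : l < v x := not_le.1 hx
      have hv' : 0 < v x := hl.trans hx'
      calc v x = v x ^ (1 - s) * v x ^ s := by rw [← Real.rpow_add hv', sub_add_cancel, Real.rpow_one]
        _ ≤ _ := by
          refine mul_le_mul_of_nonneg_right ?_ (by positivity)
          exact Real.rpow_le_rpow_of_nonpos hl hx'.le (by linarith [H.one_lt])
  have hz₂ : ∀ T ∈ S, ∑ P ∈ D T, P.len * ‖∫ t in P.I, u₂ P.n t * θ P t‖ ^ 2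
      ≤ 804 * (l ^ (1 - s)) ^ 2 * T.len := fun T _ =>
    H.tree_le ((hDQ T).trans h𝒬) (hDF T) hu₂ hw₂ hw₂0 (hind2 _) (by positivity) fun P hP => by
      have := (H.avg P (h𝒬 (hDQ T hP))).mono_fun H.int_rpow hw₂ hw₂le (by positivity)
      rwa [mul_one] at this
  have hsplit : ∀ P ∈ 𝒬, ‖∫ t in P.I, h P.n t * θ P t‖
      ≤ ‖∫ t in P.I, u₁ P.n t * θ P t‖ + ‖∫ t in P.I, u₂ P.n t * θ P t‖ := by
    intro P hP
    have hn := H.mem P (h𝒬 hP)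
    refine le_of_eq_of_le ?_ (norm_add_le _ _)
    rw [← integral_add (H.integrableOn_mul (hu₁ _ hn) (h𝒬 hP))
      (H.integrableOn_mul (hu₂ _ hn) (h𝒬 hP))]
    congr 1
    refine integral_congr_ae (Filter.Eventually.of_forall fun t => ?_)
    simp only [u₁, u₂, ← add_mul]
    rw [indicator_self_add_compl_apply]
  set z₁ : Tile → ℝ := fun P => ‖∫ t in P.I, u₁ P.n t * θ P t‖
  set z₂ : Tile → ℝ := fun P => ‖∫ t in P.I, u₂ P.n t * θ P t‖
  have hfib : ∀ z : Tile → ℝ, ∑ P ∈ 𝒬, P.len * a P * b P * z P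
      ≤ 2 * σ * τ * ∑ T ∈ S, √T.len * √(∑ P ∈ D T, P.len * z P ^ 2) := by
    intro z
    rw [← Finset.sum_fiberwise_of_maps_to hτ'S, Finset.mul_sum]
    exact Finset.sum_le_sum fun T hT => SizeLE.sum_mul_le hc h𝒬 ha0 hb0 hσ hτ ha hb (hS hT)
      (hDQ T) (hDF T) z
  have hpart₁ : ∑ T ∈ S, √T.len * √(∑ P ∈ D T, P.len * z₁ P ^ 2) ≤ √B * l * 2 ^ n₀ := by
    have hnn : ∀ T, 0 ≤ ∑ P ∈ D T, P.len * z₁ P ^ 2 := fun T =>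
      Finset.sum_nonneg fun P _ => mul_nonneg P.len_pos.le (sq_nonneg _)
    have h1 := Real.sum_sqrt_mul_sqrt_le S (f := fun T => T.len)
      (g := fun T => ∑ P ∈ D T, P.len * z₁ P ^ 2) (fun T => T.len_pos.le) hnn
    have h2 : ∑ T ∈ S, ∑ P ∈ D T, P.len * z₁ P ^ 2 ≤ B * (l ^ (2 - s) * 2 ^ n₀) := by
      rw [Finset.sum_fiberwise_of_maps_to hτ'S]
      exact (Finset.sum_le_sum_of_subset_of_nonneg h𝒬
        fun P _ _ => mul_nonneg P.len_pos.le (sq_nonneg _)).trans hz₁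
    calc _ ≤ _ := h1
      _ ≤ √(K * 2 ^ n₀) * √(B * (l ^ (2 - s) * 2 ^ n₀)) := by gcongr
      _ = √(B * (l * 2 ^ n₀) ^ 2) := by
        rw [← Real.sqrt_mul (by positivity)]
        congr 1
        have : l ^ s * l ^ (2 - s) = l ^ 2 := by
          rw [← Real.rpow_add hl, add_sub_cancel]; norm_cast
        rw [← hls]
        linear_combination (B * (2 ^ n₀) ^ 2) * this
      _ = _ := by
        rw [Real.sqrt_mul H.nonneg, Real.sqrt_sq (by positivity)]; ring
  have hpart₂ : ∑ T ∈ S, √T.len * √(∑ P ∈ D T, P.len * z₂ P ^ 2) ≤ √804 * l * 2 ^ n₀ := by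
    calc ∑ T ∈ S, √T.len * √(∑ P ∈ D T, P.len * z₂ P ^ 2)
        ≤ ∑ T ∈ S, √T.len * √(804 * (l ^ (1 - s)) ^ 2 * T.len) := by
          refine Finset.sum_le_sum fun T hT => ?_
          gcongr
          exact hz₂ T hT
      _ = √804 * l ^ (1 - s) * ∑ T ∈ S, T.len := by
          rw [Finset.mul_sum]
          refine Finset.sum_congr rfl fun T _ => ?_
          rw [Real.sqrt_mul (by positivity), Real.sqrt_mul (by norm_num),
            Real.sqrt_sq (by positivity)]
          have := Real.mul_self_sqrt T.len_pos.le
          linear_combination (√804 * l ^ (1 - s)) * this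
      _ ≤ √804 * l ^ (1 - s) * (K * 2 ^ n₀) := by gcongr
      _ = _ := by
          have : l ^ (1 - s) * l ^ s = l := by
            rw [← Real.rpow_add hl, sub_add_cancel, Real.rpow_one]
          rw [← hls]
          linear_combination (√804 * 2 ^ n₀) * this
  calc ∑ P ∈ 𝒬, P.len * a P * b P * ‖∫ t in P.I, h P.n t * θ P t‖
      ≤ ∑ P ∈ 𝒬, P.len * a P * b P * (z₁ P + z₂ P) := by
        refine Finset.sum_le_sum fun P hP => ?_
        have := P.len_pos
        have := ha0 P
        have := hb0 P
        gcongr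
        exact hsplit P hP
    _ = ∑ P ∈ 𝒬, P.len * a P * b P * z₁ P + ∑ P ∈ 𝒬, P.len * a P * b P * z₂ P := by
        rw [← Finset.sum_add_distrib]
        exact Finset.sum_congr rfl fun P _ => by ring
    _ ≤ 2 * σ * τ * (√B * l * 2 ^ n₀) + 2 * σ * τ * (√804 * l * 2 ^ n₀) :=
        add_le_add ((hfib z₁).trans (by gcongr)) ((hfib z₂).trans (by gcongr))
    _ = _ := by ring

end

lemma geom_sum_le {x : ℝ} (h0 : 0 ≤ x) (h1 : x < 1) (n : ℕ) :
    ∑ i ∈ Finset.range n, x ^ i ≤ (1 - x)⁻¹ :=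
  (summable_geometric_of_lt_one h0 h1).sum_le_tsum _ (fun i _ => pow_nonneg h0 i) |>.trans_eq
    (tsum_geometric_of_lt_one h0 h1)

/-- The constant in the number of trees needed for one step of the iteration. -/
noncomputable def cJ (s₁ s₂ : ℝ) : ℝ :=
  1 + 2 * (LocalData.cS s₁ * (2 * √cT) ^ (-(s₁ / (s₁ - 1)))
    + LocalData.cS s₂ * (2 * √cT) ^ (-(s₂ / (s₂ - 1))))

lemma cJ_pos (s₁ s₂ : ℝ) : 0 < cJ s₁ s₂ := by
  have := LocalData.cS_nonneg s₁
  have := LocalData.cS_nonneg s₂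
  have := cT_pos
  unfold cJ; positivity

/-- The constant of the local estimate. -/
noncomputable def cL (s₁ s₂ s₃ B : ℝ) : ℝ :=
  2 * (2 * √cT) * (2 * √cT) * ((√B + √804) * (cJ s₁ s₂) ^ (1 / s₃))
    * (1 - (2 : ℝ) ^ (-(2 - 1 / s₁ - 1 / s₂ - 1 / s₃)))⁻¹

lemma cL_nonneg {s₁ s₂ s₃ : ℝ} (B : ℝ) (hs : 1 / s₁ + 1 / s₂ + 1 / s₃ < 2) :
    0 ≤ cL s₁ s₂ s₃ B := by
  have h1 : (2 : ℝ) ^ (-(2 - 1 / s₁ - 1 / s₂ - 1 / s₃)) < 1 :=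
    Real.rpow_lt_one_of_one_lt_of_neg (by norm_num) (by linarith)
  have h2 : 0 ≤ (1 - (2 : ℝ) ^ (-(2 - 1 / s₁ - 1 / s₂ - 1 / s₃)))⁻¹ := inv_nonneg.2 (by linarith)
  have := cT_pos
  have := cJ_pos s₁ s₂
  unfold cL; positivity

open Classical in
/-- The main estimate, localized to a dyadic interval near which all functions have averages at
most one. -/
theorem local_estimate {𝔓 : Finset Tile} {c n₀ m₀ : ℤ} {N : Finset ℤ} {φ ψ θ : Tile → ℝ → ℂ}
    {f g : ℝ → ℂ} {h : ℤ → ℝ → ℂ} {v : ℝ → ℝ} {B s₁ s₂ s₃ : ℝ} (hc : 14 ≤ |c|)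
    (hf : LocalData 0 𝔓 n₀ m₀ φ f s₁) (hg : LocalData c 𝔓 n₀ m₀ ψ g s₂)
    (hh : DualData 𝔓 n₀ m₀ N h v θ B s₃) (hs : 1 / s₁ + 1 / s₂ + 1 / s₃ < 2) :
    ∑ P ∈ 𝔓, P.len * ‖∫ t, f t * φ P t‖ * ‖∫ t, g t * ψ P t‖ * ‖∫ t in P.I, h P.n t * θ P t‖
      ≤ cL s₁ s₂ s₃ B * 2 ^ n₀ := by
  set a : Tile → ℝ := fun P => ‖∫ t, f t * φ P t‖
  set b : Tile → ℝ := fun P => ‖∫ t, g t * ψ P t‖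
  set z : Tile → ℝ := fun P => ‖∫ t in P.I, h P.n t * θ P t‖
  have ha0 : ∀ P, 0 ≤ a P := fun P => norm_nonneg _
  have hb0 : ∀ P, 0 ≤ b P := fun P => norm_nonneg _
  have hz0 : ∀ P, 0 ≤ z P := fun P => norm_nonneg _
  have hcT := cT_pos
  have hp0 : (0 : ℝ) < 2 ^ n₀ := by positivity
  have hs1 := hf.one_lt
  have hs1' := hf.le_two
  have hs2 := hg.one_lt
  have hs2' := hg.le_two
  have hs3 := hh.one_lt
  set C₁ : ℝ := 2 * √cT with hC₁
  have hC₁0 : 0 < C₁ := by positivity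
  -- the levels
  set lev : ℝ → ℕ → ℝ := fun s j => C₁ * 2 ^ (-(j * (1 - 1 / s)) : ℝ) with hlev
  have hlev0 : ∀ s j, 0 < lev s j := fun s j => by positivity
  have hlev_succ : ∀ s, 1 < s → ∀ j, lev s j ≤ 2 * lev s (j + 1) := by
    intro s hs j
    have : (2 : ℝ) ^ (-(j * (1 - 1 / s)) : ℝ) ≤ (2 : ℝ) ^ (1 : ℝ) * 2 ^ (-((j + 1 : ℕ) * (1 - 1 / s)) : ℝ) := by
      rw [← Real.rpow_add (by norm_num)]
      refine Real.rpow_le_rpow_of_exponent_le (by norm_num) ?_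
      have h1 : 0 < 1 / s := by positivity
      push_cast
      linarith
    rw [Real.rpow_one] at this
    calc lev s j ≤ C₁ * (2 * 2 ^ (-((j + 1 : ℕ) * (1 - 1 / s)) : ℝ)) :=
        mul_le_mul_of_nonneg_left this hC₁0.le
      _ = _ := by rw [hlev]; ring
  have hlev_pow : ∀ s, 1 < s → ∀ j, lev s (j + 1) ^ (-(s / (s - 1)))
      = C₁ ^ (-(s / (s - 1))) * (2 * 2 ^ j) := by
    intro s hs j
    rw [hlev, Real.mul_rpow hC₁0.le (by positivity), ← Real.rpow_mul (by norm_num)]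
    congr 1
    have : (-((j + 1 : ℕ) * (1 - 1 / s)) : ℝ) * (-(s / (s - 1))) = (j + 1 : ℕ) := by
      have : s - 1 ≠ 0 := by linarith
      field_simp
    rw [this, Real.rpow_natCast, pow_succ']
  set δ : ℝ := 2 - 1 / s₁ - 1 / s₂ - 1 / s₃ with hδ
  set A : ℝ := 2 * C₁ * C₁ * ((√B + √804) * (cJ s₁ s₂) ^ (1 / s₃))
  have hA : 0 ≤ A := by have := cJ_pos s₁ s₂; positivity
  have hterm : ∀ j : ℕ, 2 * lev s₁ j * lev s₂ j
      * ((√B + √804) * (cJ s₁ s₂ * 2 ^ j) ^ (1 / s₃) * 2 ^ n₀) = A * ((2 : ℝ) ^ (-δ)) ^ j * 2 ^ n₀ := by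
    intro j
    have e : (2 : ℝ) ^ (-(j * (1 - 1 / s₁)) : ℝ) * 2 ^ (-(j * (1 - 1 / s₂)) : ℝ)
        * ((2 : ℝ) ^ j) ^ (1 / s₃) = ((2 : ℝ) ^ (-δ)) ^ j := by
      rw [← Real.rpow_natCast 2 j, ← Real.rpow_natCast _ j, ← Real.rpow_mul (by norm_num),
        ← Real.rpow_mul (by norm_num), ← Real.rpow_add (by norm_num), ← Real.rpow_add (by norm_num)]
      congr 1
      rw [hδ]; ring
    rw [Real.mul_rpow (cJ_pos _ _).le (by positivity), ← e]
    simp only [hlev, A]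
    ring
  have iter : ∀ J : ℕ, ∃ 𝒬 ⊆ 𝔓, SizeLE 0 𝔓 a 𝒬 (lev s₁ J) ∧ SizeLE c 𝔓 b 𝒬 (lev s₂ J) ∧
      ∑ P ∈ 𝔓, P.len * a P * b P * z P ≤ ∑ P ∈ 𝒬, P.len * a P * b P * z P
        + A * (∑ j ∈ Finset.range J, ((2 : ℝ) ^ (-δ)) ^ j) * 2 ^ n₀ := by
    intro J
    induction J with
    | zero =>
      refine ⟨𝔓, subset_rfl, ?_, ?_, by simp⟩
      · have := hf.sizeLE; simpa [hlev] using this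
      · have := hg.sizeLE; simpa [hlev] using this
    | succ J ih =>
      obtain ⟨𝒬, h𝒬, hqa, hqb, hle⟩ := ih
      obtain ⟨S₁, hS₁, hS₁le, hS₁sz⟩ := hf.exists_trees h𝒬 (hlev0 s₁ (J + 1))
        (hqa.mono subset_rfl (hlev0 _ _).le (hlev_succ s₁ hs1 J))
      obtain ⟨S₂, hS₂, hS₂le, hS₂sz⟩ := hg.exists_trees h𝒬 (hlev0 s₂ (J + 1))
        (hqb.mono subset_rfl (hlev0 _ _).le (hlev_succ s₂ hs2 J))
      rw [hlev_pow _ hs1] at hS₁le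
      rw [hlev_pow _ hs2] at hS₂le
      set 𝒬' := 𝒬.filter fun P => ∀ T ∈ S₁ ∪ S₂, ¬ T.Fat P with h𝒬'
      refine ⟨𝒬', (Finset.filter_subset _ _).trans h𝒬, hS₁sz.mono ?_ (hlev0 _ _).le le_rfl,
        hS₂sz.mono ?_ (hlev0 _ _).le le_rfl, ?_⟩
      · intro P hP
        obtain ⟨h1, h2⟩ := Finset.mem_filter.1 hP
        exact Finset.mem_filter.2 ⟨h1, fun T hT => h2 T (Finset.mem_union_left _ hT)⟩
      · intro P hP
        obtain ⟨h1, h2⟩ := Finset.mem_filter.1 hP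
        exact Finset.mem_filter.2 ⟨h1, fun T hT => h2 T (Finset.mem_union_right _ hT)⟩
      set 𝒬'' := 𝒬.filter fun P => ¬ ∀ T ∈ S₁ ∪ S₂, ¬ T.Fat P with h𝒬''
      have hsplit : ∑ P ∈ 𝒬, P.len * a P * b P * z P
          = ∑ P ∈ 𝒬', P.len * a P * b P * z P + ∑ P ∈ 𝒬'', P.len * a P * b P * z P :=
        (Finset.sum_filter_add_sum_filter_not _ _ _).symm
      have hq'' : 𝒬'' ⊆ 𝒬 := Finset.filter_subset _ _
      have hstep := hh.sum_covered_le hc (hq''.trans h𝒬) ha0 hb0 (hlev0 s₁ J).le (hlev0 s₂ J).le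
        (hqa.mono hq'' (hlev0 _ _).le le_rfl) (hqb.mono hq'' (hlev0 _ _).le le_rfl)
        (S := S₁ ∪ S₂) (Finset.union_subset hS₁ hS₂) (K := cJ s₁ s₂ * 2 ^ J)
        (by have := cJ_pos s₁ s₂; positivity) (by
          have hu : ∑ T ∈ S₁ ∪ S₂, T.len ≤ ∑ T ∈ S₁, T.len + ∑ T ∈ S₂, T.len := by
            rw [← Finset.sum_union_inter]
            exact le_add_of_nonneg_right (Finset.sum_nonneg fun T _ => T.len_pos.le)
          refine hu.trans ((add_le_add hS₁le hS₂le).trans ?_)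
          rw [cJ, ← hC₁]
          have : (0 : ℝ) < 2 ^ J * 2 ^ n₀ := by positivity
          linarith) (by
          intro P hP
          have := (Finset.mem_filter.1 hP).2
          push Not at this
          exact this)
      rw [hterm] at hstep
      rw [hsplit] at hle
      rw [Finset.sum_range_succ]
      change ∑ P ∈ 𝒬'', P.len * a P * b P * z P ≤ _ at hstep
      linarith
  have hδ0 : 0 < δ := by linarith
  have hx0 : (0 : ℝ) ≤ 2 ^ (-δ) := by positivity
  have hx1 : (2 : ℝ) ^ (-δ) < 1 := Real.rpow_lt_one_of_one_lt_of_neg (by norm_num) (by linarith)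
  have hbound : ∀ J : ℕ, ∑ P ∈ 𝔓, P.len * a P * b P * z P
      ≤ lev s₁ J * lev s₂ J * (∑ P ∈ 𝔓, P.len * z P) + cL s₁ s₂ s₃ B * 2 ^ n₀ := by
    intro J
    obtain ⟨𝒬, h𝒬, hqa, hqb, hle⟩ := iter J
    refine hle.trans (add_le_add ?_ ?_)
    · rw [Finset.mul_sum]
      refine (Finset.sum_le_sum fun P hP => ?_).trans (Finset.sum_le_sum_of_subset_of_nonneg h𝒬
        fun P _ _ => ?_)
      · have h1 := hqa.le (Or.inl rfl) h𝒬 (hlev0 _ _).le hP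
        have h2 := hqb.le (Or.inr hc) h𝒬 (hlev0 _ _).le hP
        have h3 : a P * b P ≤ lev s₁ J * lev s₂ J := mul_le_mul h1 h2 (hb0 P) (hlev0 _ _).le
        have h4 : 0 ≤ P.len * z P := mul_nonneg P.len_pos.le (hz0 P)
        calc P.len * a P * b P * z P = a P * b P * (P.len * z P) := by ring
          _ ≤ _ := by gcongr
      · have := hlev0 s₁ J
        have := hlev0 s₂ J
        have := P.len_pos
        have := hz0 P
        positivity
    · have h1 := geom_sum_le hx0 hx1 J
      have e : cL s₁ s₂ s₃ B = A * (1 - (2 : ℝ) ^ (-δ))⁻¹ := rfl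
      rw [e]
      gcongr
  have hlim : Filter.Tendsto (fun J : ℕ => lev s₁ J * lev s₂ J * (∑ P ∈ 𝔓, P.len * z P)
      + cL s₁ s₂ s₃ B * 2 ^ n₀) Filter.atTop (nhds (0 * (∑ P ∈ 𝔓, P.len * z P)
      + cL s₁ s₂ s₃ B * 2 ^ n₀)) := by
    refine Filter.Tendsto.add_const _ (Filter.Tendsto.mul_const _ ?_)
    have hl : ∀ s : ℝ, 1 < s → Filter.Tendsto (lev s) Filter.atTop (nhds 0) := by
      intro s hs
      have h1 : 0 < 1 - 1 / s := by
        rw [sub_pos, div_lt_one (by linarith)]; exact hs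
      have h2 : lev s = fun j : ℕ => C₁ * ((2 : ℝ) ^ (-(1 - 1 / s))) ^ j := by
        funext j
        rw [hlev, ← Real.rpow_natCast _ j, ← Real.rpow_mul (by norm_num)]
        ring_nf
      rw [h2]
      have := (tendsto_pow_atTop_nhds_zero_of_lt_one (r := (2 : ℝ) ^ (-(1 - 1 / s)))
        (by positivity) (Real.rpow_lt_one_of_one_lt_of_neg (by norm_num) (by linarith))).const_mul C₁
      rwa [mul_zero] at this
    have := (hl s₁ hs1).mul (hl s₂ hs2)
    rwa [mul_zero] at this
  rw [zero_mul, zero_add] at hlim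
  exact ge_of_tendsto' hlim hbound

lemma two_rpow_ne_zero (x : ℝ) : (2 : ℝ≥0∞) ^ x ≠ 0 := by simp [ENNReal.rpow_eq_zero_iff]

lemma two_rpow_ne_top (x : ℝ) : (2 : ℝ≥0∞) ^ x ≠ ∞ := by simp [ENNReal.rpow_eq_top_iff]

/-- Every positive number lies between two consecutive powers of two. -/
lemma exists_two_rpow_lt_le {y : ℝ≥0∞} (h0 : y ≠ 0) (ht : y ≠ ∞) :
    ∃ j : ℤ, (2 : ℝ≥0∞) ^ (j : ℝ) < y ∧ y ≤ 2 ^ ((j + 1 : ℤ) : ℝ) := by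
  obtain ⟨j, h1, h2⟩ := ENNReal.exists_mem_Ioc_zpow h0 ht (y := 2) (by norm_num) (by norm_num)
  exact ⟨j, by rwa [ENNReal.rpow_intCast], by rwa [ENNReal.rpow_intCast]⟩

/-- The constant of the geometric series of ratio `2 ^ (-θ)`. -/
noncomputable def cG (θ : ℝ) : ℝ≥0∞ := ∑' n : ℕ, (2 : ℝ≥0∞) ^ (-(n * θ) : ℝ)

lemma cG_eq (θ : ℝ) : cG θ = (1 - (2 : ℝ≥0∞) ^ (-θ))⁻¹ := by
  rw [cG, ← ENNReal.tsum_geometric]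
  congr 1; funext n
  rw [← ENNReal.rpow_natCast, ← ENNReal.rpow_mul]
  ring_nf

lemma cG_ne_top {θ : ℝ} (h : 0 < θ) : cG θ ≠ ∞ := by
  rw [cG_eq, Ne, ENNReal.inv_eq_top, tsub_eq_zero_iff_le, not_le]
  exact ENNReal.rpow_lt_one_of_one_lt_of_neg (by norm_num) (by linarith)

lemma one_le_cG (θ : ℝ) : 1 ≤ cG θ := by
  rw [cG_eq, ENNReal.one_le_inv]
  exact tsub_le_self

lemma tsum_two_rpow_lt_le {θ : ℝ} (h : 0 < θ) (y : ℝ≥0∞) :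
    ∑' j : ℤ, (if (2 : ℝ≥0∞) ^ (j : ℝ) < y then (2 : ℝ≥0∞) ^ (j * θ : ℝ) else 0)
      ≤ cG θ * y ^ θ := by
  rcases eq_or_ne y 0 with rfl | h0
  · simp
  rcases eq_or_ne y ∞ with rfl | ht
  · rw [ENNReal.top_rpow_of_pos h, ENNReal.mul_top (by
      have := one_le_cG θ; exact (lt_of_lt_of_le one_pos this).ne')]
    exact le_top
  obtain ⟨j₀, h1, h2⟩ := exists_two_rpow_lt_le h0 ht
  have hinj : Function.Injective fun n : ℕ => j₀ - (n : ℤ) := fun a b hab => by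
    simp only at hab; omega
  rw [← hinj.tsum_eq]
  · rw [cG, ← ENNReal.tsum_mul_right]
    refine ENNReal.tsum_le_tsum fun n => ?_
    split_ifs
    · calc (2 : ℝ≥0∞) ^ (((j₀ - n : ℤ) : ℝ) * θ) = 2 ^ (-(n * θ) : ℝ) * ((2 : ℝ≥0∞) ^ (j₀ : ℝ)) ^ θ := by
            rw [← ENNReal.rpow_mul, ← ENNReal.rpow_add _ _ (by norm_num) (by norm_num)]
            congr 1; push_cast; ring
        _ ≤ _ := by gcongr
    · exact zero_le
  · intro j hj
    simp only [Function.mem_support, ne_eq, ite_eq_right_iff, Classical.not_imp] at hj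
    have h3 : (2 : ℝ≥0∞) ^ (j : ℝ) < 2 ^ ((j₀ + 1 : ℤ) : ℝ) := hj.1.trans_le h2
    have h4 : j < j₀ + 1 := by
      by_contra hcon
      push Not at hcon
      exact absurd (ENNReal.rpow_le_rpow_of_exponent_le (x := 2) (by norm_num)
        (Int.cast_le.2 hcon : ((j₀ + 1 : ℤ) : ℝ) ≤ j)) (not_le.2 h3)
    exact ⟨(j₀ - j).toNat, by simp only; omega⟩

lemma rpow_le_tsum_two_rpow_lt {θ : ℝ} (h : 0 < θ) (y : ℝ≥0∞) :
    y ^ θ ≤ 2 ^ θ * ∑' j : ℤ, (if (2 : ℝ≥0∞) ^ (j : ℝ) < y then (2 : ℝ≥0∞) ^ (j * θ : ℝ) else 0) := by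
  rcases eq_or_ne y 0 with rfl | h0
  · simp [ENNReal.zero_rpow_of_pos h]
  rcases eq_or_ne y ∞ with rfl | ht
  · have : ∀ j : ℤ, (2 : ℝ≥0∞) ^ (j : ℝ) < ∞ := fun j => (two_rpow_ne_top _).lt_top
    simp only [this, if_true]
    have h1 : ∑' j : ℤ, (2 : ℝ≥0∞) ^ (j * θ : ℝ) = ∞ := by
      refine top_le_iff.1 ?_
      have hinj : Function.Injective fun n : ℕ => (n : ℤ) := Nat.cast_injective
      calc ∞ = ∑' n : ℕ, (1 : ℝ≥0∞) := by simp
        _ ≤ ∑' n : ℕ, (2 : ℝ≥0∞) ^ (((n : ℤ) : ℝ) * θ : ℝ) := by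
            refine ENNReal.tsum_le_tsum fun n => ?_
            rw [← ENNReal.rpow_zero (x := 2)]
            exact ENNReal.rpow_le_rpow_of_exponent_le (by norm_num) (by positivity)
        _ ≤ _ := ENNReal.tsum_comp_le_tsum_of_injective hinj _
    rw [h1, ENNReal.mul_top (two_rpow_ne_zero _)]
    exact le_top
  obtain ⟨j₀, h1, h2⟩ := exists_two_rpow_lt_le h0 ht
  calc y ^ θ ≤ (2 ^ ((j₀ + 1 : ℤ) : ℝ)) ^ θ := by gcongr
    _ = 2 ^ θ * (if (2 : ℝ≥0∞) ^ (j₀ : ℝ) < y then (2 : ℝ≥0∞) ^ (j₀ * θ : ℝ) else 0) := by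
      rw [if_pos h1, ← ENNReal.rpow_mul, ← ENNReal.rpow_add _ _ (by norm_num) (by norm_num)]
      congr 1; push_cast; ring
    _ ≤ _ := by
      gcongr
      exact ENNReal.le_tsum (f := fun j : ℤ =>
        if (2 : ℝ≥0∞) ^ (j : ℝ) < y then (2 : ℝ≥0∞) ^ (j * θ : ℝ) else 0) j₀

/-- The uncentered maximal function. -/
noncomputable def Mx (u : ℝ → ℝ≥0∞) (x : ℝ) : ℝ≥0∞ :=
  ⨆ (a : ℝ) (b : ℝ) (_ : x ∈ Ioo a b), (∫⁻ t in Ioo a b, u t) / ENNReal.ofReal (b - a)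

lemma lt_Mx {u : ℝ → ℝ≥0∞} {x : ℝ} {l : ℝ≥0∞} :
    l < Mx u x ↔ ∃ a b, x ∈ Ioo a b ∧ l < (∫⁻ t in Ioo a b, u t) / ENNReal.ofReal (b - a) := by
  simp only [Mx, lt_iSup_iff, exists_prop]

lemma measurable_Mx (u : ℝ → ℝ≥0∞) : Measurable (Mx u) := by
  refine measurable_of_Ioi fun l => IsOpen.measurableSet ?_
  rw [isOpen_iff_mem_nhds]
  intro x hx
  obtain ⟨a, b, hab, h⟩ := lt_Mx.1 hx
  exact Filter.mem_of_superset (Ioo_mem_nhds hab.1 hab.2) fun y hy => lt_Mx.2 ⟨a, b, hy, h⟩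

lemma mul_volume_lt_Mx_le (u : ℝ → ℝ≥0∞) {l : ℝ≥0∞} (hl : l ≠ 0) (hlt : l ≠ ∞) :
    l * volume {x | l < Mx u x} ≤ 5 * ∫⁻ t, u t := by
  rcases eq_or_ne (∫⁻ t, u t) ∞ with h | hfin
  · rw [h]; simp
  set ι := {p : ℝ × ℝ // p.1 < p.2 ∧
    l < (∫⁻ t in Ioo p.1 p.2, u t) / ENNReal.ofReal (p.2 - p.1)}
  have hlen : ∀ p : ι, l * ENNReal.ofReal (p.1.2 - p.1.1) ≤ ∫⁻ t in Ioo p.1.1 p.1.2, u t := by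
    intro p
    have := p.2.2.le
    rwa [ENNReal.le_div_iff_mul_le (Or.inl (by simpa using p.2.1)) (Or.inl (by simp))] at this
  set R : ℝ := ((∫⁻ t, u t) / l).toReal
  have hR : ∀ p : ι, (p.1.2 - p.1.1) / 2 ≤ R := by
    intro p
    have h1 : ENNReal.ofReal (p.1.2 - p.1.1) ≤ (∫⁻ t, u t) / l := by
      rw [ENNReal.le_div_iff_mul_le (Or.inl hl) (Or.inl hlt), mul_comm]
      exact (hlen p).trans (setLIntegral_le_lintegral _ _)
    have h2 := (ENNReal.ofReal_le_iff_le_toReal (ENNReal.div_ne_top hfin hl)).1 h1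
    have := p.2.1
    have : p.1.2 - p.1.1 ≤ R := h2
    linarith
  obtain ⟨s, -, hdisj, hcov⟩ := Vitali.exists_disjoint_subfamily_covering_enlargement_closedBall
    (univ : Set ι) (fun p => (p.1.1 + p.1.2) / 2) (fun p => (p.1.2 - p.1.1) / 2) R
    (fun p _ => hR p) 5 (by norm_num)
  have hball : ∀ p : ι, Ioo p.1.1 p.1.2 ⊆ Metric.closedBall ((p.1.1 + p.1.2) / 2) ((p.1.2 - p.1.1) / 2) := by
    intro p x hx
    rw [Real.closedBall_eq_Icc]
    constructor <;> linarith [hx.1, hx.2]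
  have hdisj' : s.PairwiseDisjoint fun p : ι => Ioo p.1.1 p.1.2 := fun p hp p' hp' hne =>
    (hdisj hp hp' hne).mono (hball p) (hball p')
  have hcount : s.Countable := hdisj'.countable_of_isOpen (fun p _ => isOpen_Ioo)
    fun p _ => nonempty_Ioo.2 p.2.1
  have hsub : {x | l < Mx u x} ⊆ ⋃ p ∈ s, Metric.closedBall ((p.1.1 + p.1.2) / 2)
      (5 * ((p.1.2 - p.1.1) / 2)) := by
    intro x hx
    obtain ⟨a, b, hab, h⟩ := lt_Mx.1 hx
    obtain ⟨p, hp, hle⟩ := hcov ⟨(a, b), hab.1.trans hab.2, h⟩ (mem_univ _)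
    exact mem_iUnion₂.2 ⟨p, hp, hle (hball ⟨(a, b), hab.1.trans hab.2, h⟩ hab)⟩
  have : Countable s := hcount
  calc l * volume {x | l < Mx u x}
      ≤ l * ∑' p : s, volume (Metric.closedBall ((p.1.1.1 + p.1.1.2) / 2)
        (5 * ((p.1.1.2 - p.1.1.1) / 2))) := by
        gcongr
        exact (measure_mono hsub).trans (measure_biUnion_le _ hcount _)
    _ = ∑' p : s, 5 * (l * ENNReal.ofReal (p.1.1.2 - p.1.1.1)) := by
        rw [← ENNReal.tsum_mul_left]
        congr 1; funext p
        rw [Real.volume_closedBall, show 2 * (5 * ((p.1.1.2 - p.1.1.1) / 2))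
          = 5 * (p.1.1.2 - p.1.1.1) by ring, ENNReal.ofReal_mul (by norm_num)]
        norm_num
        ring
    _ ≤ ∑' p : s, 5 * ∫⁻ t in Ioo p.1.1.1 p.1.1.2, u t := by
        gcongr with p
        exact hlen p.1
    _ = 5 * ∫⁻ t in ⋃ p ∈ s, Ioo p.1.1 p.1.2, u t := by
        rw [ENNReal.tsum_mul_left, lintegral_biUnion hcount (fun p _ => measurableSet_Ioo) hdisj']
    _ ≤ _ := by gcongr; exact Measure.restrict_le_self

lemma lt_Mx_truncation {u : ℝ → ℝ≥0∞} {x : ℝ} {l : ℝ≥0∞} (h : l + l < Mx u x) :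
    l < Mx (fun t => if l < u t then u t else 0) x := by
  obtain ⟨a, b, hx, hab⟩ := lt_Mx.1 h
  have hlt : a < b := hx.1.trans hx.2
  have hb0 : ENNReal.ofReal (b - a) ≠ 0 := by simpa using hlt
  have hl : l ≠ ∞ := fun hl => by simp [hl] at h
  refine lt_Mx.2 ⟨a, b, hx, ?_⟩
  by_contra hcon
  push Not at hcon
  refine absurd hab (not_lt.2 ?_)
  rw [ENNReal.div_le_iff hb0 (by simp)] at hcon ⊢
  calc ∫⁻ t in Ioo a b, u t ≤ ∫⁻ t in Ioo a b, ((if l < u t then u t else 0) + l) := by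
        refine lintegral_mono fun t => ?_
        split_ifs with ht
        · exact le_self_add
        · simpa using ht
    _ = (∫⁻ t in Ioo a b, (if l < u t then u t else 0)) + l * ENNReal.ofReal (b - a) := by
        rw [lintegral_add_right _ measurable_const]
        simp
    _ ≤ _ := by rw [add_mul]; gcongr

/-- The constant of the maximal theorem. -/
noncomputable def cM (p : ℝ) : ℝ≥0∞ := 5 * 2 ^ p * 2 ^ p * cG (p - 1)

lemma cM_ne_top {p : ℝ} (hp : 1 < p) : cM p ≠ ∞ := by
  have h1 := two_rpow_ne_top p
  have h2 := cG_ne_top (show 0 < p - 1 by linarith)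
  exact ENNReal.mul_ne_top (ENNReal.mul_ne_top (ENNReal.mul_ne_top (by norm_num) h1) h1) h2

theorem lintegral_Mx_rpow_le {p : ℝ} (hp : 1 < p) {u : ℝ → ℝ≥0∞} (hu : Measurable u) :
    ∫⁻ x, Mx u x ^ p ≤ cM p * ∫⁻ x, u x ^ p := by
  have hmeas : ∀ j : ℤ, MeasurableSet {x | (2 : ℝ≥0∞) ^ (j : ℝ) < Mx u x} := fun j =>
    measurableSet_lt measurable_const (measurable_Mx u)
  have hmeasu : ∀ j : ℤ, MeasurableSet {x | (2 : ℝ≥0∞) ^ (j : ℝ) < u x} := fun j =>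
    measurableSet_lt measurable_const hu
  have key : ∀ j : ℤ, (2 : ℝ≥0∞) ^ (((j + 1 : ℤ) : ℝ) * p) *
      volume {x | (2 : ℝ≥0∞) ^ ((j + 1 : ℤ) : ℝ) < Mx u x} ≤
      5 * 2 ^ p * ∫⁻ x, u x * (if (2 : ℝ≥0∞) ^ (j : ℝ) < u x then 2 ^ (j * (p - 1)) else 0) := by
    intro j
    have h2 : (2 : ℝ≥0∞) ^ ((j + 1 : ℤ) : ℝ) = 2 ^ (j : ℝ) + 2 ^ (j : ℝ) := by
      push_cast
      rw [ENNReal.rpow_add _ _ (by norm_num) (by norm_num), ENNReal.rpow_one, mul_two]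
    have hw := mul_volume_lt_Mx_le (fun t => if (2 : ℝ≥0∞) ^ (j : ℝ) < u t then u t else 0)
      (two_rpow_ne_zero j) (two_rpow_ne_top j)
    calc (2 : ℝ≥0∞) ^ (((j + 1 : ℤ) : ℝ) * p) * volume {x | (2 : ℝ≥0∞) ^ ((j + 1 : ℤ) : ℝ) < Mx u x}
        ≤ 2 ^ (((j + 1 : ℤ) : ℝ) * p) * volume {x | (2 : ℝ≥0∞) ^ (j : ℝ) <
          Mx (fun t => if (2 : ℝ≥0∞) ^ (j : ℝ) < u t then u t else 0) x} := by
          refine mul_le_mul' le_rfl (measure_mono fun x hx => ?_)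
          simp only [mem_ofPred_eq, h2] at hx ⊢
          exact lt_Mx_truncation hx
      _ = 2 ^ p * 2 ^ (j * (p - 1)) * (2 ^ (j : ℝ) * volume {x | (2 : ℝ≥0∞) ^ (j : ℝ) <
          Mx (fun t => if (2 : ℝ≥0∞) ^ (j : ℝ) < u t then u t else 0) x}) := by
          rw [← mul_assoc, ← ENNReal.rpow_add _ _ (by norm_num) (by norm_num),
            ← ENNReal.rpow_add _ _ (by norm_num) (by norm_num)]
          congr 2; push_cast; ring
      _ ≤ 2 ^ p * 2 ^ (j * (p - 1)) * (5 * ∫⁻ t, if (2 : ℝ≥0∞) ^ (j : ℝ) < u t then u t else 0) := by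
          gcongr
      _ = 5 * 2 ^ p * (2 ^ (j * (p - 1)) * ∫⁻ t, if (2 : ℝ≥0∞) ^ (j : ℝ) < u t then u t else 0) := by
          ring
      _ = _ := by
          rw [← lintegral_const_mul _ (Measurable.ite (hmeasu j) hu measurable_const)]
          congr 1
          refine lintegral_congr fun x => ?_
          split_ifs <;> simp [mul_comm]
  calc ∫⁻ x, Mx u x ^ p ≤ ∫⁻ x, 2 ^ p * ∑' j : ℤ,
        (if (2 : ℝ≥0∞) ^ (j : ℝ) < Mx u x then (2 : ℝ≥0∞) ^ (j * p : ℝ) else 0) :=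
        lintegral_mono fun x => rpow_le_tsum_two_rpow_lt (by linarith) _
    _ = 2 ^ p * ∑' j : ℤ, 2 ^ (j * p : ℝ) * volume {x | (2 : ℝ≥0∞) ^ (j : ℝ) < Mx u x} := by
        rw [lintegral_const_mul' _ _ (two_rpow_ne_top _), lintegral_tsum fun j =>
          (Measurable.ite (hmeas j) measurable_const measurable_const).aemeasurable]
        congr 2; funext j
        rw [← lintegral_indicator_const (hmeas j)]
        refine lintegral_congr fun x => ?_
        simp only [indicator, mem_ofPred_eq]
    _ = 2 ^ p * ∑' j : ℤ, 2 ^ (((j + 1 : ℤ) : ℝ) * p : ℝ) *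
        volume {x | (2 : ℝ≥0∞) ^ ((j + 1 : ℤ) : ℝ) < Mx u x} := by
        rw [← (Equiv.addRight (1 : ℤ)).tsum_eq]
        rfl
    _ ≤ 2 ^ p * ∑' j : ℤ, 5 * 2 ^ p *
        ∫⁻ x, u x * (if (2 : ℝ≥0∞) ^ (j : ℝ) < u x then 2 ^ (j * (p - 1)) else 0) := by
        exact mul_le_mul' le_rfl (ENNReal.tsum_le_tsum key)
    _ = 2 ^ p * (5 * 2 ^ p) * ∫⁻ x, u x *
        ∑' j : ℤ, (if (2 : ℝ≥0∞) ^ (j : ℝ) < u x then 2 ^ (j * (p - 1)) else 0) := by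
        have hm : ∀ j : ℤ, AEMeasurable (fun x => u x *
            (if (2 : ℝ≥0∞) ^ (j : ℝ) < u x then (2 : ℝ≥0∞) ^ (j * (p - 1)) else 0)) := fun j =>
          (hu.mul (Measurable.ite (hmeasu j) measurable_const measurable_const)).aemeasurable
        simp only [← ENNReal.tsum_mul_left (a := u _)]
        rw [lintegral_tsum hm, ENNReal.tsum_mul_left]; ring
    _ ≤ 2 ^ p * (5 * 2 ^ p) * ∫⁻ x, cG (p - 1) * u x ^ p := by
        refine mul_le_mul' le_rfl (lintegral_mono fun x => ?_)
        calc _ ≤ u x * (cG (p - 1) * u x ^ (p - 1)) := by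
              gcongr
              exact tsum_two_rpow_lt_le (by linarith) _
          _ = cG (p - 1) * (u x ^ (1 : ℝ) * u x ^ (p - 1)) := by rw [ENNReal.rpow_one]; ring
          _ = _ := by
              rw [← ENNReal.rpow_add_of_nonneg _ _ (by norm_num) (by linarith)]
              congr 2; ring
    _ = _ := by
        rw [lintegral_const_mul' _ _ (cG_ne_top (by linarith)), cM]
        ring

lemma Mx_le_of_le {u : ℝ → ℝ≥0∞} {C : ℝ≥0∞} (h : ∀ᵐ t, u t ≤ C) (x : ℝ) : Mx u x ≤ C := by
  refine iSup_le fun a => iSup_le fun b => iSup_le fun hx => ?_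
  have hlt : a < b := hx.1.trans hx.2
  rw [ENNReal.div_le_iff (by simpa using hlt) (by simp)]
  calc ∫⁻ t in Ioo a b, u t ≤ ∫⁻ t in Ioo a b, C := lintegral_mono_ae (ae_restrict_of_ae h)
    _ = _ := by simp

/-- If the averages of `u` around a dyadic interval are not bounded by `M`, then the maximal
function exceeds `M` on that interval. -/
lemma lt_Mx_of_not_avgLE {n m : ℤ} {u : ℝ → ℝ} {M : ℝ} (hM : 0 ≤ M) (hu0 : ∀ t, 0 ≤ u t)
    (hu : Integrable u)
    (h : ¬ AvgLE n m u M) {x : ℝ} (hx : x ∈ dya n m) :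
    ENNReal.ofReal M < Mx (fun t => ENNReal.ofReal (u t)) x := by
  simp only [AvgLE, not_forall, not_le] at h
  obtain ⟨a, b, ha, hb, h⟩ := h
  have hxa : a ≤ x := ha.trans hx.1
  have hxb : x < b := hx.2.trans_le hb
  have hab : a < b := hxa.trans_lt hxb
  -- enlarge the interval slightly
  obtain ⟨e, he0, he⟩ : ∃ e, 0 < e ∧ M * (b - a + e) < ∫ t in Ico a b, u t := by
    refine ⟨((∫ t in Ico a b, u t) - M * (b - a)) / (2 * (M + 1)), by
      apply div_pos <;> linarith, ?_⟩
    have h1 : ((∫ t in Ico a b, u t) - M * (b - a)) / (2 * (M + 1)) * (2 * (M + 1)) =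
      (∫ t in Ico a b, u t) - M * (b - a) := div_mul_cancel₀ _ (by positivity)
    have h2 : 0 < ((∫ t in Ico a b, u t) - M * (b - a)) / (2 * (M + 1)) := by
      apply div_pos <;> linarith
    nlinarith
  refine lt_Mx.2 ⟨a - e, b, ⟨by linarith, hxb⟩, ?_⟩
  rw [ENNReal.lt_div_iff_mul_lt (Or.inl (by simp; linarith)) (Or.inl (by simp)),
    ← ENNReal.ofReal_mul hM]
  calc ENNReal.ofReal (M * (b - (a - e))) < ENNReal.ofReal (∫ t in Ico a b, u t) := by
        rw [ENNReal.ofReal_lt_ofReal_iff_of_nonneg (by apply mul_nonneg hM; linarith)]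
        convert he using 2; ring
    _ = ∫⁻ t in Ico a b, ENNReal.ofReal (u t) :=
        ofReal_integral_eq_lintegral_ofReal hu.integrableOn (ae_of_all _ hu0)
    _ ≤ _ := lintegral_mono_set fun t ht => (⟨by linarith [ht.1], ht.2⟩ : t ∈ Ioo (a - e) b)

open scoped FourierTransform SchwartzMap

lemma fourier_eq_ex (f : ℝ → ℂ) (ξ : ℝ) : 𝓕 f ξ = ∫ t, f t * ex (-(t * ξ)) := by
  rw [Real.fourier_real_eq_integral_exp_smul]
  refine integral_congr_ae (ae_of_all _ fun t => ?_)
  simp only [ex, smul_eq_mul]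
  rw [mul_comm]; congr 2; push_cast; ring

lemma fourierInv_eq_ex (f : ℝ → ℂ) (x : ℝ) : 𝓕⁻ f x = ∫ t, f t * ex (t * x) := by
  rw [Real.fourierInv_eq_fourier_neg, fourier_eq_ex]
  simp

/-- Schwartz functions with Fourier transform supported in `[-9/10, 9/10]`. -/
def Bandlimited (G : 𝓢(ℝ, ℂ)) : Prop := ∀ ξ : ℝ, 9 / 10 < |ξ| → 𝓕 (G : ℝ → ℂ) ξ = 0

lemma Bandlimited.add {G H : 𝓢(ℝ, ℂ)} (hG : Bandlimited G) (hH : Bandlimited H) :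
    Bandlimited (G + H) := fun ξ hξ => by
  have h := congrArg (fun F : 𝓢(ℝ, ℂ) => F ξ) (FourierTransform.fourier_add G H)
  have h1 : 𝓕 ((G + H : 𝓢(ℝ, ℂ)) : ℝ → ℂ) ξ = 𝓕 (G : ℝ → ℂ) ξ + 𝓕 (H : ℝ → ℂ) ξ := h
  rw [h1, hG ξ hξ, hH ξ hξ, add_zero]

lemma Bandlimited.smul {G : 𝓢(ℝ, ℂ)} (hG : Bandlimited G) (c : ℂ) :
    Bandlimited (c • G) := fun ξ hξ => by
  have h := congrArg (fun F : 𝓢(ℝ, ℂ) => F ξ) (FourierTransform.fourier_smul c G)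
  have h1 : 𝓕 ((c • G : 𝓢(ℝ, ℂ)) : ℝ → ℂ) ξ = c • 𝓕 (G : ℝ → ℂ) ξ := h
  rw [h1, hG ξ hξ, smul_zero]

lemma integrable_id_smul (G : 𝓢(ℝ, ℂ)) : Integrable fun x : ℝ => x • G x := by
  have h : Function.HasTemperateGrowth (fun x : ℝ => x) := by fun_prop
  have := (SchwartzMap.smulLeftCLM ℂ (fun x : ℝ => x) G).integrable (μ := volume)
  rwa [SchwartzMap.smulLeftCLM_apply h] at this

lemma Bandlimited.deriv {G : 𝓢(ℝ, ℂ)} (hG : Bandlimited G) :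
    Bandlimited (SchwartzMap.derivCLM ℂ ℂ G) := fun ξ hξ => by
  have h : ((SchwartzMap.derivCLM ℂ ℂ G : 𝓢(ℝ, ℂ)) : ℝ → ℂ) = _root_.deriv G := by
    ext x; rfl
  rw [h, Real.fourier_deriv G.integrable G.differentiable (h ▸ SchwartzMap.integrable _)]
  simp [hG ξ hξ]

lemma Bandlimited.id_mul {G : 𝓢(ℝ, ℂ)} (hG : Bandlimited G) :
    ∃ G' : 𝓢(ℝ, ℂ), Bandlimited G' ∧ ∀ y : ℝ, G' y = y * G y := by
  have h : Function.HasTemperateGrowth (fun x : ℝ => x) := by fun_prop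
  refine ⟨SchwartzMap.smulLeftCLM ℂ (fun x : ℝ => x) G, fun ξ hξ => ?_, fun y => by
    rw [SchwartzMap.smulLeftCLM_apply_apply h]; rfl⟩
  rw [SchwartzMap.smulLeftCLM_apply h]
  have h1 := Real.hasDerivAt_fourier G.integrable (integrable_id_smul G) ξ
  have h2 : HasDerivAt (𝓕 (G : ℝ → ℂ)) 0 ξ := by
    refine (hasDerivAt_const ξ (0 : ℂ)).congr_of_eventuallyEq ?_
    have : IsOpen {x : ℝ | 9 / 10 < |x|} := isOpen_lt continuous_const continuous_abs
    filter_upwards [this.mem_nhds hξ] with x hx using hG x hx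
  have h3 := h1.unique h2
  have h4 : (fun x : ℝ => (-2 * π * Complex.I * x : ℂ) • G x) =
      (-2 * π * Complex.I : ℂ) • fun x : ℝ => x • G x := by
    ext x; simp; ring
  rw [h4, fourier_eq_ex] at h3
  simp only [Pi.smul_apply, smul_mul_assoc] at h3
  rw [integral_smul, smul_eq_zero] at h3
  rw [fourier_eq_ex]
  simp only [smul_mul_assoc]
  exact h3.resolve_left (by simp [Real.pi_ne_zero])

lemma Bandlimited.affine_mul {G : 𝓢(ℝ, ℂ)} (hG : Bandlimited G) (p q : ℝ) :
    ∃ G' : 𝓢(ℝ, ℂ), Bandlimited G' ∧ ∀ y : ℝ, G' y = ((p + q * y : ℝ) : ℂ) * G y := by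
  obtain ⟨G', h1, h2⟩ := hG.id_mul
  refine ⟨(p : ℂ) • G + (q : ℂ) • G', (hG.smul _).add (h1.smul _), fun y => ?_⟩
  simp [h2]; ring

lemma Bandlimited.quadratic_mul {G : 𝓢(ℝ, ℂ)} (hG : Bandlimited G) (β p q : ℝ) :
    ∃ G' : 𝓢(ℝ, ℂ), Bandlimited G' ∧ ∀ y : ℝ, G' y = ((1 + β * (p + q * y) ^ 2 : ℝ) : ℂ) * G y := by
  obtain ⟨G₁, h1, h1'⟩ := hG.affine_mul p q
  obtain ⟨G₂, h2, h2'⟩ := h1.affine_mul p q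
  refine ⟨G + (β : ℂ) • G₂, hG.add (h2.smul _), fun y => ?_⟩
  simp [h1', h2']; ring

lemma Bandlimited.weight_mul {G : 𝓢(ℝ, ℂ)} (hG : Bandlimited G) (β p q : ℝ) :
    ∃ G' : 𝓢(ℝ, ℂ), Bandlimited G' ∧
      ∀ y : ℝ, G' y = (((1 + β * (p + q * y) ^ 2) ^ 2 : ℝ) : ℂ) * G y := by
  obtain ⟨G₁, h1, h1'⟩ := hG.quadratic_mul β p q
  obtain ⟨G₂, h2, h2'⟩ := h1.quadratic_mul β p q
  refine ⟨G₂, h2, fun y => ?_⟩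
  simp [h1', h2']; ring

lemma integral_comp_reflect_mul_ex (G : ℝ → ℂ) {l : ℝ} (hl : 0 < l) (a ν : ℝ) :
    ∫ t, G ((a - t) / l) * ex (-(ν * t)) = l * ex (-(ν * a)) * 𝓕 G (-(l * ν)) := by
  have h1 := integral_sub_left_eq_self (fun t => G (t / l) * ex (-(ν * (a - t)))) volume a
  have h2 := Measure.integral_comp_div (fun u => G u * ex (-(ν * (a - l * u)))) l
  simp only [sub_sub_cancel] at h1
  rw [h1, fourier_eq_ex]
  rw [show (fun t => G (t / l) * ex (-(ν * (a - t)))) =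
    fun t => (fun u => G u * ex (-(ν * (a - l * u)))) (t / l) by
      ext t; simp only [mul_div_cancel₀ t hl.ne'], h2, abs_of_pos hl, ← integral_const_mul,
      ← integral_smul]
  congr 1; ext u
  rw [Complex.real_smul, show -(ν * (a - l * u)) = -(ν * a) + -(u * -(l * ν)) by ring, ex_add]
  ring

/-- Band-limited wave packets at separated frequencies are orthogonal. -/
lemma Bandlimited.orth {G H : 𝓢(ℝ, ℂ)} (hG : Bandlimited G) (hH : Bandlimited H) {l μ : ℝ}
    (hl : 0 < l) (hμ : 0 < μ) (a b : ℝ) {ν : ℝ} (hν : l⁻¹ + μ⁻¹ ≤ |ν|) :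
    ∫ t, G ((a - t) / l) * (starRingEnd ℂ) (H ((b - t) / μ)) * ex (-(ν * t)) = 0 := by
  have hinv : ∀ u : ℝ, H u = ∫ η, 𝓕 (H : ℝ → ℂ) η * ex (η * u) := fun u => by
    rw [← fourierInv_eq_ex, H.continuous.fourierInv_fourier_eq H.integrable (𝓕 H).integrable]
  have hstep : ∀ t, G ((a - t) / l) * (starRingEnd ℂ) (H ((b - t) / μ)) * ex (-(ν * t)) =
      ∫ η, G ((a - t) / l) * ((starRingEnd ℂ) (𝓕 (H : ℝ → ℂ) η) * ex (-(η * b / μ)))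
        * ex (-((ν - η / μ) * t)) := by
    intro t
    rw [hinv, ← integral_conj, mul_right_comm, ← integral_const_mul]
    congr 1; ext η
    rw [map_mul, show -((ν - η / μ) * t) = -(ν * t) + (η / μ * t) by ring, ex_add,
      show (starRingEnd ℂ) (ex (η * ((b - t) / μ))) = ex (-(η * b / μ)) * ex (η / μ * t) by
        rw [← ex_add]; unfold ex; rw [← Complex.exp_conj]; congr 1; simp [Complex.conj_ofNat]; ring]
    ring
  simp only [hstep]
  rw [integral_integral_swap]
  · refine (integral_congr_ae (ae_of_all _ fun η => ?_)).trans (integral_zero _ _)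
    by_cases hη : 9 / 10 < |η|
    · simp [hH η hη]
    · calc _ = ((starRingEnd ℂ) (𝓕 (H : ℝ → ℂ) η) * ex (-(η * b / μ))) *
            ∫ t, G ((a - t) / l) * ex (-((ν - η / μ) * t)) := by
            rw [← integral_const_mul]; congr 1; ext t; ring
        _ = 0 := by
            rw [integral_comp_reflect_mul_ex _ hl, hG, mul_zero, mul_zero]
            rw [abs_neg, abs_mul, abs_of_pos hl]
            push Not at hη
            have h1 : |η / μ| ≤ 9 / 10 * μ⁻¹ := by
              rw [abs_div, abs_of_pos hμ, div_eq_mul_inv]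
              gcongr
            have h2 : |ν| ≤ |ν - η / μ| + |η / μ| := by
              have := abs_add_le (ν - η / μ) (η / μ)
              rwa [sub_add_cancel] at this
            have h3 : l⁻¹ ≤ |ν - η / μ| := by
              have : 0 < μ⁻¹ := by positivity
              linarith
            have h4 : l * l⁻¹ ≤ l * |ν - η / μ| := by gcongr
            rw [mul_inv_cancel₀ hl.ne'] at h4
            linarith
  · have h1 : Integrable fun t : ℝ => G ((a - t) / l) := by
      have : Integrable fun t : ℝ => G (t / l) := G.integrable.comp_div hl.ne'
      exact this.comp_sub_left a
    have h2 : Integrable fun η : ℝ => (starRingEnd ℂ) (𝓕 (H : ℝ → ℂ) η) * ex (-(η * b / μ)) := by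
      have h3 : Integrable fun η : ℝ => (starRingEnd ℂ) (𝓕 (H : ℝ → ℂ) η) :=
        (Complex.conjLIE.integrable_comp_iff).2 (𝓕 H).integrable
      refine h3.mul_bdd (c := 1) ?_ (ae_of_all _ fun η => (norm_ex _).le)
      have := continuous_ex; exact (by fun_prop : Continuous _).aestronglyMeasurable
    refine (h1.mul_prod h2).mul_bdd (c := 1) ?_ (ae_of_all _ fun η => (norm_ex _).le)
    have := continuous_ex; exact (by fun_prop : Continuous _).aestronglyMeasurable

/-- A smooth step function. -/
noncomputable def step (x : ℝ) : ℝ := Real.smoothTransition ((x - 1 / 10) / (8 / 10))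

lemma step_of_le {x : ℝ} (h : x ≤ 1 / 10) : step x = 0 :=
  Real.smoothTransition.zero_of_nonpos (div_nonpos_of_nonpos_of_nonneg (by linarith) (by norm_num))

lemma step_of_ge {x : ℝ} (h : 9 / 10 ≤ x) : step x = 1 :=
  Real.smoothTransition.one_of_one_le (by rw [le_div_iff₀ (by norm_num)]; linarith)

lemma step_nonneg (x : ℝ) : 0 ≤ step x := Real.smoothTransition.nonneg _

lemma step_le_one (x : ℝ) : step x ≤ 1 := Real.smoothTransition.le_one _

lemma contDiff_step : ContDiff ℝ (⊤ : ℕ∞) step :=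
  Real.smoothTransition.contDiff.comp (by fun_prop)

/-- A bump function whose integer translates form a partition of unity. -/
noncomputable def chi (ξ : ℝ) : ℝ := step (ξ + 1) - step ξ

lemma chi_eq_zero {ξ : ℝ} (h : 9 / 10 ≤ |ξ|) : chi ξ = 0 := by
  unfold chi
  rcases le_abs'.1 h with h | h
  · rw [step_of_le (by linarith), step_of_le (by linarith), sub_zero]
  · rw [step_of_ge (by linarith), step_of_ge h, sub_self]

lemma contDiff_chi : ContDiff ℝ (⊤ : ℕ∞) chi := by
  unfold chi
  exact (contDiff_step.comp (by fun_prop)).sub contDiff_step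

lemma sum_chi (ξ : ℝ) (a : ℤ) (N : ℕ) :
    ∑ k ∈ Finset.Ico a (a + N), chi (ξ - k) = step (ξ - a + 1) - step (ξ - a - N + 1) := by
  induction N with
  | zero => simp
  | succ N ih =>
    rw [show (a + ((N + 1 : ℕ) : ℤ)) = (a + N) + 1 by push_cast; ring,
      ← Finset.insert_Ico_right_eq_Ico_add_one (by omega : a ≤ a + N),
      Finset.sum_insert (by simp), ih, chi]
    push_cast
    rw [show ξ - (a + N) + 1 = ξ - a - N + 1 by ring, show ξ - a - (N + 1) + 1 = ξ - (a + N) by ring]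
    ring

lemma hasCompactSupport_chi : HasCompactSupport fun ξ => (chi ξ : ℂ) := by
  refine HasCompactSupport.intro (isCompact_Icc (a := (-1 : ℝ)) (b := 1)) fun ξ hξ => ?_
  rw [chi_eq_zero, Complex.ofReal_zero]
  by_contra hcon
  push Not at hcon
  exact hξ (abs_le.1 (by linarith))

/-- The bump function as a Schwartz function. -/
noncomputable def chiS : 𝓢(ℝ, ℂ) :=
  hasCompactSupport_chi.toSchwartzMap (Complex.ofRealCLM.contDiff.comp contDiff_chi)

/-- The kernel of the frequency localization, and its derivative. -/
noncomputable def Kp : Bool → 𝓢(ℝ, ℂ)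
  | false => 𝓕⁻ chiS
  | true => SchwartzMap.derivCLM ℂ ℂ (𝓕⁻ chiS)

lemma fourier_Kp (ξ : ℝ) : 𝓕 (Kp false : ℝ → ℂ) ξ = chi ξ := by
  have h : 𝓕 (Kp false) = chiS := FourierTransform.fourier_fourierInv_eq chiS
  exact congrArg (fun F : 𝓢(ℝ, ℂ) => F ξ) h

lemma hasDerivAt_Kp (x : ℝ) : HasDerivAt (Kp false) (Kp true x) x :=
  (Kp false).differentiableAt.hasDerivAt

lemma bandlimited_Kp (b : Bool) : Bandlimited (Kp b) := by
  have h : Bandlimited (Kp false) := fun ξ hξ => by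
    rw [fourier_Kp, chi_eq_zero hξ.le, Complex.ofReal_zero]
  cases b
  · exact h
  · exact h.deriv

lemma exists_decay (G : 𝓢(ℝ, ℂ)) (k : ℕ) : ∃ C : ℝ, 0 < C ∧ ∀ u, (1 + |u|) ^ k * ‖G u‖ ≤ C := by
  refine ⟨2 ^ k * ((Finset.Iic (k, 0)).sup fun m => SchwartzMap.seminorm ℝ m.1 m.2) G + 1,
    by positivity, fun u => ?_⟩
  have := SchwartzMap.one_add_le_sup_seminorm_apply (𝕜 := ℝ) (m := (k, 0)) (k := k) (n := 0)
    le_rfl le_rfl G u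
  rw [norm_iteratedFDeriv_zero] at this
  exact this.trans (by linarith)

lemma exists_Kp_bound : ∃ C : ℝ, 0 < C ∧ ∀ b u, (1 + |u|) ^ 8 * ‖Kp b u‖ ≤ C ∧
    (1 + |u|) ^ 8 * ‖deriv (Kp b) u‖ ≤ C := by
  choose! C hC hC' using fun G => exists_decay G 8
  refine ⟨∑ b, (C (Kp b) + C (SchwartzMap.derivCLM ℂ ℂ (Kp b))), ?_, fun b u => ?_⟩
  · simp only [Fintype.sum_bool]
    have h1 := hC (Kp true); have h2 := hC (SchwartzMap.derivCLM ℂ ℂ (Kp true))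
    have h3 := hC (Kp false); have h4 := hC (SchwartzMap.derivCLM ℂ ℂ (Kp false))
    linarith
  · have h : C (Kp b) + C (SchwartzMap.derivCLM ℂ ℂ (Kp b)) ≤
        ∑ b, (C (Kp b) + C (SchwartzMap.derivCLM ℂ ℂ (Kp b))) :=
      Finset.single_le_sum (f := fun b => C (Kp b) + C (SchwartzMap.derivCLM ℂ ℂ (Kp b)))
        (fun b _ => add_nonneg (hC _).le (hC _).le) (Finset.mem_univ b)
    have h1 := hC (Kp b); have h2 := hC (SchwartzMap.derivCLM ℂ ℂ (Kp b))
    exact ⟨(hC' _ u).trans (by linarith), (hC' (SchwartzMap.derivCLM ℂ ℂ (Kp b)) u).trans (by linarith)⟩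

/-- A decay constant of the kernels. -/
noncomputable def cK : ℝ := exists_Kp_bound.choose

lemma cK_pos : 0 < cK := exists_Kp_bound.choose_spec.1

lemma Kp_le (b : Bool) (u : ℝ) : ‖Kp b u‖ ≤ cK * ((1 + |u|) ^ 8)⁻¹ := by
  rw [← div_eq_mul_inv, le_div_iff₀ (by positivity), mul_comm]
  exact (exists_Kp_bound.choose_spec.2 b u).1

lemma deriv_Kp_le (b : Bool) (u : ℝ) : ‖deriv (Kp b) u‖ ≤ cK * ((1 + |u|) ^ 8)⁻¹ := by
  rw [← div_eq_mul_inv, le_div_iff₀ (by positivity), mul_comm]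
  exact (exists_Kp_bound.choose_spec.2 b u).2

lemma Kp_sub_le (b : Bool) {u u' : ℝ} (h : |u - u'| ≤ 1) :
    ‖Kp b u - Kp b u'‖ ≤ 2 ^ 8 * cK * ((1 + |u|) ^ 8)⁻¹ * |u - u'| := by
  refine (convex_uIcc u u').norm_image_sub_le_of_norm_deriv_le
    (fun x _ => (Kp b).differentiableAt) (fun x hx => ?_) right_mem_uIcc left_mem_uIcc
  have h1 : |u - x| ≤ |u - u'| := by
    rw [abs_sub_comm u x]
    exact (abs_sub_left_of_mem_uIcc hx).trans (abs_sub_comm _ _).le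
  have h2 : 1 + |u| ≤ 2 * (1 + |x|) := by
    have := abs_sub_abs_le_abs_sub u x
    have := abs_nonneg x
    linarith
  calc ‖deriv (Kp b) x‖ ≤ cK * ((1 + |x|) ^ 8)⁻¹ := deriv_Kp_le b x
    _ ≤ cK * (2 ^ 8 * ((1 + |u|) ^ 8)⁻¹) := by
        refine mul_le_mul_of_nonneg_left ?_ cK_pos.le
        rw [← div_eq_mul_inv, le_div_iff₀ (by positivity), ← div_eq_inv_mul,
          div_le_iff₀ (by positivity), ← mul_pow]
        gcongr
    _ = _ := by ring

/-- The unnormalized wave packet with frequency `ζ` at scale `l` centred at `x`. -/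
noncomputable def pk (l ζ : ℝ) (b : Bool) (x t : ℝ) : ℂ :=
  ((l⁻¹ : ℝ) : ℂ) * Kp b ((x - t) / l) * ex (-(ζ * t))

lemma continuous_pk (l ζ : ℝ) (b : Bool) (x : ℝ) : Continuous (pk l ζ b x) := by
  have h1 := continuous_ex
  have h2 := (Kp b).continuous
  unfold pk
  fun_prop

lemma norm_pk_le {l : ℝ} (hl : 0 < l) (ζ : ℝ) (b : Bool) (x t : ℝ) : ‖pk l ζ b x t‖ ≤ l⁻¹ * cK := by
  rw [pk, norm_mul, norm_mul, norm_ex, mul_one, Complex.norm_real, Real.norm_eq_abs,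
    abs_of_pos (by positivity)]
  gcongr
  refine (Kp_le b _).trans (mul_le_of_le_one_right cK_pos.le (inv_le_one_of_one_le₀ ?_))
  exact one_le_pow₀ (by linarith [abs_nonneg ((x - t) / l)])

/-- The normalized wave packets. -/
noncomputable def npk (c : ℤ) (x : Tile → ℝ) (b : Tile → Bool) (P : Tile) (t : ℝ) : ℂ :=
  (((2 ^ 8 * cK)⁻¹ * (P.rho (x P) ^ 8)⁻¹ : ℝ) : ℂ) * pk P.len (P.zeta c) (b P) (x P) t

lemma Tile.rho_inv_mul_le (P : Tile) (x t : ℝ) :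
    (P.rho x ^ 8)⁻¹ * ((1 + |(x - t) / P.len|) ^ 8)⁻¹ ≤ (P.rho t ^ 8)⁻¹ := by
  rw [← mul_inv, ← mul_pow]
  have h := P.rho_le_mul x t
  rw [← sub_div] at h
  have := P.rho_pos t
  exact inv_anti₀ (by positivity) (pow_le_pow_left₀ this.le h 8)

lemma packets_npk (c : ℤ) (𝔓 : Finset Tile) (x : Tile → ℝ) (b : Tile → Bool) :
    Packets c 𝔓 (npk c x b) where
  cont P _ := by
    have := continuous_pk P.len (P.zeta c) (b P) (x P)
    unfold npk; fun_prop
  bound P _ t := by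
    have hl := P.len_pos
    have hr := P.rho_pos (x P)
    have hK := cK_pos
    rw [npk, pk, norm_mul, norm_mul, norm_mul, norm_ex, mul_one, Complex.norm_real,
      Complex.norm_real, Real.norm_of_nonneg (by positivity), Real.norm_of_nonneg (by positivity)]
    calc _ ≤ (2 ^ 8 * cK)⁻¹ * (P.rho (x P) ^ 8)⁻¹ * (P.len⁻¹ *
          (cK * ((1 + |(x P - t) / P.len|) ^ 8)⁻¹)) := by
          gcongr
          exact Kp_le _ _
      _ = (2 ^ 8)⁻¹ * P.len⁻¹ * ((P.rho (x P) ^ 8)⁻¹ * ((1 + |(x P - t) / P.len|) ^ 8)⁻¹) := by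
          field_simp
      _ ≤ (2 ^ 8)⁻¹ * P.len⁻¹ * (P.rho t ^ 8)⁻¹ := by
          gcongr; exact P.rho_inv_mul_le _ _
      _ ≤ _ := by
          have := P.rho_pos t
          gcongr
          exact mul_le_of_le_one_left (by positivity) (by norm_num)
  smooth P _ t t' htt := by
    have hl := P.len_pos
    have hr := P.rho_pos (x P)
    have hK := cK_pos
    have hρ := P.rho_pos t
    have e : ∀ s, ex (P.zeta c * s) * npk c x b P s =
        (((2 ^ 8 * cK)⁻¹ * (P.rho (x P) ^ 8)⁻¹ * P.len⁻¹ : ℝ) : ℂ) *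
          Kp (b P) ((x P - s) / P.len) := fun s => by
      have : ex (P.zeta c * s) * ex (-(P.zeta c * s)) = 1 := by rw [← ex_add]; simp
      calc _ = (((2 ^ 8 * cK)⁻¹ * (P.rho (x P) ^ 8)⁻¹ * P.len⁻¹ : ℝ) : ℂ) *
          Kp (b P) ((x P - s) / P.len) * (ex (P.zeta c * s) * ex (-(P.zeta c * s))) := by
            unfold npk pk; push_cast; ring
        _ = _ := by rw [this, mul_one]
    rw [e, e, ← mul_sub, norm_mul, Complex.norm_real, Real.norm_of_nonneg (by positivity)]
    have h1 : |(x P - t) / P.len - (x P - t') / P.len| = |t - t'| * P.len⁻¹ := by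
      rw [← sub_div, abs_div, abs_of_pos hl, div_eq_mul_inv, abs_sub_comm t t']
      congr 2; ring
    have h2 := Kp_sub_le (b P) (u := (x P - t) / P.len) (u' := (x P - t') / P.len) (by
      rw [h1, ← div_eq_mul_inv]; exact div_le_one_of_le₀ htt hl.le)
    rw [h1] at h2
    calc _ ≤ (2 ^ 8 * cK)⁻¹ * (P.rho (x P) ^ 8)⁻¹ * P.len⁻¹ *
          (2 ^ 8 * cK * ((1 + |(x P - t) / P.len|) ^ 8)⁻¹ * (|t - t'| * P.len⁻¹)) := by gcongr
      _ = |t - t'| * P.len⁻¹ * P.len⁻¹ *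
          ((P.rho (x P) ^ 8)⁻¹ * ((1 + |(x P - t) / P.len|) ^ 8)⁻¹) := by field_simp
      _ ≤ |t - t'| * P.len⁻¹ * P.len⁻¹ * (P.rho t ^ 8)⁻¹ := by
          gcongr; exact P.rho_inv_mul_le _ _
      _ ≤ _ := by
          gcongr
          · exact P.one_le_rho t
          · norm_num
  orth P _ P' _ hN a β := by
    have hl := P.len_pos
    have hl' := P'.len_pos
    obtain ⟨G, hG, hG'⟩ := (bandlimited_Kp (b P)).weight_mul β (x P - a) (-P.len)
    have hν : P.len⁻¹ + P'.len⁻¹ ≤ |P.zeta c - P'.zeta c| := by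
      rw [Tile.Near, not_lt] at hN; exact hN
    have h := hG.orth (bandlimited_Kp (b P')) hl hl' (x P) (x P') hν
    rw [← mul_zero ((((2 ^ 8 * cK)⁻¹ * (P.rho (x P) ^ 8)⁻¹ * P.len⁻¹ *
      ((2 ^ 8 * cK)⁻¹ * (P'.rho (x P') ^ 8)⁻¹ * P'.len⁻¹) : ℝ)) : ℂ), ← h, ← integral_const_mul]
    refine integral_congr_ae (ae_of_all _ fun t => ?_)
    have e1 : (starRingEnd ℂ) (ex (-(P'.zeta c * t))) = ex (P'.zeta c * t) := by
      unfold ex; rw [← Complex.exp_conj]; congr 1; simp [Complex.conj_ofNat]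
    have e2 : x P - a + -P.len * ((x P - t) / P.len) = t - a := by field_simp; ring
    simp only [npk, pk, map_mul, Complex.conj_ofReal, hG', e2, e1]
    rw [show -((P.zeta c - P'.zeta c) * t) = -(P.zeta c * t) + P'.zeta c * t by ring, ex_add]
    push_cast
    ring

/-- The local transform of `f` with frequency `ζ` at scale `l`. -/
noncomputable def tf (f : ℝ → ℂ) (l ζ : ℝ) (b : Bool) (x : ℝ) : ℂ := ∫ t, f t * pk l ζ b x t

section tf

variable {f g : ℝ → ℂ} {l : ℝ}

lemma aestronglyMeasurable_mul_pk (hf : Integrable f) (ζ : ℝ) (b : Bool) (x : ℝ) :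
    AEStronglyMeasurable (fun t => f t * pk l ζ b x t) volume :=
  hf.aestronglyMeasurable.mul (continuous_pk l ζ b x).aestronglyMeasurable

lemma norm_mul_pk_le (hl : 0 < l) (ζ : ℝ) (b : Bool) (x t : ℝ) :
    ‖f t * pk l ζ b x t‖ ≤ l⁻¹ * cK * ‖f t‖ := by
  rw [norm_mul, mul_comm]
  gcongr
  exact norm_pk_le hl ζ b x t

lemma integrable_mul_pk (hf : Integrable f) (hl : 0 < l) (ζ : ℝ) (b : Bool) (x : ℝ) :
    Integrable fun t => f t * pk l ζ b x t :=
  (hf.norm.const_mul (l⁻¹ * cK)).mono' (aestronglyMeasurable_mul_pk hf ζ b x)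
    (ae_of_all _ (norm_mul_pk_le hl ζ b x))

lemma norm_tf_le (hf : Integrable f) (hl : 0 < l) (ζ : ℝ) (b : Bool) (x : ℝ) :
    ‖tf f l ζ b x‖ ≤ l⁻¹ * cK * ∫ t, ‖f t‖ := by
  rw [← integral_const_mul]
  exact norm_integral_le_of_norm_le (hf.norm.const_mul _) (ae_of_all _ (norm_mul_pk_le hl ζ b x))

lemma continuous_tf (hf : Integrable f) (hl : 0 < l) (ζ : ℝ) (b : Bool) :
    Continuous (tf f l ζ b) := by
  refine continuous_of_dominated (fun x => aestronglyMeasurable_mul_pk hf ζ b x)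
    (fun x => ae_of_all _ (norm_mul_pk_le hl ζ b x)) (hf.norm.const_mul (l⁻¹ * cK))
    (ae_of_all _ fun t => ?_)
  have h2 := (Kp b).continuous
  unfold pk
  fun_prop

lemma hasDerivAt_tf (hf : Integrable f) (hl : 0 < l) (ζ : ℝ) (x : ℝ) :
    HasDerivAt (tf f l ζ false) (((l⁻¹ : ℝ) : ℂ) * tf f l ζ true x) x := by
  have key : ∀ x t, HasDerivAt (fun x => f t * pk l ζ false x t)
      (((l⁻¹ : ℝ) : ℂ) * (f t * pk l ζ true x t)) x := fun x t => by
    have h1 : HasDerivAt (fun x : ℝ => (x - t) / l) (l⁻¹) x := by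
      simpa [one_div] using ((hasDerivAt_id x).sub_const t).div_const l
    have h2 := (hasDerivAt_Kp ((x - t) / l)).scomp x h1
    have h3 := ((h2.const_mul ((l⁻¹ : ℝ) : ℂ)).mul_const (ex (-(ζ * t)))).const_mul (f t)
    refine h3.congr_deriv ?_
    rw [pk, Complex.real_smul]; ring
  have h := hasDerivAt_integral_of_dominated_loc_of_deriv_le (μ := volume)
    (F := fun x t => f t * pk l ζ false x t)
    (F' := fun x t => ((l⁻¹ : ℝ) : ℂ) * (f t * pk l ζ true x t)) (x₀ := x)
    (bound := fun t => l⁻¹ * (l⁻¹ * cK * ‖f t‖)) Filter.univ_mem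
    (Filter.Eventually.of_forall fun x => aestronglyMeasurable_mul_pk hf ζ false x)
    (integrable_mul_pk hf hl ζ false x)
    ((aestronglyMeasurable_mul_pk hf ζ true x).const_mul _)
    (ae_of_all _ fun t x _ => ?_) ((hf.norm.const_mul _).const_mul _)
    (ae_of_all _ fun t x _ => key x t)
  · have h2 := h.2
    rw [integral_const_mul] at h2
    exact h2
  · rw [norm_mul, Complex.norm_real, Real.norm_of_nonneg (by positivity)]
    gcongr
    exact norm_mul_pk_le hl ζ true x t

lemma exists_near_max (hf : Integrable f) (P : Tile) (ζ : ℝ) :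
    ∃ x b, ∀ x' b', ‖tf f P.len ζ b' x'‖ * (P.rho x' ^ 8)⁻¹ ≤
      2 * (‖tf f P.len ζ b x‖ * (P.rho x ^ 8)⁻¹) := by
  set F : ℝ × Bool → ℝ := fun z => ‖tf f P.len ζ z.2 z.1‖ * (P.rho z.1 ^ 8)⁻¹
  have h0 : ∀ z, 0 ≤ F z := fun z => by
    have := P.rho_pos z.1
    positivity
  have hbdd : BddAbove (range F) := by
    refine ⟨P.len⁻¹ * cK * ∫ t, ‖f t‖, ?_⟩
    rintro _ ⟨z, rfl⟩
    have := P.one_le_rho z.1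
    exact (mul_le_of_le_one_right (norm_nonneg _)
      (inv_le_one_of_one_le₀ (one_le_pow₀ this))).trans (norm_tf_le hf P.len_pos ζ _ _)
  suffices ∃ z, ∀ z', F z' ≤ 2 * F z by
    obtain ⟨z, hz⟩ := this
    exact ⟨z.1, z.2, fun x' b' => hz (x', b')⟩
  by_cases hs : (⨆ z, F z) ≤ 0
  · refine ⟨(0, false), fun z' => ?_⟩
    have := le_ciSup hbdd z'
    linarith [h0 (0, false)]
  · push Not at hs
    obtain ⟨z, hz⟩ := exists_lt_of_lt_ciSup (half_lt_self hs)
    refine ⟨z, fun z' => ?_⟩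
    have := le_ciSup hbdd z'
    linarith

/-- The bilinear form of two local transforms. -/
noncomputable def vf (f g w : ℝ → ℂ) (l ζ ζ' : ℝ) (b b' : Bool) (x : ℝ) : ℂ :=
  ∫ y, tf f l ζ b (x - l * y) * tf g l ζ' b' (x + l * y) * w y

variable {w : ℝ → ℂ}

lemma norm_vf_integrand_le (hf : Integrable f) (hg : Integrable g) (hl : 0 < l) (ζ ζ' : ℝ)
    (b b' : Bool) (x y : ℝ) :
    ‖tf f l ζ b (x - l * y) * tf g l ζ' b' (x + l * y) * w y‖ ≤
      (l⁻¹ * cK * ∫ t, ‖f t‖) * (l⁻¹ * cK * ∫ t, ‖g t‖) * ‖w y‖ := by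
  rw [norm_mul, norm_mul]
  have := norm_tf_le hf hl ζ b (x - l * y)
  have := norm_tf_le hg hl ζ' b' (x + l * y)
  gcongr
  exact (norm_nonneg _).trans (norm_tf_le hf hl ζ b (x - l * y))

lemma aestronglyMeasurable_vf_integrand (hf : Integrable f) (hg : Integrable g) (hw : Integrable w)
    (hl : 0 < l) (ζ ζ' : ℝ) (b b' : Bool) (x : ℝ) :
    AEStronglyMeasurable (fun y => tf f l ζ b (x - l * y) * tf g l ζ' b' (x + l * y) * w y)
      volume := by
  have h1 := continuous_tf hf hl ζ b
  have h2 := continuous_tf hg hl ζ' b'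
  exact (Continuous.aestronglyMeasurable (by fun_prop)).mul hw.aestronglyMeasurable

lemma integrable_vf_integrand (hf : Integrable f) (hg : Integrable g) (hw : Integrable w)
    (hl : 0 < l) (ζ ζ' : ℝ) (b b' : Bool) (x : ℝ) :
    Integrable fun y => tf f l ζ b (x - l * y) * tf g l ζ' b' (x + l * y) * w y :=
  (hw.norm.const_mul _).mono' (aestronglyMeasurable_vf_integrand hf hg hw hl ζ ζ' b b' x)
    (ae_of_all _ (norm_vf_integrand_le hf hg hl ζ ζ' b b' x))

lemma continuous_vf (hf : Integrable f) (hg : Integrable g) (hw : Integrable w) (hl : 0 < l)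
    (ζ ζ' : ℝ) (b b' : Bool) : Continuous (vf f g w l ζ ζ' b b') := by
  refine continuous_of_dominated (fun x => aestronglyMeasurable_vf_integrand hf hg hw hl ζ ζ' b b' x)
    (fun x => ae_of_all _ (norm_vf_integrand_le hf hg hl ζ ζ' b b' x)) (hw.norm.const_mul _)
    (ae_of_all _ fun t => ?_)
  have h1 := continuous_tf hf hl ζ b
  have h2 := continuous_tf hg hl ζ' b'
  fun_prop

lemma hasDerivAt_vf (hf : Integrable f) (hg : Integrable g) (hw : Integrable w) (hl : 0 < l)
    (ζ ζ' : ℝ) (x : ℝ) : HasDerivAt (vf f g w l ζ ζ' false false)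
      (((l⁻¹ : ℝ) : ℂ) * (vf f g w l ζ ζ' true false x + vf f g w l ζ ζ' false true x)) x := by
  have key : ∀ x y, HasDerivAt
      (fun x => tf f l ζ false (x - l * y) * tf g l ζ' false (x + l * y) * w y)
      (((l⁻¹ : ℝ) : ℂ) * (tf f l ζ true (x - l * y) * tf g l ζ' false (x + l * y) * w y +
        tf f l ζ false (x - l * y) * tf g l ζ' true (x + l * y) * w y)) x := fun x y => by
    have h1 := (hasDerivAt_tf hf hl ζ (x - l * y)).comp_sub_const x (l * y)
    have h2 := (hasDerivAt_tf hg hl ζ' (x + l * y)).comp_add_const x (l * y)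
    refine ((h1.mul h2).mul_const (w y)).congr_deriv ?_
    ring
  have hi := fun b b' => integrable_vf_integrand hf hg hw hl ζ ζ' b b'
  have hb := fun b b' => norm_vf_integrand_le (w := w) hf hg hl ζ ζ' b b'
  have h := hasDerivAt_integral_of_dominated_loc_of_deriv_le (μ := volume)
    (F := fun x y => tf f l ζ false (x - l * y) * tf g l ζ' false (x + l * y) * w y)
    (F' := fun x y => ((l⁻¹ : ℝ) : ℂ) *
      (tf f l ζ true (x - l * y) * tf g l ζ' false (x + l * y) * w y +
        tf f l ζ false (x - l * y) * tf g l ζ' true (x + l * y) * w y)) (x₀ := x)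
    (bound := fun y => l⁻¹ * (2 * ((l⁻¹ * cK * ∫ t, ‖f t‖) * (l⁻¹ * cK * ∫ t, ‖g t‖) * ‖w y‖)))
    Filter.univ_mem
    (Filter.Eventually.of_forall fun x => (hi false false x).aestronglyMeasurable)
    (hi false false x)
    (((hi true false x).add (hi false true x)).const_mul _).aestronglyMeasurable
    (ae_of_all _ fun t x _ => ?_) (((hw.norm.const_mul _).const_mul _).const_mul _)
    (ae_of_all _ fun t x _ => key x t)
  · have h2 := h.2
    rw [integral_const_mul, integral_add (hi true false x) (hi false true x)] at h2
    exact h2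
  · rw [norm_mul, Complex.norm_real, Real.norm_of_nonneg (by positivity)]
    gcongr
    refine (norm_add_le _ _).trans ?_
    linarith [hb true false x t, hb false true x t]

lemma norm_vf_le {P : Tile} {ζ ζ' A B : ℝ} {b b' : Bool} (hA : ∀ x, ‖tf f P.len ζ b x‖ ≤ A * P.rho x ^ 8)
    (hB : ∀ x, ‖tf g P.len ζ' b' x‖ ≤ B * P.rho x ^ 8)
    (hw : Integrable fun y => (1 + |y|) ^ 16 * ‖w y‖) {x : ℝ} (hx : x ∈ P.I) :
    ‖vf f g w P.len ζ ζ' b b' x‖ ≤ 2 ^ 16 * A * B * ∫ y, (1 + |y|) ^ 16 * ‖w y‖ := by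
  have hl := P.len_pos
  have hA0 : 0 ≤ A := by
    have := (norm_nonneg _).trans (hA x)
    have h := P.rho_pos x
    exact nonneg_of_mul_nonneg_left this (by positivity)
  have hB0 : 0 ≤ B := by
    have := (norm_nonneg _).trans (hB x)
    have h := P.rho_pos x
    exact nonneg_of_mul_nonneg_left this (by positivity)
  have hρ : ∀ z y, |x - z| = P.len * |y| → P.rho z ≤ 2 * (1 + |y|) := fun z y h => by
    have h1 := P.rho_le_add x z
    rw [h, mul_div_cancel_left₀ _ hl.ne'] at h1
    have h2 : P.rho x ≤ 2 := by
      have hx' := hx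
      rw [Tile.I, mem_dya, Int.floor_eq_iff] at hx'
      rw [Tile.rho, abs_of_nonneg (by linarith)]
      linarith
    linarith [abs_nonneg y]
  rw [← integral_const_mul]
  refine norm_integral_le_of_norm_le (hw.const_mul _) (ae_of_all _ fun y => ?_)
  rw [norm_mul, norm_mul]
  have h1 := hρ (x - P.len * y) y (by rw [sub_sub_cancel, abs_mul, abs_of_pos hl])
  have h2 := hρ (x + P.len * y) y (by
    rw [sub_add_cancel_left, abs_neg, abs_mul, abs_of_pos hl])
  have h3 := P.rho_pos (x - P.len * y)
  have h4 := P.rho_pos (x + P.len * y)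
  calc _ ≤ (A * (2 * (1 + |y|)) ^ 8) * (B * (2 * (1 + |y|)) ^ 8) * ‖w y‖ := by
        gcongr
        · exact (hA _).trans (by gcongr)
        · exact (hB _).trans (by gcongr)
    _ = _ := by ring

end tf

lemma conj_ex (x : ℝ) : (starRingEnd ℂ) (ex x) = ex (-x) := by
  unfold ex; rw [← Complex.exp_conj]; congr 1; simp [Complex.conj_ofNat]

lemma ex_intCast (k : ℤ) : ex k = 1 := by
  rw [ex, ← Complex.exp_int_mul_two_pi_mul_I k]
  congr 1; push_cast; ring

lemma setIntegral_ex_eq_zero {l : ℝ} (hl : 0 < l) (a : ℝ) {k : ℤ} (hk : k ≠ 0) :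
    ∫ t in Ioc a (a + l), ex (k * t / l) = 0 := by
  rw [← intervalIntegral.integral_of_le (by linarith)]
  have hc : (2 * π * k / l * Complex.I : ℂ) ≠ 0 := by
    have : (π : ℂ) ≠ 0 := Complex.ofReal_ne_zero.2 pi_ne_zero
    have h2 : (k : ℂ) ≠ 0 := Int.cast_ne_zero.2 hk
    have h3 : (l : ℂ) ≠ 0 := Complex.ofReal_ne_zero.2 hl.ne'
    have h4 := Complex.I_ne_zero
    exact mul_ne_zero (div_ne_zero (mul_ne_zero (mul_ne_zero two_ne_zero this) h2) h3) h4
  have h1 := integral_exp_mul_complex (a := a) (b := a + l) hc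
  have e : ∀ t : ℝ, Complex.exp (2 * π * k / l * Complex.I * t) = ex (k * t / l) := fun t => by
    rw [ex]; congr 1; push_cast; ring
  simp_rw [e] at h1
  rw [h1, show k * (a + l) / l = k * a / l + k by field_simp, ex_add, ex_intCast, mul_one, sub_self,
    zero_div]

lemma memLp_indicator_ex {l : ℝ} (a : ℝ) (ν : ℝ) :
    MemLp ((Ioc a (a + l)).indicator fun t => ex (ν * t)) 2 volume := by
  refine (memLp_indicator_iff_restrict measurableSet_Ioc).2 ?_
  have h := continuous_ex
  exact MemLp.of_bound (Continuous.aestronglyMeasurable (by fun_prop)) 1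
    (ae_of_all _ fun t => (norm_ex _).le)

/-- Bessel's inequality for the trigonometric system on an interval. -/
lemma sum_norm_setIntegral_mul_ex_le {l : ℝ} (hl : 0 < l) (a : ℝ) (c : ℤ) (K : Finset ℤ) {E : Set ℝ}
    (hE : MeasurableSet E) (hEI : E ⊆ Ioc a (a + l)) {u : ℝ → ℂ} (hu : MemLp u 2 volume) :
    ∑ k ∈ K, ‖∫ t in E, u t * ex ((2 * k + c) * t / l)‖ ^ 2 ≤
      l * ∫ t in Ioc a (a + l), ‖u t‖ ^ 2 := by
  set I := Ioc a (a + l)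
  have hI : MeasurableSet I := measurableSet_Ioc
  have hm : ∀ k : ℤ, MemLp (I.indicator fun t => ex (-((2 * k + c) / l) * t)) 2 volume :=
    fun k => memLp_indicator_ex a _
  have hmu : MemLp (E.indicator u) 2 volume := hu.indicator hE
  have hs : (0 : ℝ) < √l := Real.sqrt_pos.2 hl
  set v : ℤ → Lp ℂ 2 (volume : Measure ℝ) := fun k =>
    (((√l)⁻¹ : ℝ) : ℂ) • lp2 (I.indicator fun t => ex (-((2 * k + c) / l) * t)) with hv
  have hin : ∀ k k' : ℤ, ⟪v k, v k'⟫_ℂ = ((l⁻¹ : ℝ) : ℂ) * ∫ t in I, ex (((2 * (k - k') : ℤ) : ℝ) * t / l) := by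
    intro k k'
    rw [hv, inner_smul_left, inner_smul_right, inner_lp2 (hm k) (hm k'), Complex.conj_ofReal, ← mul_assoc,
      ← Complex.ofReal_mul, ← mul_inv, Real.mul_self_sqrt hl.le,
      ← integral_indicator hI]
    congr 2
    ext t
    by_cases ht : t ∈ I
    · simp only [indicator_of_mem ht, conj_ex]
      rw [← ex_add]; congr 1; push_cast; field_simp; ring
    · simp [indicator_of_notMem ht]
  have ho : Orthonormal ℂ v := by
    rw [orthonormal_iff_ite]
    intro k k'
    rw [hin]
    split_ifs with h
    · subst h
      simp [I, hl.le, hl.ne']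
    · rw [setIntegral_ex_eq_zero hl a (by omega), mul_zero]
  have hB := ho.sum_inner_products_le (s := K) (lp2 (E.indicator u))
  have hF : ∀ k : ℤ, ⟪v k, lp2 (E.indicator u)⟫_ℂ =
      (((√l)⁻¹ : ℝ) : ℂ) * ∫ t in E, u t * ex ((2 * k + c) * t / l) := fun k => by
    rw [hv, inner_smul_left, inner_lp2 (hm k) hmu, Complex.conj_ofReal, ← integral_indicator hE]
    congr 2
    ext t
    by_cases ht : t ∈ E
    · simp only [indicator_of_mem ht, indicator_of_mem (hEI ht), conj_ex]
      rw [mul_comm]; congr 2; ring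
    · simp [indicator_of_notMem ht]
  simp_rw [hF, norm_mul, Complex.norm_real, mul_pow] at hB
  rw [← Finset.mul_sum, norm_lp2_sq hmu, Real.norm_of_nonneg (by positivity), inv_pow,
    Real.sq_sqrt hl.le, inv_mul_le_iff₀ hl] at hB
  refine hB.trans (mul_le_mul_of_nonneg_left ?_ hl.le)
  rw [← integral_indicator hI]
  refine integral_mono_of_nonneg (ae_of_all _ fun t => by positivity) ?_ (ae_of_all _ fun t => ?_)
  · exact ((memLp_two_iff_integrable_sq_norm hu.1).1 hu).indicator hI
  · by_cases ht : t ∈ E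
    · simp only [indicator_of_mem ht, indicator_of_mem (hEI ht), le_refl]
    · simp only [indicator_of_notMem ht]
      rw [norm_zero, zero_pow two_ne_zero]
      exact indicator_nonneg (fun _ _ => by positivity) _

lemma sq_setIntegral_Ioc_le {l : ℝ} (hl : 0 < l) (a : ℝ) {F : ℝ → ℝ}
    (hF : IntegrableOn F (Ioc a (a + l))) (hF2 : IntegrableOn (fun t => F t ^ 2) (Ioc a (a + l))) :
    (∫ t in Ioc a (a + l), F t) ^ 2 ≤ l * ∫ t in Ioc a (a + l), F t ^ 2 := by
  set m := l⁻¹ * ∫ t in Ioc a (a + l), F t with hm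
  have h0 : 0 ≤ ∫ t in Ioc a (a + l), (F t - m) ^ 2 := integral_nonneg fun t => sq_nonneg _
  have e : ∫ t in Ioc a (a + l), (F t - m) ^ 2 =
      (∫ t in Ioc a (a + l), F t ^ 2) - 2 * m * (∫ t in Ioc a (a + l), F t) + l * m ^ 2 := by
    have : ∀ t, (F t - m) ^ 2 = F t ^ 2 - 2 * m * F t + m ^ 2 := fun t => by ring
    simp_rw [this]
    have hc : IntegrableOn (fun _ : ℝ => m ^ 2) (Ioc a (a + l)) := by simp
    have h1 := hF2.sub (hF.const_mul (2 * m))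
    have := integral_add h1 hc
    simp only [Pi.sub_apply] at this
    rw [this, integral_sub hF2 (hF.const_mul _), integral_const_mul]
    simp [hl.le]
  rw [e] at h0
  have hJ : (∫ t in Ioc a (a + l), F t) = l * m := by rw [hm]; field_simp
  rw [hJ] at h0 ⊢
  have := mul_le_mul_of_nonneg_left h0 hl.le
  linarith [this]

/-- Bessel's inequality for a smooth perturbation of the trigonometric system. -/
lemma sum_norm_setIntegral_mul_ex_mul_le {l : ℝ} (hl : 0 < l) (a : ℝ) (c : ℤ) (K : Finset ℤ)
    {κ κ' : ℤ → ℝ → ℂ} (hκ : ∀ k ∈ K, ∀ t, HasDerivAt (κ k) (κ' k t) t)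
    (hκc : ∀ k ∈ K, Continuous (κ' k)) (hκ1 : ∀ k ∈ K, ‖κ k a‖ ≤ 1)
    (hκ2 : ∀ k ∈ K, ∀ t ∈ Ioo a (a + l), ‖κ' k t‖ ≤ 2 / l)
    {u : ℝ → ℂ} (hu1 : Integrable u) (hu : MemLp u 2 volume) :
    ∑ k ∈ K, ‖∫ t in Ioc a (a + l), u t * ex ((2 * k + c) * t / l) * κ k t‖ ^ 2 ≤
      10 * l * ∫ t in Ioc a (a + l), ‖u t‖ ^ 2 := by
  set I := Ioc a (a + l) with hI
  set μ := (volume : Measure ℝ).restrict I with hμ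
  set M := ∫ t in I, ‖u t‖ ^ 2 with hM
  have hex := continuous_ex
  set w : ℤ → ℝ → ℂ := fun k t => u t * ex ((2 * k + c) * t / l) with hw
  have hwi : ∀ k, Integrable (w k) := fun k => by
    refine hu1.mono (hu1.aestronglyMeasurable.mul (Continuous.aestronglyMeasurable (by fun_prop)))
      (ae_of_all _ fun t => ?_)
    rw [hw, norm_mul, norm_ex, mul_one]
  set U : ℤ → ℝ → ℂ := fun k s => ∫ t in I ∩ Ici s, w k t with hU
  have hUB : ∀ s, ∑ k ∈ K, ‖U k s‖ ^ 2 ≤ l * M := fun s =>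
    sum_norm_setIntegral_mul_ex_le hl a c K (measurableSet_Ioc.inter measurableSet_Ici)
      inter_subset_left hu
  have hUB' : ∑ k ∈ K, ‖∫ t in I, w k t‖ ^ 2 ≤ l * M :=
    sum_norm_setIntegral_mul_ex_le hl a c K measurableSet_Ioc subset_rfl hu
  have hUle : ∀ k s, ‖U k s‖ ≤ ∫ t, ‖w k t‖ := fun k s =>
    (norm_integral_le_integral_norm _).trans
      (setIntegral_le_integral (hwi k).norm (ae_of_all _ fun _ => norm_nonneg _))
  have hUi : ∀ k s, U k s = ∫ t, (Ici s).indicator (w k) t ∂μ := fun k s => by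
    rw [integral_indicator measurableSet_Ici, hμ, Measure.restrict_restrict measurableSet_Ici,
      inter_comm]
  have hUm : ∀ k, AEStronglyMeasurable (U k) μ := fun k => by
    have h1 : AEStronglyMeasurable (fun z : ℝ × ℝ => (Ici z.1).indicator (w k) z.2) (μ.prod μ) := by
      have h2 : AEStronglyMeasurable (fun z : ℝ × ℝ => w k z.2) (μ.prod μ) :=
        (hwi k).aestronglyMeasurable.restrict.comp_snd
      have h3 : MeasurableSet {z : ℝ × ℝ | z.1 ≤ z.2} := measurableSet_le measurable_fst measurable_snd
      refine (h2.indicator h3).congr (ae_of_all _ fun z => ?_)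
      simp [indicator]
    exact (h1.integral_prod_right').congr (ae_of_all _ fun s => (hUi k s).symm)
  have hUint : ∀ k, Integrable (fun s => ‖U k s‖) μ := fun k =>
    Integrable.of_bound (hUm k).norm (∫ t, ‖w k t‖) (ae_of_all _ fun s => by
      rw [norm_norm]; exact hUle k s)
  have hUint2 : ∀ k, Integrable (fun s => ‖U k s‖ ^ 2) μ := fun k =>
    Integrable.of_bound ((hUm k).norm.pow 2) ((∫ t, ‖w k t‖) ^ 2) (ae_of_all _ fun s => by
      rw [norm_pow, norm_norm]; exact pow_le_pow_left₀ (norm_nonneg _) (hUle k s) 2)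
  have hrep : ∀ k ∈ K, ∫ t in I, w k t * κ k t =
      κ k a * (∫ t in I, w k t) + ∫ s in I, κ' k s * U k s := fun k hk => by
    have hκ'i : Integrable (κ' k) μ := (hκc k hk).integrableOn_Ioc
    have h1 : ∀ t ∈ I, κ k t = κ k a + ∫ s, (Iic t).indicator (κ' k) s ∂μ := fun t ht => by
      rw [integral_indicator measurableSet_Iic, hμ, Measure.restrict_restrict measurableSet_Iic,
        inter_comm, hI, Ioc_inter_Iic, min_eq_right ht.2, ← intervalIntegral.integral_of_le ht.1.le,
        intervalIntegral.integral_eq_sub_of_hasDerivAt (fun s _ => hκ k hk s)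
          ((hκc k hk).intervalIntegrable _ _)]
      ring
    have hH : Integrable (fun z : ℝ × ℝ => w k z.1 * (Iic z.1).indicator (κ' k) z.2) (μ.prod μ) := by
      have h3 : MeasurableSet {z : ℝ × ℝ | z.2 ≤ z.1} := measurableSet_le measurable_snd measurable_fst
      refine (((hwi k).restrict (s := I)).mul_prod hκ'i |>.indicator h3).congr (ae_of_all _ fun z => ?_)
      simp only [indicator, mem_ofPred_eq, mem_Iic]
      split_ifs <;> simp
    have hswap : ∫ t, w k t * (∫ s, (Iic t).indicator (κ' k) s ∂μ) ∂μ = ∫ s, κ' k s * U k s ∂μ := by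
      simp_rw [← integral_const_mul]
      rw [integral_integral_swap hH]
      refine integral_congr_ae (ae_of_all _ fun s => ?_)
      simp only [hUi, ← integral_const_mul]
      refine integral_congr_ae (ae_of_all _ fun t => ?_)
      simp only [indicator, mem_Iic, mem_Ici]
      split_ifs <;> ring
    have hint2 : Integrable (fun t => w k t * (∫ s, (Iic t).indicator (κ' k) s ∂μ)) μ := by
      have := hH.integral_prod_left
      simpa only [integral_const_mul] using this
    rw [← hswap, mul_comm (κ k a), ← integral_mul_const, ← integral_add ((hwi k).restrict.mul_const _) hint2]
    refine setIntegral_congr_fun measurableSet_Ioc fun t ht => ?_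
    simp only [h1 t ht, mul_add]
  have hterm : ∀ k ∈ K, ‖∫ t in I, w k t * κ k t‖ ^ 2 ≤
      2 * ‖∫ t in I, w k t‖ ^ 2 + 8 / l * ∫ s in I, ‖U k s‖ ^ 2 := fun k hk => by
    rw [hrep k hk]
    have h1 : ‖∫ s in I, κ' k s * U k s‖ ≤ 2 / l * ∫ s in I, ‖U k s‖ := by
      rw [← integral_const_mul]
      refine norm_integral_le_of_norm_le ((hUint k).const_mul _) ?_
      have : ∀ᵐ s ∂μ, s ∈ Ioo a (a + l) := by
        rw [hμ, ← restrict_Ioo_eq_restrict_Ioc]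
        exact ae_restrict_mem measurableSet_Ioo
      filter_upwards [this] with s hs
      rw [norm_mul]
      gcongr
      exact hκ2 k hk s hs
    have h2 := sq_setIntegral_Ioc_le hl a (hUint k) (hUint2 k)
    have h3 : ‖κ k a * ∫ t in I, w k t‖ ≤ ‖∫ t in I, w k t‖ := by
      rw [norm_mul]
      exact mul_le_of_le_one_left (norm_nonneg _) (hκ1 k hk)
    have h4 : ‖∫ s in I, κ' k s * U k s‖ ^ 2 ≤ 4 / l * ∫ s in I, ‖U k s‖ ^ 2 := by
      calc _ ≤ (2 / l * ∫ s in I, ‖U k s‖) ^ 2 := pow_le_pow_left₀ (norm_nonneg _) h1 2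
        _ = 4 / l ^ 2 * (∫ s in I, ‖U k s‖) ^ 2 := by ring
        _ ≤ 4 / l ^ 2 * (l * ∫ s in I, ‖U k s‖ ^ 2) := by gcongr
        _ = _ := by field_simp
    calc _ ≤ (‖∫ t in I, w k t‖ + ‖∫ s in I, κ' k s * U k s‖) ^ 2 :=
          pow_le_pow_left₀ (norm_nonneg _) ((norm_add_le _ _).trans (by gcongr)) 2
      _ ≤ 2 * (‖∫ t in I, w k t‖ ^ 2 + ‖∫ s in I, κ' k s * U k s‖ ^ 2) := add_sq_le
      _ ≤ 2 * (‖∫ t in I, w k t‖ ^ 2 + 4 / l * ∫ s in I, ‖U k s‖ ^ 2) := by gcongr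
      _ = _ := by ring
  have hM0 : 0 ≤ M := integral_nonneg fun t => by positivity
  have hsumU : ∑ k ∈ K, ∫ s in I, ‖U k s‖ ^ 2 ≤ l * (l * M) := by
    rw [← integral_finsetSum _ fun k _ => hUint2 k]
    calc _ ≤ ∫ s in I, l * M := integral_mono (integrable_finsetSum _ fun k _ => hUint2 k)
          (integrable_const _) hUB
      _ = _ := by simp [hI, hl.le]
  calc _ ≤ ∑ k ∈ K, (2 * ‖∫ t in I, w k t‖ ^ 2 + 8 / l * ∫ s in I, ‖U k s‖ ^ 2) :=
        Finset.sum_le_sum hterm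
    _ = 2 * ∑ k ∈ K, ‖∫ t in I, w k t‖ ^ 2 + 8 / l * ∑ k ∈ K, ∫ s in I, ‖U k s‖ ^ 2 := by
        rw [Finset.sum_add_distrib, Finset.mul_sum, Finset.mul_sum]
    _ ≤ 2 * (l * M) + 8 / l * (l * (l * M)) := by gcongr
    _ = _ := by field_simp; ring

/-- The bilinear averaging operator with kernel `Θ` at scale `l`. -/
noncomputable def bt (Θ : ℝ → ℂ) (l : ℝ) (f g : ℝ → ℂ) (x : ℝ) : ℂ :=
  ∫ y, f (x - l * y) * g (x + l * y) * Θ y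

/-- The function with Fourier transform `F`. -/
noncomputable def ift (F : ℝ → ℂ) (x : ℝ) : ℂ := ∫ ξ, F ξ * ex (ξ * x)

lemma ift_fourier (f : 𝓢(ℝ, ℂ)) : ift (𝓕 (f : ℝ → ℂ)) = f := by
  ext x
  have h : 𝓕⁻ (𝓕 f) = f := FourierTransform.fourierInv_fourier_eq f
  have h2 : (𝓕⁻ (𝓕 f)) x = f x := congrArg (fun F : 𝓢(ℝ, ℂ) => F x) h
  rw [← h2, SchwartzMap.fourierInv_coe, fourierInv_eq_ex, SchwartzMap.fourier_coe, ift]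

lemma integrable_fourier (f : 𝓢(ℝ, ℂ)) : Integrable (𝓕 (f : ℝ → ℂ)) :=
  (𝓕 f : 𝓢(ℝ, ℂ)).integrable

lemma continuous_fourier (f : 𝓢(ℝ, ℂ)) : Continuous (𝓕 (f : ℝ → ℂ)) :=
  (𝓕 f : 𝓢(ℝ, ℂ)).continuous

lemma norm_fourier_le (f : ℝ → ℂ) (ξ : ℝ) : ‖𝓕 f ξ‖ ≤ ∫ t, ‖f t‖ := by
  rw [fourier_eq_ex]
  refine (norm_integral_le_integral_norm _).trans (le_of_eq ?_)
  simp

/-- The bilinear average on the Fourier side. -/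
lemma bt_ift {F G : ℝ → ℂ} (hF : Integrable F) (hG : Integrable G) {Θ : ℝ → ℂ} (hΘ : Integrable Θ)
    (l x : ℝ) : bt Θ l (ift F) (ift G) x =
      ∫ z : ℝ × ℝ, F z.1 * G z.2 * ex ((z.1 + z.2) * x) * 𝓕 Θ (l * (z.1 - z.2)) := by
  have hex := continuous_ex
  have h1 : ∀ y, ift F (x - l * y) * ift G (x + l * y) * Θ y =
      ∫ z : ℝ × ℝ, F z.1 * G z.2 * Θ y * (ex ((z.1 + z.2) * x) * ex (-(y * (l * (z.1 - z.2))))) := by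
    intro y
    rw [ift, ift, ← integral_prod_mul, ← integral_mul_const]
    refine integral_congr_ae (ae_of_all _ fun z => ?_)
    simp only
    rw [← ex_add, show (z.1 + z.2) * x + -(y * (l * (z.1 - z.2))) =
      z.1 * (x - l * y) + z.2 * (x + l * y) by ring, ex_add]
    ring
  have hint : Integrable (fun p : ℝ × (ℝ × ℝ) => F p.2.1 * G p.2.2 * Θ p.1 *
      (ex ((p.2.1 + p.2.2) * x) * ex (-(p.1 * (l * (p.2.1 - p.2.2)))))) (volume.prod volume) := by
    have h2 : Integrable (fun p : ℝ × (ℝ × ℝ) => Θ p.1 * (F p.2.1 * G p.2.2)) (volume.prod volume) :=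
      hΘ.mul_prod (hF.mul_prod hG)
    refine (h2.mul_bdd (c := 1) (g := fun p => ex ((p.2.1 + p.2.2) * x) *
      ex (-(p.1 * (l * (p.2.1 - p.2.2))))) (Continuous.aestronglyMeasurable (by fun_prop))
      (ae_of_all _ fun p => by simp)).congr (ae_of_all _ fun p => ?_)
    simp only; ring
  rw [bt]
  simp_rw [h1]
  rw [integral_integral_swap (f := fun (y : ℝ) (z : ℝ × ℝ) => F z.1 * G z.2 * Θ y *
    (ex ((z.1 + z.2) * x) * ex (-(y * (l * (z.1 - z.2)))))) hint]
  refine integral_congr_ae (ae_of_all _ fun z => ?_)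
  simp only
  rw [fourier_eq_ex, ← integral_const_mul]
  refine integral_congr_ae (ae_of_all _ fun y => ?_)
  simp only; ring

lemma integrable_bt_ift {F G : ℝ → ℂ} (hF : Integrable F) (hG : Integrable G) {m : ℝ × ℝ → ℂ}
    (hm : Continuous m) {C : ℝ} (hC : ∀ z, ‖m z‖ ≤ C) (x : ℝ) :
    Integrable fun z : ℝ × ℝ => F z.1 * G z.2 * ex ((z.1 + z.2) * x) * m z := by
  have hex := continuous_ex
  have h1 := (hF.mul_prod hG).mul_bdd (c := C) (g := fun z => ex ((z.1 + z.2) * x) * m z)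
    (Continuous.aestronglyMeasurable (by fun_prop)) (ae_of_all _ fun z => by simpa using hC z)
  refine h1.congr (ae_of_all _ fun z => ?_)
  simp only; ring

/-- A local transform is a frequency localization. -/
lemma ex_mul_tf (f : 𝓢(ℝ, ℂ)) {l : ℝ} (hl : 0 < l) (k : ℤ) (x : ℝ) :
    ex (k / l * x) * tf f l (k / l) false x =
      ift (fun ξ => 𝓕 (f : ℝ → ℂ) ξ * chi (l * ξ - k)) x := by
  have hex := continuous_ex
  have hK := (Kp false).continuous
  set F := 𝓕 (f : ℝ → ℂ)
  have hF : Integrable F := integrable_fourier f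
  set ζ : ℝ := k / l
  have h1 : ∀ t, f t * pk l ζ false x t =
      ∫ ξ, F ξ * (Kp false ((x - t) / l) * (l⁻¹ : ℝ)) * (ex (ξ * t) * ex (-(ζ * t))) := fun t => by
    have : f t = ift F t := by rw [ift_fourier]
    rw [this, ift, ← integral_mul_const]
    refine integral_congr_ae (ae_of_all _ fun ξ => ?_)
    simp only [pk]; ring
  have hKi : Integrable fun t => Kp false ((x - t) / l) * ((l⁻¹ : ℝ) : ℂ) := by
    have h2 : Integrable fun t => Kp false (t / l) := (Kp false).integrable.comp_div hl.ne'
    exact (h2.comp_sub_left x).mul_const _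
  have hint : Integrable (fun p : ℝ × ℝ => F p.2 * (Kp false ((x - p.1) / l) * (l⁻¹ : ℝ)) *
      (ex (p.2 * p.1) * ex (-(ζ * p.1)))) (volume.prod volume) := by
    refine ((hKi.mul_prod hF).mul_bdd (c := 1) (g := fun p => ex (p.2 * p.1) * ex (-(ζ * p.1)))
      (Continuous.aestronglyMeasurable (by fun_prop))
      (ae_of_all _ fun p => by simp)).congr (ae_of_all _ fun p => ?_)
    simp only; ring
  rw [tf]
  simp_rw [h1]
  rw [integral_integral_swap (f := fun t ξ => F ξ * (Kp false ((x - t) / l) * (l⁻¹ : ℝ)) *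
    (ex (ξ * t) * ex (-(ζ * t)))) hint, ift, ← integral_const_mul]
  refine integral_congr_ae (ae_of_all _ fun ξ => ?_)
  simp only
  have h3 : ∀ t, F ξ * (Kp false ((x - t) / l) * (l⁻¹ : ℝ)) * (ex (ξ * t) * ex (-(ζ * t))) =
      F ξ * (l⁻¹ : ℝ) * (Kp false ((x - t) / l) * ex (-((ζ - ξ) * t))) := fun t => by
    rw [show -((ζ - ξ) * t) = ξ * t + -(ζ * t) by ring, ex_add]; ring
  simp_rw [h3]
  rw [integral_const_mul, integral_comp_reflect_mul_ex _ hl, fourier_Kp,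
    show -(l * (ζ - ξ)) = l * ξ - k by simp only [ζ]; field_simp; ring,
    show ξ * x = ζ * x + -((ζ - ξ) * x) by ring, ex_add]
  have : (l : ℂ) ≠ 0 := Complex.ofReal_ne_zero.2 hl.ne'
  push_cast
  field_simp

section

/-- The frequency offsets which occur in the decomposition. -/
noncomputable def offs : Finset ℤ := Finset.Ico (-66) (-13) ∪ Finset.Ico 14 67

lemma le_of_mem_offs {c : ℤ} (hc : c ∈ offs) : 14 ≤ |c| ∧ |c| ≤ 66 := by
  simp only [offs, Finset.mem_union, Finset.mem_Ico] at hc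
  rcases hc with hc | hc
  · rw [abs_of_neg (by omega)]; omega
  · rw [abs_of_pos (by omega)]; omega

lemma sum_chi_offs {ξ : ℝ} (h1 : 15 ≤ |ξ|) (h2 : |ξ| ≤ 65) : ∑ c ∈ offs, chi (ξ - c) = 1 := by
  have hd : Disjoint (Finset.Ico (-66 : ℤ) (-13)) (Finset.Ico 14 67) :=
    Finset.disjoint_left.2 fun c hc hc' => by simp only [Finset.mem_Ico] at hc hc'; omega
  have e1 := sum_chi ξ (-66) 53
  have e2 := sum_chi ξ 14 53
  norm_num at e1 e2
  rw [offs, Finset.sum_union hd, e1, e2]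
  rcases le_abs.1 h1 with h | h
  · rw [abs_of_nonneg (by linarith)] at h2
    rw [step_of_ge (by linarith), step_of_ge (by linarith), step_of_ge (by linarith),
      step_of_le (by linarith)]
    norm_num
  · rw [abs_of_nonpos (by linarith)] at h2
    rw [step_of_ge (by linarith), step_of_le (by linarith), step_of_le (by linarith),
      step_of_le (by linarith)]
    norm_num

/-- Frequency localized pieces. -/
noncomputable def fpiece (f : ℝ → ℂ) (l : ℝ) (k : ℤ) : ℝ → ℂ :=
  ift fun ξ => 𝓕 f ξ * chi (l * ξ - k)

lemma continuous_chi : Continuous chi := contDiff_chi.continuous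

lemma abs_chi_le_one (ξ : ℝ) : |chi ξ| ≤ 1 := by
  rw [chi, abs_le]
  have h1 := step_nonneg ξ; have h2 := step_nonneg (ξ + 1)
  have h3 := step_le_one ξ; have h4 := step_le_one (ξ + 1)
  constructor <;> linarith

lemma integrable_fourier_mul_chi (f : 𝓢(ℝ, ℂ)) (l : ℝ) (k : ℤ) :
    Integrable fun ξ => 𝓕 (f : ℝ → ℂ) ξ * chi (l * ξ - k) := by
  have := continuous_chi
  refine (integrable_fourier f).mul_bdd (c := 1) (Continuous.aestronglyMeasurable (by fun_prop))
    (ae_of_all _ fun ξ => ?_)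
  rw [Complex.norm_real]; exact abs_chi_le_one _

/-- The frequencies of size at most `K`. -/
noncomputable def freqs (K : ℕ) : Finset ℤ := Finset.Ico (-(K : ℤ)) (-(K : ℤ) + ((2 * K : ℕ) : ℤ))

/-- The truncated frequency decomposition of the bilinear average. -/
noncomputable def btK (Θ : ℝ → ℂ) (l : ℝ) (f g : ℝ → ℂ) (K : ℕ) (x : ℝ) : ℂ :=
  ∑ k ∈ freqs K, ∑ c ∈ offs, bt Θ l (fpiece f l k) (fpiece g l (k + c)) x

lemma sum_freqs_chi (K : ℕ) (ξ : ℝ) :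
    ∑ k ∈ freqs K, chi (ξ - k) = step (ξ + K + 1) - step (ξ - K + 1) := by
  rw [freqs, sum_chi]; congr 2 <;> push_cast <;> ring

lemma abs_sum_freqs_chi_le (K : ℕ) (ξ : ℝ) : |∑ k ∈ freqs K, chi (ξ - k)| ≤ 1 := by
  rw [sum_freqs_chi, abs_le]
  have h1 := step_nonneg (ξ + K + 1); have h2 := step_nonneg (ξ - K + 1)
  have h3 := step_le_one (ξ + K + 1); have h4 := step_le_one (ξ - K + 1)
  constructor <;> linarith

variable {Θ : 𝓢(ℝ, ℂ)}

lemma btK_eq (hΘ : ∀ ξ, 𝓕 (Θ : ℝ → ℂ) ξ ≠ 0 → 16 ≤ |ξ| ∧ |ξ| ≤ 64) (f g : 𝓢(ℝ, ℂ)) (l : ℝ) (K : ℕ)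
    (x : ℝ) : btK Θ l f g K x = ∫ z : ℝ × ℝ, 𝓕 (f : ℝ → ℂ) z.1 * 𝓕 (g : ℝ → ℂ) z.2 *
      ex ((z.1 + z.2) * x) * (((∑ k ∈ freqs K, chi (l * z.1 - k) : ℝ) : ℂ) *
        𝓕 (Θ : ℝ → ℂ) (l * (z.1 - z.2))) := by
  have hΘc := continuous_fourier Θ
  have hm : Continuous fun z : ℝ × ℝ => 𝓕 (Θ : ℝ → ℂ) (l * (z.1 - z.2)) := by fun_prop
  have hi := fun k k' => integrable_bt_ift (integrable_fourier_mul_chi f l k)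
    (integrable_fourier_mul_chi g l k') hm (fun z => norm_fourier_le Θ _) x
  rw [btK]
  simp only [fpiece]
  simp_rw [bt_ift (integrable_fourier_mul_chi f l _) (integrable_fourier_mul_chi g l _) Θ.integrable]
  simp_rw [← integral_finsetSum offs fun c _ => hi _ _]
  rw [← integral_finsetSum _ fun k _ => integrable_finsetSum _ fun c _ => hi _ _]
  refine integral_congr_ae (ae_of_all _ fun z => ?_)
  simp only
  rw [Complex.ofReal_sum, Finset.sum_mul, Finset.mul_sum]
  refine Finset.sum_congr rfl fun k _ => ?_
  by_cases h0 : 𝓕 (Θ : ℝ → ℂ) (l * (z.1 - z.2)) = 0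
  · simp [h0]
  by_cases h1 : 9 / 10 ≤ |l * z.1 - k|
  · simp [chi_eq_zero h1]
  push Not at h1
  obtain ⟨h2, h3⟩ := hΘ _ h0
  have e : ∑ c ∈ offs, chi (l * z.2 - k - c) = 1 := by
    have e1 : l * z.2 - k = (l * z.1 - k) - l * (z.1 - z.2) := by ring
    refine sum_chi_offs ?_ ?_
    · rw [e1, abs_sub_comm]
      linarith [abs_sub_abs_le_abs_sub (l * (z.1 - z.2)) (l * z.1 - k)]
    · rw [e1]
      linarith [abs_sub (l * z.1 - k) (l * (z.1 - z.2))]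
  calc _ = 𝓕 (f : ℝ → ℂ) z.1 * chi (l * z.1 - k) * 𝓕 (g : ℝ → ℂ) z.2 * ex ((z.1 + z.2) * x) *
        𝓕 (Θ : ℝ → ℂ) (l * (z.1 - z.2)) * ((∑ c ∈ offs, chi (l * z.2 - k - c) : ℝ) : ℂ) := by
        rw [Complex.ofReal_sum, Finset.mul_sum]
        refine Finset.sum_congr rfl fun c _ => ?_
        rw [show l * z.2 - ((k + c : ℤ) : ℝ) = l * z.2 - k - c by push_cast; ring]
        ring
    _ = _ := by rw [e]; push_cast; ring

lemma norm_btK_le (hΘ : ∀ ξ, 𝓕 (Θ : ℝ → ℂ) ξ ≠ 0 → 16 ≤ |ξ| ∧ |ξ| ≤ 64) (f g : 𝓢(ℝ, ℂ)) (l : ℝ)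
    (K : ℕ) (x : ℝ) : ‖btK Θ l f g K x‖ ≤
      ∫ z : ℝ × ℝ, ‖𝓕 (f : ℝ → ℂ) z.1 * 𝓕 (g : ℝ → ℂ) z.2‖ * ∫ t, ‖Θ t‖ := by
  rw [btK_eq hΘ]
  refine norm_integral_le_of_norm_le
    (((integrable_fourier f).mul_prod (integrable_fourier g)).norm.mul_const _)
    (ae_of_all _ fun z => ?_)
  rw [norm_mul, norm_mul _ (ex _), norm_ex, mul_one]
  gcongr
  rw [norm_mul, Complex.norm_real]
  exact (mul_le_of_le_one_left (norm_nonneg _) (abs_sum_freqs_chi_le K _)).trans (norm_fourier_le _ _)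

lemma tendsto_btK (hΘ : ∀ ξ, 𝓕 (Θ : ℝ → ℂ) ξ ≠ 0 → 16 ≤ |ξ| ∧ |ξ| ≤ 64) (f g : 𝓢(ℝ, ℂ)) (l : ℝ)
    (x : ℝ) : Filter.Tendsto (fun K => btK Θ l f g K x) Filter.atTop (nhds (bt Θ l f g x)) := by
  have e : bt Θ l f g x = bt Θ l (ift (𝓕 (f : ℝ → ℂ))) (ift (𝓕 (g : ℝ → ℂ))) x := by
    rw [ift_fourier, ift_fourier]
  rw [e, bt_ift (integrable_fourier f) (integrable_fourier g) Θ.integrable]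
  simp_rw [btK_eq hΘ]
  have hΘc := continuous_fourier Θ
  have hcc := continuous_chi
  have hb : ∀ K (z : ℝ × ℝ), ‖(((∑ k ∈ freqs K, chi (l * z.1 - k) : ℝ) : ℂ) *
      𝓕 (Θ : ℝ → ℂ) (l * (z.1 - z.2)))‖ ≤ ∫ t, ‖Θ t‖ := fun K z => by
    rw [norm_mul, Complex.norm_real]
    exact (mul_le_of_le_one_left (norm_nonneg _) (abs_sum_freqs_chi_le K _)).trans
      (norm_fourier_le _ _)
  refine tendsto_integral_of_dominated_convergence
    (fun z => ‖𝓕 (f : ℝ → ℂ) z.1 * 𝓕 (g : ℝ → ℂ) z.2‖ * ∫ t, ‖Θ t‖) (fun K => ?_)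
    (((integrable_fourier f).mul_prod (integrable_fourier g)).norm.mul_const _)
    (fun K => ae_of_all _ fun z => ?_) (ae_of_all _ fun z => ?_)
  · exact (integrable_bt_ift (integrable_fourier f) (integrable_fourier g)
      (m := fun z => (((∑ k ∈ freqs K, chi (l * z.1 - k) : ℝ) : ℂ) *
      𝓕 (Θ : ℝ → ℂ) (l * (z.1 - z.2)))) (by fun_prop) (hb K) x).aestronglyMeasurable
  · rw [norm_mul, norm_mul _ (ex _), norm_ex, mul_one]
    gcongr
    exact hb K z
  · refine tendsto_const_nhds.congr' ?_
    obtain ⟨K₀, hK₀⟩ := exists_nat_ge (|l * z.1| + 2)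
    filter_upwards [Filter.eventually_ge_atTop K₀] with K hK
    have hK' : (K₀ : ℝ) ≤ K := by exact_mod_cast hK
    have h1 := neg_abs_le (l * z.1); have h2 := le_abs_self (l * z.1)
    rw [sum_freqs_chi, step_of_ge (by linarith), step_of_le (by linarith)]
    simp

/-- The pieces are modulated local transforms. -/
lemma bt_fpiece (f g : 𝓢(ℝ, ℂ)) (P : Tile) (c : ℤ) (x : ℝ) :
    bt Θ P.len (fpiece f P.len P.k) (fpiece g P.len (P.k + c)) x =
      ex ((2 * P.k + c) * x / P.len) * vf f g (fun y => ex (c * y) * Θ y) P.len (P.zeta 0) (P.zeta c)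
        false false x := by
  have hl := P.len_pos
  have e0 : P.zeta 0 = (P.k : ℝ) / P.len := by rw [Tile.zeta, Tile.len]; simp
  have ec : P.zeta c = ((P.k + c : ℤ) : ℝ) / P.len := by rw [Tile.zeta, Tile.len]; push_cast; ring
  rw [bt, vf, ← integral_const_mul]
  refine integral_congr_ae (ae_of_all _ fun y => ?_)
  simp only [fpiece]
  rw [← ex_mul_tf f hl, ← ex_mul_tf g hl, ← e0, ← ec]
  have : ex (P.zeta 0 * (x - P.len * y)) * ex (P.zeta c * (x + P.len * y)) =
      ex ((2 * P.k + c) * x / P.len) * ex (c * y) := by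
    rw [← ex_add, ← ex_add, e0, ec]
    congr 1; push_cast; field_simp; ring
  calc _ = (ex (P.zeta 0 * (x - P.len * y)) * ex (P.zeta c * (x + P.len * y))) *
      (tf f P.len (P.zeta 0) false (x - P.len * y) * tf g P.len (P.zeta c) false (x + P.len * y) * Θ y) := by
        ring
    _ = _ := by rw [this]; ring

end

section

/-- The weighted norm which controls the bilinear averages. -/
noncomputable def qn (Θ : ℝ → ℂ) : ℝ := ∫ y, (1 + |y|) ^ 16 * ‖Θ y‖

lemma integrable_qn (Θ : 𝓢(ℝ, ℂ)) : Integrable fun y => (1 + |y|) ^ 16 * ‖Θ y‖ := by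
  obtain ⟨C, hC, h⟩ := exists_decay Θ 18
  refine ((integrable_one_add_norm (μ := (volume : Measure ℝ)) (r := 2) (by simp)).const_mul C).mono'
    (Continuous.aestronglyMeasurable (by have := Θ.continuous; fun_prop)) (ae_of_all _ fun y => ?_)
  have h0 := abs_nonneg y
  rw [Real.norm_of_nonneg (by positivity), Real.norm_eq_abs, Real.rpow_neg (by positivity),
    ← div_eq_mul_inv, le_div_iff₀ (by positivity)]
  calc _ = (1 + |y|) ^ 18 * ‖Θ y‖ := by norm_cast; ring
    _ ≤ C := h y

lemma qn_nonneg (Θ : ℝ → ℂ) : 0 ≤ qn Θ := integral_nonneg fun y => by positivity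

/-- Hypotheses of the local estimate for a collection `J` of dyadic intervals. -/
structure LocalHyp (J : Finset (ℤ × ℤ)) (n₀ m₀ : ℤ) (N : Finset ℤ) (f g : ℝ → ℂ) (h : ℤ → ℝ → ℂ)
    (v : ℝ → ℝ) (s₁ s₂ s₃ : ℝ) : Prop where
  sub : ∀ p ∈ J, dya p.1 p.2 ⊆ dya n₀ m₀
  mem : ∀ p ∈ J, p.1 ∈ N
  avg_f : ∀ p ∈ J, AvgLE p.1 p.2 (fun t => ‖f t‖ ^ s₁) 1
  avg_g : ∀ p ∈ J, AvgLE p.1 p.2 (fun t => ‖g t‖ ^ s₂) 1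
  avg_v : ∀ p ∈ J, AvgLE p.1 p.2 (fun t => v t ^ s₃) 1
  int_f : Integrable f
  int_g : Integrable g
  int_f_rpow : Integrable fun t => ‖f t‖ ^ s₁
  int_g_rpow : Integrable fun t => ‖g t‖ ^ s₂
  int_h : ∀ n ∈ N, Integrable (h n)
  meas_v : Measurable v
  v_nonneg : ∀ x, 0 ≤ v x
  int_v : Integrable v
  int_v_rpow : Integrable fun x => v x ^ s₃
  sq_le : ∀ x, ∑ n ∈ N, ‖h n x‖ ^ 2 ≤ v x ^ 2
  one_lt_f : 1 < s₁
  le_two_f : s₁ ≤ 2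
  one_lt_g : 1 < s₂
  le_two_g : s₂ ≤ 2
  one_lt_v : 1 < s₃
  le_two_v : s₃ ≤ 2
  sum_lt : 1 / s₁ + 1 / s₂ + 1 / s₃ < 2

variable {J : Finset (ℤ × ℤ)} {n₀ m₀ : ℤ} {N : Finset ℤ} {h : ℤ → ℝ → ℂ}
  {v : ℝ → ℝ} {s₁ s₂ s₃ : ℝ}

lemma exists_packets {f : ℝ → ℂ} (hf : Integrable f) (c : ℤ) : ∃ (x : Tile → ℝ) (b : Tile → Bool),
    ∀ (P : Tile) x' b', ‖tf f P.len (P.zeta c) b' x'‖ ≤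
      2 ^ 9 * cK * ‖∫ t, f t * npk c x b P t‖ * P.rho x' ^ 8 := by
  choose x b hxb using fun P : Tile => exists_near_max hf P (P.zeta c)
  refine ⟨x, b, fun P x' b' => ?_⟩
  have h1 := hxb P x' b'
  have hr := P.rho_pos x'
  have hr' := P.rho_pos (x P)
  have hK := cK_pos
  rw [← div_eq_mul_inv, div_le_iff₀ (by positivity)] at h1
  have e : ∫ t, f t * npk c x b P t =
      (((2 ^ 8 * cK)⁻¹ * (P.rho (x P) ^ 8)⁻¹ : ℝ) : ℂ) * tf f P.len (P.zeta c) (b P) (x P) := by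
    rw [tf, ← integral_const_mul]
    refine integral_congr_ae (ae_of_all _ fun t => ?_)
    simp only [npk]; ring
  rw [e, norm_mul, Complex.norm_real, Real.norm_of_nonneg (by positivity)]
  refine h1.trans (le_of_eq ?_)
  field_simp

/-- The estimate for a thin collection of tiles and a single frequency offset. -/
lemma norm_sum_tile_le {f g Θ : 𝓢(ℝ, ℂ)} (H : LocalHyp J n₀ m₀ N f g h v s₁ s₂ s₃) {c : ℤ}
    (hc : 14 ≤ |c|) (hc' : |c| ≤ 66) {𝔓 : Finset Tile} (hthin : Thin 𝔓)
    (h𝔓 : ∀ P ∈ 𝔓, (P.n, P.m) ∈ J) :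
    ‖∑ P ∈ 𝔓, ∫ x in P.I, bt Θ P.len (fpiece f P.len P.k) (fpiece g P.len (P.k + c)) x * h P.n x‖ ≤
      2 ^ 34 * cK ^ 2 * qn Θ * (cL s₁ s₂ s₃ 10 * 2 ^ n₀) := by
  obtain ⟨xf, bf, hfp⟩ := exists_packets H.int_f 0
  obtain ⟨xg, bg, hgp⟩ := exists_packets H.int_g c
  set a : Tile → ℝ := fun P => ‖∫ t, f t * npk 0 xf bf P t‖
  set b : Tile → ℝ := fun P => ‖∫ t, g t * npk c xg bg P t‖
  have ha0 : ∀ P, 0 ≤ a P := fun P => norm_nonneg _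
  have hb0 : ∀ P, 0 ≤ b P := fun P => norm_nonneg _
  have hQ := qn_nonneg Θ
  have hK := cK_pos
  have hex := continuous_ex
  set w : ℝ → ℂ := fun y => ex (c * y) * Θ y with hw
  have hwn : ∀ y, ‖w y‖ = ‖Θ y‖ := fun y => by simp [hw]
  have hwi : Integrable fun y => (1 + |y|) ^ 16 * ‖w y‖ := by
    simp_rw [hwn]; exact integrable_qn Θ
  have hw1 : Integrable w := by
    have := Θ.continuous
    exact Θ.integrable.mono (Continuous.aestronglyMeasurable (by fun_prop))
      (ae_of_all _ fun y => (hwn y).le)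
  set V : Bool → Bool → Tile → ℝ → ℂ := fun b b' P =>
    vf f g w P.len (P.zeta 0) (P.zeta c) b b' with hV
  set D : Tile → ℝ := fun P => 2 ^ 34 * cK ^ 2 * qn Θ * (a P * b P) with hD
  have hD0 : ∀ P, 0 ≤ D P := fun P => by
    have := ha0 P; have := hb0 P; simp only [hD]; positivity
  have hVD : ∀ b b' P, ∀ x ∈ P.I, ‖V b b' P x‖ ≤ D P := fun i j P x hx => by
    refine (norm_vf_le (fun x' => hfp P x' i) (fun x' => hgp P x' j) hwi hx).trans (le_of_eq ?_)
    simp_rw [hwn]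
    simp only [hD, qn, a, b]; ring
  set κ : Tile → ℝ → ℂ := fun P t => (((D P)⁻¹ : ℝ) : ℂ) * V false false P t with hκ
  set κ' : Tile → ℝ → ℂ := fun P t => (((D P)⁻¹ : ℝ) : ℂ) * (((P.len⁻¹ : ℝ) : ℂ) *
    (V true false P t + V false true P t)) with hκ'
  have hκd : ∀ P t, HasDerivAt (κ P) (κ' P t) t := fun P t =>
    (hasDerivAt_vf H.int_f H.int_g hw1 P.len_pos _ _ t).const_mul _
  have hVc : ∀ b b' P, Continuous (V b b' P) := fun b b' P =>
    continuous_vf H.int_f H.int_g hw1 P.len_pos _ _ b b'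
  have hκ1 : ∀ P, ∀ t ∈ P.I, ‖κ P t‖ ≤ 1 := fun P t ht => by
    rw [hκ, norm_mul, Complex.norm_real, Real.norm_of_nonneg (inv_nonneg.2 (hD0 P)), ← div_eq_inv_mul]
    exact div_le_one_of_le₀ (hVD _ _ P t ht) (hD0 P)
  have hκ2 : ∀ P, ∀ t ∈ P.I, ‖κ' P t‖ ≤ 2 / P.len := fun P t ht => by
    have hl := P.len_pos
    rw [hκ', norm_mul, norm_mul, Complex.norm_real, Complex.norm_real,
      Real.norm_of_nonneg (inv_nonneg.2 (hD0 P)), Real.norm_of_nonneg (inv_nonneg.2 hl.le)]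
    have h1 : ‖V true false P t + V false true P t‖ ≤ 2 * D P :=
      (norm_add_le _ _).trans (by linarith [hVD true false P t ht, hVD false true P t ht])
    have h2 : (D P)⁻¹ * D P ≤ 1 := inv_mul_le_one
    have := hD0 P
    calc _ ≤ (D P)⁻¹ * (P.len⁻¹ * (2 * D P)) := by gcongr
      _ = 2 / P.len * ((D P)⁻¹ * D P) := by ring
      _ ≤ 2 / P.len * 1 := by gcongr
      _ = _ := mul_one _
  set θ : Tile → ℝ → ℂ := fun P t => ((P.len⁻¹ : ℝ) : ℂ) * (ex ((2 * P.k + c) * t / P.len) * κ P t)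
    with hθ
  have hLf : LocalData 0 𝔓 n₀ m₀ (npk 0 xf bf) f s₁ :=
    { packets := packets_npk 0 𝔓 xf bf
      thin := hthin
      le := by simp
      offset := Or.inl rfl
      sub := fun P hP => H.sub _ (h𝔓 P hP)
      int := H.int_f
      int_rpow := H.int_f_rpow
      avg := fun P hP => H.avg_f _ (h𝔓 P hP)
      one_lt := H.one_lt_f
      le_two := H.le_two_f }
  have hLg : LocalData c 𝔓 n₀ m₀ (npk c xg bg) g s₂ :=
    { packets := packets_npk c 𝔓 xg bg
      thin := hthin
      le := hc'
      offset := Or.inr hc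
      sub := fun P hP => H.sub _ (h𝔓 P hP)
      int := H.int_g
      int_rpow := H.int_g_rpow
      avg := fun P hP => H.avg_g _ (h𝔓 P hP)
      one_lt := H.one_lt_g
      le_two := H.le_two_g }
  have hDu : DualData 𝔓 n₀ m₀ N h v θ 10 s₃ :=
    { cont := fun P _ => by
        have := hVc false false P
        simp only [hθ, hκ]; fun_prop
      bound := fun P _ t ht => by
        have hl := P.len_pos
        rw [hθ, norm_mul, norm_mul, norm_ex, one_mul, Complex.norm_real,
          Real.norm_of_nonneg (inv_nonneg.2 hl.le)]
        exact mul_le_of_le_one_right (inv_nonneg.2 hl.le) (hκ1 P t ht)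
      bessel := fun n m u hu hu2 => by
        have hl : (0 : ℝ) < 2 ^ n := by positivity
        set l : ℝ := 2 ^ n with hl'
        have hI : dya n m = Ico (l * m) (l * m + l) := by rw [dya]; congr 1; ring
        have hB := sum_norm_setIntegral_mul_ex_mul_le hl (l * m) c
          ((𝔓.filter fun P => P.n = n ∧ P.m = m).image Tile.k)
          (κ := fun k => κ ⟨n, m, k⟩) (κ' := fun k => κ' ⟨n, m, k⟩)
          (fun k _ t => hκd _ t) (fun k _ => by
            have h1 := hVc true false ⟨n, m, k⟩; have h2 := hVc false true ⟨n, m, k⟩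
            simp only [hκ']; fun_prop)
          (fun k _ => hκ1 ⟨n, m, k⟩ _ (left_mem_dya n m))
          (fun k _ t ht => hκ2 ⟨n, m, k⟩ t (by
            change t ∈ dya n m
            rw [hI]; exact Ioo_subset_Ico_self ht)) hu
          ((memLp_two_iff_integrable_sq_norm hu.aestronglyMeasurable).2 hu2)
        rw [Finset.sum_image (fun P hP P' hP' hk => by
          obtain ⟨_, hn, hm⟩ := Finset.mem_filter.1 hP
          obtain ⟨_, hn', hm'⟩ := Finset.mem_filter.1 hP'
          cases P; cases P'; simp_all)] at hB
        rw [hI, integral_Ico_eq_integral_Ioc]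
        have hB2 := mul_le_mul_of_nonneg_left hB (inv_nonneg.2 hl.le)
        rw [Finset.mul_sum] at hB2
        have e2 : ∀ X : ℝ, l⁻¹ * (10 * l * X) = 10 * X := fun X => by field_simp
        rw [e2] at hB2
        refine (Finset.sum_le_sum fun P hP => le_of_eq ?_).trans hB2
        obtain ⟨_, hn, hm⟩ := Finset.mem_filter.1 hP
        have hP' : P = ⟨n, m, P.k⟩ := by cases P; simp_all
        have hlen : P.len = l := by rw [Tile.len, hn]
        rw [← hP', Tile.I, hn, hm, hI, integral_Ico_eq_integral_Ioc]
        have e3 : ∀ t, u t * θ P t = ((l⁻¹ : ℝ) : ℂ) *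
            (u t * ex ((2 * P.k + c) * t / l) * κ P t) := fun t => by
          simp only [hθ, hlen]; ring
        simp_rw [e3]
        rw [integral_const_mul, norm_mul, Complex.norm_real, Real.norm_of_nonneg (inv_nonneg.2 hl.le),
          hlen]
        field_simp
      nonneg := by norm_num
      mem := fun P hP => H.mem _ (h𝔓 P hP)
      sub := fun P hP => H.sub _ (h𝔓 P hP)
      int := H.int_h
      meas := H.meas_v
      v_nonneg := H.v_nonneg
      int_v := H.int_v
      int_rpow := H.int_v_rpow
      sq_le := H.sq_le
      avg := fun P hP => H.avg_v _ (h𝔓 P hP)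
      one_lt := H.one_lt_v
      le_two := H.le_two_v }
  have hmain := local_estimate hc hLf hLg hDu H.sum_lt
  have hmain2 := mul_le_mul_of_nonneg_left hmain
    (by positivity : 0 ≤ 2 ^ 34 * cK ^ 2 * qn Θ)
  refine le_trans ?_ hmain2
  rw [Finset.mul_sum]
  refine (norm_sum_le _ _).trans (Finset.sum_le_sum fun P _ => le_of_eq ?_)
  have e : ∫ x in P.I, bt Θ P.len (fpiece f P.len P.k) (fpiece g P.len (P.k + c)) x * h P.n x =
      ((P.len * D P : ℝ) : ℂ) * ∫ x in P.I, h P.n x * θ P x := by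
    rw [← integral_const_mul]
    refine setIntegral_congr_fun measurableSet_Ico fun x hx => ?_
    have hl : (P.len : ℂ) ≠ 0 := Complex.ofReal_ne_zero.2 P.len_pos.ne'
    have h1 : V false false P x = D P * ((((D P)⁻¹ : ℝ) : ℂ) * V false false P x) := by
      rcases eq_or_ne (D P) 0 with h0 | h0
      · have := hVD false false P x hx
        rw [h0] at this
        rw [norm_le_zero_iff.1 this]; simp
      · have : (D P : ℂ) ≠ 0 := Complex.ofReal_ne_zero.2 h0
        push_cast; field_simp
    have h2 := bt_fpiece (Θ := Θ) f g P c x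
    simp only [hθ, hκ]
    rw [h2]
    change _ * V false false P x * _ = _
    nth_rewrite 1 [h1]
    push_cast
    field_simp
  rw [e, norm_mul, Complex.norm_real, Real.norm_of_nonneg (mul_nonneg P.len_pos.le (hD0 P))]
  simp only [hD, a, b]
  ring

end

section

variable {J : Finset (ℤ × ℤ)} {n₀ m₀ : ℤ} {N : Finset ℤ} {h : ℤ → ℝ → ℂ}
  {v : ℝ → ℝ} {s₁ s₂ s₃ : ℝ}

lemma continuous_bt_fpiece (Θ f g : 𝓢(ℝ, ℂ)) (n k c : ℤ) :
    Continuous (bt Θ (2 ^ n) (fpiece f (2 ^ n) k) (fpiece g (2 ^ n) (k + c))) := by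
  have e := bt_fpiece (Θ := Θ) f g ⟨n, 0, k⟩ c
  simp only [Tile.len] at e
  rw [funext e]
  have hex := continuous_ex
  have hw : Integrable fun y => ex (c * y) * Θ y := by
    have := Θ.continuous
    exact Θ.integrable.mono (Continuous.aestronglyMeasurable (by fun_prop))
      (ae_of_all _ fun y => by simp)
  have := continuous_vf f.integrable g.integrable hw (by positivity : (0 : ℝ) < 2 ^ n)
    ((⟨n, 0, k⟩ : Tile).zeta 0) ((⟨n, 0, k⟩ : Tile).zeta c) false false
  fun_prop

lemma norm_bt_ift_le {F G : ℝ → ℂ} (hF : Integrable F) (hG : Integrable G) {Θ : ℝ → ℂ}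
    (hΘ : Integrable Θ) (l x : ℝ) : ‖bt Θ l (ift F) (ift G) x‖ ≤
      ∫ z : ℝ × ℝ, ‖F z.1 * G z.2‖ * ∫ t, ‖Θ t‖ := by
  rw [bt_ift hF hG hΘ]
  refine norm_integral_le_of_norm_le ((hF.mul_prod hG).norm.mul_const _) (ae_of_all _ fun z => ?_)
  rw [norm_mul, norm_mul _ (ex _), norm_ex, mul_one]
  gcongr
  exact norm_fourier_le _ _

lemma integrable_bt_fpiece_mul (Θ f g : 𝓢(ℝ, ℂ)) (n k c : ℤ) {u : ℝ → ℂ} (hu : Integrable u) :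
    Integrable fun x => bt Θ (2 ^ n) (fpiece f (2 ^ n) k) (fpiece g (2 ^ n) (k + c)) x * u x :=
  hu.bdd_mul (continuous_bt_fpiece Θ f g n k c).aestronglyMeasurable
    (ae_of_all _ fun x => norm_bt_ift_le (integrable_fourier_mul_chi f _ _)
      (integrable_fourier_mul_chi g _ _) Θ.integrable _ x)

/-- The constant of the local estimate for all frequencies. -/
noncomputable def cB (s₁ s₂ s₃ : ℝ) : ℝ := offs.card * (40 * (2 ^ 34 * cK ^ 2 * cL s₁ s₂ s₃ 10))

/-- The tiles over the intervals in `J` with frequencies at most `K`. -/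
noncomputable def tiles (J : Finset (ℤ × ℤ)) (K : ℕ) : Finset Tile :=
  open Classical in (J ×ˢ freqs K).image fun z => ⟨z.1.1, z.1.2, z.2⟩

lemma sum_tiles (J : Finset (ℤ × ℤ)) (K : ℕ) (F : Tile → ℂ) :
    ∑ P ∈ tiles J K, F P = ∑ p ∈ J, ∑ k ∈ freqs K, F ⟨p.1, p.2, k⟩ := by
  classical
  rw [tiles, Finset.sum_image, Finset.sum_product]
  rintro ⟨⟨a, b⟩, c⟩ _ ⟨⟨a', b'⟩, c'⟩ _ hh
  simp_all

lemma norm_sum_tiles_le {f g Θ : 𝓢(ℝ, ℂ)} (H : LocalHyp J n₀ m₀ N f g h v s₁ s₂ s₃) {c : ℤ}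
    (hc : 14 ≤ |c|) (hc' : |c| ≤ 66) (K : ℕ) :
    ‖∑ P ∈ tiles J K,
      ∫ x in P.I, bt Θ P.len (fpiece f P.len P.k) (fpiece g P.len (P.k + c)) x * h P.n x‖ ≤
      40 * (2 ^ 34 * cK ^ 2 * qn Θ * (cL s₁ s₂ s₃ 10 * 2 ^ n₀)) := by
  classical
  have hmap : ∀ P ∈ tiles J K, (P.n % 10, P.k % 4) ∈
      (Finset.Ico 0 10 ×ˢ Finset.Ico 0 4 : Finset (ℤ × ℤ)) := fun P _ => by
    simp only [Finset.mem_product, Finset.mem_Ico]; omega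
  rw [← Finset.sum_fiberwise_of_maps_to hmap]
  refine (norm_sum_le _ _).trans ?_
  refine (Finset.sum_le_card_nsmul _ _ (2 ^ 34 * cK ^ 2 * qn Θ * (cL s₁ s₂ s₃ 10 * 2 ^ n₀))
    fun r _ => norm_sum_tile_le H hc hc' (fun P hP P' hP' => ?_) fun P hP => ?_).trans (le_of_eq ?_)
  · have h1 := (Finset.mem_filter.1 hP).2
    have h2 := (Finset.mem_filter.1 hP').2
    rw [← h2, Prod.mk.injEq] at h1
    constructor <;> intro <;> omega
  · have h1 := (Finset.mem_filter.1 hP).1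
    simp only [tiles, Finset.mem_image, Finset.mem_product] at h1
    obtain ⟨z, hz, rfl⟩ := h1
    exact hz.1
  · rw [Finset.card_product, Int.card_Ico, Int.card_Ico, nsmul_eq_mul]
    norm_num [show Int.toNat 10 = 10 from rfl, show Int.toNat 4 = 4 from rfl]

/-- The local estimate for the bilinear averages. -/
theorem norm_sum_bt_le {f g Θ : 𝓢(ℝ, ℂ)} (hΘ : ∀ ξ, 𝓕 (Θ : ℝ → ℂ) ξ ≠ 0 → 16 ≤ |ξ| ∧ |ξ| ≤ 64)
    (H : LocalHyp J n₀ m₀ N f g h v s₁ s₂ s₃) :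
    ‖∑ p ∈ J, ∫ x in dya p.1 p.2, bt Θ (2 ^ p.1) f g x * h p.1 x‖ ≤
      cB s₁ s₂ s₃ * qn Θ * 2 ^ n₀ := by
  have hlim : Filter.Tendsto
      (fun K => ∑ p ∈ J, ∫ x in dya p.1 p.2, btK Θ (2 ^ p.1) f g K x * h p.1 x) Filter.atTop
      (nhds (∑ p ∈ J, ∫ x in dya p.1 p.2, bt Θ (2 ^ p.1) f g x * h p.1 x)) := by
    refine tendsto_finsetSum _ fun p hp => ?_
    have hi := (H.int_h p.1 (H.mem p hp)).restrict (s := dya p.1 p.2)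
    refine tendsto_integral_of_dominated_convergence
      (fun x => (∫ z : ℝ × ℝ, ‖𝓕 (f : ℝ → ℂ) z.1 * 𝓕 (g : ℝ → ℂ) z.2‖ * ∫ t, ‖Θ t‖) * ‖h p.1 x‖)
      (fun K => ?_) (hi.norm.const_mul _) (fun K => ae_of_all _ fun x => ?_)
      (ae_of_all _ fun x => (tendsto_btK hΘ f g _ x).mul_const _)
    · refine AEStronglyMeasurable.mul (Continuous.aestronglyMeasurable ?_) hi.aestronglyMeasurable
      unfold btK
      exact continuous_finsetSum _ fun k _ => continuous_finsetSum _ fun c _ =>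
        continuous_bt_fpiece Θ f g p.1 k c
    · rw [norm_mul]
      gcongr
      exact norm_btK_le hΘ f g _ K x
  refine le_of_tendsto hlim.norm (Filter.Eventually.of_forall fun K => ?_)
  have e : ∑ p ∈ J, ∫ x in dya p.1 p.2, btK Θ (2 ^ p.1) f g K x * h p.1 x =
      ∑ c ∈ offs, ∑ P ∈ tiles J K,
        ∫ x in P.I, bt Θ P.len (fpiece f P.len P.k) (fpiece g P.len (P.k + c)) x * h P.n x := by
    simp_rw [sum_tiles]
    rw [Finset.sum_comm]
    refine Finset.sum_congr rfl fun p hp => ?_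
    rw [Finset.sum_comm]
    have hi := fun k c => (integrable_bt_fpiece_mul Θ f g p.1 k c
      (H.int_h p.1 (H.mem p hp))).restrict (s := dya p.1 p.2)
    simp only [Tile.I, Tile.len]
    simp_rw [← integral_finsetSum _ fun c _ => hi _ c]
    rw [← integral_finsetSum _ fun k _ => integrable_finsetSum _ fun c _ => hi k c]
    simp only [btK, Finset.sum_mul]
  rw [e]
  refine (norm_sum_le _ _).trans ((Finset.sum_le_card_nsmul _ _ _ fun c hc =>
    norm_sum_tiles_le H (le_of_mem_offs hc).1 (le_of_mem_offs hc).2 K).trans (le_of_eq ?_))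
  rw [nsmul_eq_mul, cB]; ring

end

section

/-- For each dyadic interval there is a dyadic level which bounds the averages of `u` optimally. -/
lemma exists_avgLE_level {u : ℝ → ℝ} (hu0 : ∀ t, 0 ≤ u t) (hu : Integrable u) (hpos : 0 < ∫ t, u t)
    {s : ℝ} (hs : 0 < s) (n m : ℤ) : ∃ j : ℤ, AvgLE n m u (((2 : ℝ) ^ j) ^ s) ∧
      ¬ AvgLE n m u (((2 : ℝ) ^ (j - 1)) ^ s) := by
  have hroot : ∀ c : ℝ, 0 < c → (c ^ s⁻¹) ^ s = c := fun c hc => Real.rpow_inv_rpow hc.le hs.ne'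
  have hbdd : ∃ b : ℤ, ∀ z : ℤ, AvgLE n m u (((2 : ℝ) ^ z) ^ s) → b ≤ z := by
    have hlim := intervalIntegral_tendsto_integral hu
      (Filter.tendsto_neg_atTop_atBot.comp tendsto_natCast_atTop_atTop)
      (tendsto_natCast_atTop_atTop (R := ℝ))
    obtain ⟨K, hK, h1, h2⟩ := ((hlim.eventually (lt_mem_nhds hpos)).and
      (((tendsto_natCast_atTop_atTop (R := ℝ)).eventually_ge_atTop (-((2 : ℝ) ^ n * m))).and
        ((tendsto_natCast_atTop_atTop (R := ℝ)).eventually_ge_atTop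
          ((2 : ℝ) ^ n * (m + 1))))).exists
    simp only [Function.comp_apply] at hK
    have hK0 : (0 : ℝ) < K := by
      have := zpow_pos (two_pos (α := ℝ)) n
      nlinarith
    rw [intervalIntegral.integral_of_le (by linarith), ← integral_Ico_eq_integral_Ioc] at hK
    have hc : 0 < (∫ t in Ico (-(K : ℝ)) K, u t) / (K - -K) := div_pos hK (by linarith)
    obtain ⟨b, hb, -⟩ := exists_mem_Ico_zpow (Real.rpow_pos_of_pos hc s⁻¹) one_lt_two
    refine ⟨b, fun z hz => ?_⟩
    have h3 := hz (-K) K (by linarith) h2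
    rw [← div_le_iff₀ (by linarith)] at h3
    have h4 : ((∫ t in Ico (-(K : ℝ)) K, u t) / (K - -K)) ^ s⁻¹ ≤ 2 ^ z := by
      refine le_of_not_gt fun h => absurd h3 (not_le.2 ?_)
      calc _ < _ := Real.rpow_lt_rpow (by positivity) h hs
        _ = _ := hroot _ hc
    exact (zpow_le_zpow_iff_right₀ one_lt_two).1 (hb.trans h4)
  have hinh : ∃ z : ℤ, AvgLE n m u (((2 : ℝ) ^ z) ^ s) := by
    have hc : 0 < (∫ t, u t) / 2 ^ n := by positivity
    obtain ⟨z, -, hz⟩ := exists_mem_Ico_zpow (Real.rpow_pos_of_pos hc s⁻¹) one_lt_two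
    refine ⟨z + 1, fun a b ha hb => ?_⟩
    have h1 : (∫ t, u t) / 2 ^ n ≤ ((2 : ℝ) ^ (z + 1)) ^ s := by
      rw [← hroot _ hc]
      exact Real.rpow_le_rpow (by positivity) hz.le hs.le
    calc ∫ t in Ico a b, u t ≤ ∫ t, u t := setIntegral_le_integral hu (ae_of_all _ hu0)
      _ ≤ ((2 : ℝ) ^ (z + 1)) ^ s * 2 ^ n := by rwa [← div_le_iff₀ (by positivity)]
      _ ≤ _ := by gcongr; linarith
  obtain ⟨j, hj, hmin⟩ := Int.exists_least_of_bdd hbdd hinh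
  exact ⟨j, hj, fun h => by have := hmin _ h; omega⟩

/-- The hypotheses on the functions in the dual form of the square function estimate. -/
structure GlobalHyp (N : Finset ℤ) (f g : ℝ → ℂ) (h : ℤ → ℝ → ℂ) (v : ℝ → ℝ) (s₁ s₂ s₃ : ℝ) :
    Prop where
  int_f_rpow : Integrable fun t => ‖f t‖ ^ s₁
  int_g_rpow : Integrable fun t => ‖g t‖ ^ s₂
  int_h : ∀ n ∈ N, Integrable (h n)
  meas_v : Measurable v
  v_nonneg : ∀ x, 0 ≤ v x
  int_v : Integrable v
  int_v_rpow : Integrable fun x => v x ^ s₃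
  sq_le : ∀ x, ∑ n ∈ N, ‖h n x‖ ^ 2 ≤ v x ^ 2
  one_lt_f : 1 < s₁
  le_two_f : s₁ ≤ 2
  one_lt_g : 1 < s₂
  le_two_g : s₂ ≤ 2
  one_lt_v : 1 < s₃
  le_two_v : s₃ ≤ 2
  sum_lt : 1 / s₁ + 1 / s₂ + 1 / s₃ < 2

variable {J : Finset (ℤ × ℤ)} {N : Finset ℤ} {h : ℤ → ℝ → ℂ} {v : ℝ → ℝ} {s₁ s₂ s₃ : ℝ}

lemma AvgLE.smul_rpow {n m : ℤ} {u : ℝ → ℝ} (hu : ∀ t, 0 ≤ u t) {a s : ℝ} (ha : 0 < a)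
    (h : AvgLE n m (fun t => u t ^ s) (a ^ s)) : AvgLE n m (fun t => (a⁻¹ * u t) ^ s) 1 :=
  fun x y hx hy => by
    simp_rw [Real.mul_rpow (inv_pos.2 ha).le (hu _)]
    rw [integral_const_mul, Real.inv_rpow ha.le, inv_mul_le_iff₀ (by positivity), one_mul]
    exact h x y hx hy

lemma bt_smul (Θ : ℝ → ℂ) (l : ℝ) (a b : ℂ) (f g : ℝ → ℂ) (x : ℝ) :
    bt Θ l (fun t => a * f t) (fun t => b * g t) x = a * b * bt Θ l f g x := by
  simp only [bt]
  rw [← integral_const_mul]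
  congr 1; ext y; ring

variable {f g Θ : 𝓢(ℝ, ℂ)}

/-- The local estimate at arbitrary levels. -/
lemma norm_sum_bt_level_le (hΘ : ∀ ξ, 𝓕 (Θ : ℝ → ℂ) ξ ≠ 0 → 16 ≤ |ξ| ∧ |ξ| ≤ 64)
    (H : GlobalHyp N f g h v s₁ s₂ s₃) {n₀ m₀ : ℤ} (hsub : ∀ p ∈ J, dya p.1 p.2 ⊆ dya n₀ m₀)
    (hmem : ∀ p ∈ J, p.1 ∈ N) {a b c : ℝ} (ha : 0 < a) (hb : 0 < b) (hc : 0 < c)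
    (hf : ∀ p ∈ J, AvgLE p.1 p.2 (fun t => ‖f t‖ ^ s₁) (a ^ s₁))
    (hg : ∀ p ∈ J, AvgLE p.1 p.2 (fun t => ‖g t‖ ^ s₂) (b ^ s₂))
    (hv : ∀ p ∈ J, AvgLE p.1 p.2 (fun t => v t ^ s₃) (c ^ s₃)) :
    ‖∑ p ∈ J, ∫ x in dya p.1 p.2, bt Θ (2 ^ p.1) f g x * h p.1 x‖ ≤
      cB s₁ s₂ s₃ * qn Θ * (a * b * c) * 2 ^ n₀ := by
  have e1 : ⇑(((a⁻¹ : ℝ) : ℂ) • f) = fun t => ((a⁻¹ : ℝ) : ℂ) * f t := rfl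
  have e2 : ⇑(((b⁻¹ : ℝ) : ℂ) • g) = fun t => ((b⁻¹ : ℝ) : ℂ) * g t := rfl
  have n1 : ∀ t, ‖((a⁻¹ : ℝ) : ℂ) * f t‖ = a⁻¹ * ‖f t‖ := fun t => by
    rw [norm_mul, Complex.norm_real, Real.norm_of_nonneg (by positivity)]
  have n2 : ∀ t, ‖((b⁻¹ : ℝ) : ℂ) * g t‖ = b⁻¹ * ‖g t‖ := fun t => by
    rw [norm_mul, Complex.norm_real, Real.norm_of_nonneg (by positivity)]
  have n3 : ∀ n t, ‖((c⁻¹ : ℝ) : ℂ) * h n t‖ = c⁻¹ * ‖h n t‖ := fun n t => by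
    rw [norm_mul, Complex.norm_real, Real.norm_of_nonneg (by positivity)]
  have key := norm_sum_bt_le (f := ((a⁻¹ : ℝ) : ℂ) • f) (g := ((b⁻¹ : ℝ) : ℂ) • g)
    (J := J) (n₀ := n₀) (m₀ := m₀) (N := N) (h := fun n t => ((c⁻¹ : ℝ) : ℂ) * h n t)
    (v := fun t => c⁻¹ * v t) (s₁ := s₁) (s₂ := s₂) (s₃ := s₃) hΘ
    { sub := hsub
      mem := hmem
      avg_f := fun p hp => by
        simp only [e1, n1]; exact (hf p hp).smul_rpow (fun t => norm_nonneg _) ha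
      avg_g := fun p hp => by
        simp only [e2, n2]; exact (hg p hp).smul_rpow (fun t => norm_nonneg _) hb
      avg_v := fun p hp => (hv p hp).smul_rpow H.v_nonneg hc
      int_f := SchwartzMap.integrable _
      int_g := SchwartzMap.integrable _
      int_f_rpow := by
        simp only [e1, n1, Real.mul_rpow (inv_pos.2 ha).le (norm_nonneg _)]
        exact H.int_f_rpow.const_mul _
      int_g_rpow := by
        simp only [e2, n2, Real.mul_rpow (inv_pos.2 hb).le (norm_nonneg _)]
        exact H.int_g_rpow.const_mul _
      int_h := fun n hn => (H.int_h n hn).const_mul _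
      meas_v := H.meas_v.const_mul _
      v_nonneg := fun x => mul_nonneg (inv_pos.2 hc).le (H.v_nonneg x)
      int_v := H.int_v.const_mul _
      int_v_rpow := by
        simp only [Real.mul_rpow (inv_pos.2 hc).le (H.v_nonneg _)]
        exact H.int_v_rpow.const_mul _
      sq_le := fun x => by
        simp only [n3, mul_pow]
        rw [← Finset.mul_sum]
        exact mul_le_mul_of_nonneg_left (H.sq_le x) (by positivity)
      one_lt_f := H.one_lt_f
      le_two_f := H.le_two_f
      one_lt_g := H.one_lt_g
      le_two_g := H.le_two_g
      one_lt_v := H.one_lt_v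
      le_two_v := H.le_two_v
      sum_lt := H.sum_lt }
  have e : ∑ p ∈ J, ∫ x in dya p.1 p.2, bt Θ (2 ^ p.1) f g x * h p.1 x =
      ((a * b * c : ℝ) : ℂ) * ∑ p ∈ J, ∫ x in dya p.1 p.2,
        bt Θ (2 ^ p.1) (((a⁻¹ : ℝ) : ℂ) • f : 𝓢(ℝ, ℂ)) (((b⁻¹ : ℝ) : ℂ) • g : 𝓢(ℝ, ℂ)) x *
          (((c⁻¹ : ℝ) : ℂ) * h p.1 x) := by
    rw [Finset.mul_sum]
    refine Finset.sum_congr rfl fun p _ => ?_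
    rw [← integral_const_mul]
    congr 1; ext x
    rw [e1, e2, bt_smul]
    have h1 : (a : ℂ) ≠ 0 := by exact_mod_cast ha.ne'
    have h2 : (b : ℂ) ≠ 0 := by exact_mod_cast hb.ne'
    have h3 : (c : ℂ) ≠ 0 := by exact_mod_cast hc.ne'
    push_cast
    field_simp
  rw [e, norm_mul, Complex.norm_real, Real.norm_of_nonneg (by positivity)]
  calc _ ≤ (a * b * c) * (cB s₁ s₂ s₃ * qn Θ * 2 ^ n₀) := by gcongr
    _ = _ := by ring

/-- The union of the dyadic intervals in `J`. -/
def shadow (J : Finset (ℤ × ℤ)) : Set ℝ := ⋃ p ∈ J, dya p.1 p.2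

lemma mem_shadow {x : ℝ} : x ∈ shadow J ↔ ∃ p ∈ J, x ∈ dya p.1 p.2 := by simp [shadow]

lemma measurableSet_shadow (J : Finset (ℤ × ℤ)) : MeasurableSet (shadow J) :=
  Finset.measurableSet_biUnion _ fun p _ => measurableSet_dya p.1 p.2

lemma volume_shadow_ne_top (J : Finset (ℤ × ℤ)) : volume (shadow J) ≠ ∞ := by
  refine ((measure_biUnion_finset_le _ _).trans_lt ?_).ne
  simp [ENNReal.sum_lt_top, volume_dya]

lemma shadow_mono {J J' : Finset (ℤ × ℤ)} (h : J ⊆ J') : shadow J ⊆ shadow J' :=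
  biUnion_subset_biUnion_left h

/-- Each finite collection of dyadic intervals is governed by its maximal elements. -/
lemma exists_top (J : Finset (ℤ × ℤ)) : ∃ T : ℤ × ℤ → ℤ × ℤ,
    (∀ p ∈ J, T p ∈ J ∧ dya p.1 p.2 ⊆ dya (T p).1 (T p).2) ∧
    ∀ p ∈ J, ∀ q ∈ J, T p ≠ T q → Disjoint (dya (T p).1 (T p).2) (dya (T q).1 (T q).2) := by
  classical
  have hex : ∀ p ∈ J, ∃ q ∈ J, dya p.1 p.2 ⊆ dya q.1 q.2 ∧
      ∀ r ∈ J, dya p.1 p.2 ⊆ dya r.1 r.2 → r.1 ≤ q.1 := fun p hp => by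
    obtain ⟨q, hq, hmax⟩ := (J.filter fun q => dya p.1 p.2 ⊆ dya q.1 q.2).exists_max_image
      (fun q => q.1) ⟨p, by simp [hp]⟩
    rw [Finset.mem_filter] at hq
    exact ⟨q, hq.1, hq.2, fun r hr h => hmax r (by simp [hr, h])⟩
  choose! T hT hsub hmax using hex
  refine ⟨T, fun p hp => ⟨hT p hp, hsub p hp⟩, fun p hp q hq hne => ?_⟩
  by_contra hd
  obtain ⟨x, hx, hx'⟩ := Set.not_disjoint_iff.1 hd
  have hle : ∀ p ∈ J, ∀ q ∈ J, x ∈ dya (T p).1 (T p).2 → x ∈ dya (T q).1 (T q).2 →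
      (T q).1 ≤ (T p).1 := fun p hp q hq hx hx' => by
    by_contra! hlt
    exact absurd (hmax p hp (T q) (hT q hq)
      ((hsub p hp).trans (dya_subset_of_le hlt.le hx' hx))) (not_le.2 hlt)
  have h1 := (hle p hp q hq hx hx').antisymm (hle q hq p hp hx' hx)
  refine hne (Prod.ext h1.symm ?_)
  rw [mem_dya] at hx hx'
  rw [← hx, ← hx', h1]

/-- The estimate for a collection of intervals on which all levels are bounded. -/
lemma norm_sum_bt_shadow_le (hΘ : ∀ ξ, 𝓕 (Θ : ℝ → ℂ) ξ ≠ 0 → 16 ≤ |ξ| ∧ |ξ| ≤ 64)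
    (H : GlobalHyp N f g h v s₁ s₂ s₃) (hmem : ∀ p ∈ J, p.1 ∈ N) {a b c : ℝ}
    (ha : 0 < a) (hb : 0 < b) (hc : 0 < c)
    (hf : ∀ p ∈ J, AvgLE p.1 p.2 (fun t => ‖f t‖ ^ s₁) (a ^ s₁))
    (hg : ∀ p ∈ J, AvgLE p.1 p.2 (fun t => ‖g t‖ ^ s₂) (b ^ s₂))
    (hv : ∀ p ∈ J, AvgLE p.1 p.2 (fun t => v t ^ s₃) (c ^ s₃)) :
    ‖∑ p ∈ J, ∫ x in dya p.1 p.2, bt Θ (2 ^ p.1) f g x * h p.1 x‖ₑ ≤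
      ENNReal.ofReal (cB s₁ s₂ s₃ * qn Θ * (a * b * c)) * volume (shadow J) := by
  classical
  obtain ⟨T, hT, hdisj⟩ := exists_top J
  rw [← Finset.sum_fiberwise_of_maps_to (t := J.image T) fun p hp => Finset.mem_image_of_mem T hp]
  have hq0 : 0 ≤ cB s₁ s₂ s₃ * qn Θ * (a * b * c) := by
    have h1 := qn_nonneg Θ
    have h2 : 0 ≤ cB s₁ s₂ s₃ := by
      have := cL_nonneg (B := 10) H.sum_lt
      have := cK_pos
      unfold cB; positivity
    positivity
  calc _ ≤ ∑ q ∈ J.image T, ENNReal.ofReal (cB s₁ s₂ s₃ * qn Θ * (a * b * c) * 2 ^ q.1) := by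
        refine (enorm_sum_le _ _).trans (Finset.sum_le_sum fun q hq => ?_)
        rw [← ofReal_norm]
        refine ENNReal.ofReal_le_ofReal (norm_sum_bt_level_le hΘ H (m₀ := q.2) (fun p hp => ?_)
          (fun p hp => ?_) ha hb hc (fun p hp => ?_) (fun p hp => ?_) fun p hp => ?_)
        all_goals obtain ⟨hpJ, rfl⟩ := Finset.mem_filter.1 hp
        exacts [(hT p hpJ).2, hmem p hpJ, hf p hpJ, hg p hpJ, hv p hpJ]
    _ = ENNReal.ofReal (cB s₁ s₂ s₃ * qn Θ * (a * b * c)) *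
          ∑ q ∈ J.image T, volume (dya q.1 q.2) := by
        rw [Finset.mul_sum]
        refine Finset.sum_congr rfl fun q _ => ?_
        rw [volume_dya, ENNReal.ofReal_mul hq0]
    _ = ENNReal.ofReal (cB s₁ s₂ s₃ * qn Θ * (a * b * c)) *
          volume (⋃ q ∈ J.image T, dya q.1 q.2) := by
        rw [measure_biUnion_finset _ fun q _ => measurableSet_dya q.1 q.2]
        intro q hq q' hq' hne
        obtain ⟨p, hp, rfl⟩ := Finset.mem_image.1 (Finset.mem_coe.1 hq)
        obtain ⟨p', hp', rfl⟩ := Finset.mem_image.1 (Finset.mem_coe.1 hq')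
        exact hdisj p hp p' hp' hne
    _ ≤ _ := by
        gcongr
        refine shadow_mono fun q hq => ?_
        obtain ⟨p, hp, rfl⟩ := Finset.mem_image.1 hq
        exact (hT p hp).1

end

section

lemma ofReal_two_zpow (j : ℤ) : ENNReal.ofReal ((2 : ℝ) ^ j) = 2 ^ (j : ℝ) := by
  rw [← Real.rpow_intCast, ← ENNReal.ofReal_rpow_of_pos two_pos, ENNReal.ofReal_ofNat]

/-- A sum of dyadic levels is dominated by any quantity which exceeds them. -/
lemma sum_two_rpow_le {θ : ℝ} (hθ : 0 < θ) {Y : ℝ≥0∞} (s : Finset ℤ)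
    (h : ∀ j ∈ s, (2 : ℝ≥0∞) ^ ((j - 1 : ℤ) : ℝ) < Y) :
    ∑ j ∈ s, (2 : ℝ≥0∞) ^ (j * θ : ℝ) ≤ 2 ^ θ * cG θ * Y ^ θ := by
  calc ∑ j ∈ s, (2 : ℝ≥0∞) ^ (j * θ : ℝ)
      ≤ ∑ j ∈ s, 2 ^ θ * (if (2 : ℝ≥0∞) ^ ((j - 1 : ℤ) : ℝ) < Y then
          (2 : ℝ≥0∞) ^ (((j - 1 : ℤ) : ℝ) * θ) else 0) := by
        refine Finset.sum_le_sum fun j hj => ?_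
        rw [if_pos (h j hj), ← ENNReal.rpow_add _ _ (by norm_num) (by norm_num)]
        refine le_of_eq (congrArg _ ?_)
        push_cast; ring
    _ ≤ ∑' j : ℤ, 2 ^ θ * (if (2 : ℝ≥0∞) ^ ((j - 1 : ℤ) : ℝ) < Y then
          (2 : ℝ≥0∞) ^ (((j - 1 : ℤ) : ℝ) * θ) else 0) := ENNReal.sum_le_tsum s
    _ = 2 ^ θ * ∑' j : ℤ, (if (2 : ℝ≥0∞) ^ (j : ℝ) < Y then (2 : ℝ≥0∞) ^ ((j : ℝ) * θ) else 0) := by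
        rw [ENNReal.tsum_mul_left, ← (Equiv.subRight (1 : ℤ)).tsum_eq
          fun j : ℤ => if (2 : ℝ≥0∞) ^ (j : ℝ) < Y then (2 : ℝ≥0∞) ^ ((j : ℝ) * θ) else 0]
        rfl
    _ ≤ _ := by
        rw [mul_assoc]
        gcongr
        exact tsum_two_rpow_lt_le hθ Y

/-- The maximal function of order `s`. -/
noncomputable def Ms (s : ℝ) (u : ℝ → ℝ≥0∞) (x : ℝ) : ℝ≥0∞ := Mx (fun t => u t ^ s) x ^ (1 / s)

lemma measurable_Ms (s : ℝ) (u : ℝ → ℝ≥0∞) : Measurable (Ms s u) :=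
  (measurable_Mx _).pow_const _

lemma lt_Ms_of_not_avgLE {n m j : ℤ} {u : ℝ → ℝ} {s : ℝ} (hs : 0 < s) (hu0 : ∀ t, 0 ≤ u t)
    (hu : Integrable fun t => u t ^ s) (h : ¬ AvgLE n m (fun t => u t ^ s) (((2 : ℝ) ^ j) ^ s))
    {x : ℝ} (hx : x ∈ dya n m) : (2 : ℝ≥0∞) ^ (j : ℝ) < Ms s (fun t => ENNReal.ofReal (u t)) x := by
  have h1 := lt_Mx_of_not_avgLE (by positivity) (fun t => Real.rpow_nonneg (hu0 t) s) hu h hx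
  rw [← ENNReal.ofReal_rpow_of_nonneg (by positivity) hs.le, ofReal_two_zpow] at h1
  rw [Ms, one_div, ← ENNReal.rpow_lt_rpow_iff hs, ENNReal.rpow_inv_rpow hs.ne']
  refine h1.trans_le (le_of_eq ?_)
  congr 1; ext t
  rw [ENNReal.ofReal_rpow_of_nonneg (hu0 t) hs.le]

variable {J : Finset (ℤ × ℤ)} {N : Finset ℤ} {h : ℤ → ℝ → ℂ} {v : ℝ → ℝ} {s₁ s₂ s₃ : ℝ}
variable {f g Θ : 𝓢(ℝ, ℂ)}

lemma GlobalHyp.cB_nonneg {f g : ℝ → ℂ} (H : GlobalHyp N f g h v s₁ s₂ s₃) : 0 ≤ cB s₁ s₂ s₃ := by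
  have := cL_nonneg (B := 10) H.sum_lt
  have := cK_pos
  unfold cB; positivity

/-- The dual estimate for a collection of intervals on which two levels are bounded. -/
lemma enorm_sum_bt_shadow_le (hΘ : ∀ ξ, 𝓕 (Θ : ℝ → ℂ) ξ ≠ 0 → 16 ≤ |ξ| ∧ |ξ| ≤ 64)
    (H : GlobalHyp N f g h v s₁ s₂ s₃) (hmem : ∀ p ∈ J, p.1 ∈ N) {j l : ℤ}
    (hf : ∀ p ∈ J, AvgLE p.1 p.2 (fun t => ‖f t‖ ^ s₁) (((2 : ℝ) ^ j) ^ s₁))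
    (hg : ∀ p ∈ J, AvgLE p.1 p.2 (fun t => ‖g t‖ ^ s₂) (((2 : ℝ) ^ l) ^ s₂)) :
    ‖∑ p ∈ J, ∫ x in dya p.1 p.2, bt Θ (2 ^ p.1) f g x * h p.1 x‖ₑ ≤
      ENNReal.ofReal (cB s₁ s₂ s₃ * qn Θ) * (2 * cG 1) * (2 ^ ((j + l : ℤ) : ℝ) *
        ∫⁻ x in shadow J, Ms s₃ (fun t => ENNReal.ofReal (v t)) x) := by
  classical
  have hs0 : 0 < s₃ := one_pos.trans H.one_lt_v
  have hcB := H.cB_nonneg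
  have hqn := qn_nonneg Θ
  have hv0 : ∀ t, 0 ≤ v t ^ s₃ := fun t => Real.rpow_nonneg (H.v_nonneg t) _
  have hI : 0 ≤ ∫ t, v t ^ s₃ := integral_nonneg hv0
  rcases hI.eq_or_lt with hz | hpos
  · have hz' := (integral_eq_zero_iff_of_nonneg hv0 H.int_v_rpow).1 hz.symm
    have : ∑ p ∈ J, ∫ x in dya p.1 p.2, bt Θ (2 ^ p.1) f g x * h p.1 x = 0 := by
      refine Finset.sum_eq_zero fun p hp => ?_
      rw [setIntegral_eq_zero_of_ae_eq_zero]
      filter_upwards [hz'] with x hx _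
      have h1 : v x = 0 := (Real.rpow_eq_zero (H.v_nonneg x) hs0.ne').1 hx
      have h2 := (Finset.single_le_sum (f := fun n => ‖h n x‖ ^ 2) (fun n _ => by positivity)
        (hmem p hp)).trans (H.sq_le x)
      rw [h1] at h2
      have h3 : h p.1 x = 0 := by
        rw [← norm_eq_zero]
        nlinarith [norm_nonneg (h p.1 x)]
      rw [h3, mul_zero]
    rw [this]
    simp
  choose lev hlev hlev' using fun p : ℤ × ℤ =>
    exists_avgLE_level hv0 H.int_v_rpow hpos hs0 p.1 p.2
  rw [← Finset.sum_fiberwise_of_maps_to (t := J.image lev)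
    fun p hp => Finset.mem_image_of_mem lev hp]
  have hmeas : ∀ m, MeasurableSet (shadow (J.filter fun p => lev p = m)) := fun m =>
    measurableSet_shadow _
  calc _ ≤ ∑ m ∈ J.image lev, ENNReal.ofReal (cB s₁ s₂ s₃ * qn Θ) * 2 ^ ((j + l : ℤ) : ℝ) *
        ∫⁻ x, 2 ^ (m : ℝ) * (shadow (J.filter fun p => lev p = m)).indicator 1 x := by
        refine (enorm_sum_le _ _).trans (Finset.sum_le_sum fun m hm => ?_)
        refine (norm_sum_bt_shadow_le (a := 2 ^ j) (b := 2 ^ l) (c := 2 ^ m) hΘ H ?_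
          (by positivity) (by positivity) (by positivity) ?_ ?_ ?_).trans (le_of_eq ?_)
        · exact fun p hp => hmem p (Finset.mem_filter.1 hp).1
        · exact fun p hp => hf p (Finset.mem_filter.1 hp).1
        · exact fun p hp => hg p (Finset.mem_filter.1 hp).1
        · intro p hp
          obtain ⟨-, rfl⟩ := Finset.mem_filter.1 hp
          exact hlev p
        · rw [lintegral_const_mul' _ _ (two_rpow_ne_top _), lintegral_indicator_one (hmeas m),
            ENNReal.ofReal_mul (mul_nonneg hcB hqn), ← zpow_add₀ two_ne_zero,
            ENNReal.ofReal_mul (by positivity : (0 : ℝ) ≤ 2 ^ (j + l)), ofReal_two_zpow,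
            ofReal_two_zpow]
          ring
    _ = ENNReal.ofReal (cB s₁ s₂ s₃ * qn Θ) * 2 ^ ((j + l : ℤ) : ℝ) *
        ∫⁻ x, ∑ m ∈ J.image lev,
          2 ^ (m : ℝ) * (shadow (J.filter fun p => lev p = m)).indicator 1 x := by
        rw [← Finset.mul_sum, lintegral_finsetSum]
        exact fun m _ => (measurable_one.indicator (hmeas m)).const_mul _
    _ ≤ ENNReal.ofReal (cB s₁ s₂ s₃ * qn Θ) * 2 ^ ((j + l : ℤ) : ℝ) *
        ∫⁻ x, (shadow J).indicator
          (fun x => 2 * cG 1 * Ms s₃ (fun t => ENNReal.ofReal (v t)) x) x := by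
        gcongr with x
        by_cases hx : x ∈ shadow J
        · rw [indicator_of_mem hx]
          have := sum_two_rpow_le one_pos (Y := Ms s₃ (fun t => ENNReal.ofReal (v t)) x)
            ((J.image lev).filter fun m => x ∈ shadow (J.filter fun p => lev p = m))
            fun m hm => by
              obtain ⟨p, hp, hpx⟩ := mem_shadow.1 (Finset.mem_filter.1 hm).2
              obtain ⟨-, rfl⟩ := Finset.mem_filter.1 hp
              exact lt_Ms_of_not_avgLE hs0 H.v_nonneg H.int_v_rpow (hlev' p) hpx
          simp only [ENNReal.rpow_one, mul_one] at this
          refine le_trans (le_of_eq ?_) this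
          rw [Finset.sum_filter]
          refine Finset.sum_congr rfl fun m _ => ?_
          rw [indicator_apply]
          split_ifs <;> simp
        · rw [indicator_of_notMem hx]
          refine le_of_eq (Finset.sum_eq_zero fun m _ => ?_)
          rw [indicator_of_notMem, mul_zero]
          exact fun h => hx (shadow_mono (Finset.filter_subset _ _) h)
    _ = _ := by
        rw [lintegral_indicator (measurableSet_shadow J),
          lintegral_const_mul _ (measurable_Ms _ _)]
        ring

/-- The dual estimate for a collection of intervals with prescribed levels. -/
lemma enorm_sum_bt_le_lintegral (hΘ : ∀ ξ, 𝓕 (Θ : ℝ → ℂ) ξ ≠ 0 → 16 ≤ |ξ| ∧ |ξ| ≤ 64)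
    (H : GlobalHyp N f g h v s₁ s₂ s₃) (hmem : ∀ p ∈ J, p.1 ∈ N) {cl : ℤ × ℤ → ℤ × ℤ}
    (hf : ∀ p ∈ J, AvgLE p.1 p.2 (fun t => ‖f t‖ ^ s₁) (((2 : ℝ) ^ (cl p).1) ^ s₁))
    (hg : ∀ p ∈ J, AvgLE p.1 p.2 (fun t => ‖g t‖ ^ s₂) (((2 : ℝ) ^ (cl p).2) ^ s₂))
    {F : ℝ → ℝ≥0∞} (hF : ∀ x, ∑ c ∈ J.image cl, (shadow (J.filter fun p => cl p = c)).indicator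
      (fun _ => (2 : ℝ≥0∞) ^ ((c.1 + c.2 : ℤ) : ℝ)) x ≤ F x) :
    ‖∑ p ∈ J, ∫ x in dya p.1 p.2, bt Θ (2 ^ p.1) f g x * h p.1 x‖ₑ ≤
      ENNReal.ofReal (cB s₁ s₂ s₃ * qn Θ) * (2 * cG 1) *
        ∫⁻ x, F x * Ms s₃ (fun t => ENNReal.ofReal (v t)) x := by
  classical
  rw [← Finset.sum_fiberwise_of_maps_to (t := J.image cl)
    fun p hp => Finset.mem_image_of_mem cl hp]
  have hmeas : ∀ m, MeasurableSet (shadow (J.filter fun p => cl p = m)) := fun m =>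
    measurableSet_shadow _
  calc _ ≤ ∑ c ∈ J.image cl, ENNReal.ofReal (cB s₁ s₂ s₃ * qn Θ) * (2 * cG 1) *
        ∫⁻ x, (shadow (J.filter fun p => cl p = c)).indicator
          (fun _ => (2 : ℝ≥0∞) ^ ((c.1 + c.2 : ℤ) : ℝ)) x *
            Ms s₃ (fun t => ENNReal.ofReal (v t)) x := by
        refine (enorm_sum_le _ _).trans (Finset.sum_le_sum fun c hc => ?_)
        refine (enorm_sum_bt_shadow_le (j := c.1) (l := c.2) hΘ H ?_ ?_ ?_).trans (le_of_eq ?_)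
        · exact fun p hp => hmem p (Finset.mem_filter.1 hp).1
        · intro p hp
          obtain ⟨hpJ, rfl⟩ := Finset.mem_filter.1 hp
          exact hf p hpJ
        · intro p hp
          obtain ⟨hpJ, rfl⟩ := Finset.mem_filter.1 hp
          exact hg p hpJ
        · congr 1
          rw [← lintegral_const_mul' _ _ (two_rpow_ne_top _), ← lintegral_indicator (hmeas c)]
          congr 1; ext x
          simp only [indicator_apply, ite_mul, zero_mul]
    _ ≤ _ := by
        rw [← Finset.mul_sum, ← lintegral_finsetSum]
        · gcongr with x
          rw [← Finset.sum_mul]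
          gcongr
          exact hF x
        · exact fun c _ => (measurable_const.indicator (hmeas c)).mul (measurable_Ms _ _)

end

section

variable {J : Finset (ℤ × ℤ)}

lemma sum_indicator_dya {M : Type*} [AddCommMonoid M] (J : Finset (ℤ × ℤ)) (φ : ℤ → ℝ → M) (x : ℝ) :
    ∑ p ∈ J, (dya p.1 p.2).indicator (φ p.1) x =
      ∑ n ∈ J.image Prod.fst, if (n, ⌊x / (2 : ℝ) ^ n⌋) ∈ J then φ n x else 0 := by
  classical
  simp only [indicator_apply]
  rw [← Finset.sum_filter, ← Finset.sum_filter]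
  refine Finset.sum_nbij Prod.fst (fun p hp => ?_) (fun p hp q hq h => ?_) (fun n hn => ?_)
    fun p _ => rfl
  · obtain ⟨hp, hx⟩ := Finset.mem_filter.1 hp
    rw [Finset.mem_filter, mem_dya.1 hx]
    exact ⟨Finset.mem_image_of_mem _ hp, hp⟩
  · have h1 := mem_dya.1 (Finset.mem_filter.1 (Finset.mem_coe.1 hp)).2
    have h2 := mem_dya.1 (Finset.mem_filter.1 (Finset.mem_coe.1 hq)).2
    exact Prod.ext h (by rw [← h1, ← h2, h])
  · have h1 := (Finset.mem_filter.1 (Finset.mem_coe.1 hn)).2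
    exact ⟨(n, ⌊x / (2 : ℝ) ^ n⌋), by simp [h1, mem_dya], rfl⟩

/-- The square of the square function of the restrictions of `a` to the intervals in `J`. -/
noncomputable def sqJ (J : Finset (ℤ × ℤ)) (a : ℤ → ℝ → ℂ) (x : ℝ) : ℝ :=
  ∑ p ∈ J, (dya p.1 p.2).indicator (fun x => ‖a p.1 x‖ ^ 2) x

lemma sqJ_nonneg (J : Finset (ℤ × ℤ)) (a : ℤ → ℝ → ℂ) (x : ℝ) : 0 ≤ sqJ J a x :=
  Finset.sum_nonneg fun p _ => indicator_nonneg (fun x _ => by positivity) x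

lemma sqJ_eq (J : Finset (ℤ × ℤ)) (a : ℤ → ℝ → ℂ) (x : ℝ) : sqJ J a x =
    ∑ n ∈ J.image Prod.fst, if (n, ⌊x / (2 : ℝ) ^ n⌋) ∈ J then ‖a n x‖ ^ 2 else 0 :=
  sum_indicator_dya J (fun n x => ‖a n x‖ ^ 2) x

lemma sqJ_of_notMem {a : ℤ → ℝ → ℂ} {x : ℝ} (h : x ∉ shadow J) : sqJ J a x = 0 :=
  Finset.sum_eq_zero fun _ hp => indicator_of_notMem (fun hx => h (mem_shadow.2 ⟨_, hp, hx⟩)) _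

lemma measurable_sqJ {a : ℤ → ℝ → ℂ} (ha : ∀ n, Measurable (a n)) : Measurable (sqJ J a) :=
  Finset.measurable_fun_sum _ fun p _ => ((ha p.1).norm.pow_const 2).indicator (measurableSet_dya _ _)

lemma exists_sqJ_le {a : ℤ → ℝ → ℂ} (ha : ∀ n, ∃ C, ∀ x, ‖a n x‖ ≤ C) :
    ∃ C, 0 ≤ C ∧ ∀ x, sqJ J a x ≤ C := by
  choose C hC using ha
  refine ⟨∑ p ∈ J, C p.1 ^ 2, Finset.sum_nonneg fun _ _ => sq_nonneg _, fun x =>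
    Finset.sum_le_sum fun p _ => indicator_le_self' (fun _ _ => by positivity) x |>.trans ?_⟩
  exact pow_le_pow_left₀ (norm_nonneg _) (hC p.1 x) 2

lemma integrable_of_shadow {E : Type*} [NormedAddCommGroup E] {u : ℝ → E}
    (hm : AEStronglyMeasurable u) {C : ℝ} (hC : ∀ x, ‖u x‖ ≤ C)
    (hu : ∀ x, x ∉ shadow J → u x = 0) : Integrable u := by
  rw [← integrableOn_iff_integrable_of_support_subset (s := shadow J) fun x hx => by
    by_contra h; exact hx (hu x h)]
  exact Measure.integrableOn_of_bounded (volume_shadow_ne_top J) hm (ae_of_all _ hC)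

lemma integrable_sqJ_rpow {a : ℤ → ℝ → ℂ} (ham : ∀ n, Measurable (a n))
    (ha : ∀ n, ∃ C, ∀ x, ‖a n x‖ ≤ C) {t : ℝ} (ht : 0 < t) :
    Integrable fun x => sqJ J a x ^ t := by
  obtain ⟨C, hC0, hC⟩ := exists_sqJ_le (J := J) ha
  refine integrable_of_shadow (J := J) ((measurable_sqJ ham).pow_const t).aestronglyMeasurable
    (C := C ^ t) (fun x => ?_) fun x hx => by rw [sqJ_of_notMem hx, Real.zero_rpow ht.ne']
  rw [Real.norm_of_nonneg (Real.rpow_nonneg (sqJ_nonneg _ _ _) _)]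
  exact Real.rpow_le_rpow (sqJ_nonneg _ _ _) (hC x) ht.le

open Classical in
/-- The functions dual to the square function over `J` with exponent `w`. -/
noncomputable def dualFun (J : Finset (ℤ × ℤ)) (a : ℤ → ℝ → ℂ) (w : ℝ) (n : ℤ) (x : ℝ) : ℂ :=
  if (n, ⌊x / (2 : ℝ) ^ n⌋) ∈ J then
    starRingEnd ℂ (a n x) * ((sqJ J a x ^ ((w - 2) / 2) : ℝ) : ℂ) else 0

variable {a : ℤ → ℝ → ℂ} {w : ℝ}

lemma sum_norm_dualFun_sq (hw : 2 ≤ w) (x : ℝ) :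
    ∑ n ∈ J.image Prod.fst, ‖dualFun J a w n x‖ ^ 2 = (sqJ J a x ^ ((w - 1) / 2)) ^ 2 := by
  have h0 := sqJ_nonneg J a x
  have e : ∀ n, ‖dualFun J a w n x‖ ^ 2 =
      (if (n, ⌊x / (2 : ℝ) ^ n⌋) ∈ J then ‖a n x‖ ^ 2 else 0) * sqJ J a x ^ (w - 2) := fun n => by
    rw [dualFun]
    split_ifs
    · rw [norm_mul, RCLike.norm_conj, Complex.norm_real, Real.norm_of_nonneg (by positivity), mul_pow,
        ← Real.rpow_mul_natCast h0]
      congr 2; push_cast; ring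
    · simp
  simp_rw [e]
  rw [← Finset.sum_mul, ← sqJ_eq, ← Real.rpow_mul_natCast h0]
  nth_rw 1 [← Real.rpow_one (sqJ J a x)]
  rw [← Real.rpow_add_of_nonneg h0 zero_le_one (by linarith)]
  congr 1; push_cast; ring

lemma integrable_dualFun (ham : ∀ n, Measurable (a n)) (ha : ∀ n, ∃ C, ∀ x, ‖a n x‖ ≤ C)
    (hw : 2 ≤ w) (n : ℤ) : Integrable (dualFun J a w n) := by
  classical
  obtain ⟨C, hC0, hC⟩ := exists_sqJ_le (J := J) ha
  obtain ⟨D, hD⟩ := ha n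
  have hD0 : 0 ≤ D := (norm_nonneg _).trans (hD 0)
  refine integrable_of_shadow (J := J) (Measurable.aestronglyMeasurable ?_)
    (C := D * C ^ ((w - 2) / 2)) (fun x => ?_) fun x hx => ?_
  · refine Measurable.ite ?_ ?_ measurable_const
    · have : Measurable fun x : ℝ => ⌊x / (2 : ℝ) ^ n⌋ := by fun_prop
      exact this (t := {m | (n, m) ∈ J}) (MeasurableSet.of_discrete)
    · have := measurable_sqJ (J := J) ham
      have := ham n
      fun_prop
  · rw [dualFun]
    split_ifs
    · rw [norm_mul, RCLike.norm_conj, Complex.norm_real,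
        Real.norm_of_nonneg (Real.rpow_nonneg (sqJ_nonneg _ _ _) _)]
      exact mul_le_mul (hD x) (Real.rpow_le_rpow (sqJ_nonneg _ _ _) (hC x) (by linarith))
        (Real.rpow_nonneg (sqJ_nonneg _ _ _) _) hD0
    · rw [norm_zero]; positivity
  · rw [dualFun, if_neg]
    exact fun h => hx (mem_shadow.2 ⟨_, h, mem_dya.2 rfl⟩)

lemma sum_integral_dualFun (ham : ∀ n, Measurable (a n)) (ha : ∀ n, ∃ C, ∀ x, ‖a n x‖ ≤ C)
    (hw : 2 ≤ w) : ∑ p ∈ J, ∫ x in dya p.1 p.2, a p.1 x * dualFun J a w p.1 x =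
      ((∫ x, sqJ J a x ^ (w / 2) : ℝ) : ℂ) := by
  classical
  have hi : ∀ n, Integrable fun x => a n x * dualFun J a w n x := fun n => by
    obtain ⟨C, hC⟩ := ha n
    exact (integrable_dualFun ham ha hw n).bdd_mul (ham n).aestronglyMeasurable (ae_of_all _ hC)
  simp_rw [← integral_indicator (measurableSet_dya _ _)]
  rw [← integral_finsetSum _ fun p _ => (hi p.1).indicator (measurableSet_dya _ _),
    ← integral_complex_ofReal]
  congr 1; ext x
  rw [sum_indicator_dya J (fun n x => a n x * dualFun J a w n x)]
  have h0 := sqJ_nonneg J a x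
  have e : ∀ n, (if (n, ⌊x / (2 : ℝ) ^ n⌋) ∈ J then a n x * dualFun J a w n x else 0) =
      (((if (n, ⌊x / (2 : ℝ) ^ n⌋) ∈ J then ‖a n x‖ ^ 2 else 0) * sqJ J a x ^ ((w - 2) / 2) : ℝ) :
        ℂ) := fun n => by
    split_ifs with h
    · rw [dualFun, if_pos h, ← mul_assoc, Complex.mul_conj']
      push_cast; rfl
    · simp
  simp_rw [e]
  rw [← Complex.ofReal_sum, ← Finset.sum_mul, ← sqJ_eq]
  nth_rw 1 [← Real.rpow_one (sqJ J a x)]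
  rw [← Real.rpow_add_of_nonneg h0 zero_le_one (by linarith)]
  congr 2; ring

lemma continuous_bt (Θ f g : 𝓢(ℝ, ℂ)) (l : ℝ) : Continuous (bt Θ l f g) := by
  obtain ⟨C, -, hC⟩ := exists_decay f 0
  obtain ⟨D, -, hD⟩ := exists_decay g 0
  have hf := f.continuous
  have hg := g.continuous
  have hΘ := Θ.continuous
  refine continuous_of_dominated (bound := fun y => C * D * ‖Θ y‖)
    (fun x => Continuous.aestronglyMeasurable (by fun_prop)) (fun x => ae_of_all _ fun y => ?_)
    (Θ.integrable.norm.const_mul _) (ae_of_all _ fun y => by fun_prop)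
  have h1 := hC (x - l * y)
  have h2 := hD (x + l * y)
  rw [pow_zero, one_mul] at h1 h2
  rw [norm_mul, norm_mul]
  gcongr
  exact (norm_nonneg _).trans h1

lemma exists_norm_bt_le (Θ f g : 𝓢(ℝ, ℂ)) (l : ℝ) : ∃ C, ∀ x, ‖bt Θ l f g x‖ ≤ C := by
  obtain ⟨C, -, hC⟩ := exists_decay f 0
  obtain ⟨D, -, hD⟩ := exists_decay g 0
  refine ⟨∫ y, C * D * ‖Θ y‖, fun x => norm_integral_le_of_norm_le
    (Θ.integrable.norm.const_mul _) (ae_of_all _ fun y => ?_)⟩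
  have h1 := hC (x - l * y)
  have h2 := hD (x + l * y)
  rw [pow_zero, one_mul] at h1 h2
  rw [norm_mul, norm_mul]
  gcongr
  exact (norm_nonneg _).trans h1

end

section

/-- Admissible exponents. -/
structure Exps (s₁ s₂ s₃ : ℝ) : Prop where
  one_lt_f : 1 < s₁
  le_two_f : s₁ ≤ 2
  one_lt_g : 1 < s₂
  le_two_g : s₂ ≤ 2
  one_lt_v : 1 < s₃
  le_two_v : s₃ ≤ 2
  sum_lt : 1 / s₁ + 1 / s₂ + 1 / s₃ < 2

lemma integrable_schwartz_rpow (f : 𝓢(ℝ, ℂ)) {s : ℝ} (hs : 0 < s) :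
    Integrable fun t => ‖f t‖ ^ s := by
  have := (f.memLp (ENNReal.ofReal s) volume).integrable_norm_rpow
    (by simpa using hs) ENNReal.ofReal_ne_top
  rwa [ENNReal.toReal_ofReal hs.le] at this

lemma le_rpow_of_le_mul_rpow {X A : ℝ≥0∞} {w w' : ℝ} (hw : w.HolderConjugate w') (hX : X ≠ ∞)
    (h : X ≤ A * X ^ (1 / w')) : X ≤ A ^ w := by
  rcases eq_or_ne X 0 with rfl | h0
  · exact zero_le
  have h1 : X ^ (1 / w) * X ^ (1 / w') ≤ A * X ^ (1 / w') := by
    rw [← ENNReal.rpow_add _ _ h0 hX]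
    have : 1 / w + 1 / w' = 1 := by rw [one_div, one_div]; exact hw.inv_add_inv_eq_one
    rwa [this, ENNReal.rpow_one]
  have h2 : X ^ (1 / w) ≤ A := by
    refine (ENNReal.mul_le_mul_iff_left ?_ ?_).1 h1
    · simp [ENNReal.rpow_eq_zero_iff, h0, hX]
    · exact ENNReal.rpow_ne_top_of_nonneg (by have := hw.symm.pos; positivity) hX
  calc X = (X ^ (1 / w)) ^ w := by rw [one_div, ENNReal.rpow_inv_rpow hw.pos.ne']
    _ ≤ A ^ w := ENNReal.rpow_le_rpow h2 hw.pos.le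

/-- The constant in the square function estimate for exponents at least `2`. -/
noncomputable def cD (s₁ s₂ s₃ w : ℝ) : ℝ≥0∞ :=
  ENNReal.ofReal (cB s₁ s₂ s₃) * (2 * cG 1) * cM (w / (w - 1) / s₃) ^ (1 - 1 / w)

lemma cD_ne_top {s₁ s₂ s₃ w : ℝ} (hw : 2 ≤ w) (hs : 1 < w / (w - 1) / s₃) :
    cD s₁ s₂ s₃ w ≠ ∞ := by
  refine ENNReal.mul_ne_top (ENNReal.mul_ne_top ENNReal.ofReal_ne_top
    (ENNReal.mul_ne_top (by simp) (cG_ne_top one_pos))) (ENNReal.rpow_ne_top_of_nonneg ?_ (cM_ne_top hs))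
  rw [sub_nonneg, div_le_one (by linarith)]
  linarith

variable {J : Finset (ℤ × ℤ)} {s₁ s₂ s₃ w : ℝ} {f g Θ : 𝓢(ℝ, ℂ)}

/-- The square function estimate for exponents at least `2` and prescribed levels. -/
theorem lintegral_sqJ_rpow_le (hΘ : ∀ ξ, 𝓕 (Θ : ℝ → ℂ) ξ ≠ 0 → 16 ≤ |ξ| ∧ |ξ| ≤ 64)
    (E : Exps s₁ s₂ s₃) (hw : 2 ≤ w) (hws : 1 < w / (w - 1) / s₃) {cl : ℤ × ℤ → ℤ × ℤ}
    (hf : ∀ p ∈ J, AvgLE p.1 p.2 (fun t => ‖f t‖ ^ s₁) (((2 : ℝ) ^ (cl p).1) ^ s₁))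
    (hg : ∀ p ∈ J, AvgLE p.1 p.2 (fun t => ‖g t‖ ^ s₂) (((2 : ℝ) ^ (cl p).2) ^ s₂))
    {F : ℝ → ℝ≥0∞} (hFm : Measurable F)
    (hF : ∀ x, ∑ c ∈ J.image cl, (shadow (J.filter fun p => cl p = c)).indicator
      (fun _ => (2 : ℝ≥0∞) ^ ((c.1 + c.2 : ℤ) : ℝ)) x ≤ F x) :
    ∫⁻ x, ENNReal.ofReal (sqJ J (fun n => bt Θ (2 ^ n) f g) x) ^ (w / 2) ≤
      (cD s₁ s₂ s₃ w * ENNReal.ofReal (qn Θ)) ^ w * ∫⁻ x, F x ^ w := by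
  set a : ℤ → ℝ → ℂ := fun n => bt Θ (2 ^ n) f g with ha
  have ham : ∀ n, Measurable (a n) := fun n => (continuous_bt Θ f g _).measurable
  have hab : ∀ n, ∃ C, ∀ x, ‖a n x‖ ≤ C := fun n => exists_norm_bt_le Θ f g _
  set v : ℝ → ℝ := fun x => sqJ J a x ^ ((w - 1) / 2) with hv
  have hs1 := E.one_lt_f
  have hs2 := E.one_lt_g
  have hs3 := E.one_lt_v
  have hvr : ∀ t : ℝ, ∀ x, v x ^ t = sqJ J a x ^ ((w - 1) / 2 * t) := fun t x => by
    rw [hv, ← Real.rpow_mul (sqJ_nonneg _ _ _)]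
  have H : GlobalHyp (J.image Prod.fst) f g (dualFun J a w) v s₁ s₂ s₃ :=
    { int_f_rpow := integrable_schwartz_rpow f (by linarith)
      int_g_rpow := integrable_schwartz_rpow g (by linarith)
      int_h := fun n _ => integrable_dualFun ham hab hw n
      meas_v := (measurable_sqJ ham).pow_const _
      v_nonneg := fun x => Real.rpow_nonneg (sqJ_nonneg _ _ _) _
      int_v := integrable_sqJ_rpow ham hab (by linarith)
      int_v_rpow := by
        simp_rw [hvr]
        exact integrable_sqJ_rpow ham hab (mul_pos (by linarith) (by linarith))
      sq_le := fun x => (sum_norm_dualFun_sq hw x).le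
      one_lt_f := E.one_lt_f
      le_two_f := E.le_two_f
      one_lt_g := E.one_lt_g
      le_two_g := E.le_two_g
      one_lt_v := E.one_lt_v
      le_two_v := E.le_two_v
      sum_lt := E.sum_lt }
  have h1 := enorm_sum_bt_le_lintegral hΘ H (fun p hp => Finset.mem_image_of_mem _ hp) hf hg hF
  have h2 : ∑ p ∈ J, ∫ x in dya p.1 p.2, bt Θ (2 ^ p.1) f g x * dualFun J a w p.1 x =
      ((∫ x, sqJ J a x ^ (w / 2) : ℝ) : ℂ) := sum_integral_dualFun ham hab hw
  have hint : Integrable fun x => sqJ J a x ^ (w / 2) := integrable_sqJ_rpow ham hab (by linarith)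
  have hX : ∫⁻ x, ENNReal.ofReal (sqJ J a x) ^ (w / 2) =
      ENNReal.ofReal (∫ x, sqJ J a x ^ (w / 2)) := by
    rw [ofReal_integral_eq_lintegral_ofReal hint
      (ae_of_all _ fun x => Real.rpow_nonneg (sqJ_nonneg _ _ _) _)]
    congr 1; ext x
    rw [ENNReal.ofReal_rpow_of_nonneg (sqJ_nonneg _ _ _) (by linarith)]
  rw [h2, ← ofReal_norm, Complex.norm_real, Real.norm_of_nonneg
    (integral_nonneg fun x => Real.rpow_nonneg (sqJ_nonneg _ _ _) _), ← hX] at h1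
  have hconj : w.HolderConjugate (w / (w - 1)) := Real.HolderConjugate.conjExponent (by linarith)
  set w' := w / (w - 1) with hw'
  have hVm : Measurable (Ms s₃ fun t => ENNReal.ofReal (v t)) := measurable_Ms _ _
  have h3 := ENNReal.lintegral_mul_le_Lp_mul_Lq volume hconj hFm.aemeasurable hVm.aemeasurable
  have hM : ∫⁻ x, Ms s₃ (fun t => ENNReal.ofReal (v t)) x ^ w' ≤
      cM (w' / s₃) * ∫⁻ x, ENNReal.ofReal (sqJ J a x) ^ (w / 2) := by
    have hvm : Measurable fun t => ENNReal.ofReal (v t) ^ s₃ :=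
      (H.meas_v.ennreal_ofReal).pow_const _
    have := lintegral_Mx_rpow_le hws hvm
    refine le_trans (le_of_eq ?_) (this.trans (le_of_eq ?_))
    · congr 1; ext x
      rw [Ms, ← ENNReal.rpow_mul]
      congr 1; ring
    · congr 2; ext x
      rw [← ENNReal.rpow_mul, hv, ← ENNReal.ofReal_rpow_of_nonneg (sqJ_nonneg _ _ _) (by linarith),
        ← ENNReal.rpow_mul]
      congr 1
      have : w - 1 ≠ 0 := by linarith
      rw [hw']; field_simp
  set X := ∫⁻ x, ENNReal.ofReal (sqJ J a x) ^ (w / 2) with hXdef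
  have hfin : X ≠ ∞ := by rw [hX]; exact ENNReal.ofReal_ne_top
  have hw1 : 1 / w' = 1 - 1 / w := by
    have := hconj.inv_add_inv_eq_one
    rw [one_div, one_div]; linarith
  have h4 : X ≤ (cD s₁ s₂ s₃ w * ENNReal.ofReal (qn Θ) * (∫⁻ x, F x ^ w) ^ (1 / w)) *
      X ^ (1 / w') := by
    calc X ≤ _ := h1
      _ ≤ ENNReal.ofReal (cB s₁ s₂ s₃ * qn Θ) * (2 * cG 1) * ((∫⁻ x, F x ^ w) ^ (1 / w) *
          (cM (w' / s₃) * X) ^ (1 / w')) := by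
        gcongr
        refine h3.trans ?_
        gcongr
        have := hconj.symm.pos
        positivity
      _ = _ := by
        rw [ENNReal.mul_rpow_of_nonneg _ _ (by have := hconj.symm.pos; positivity),
          ENNReal.ofReal_mul H.cB_nonneg, cD, ← hw', hw1]
        ring
  refine (le_rpow_of_le_mul_rpow hconj hfin h4).trans (le_of_eq ?_)
  rw [ENNReal.mul_rpow_of_nonneg _ _ hconj.pos.le, one_div, ENNReal.rpow_inv_rpow hconj.pos.ne']

end

section

lemma rpow_sum_le_sum_rpow {ι : Type*} (s : Finset ι) (u : ι → ℝ≥0∞) {θ : ℝ} (h0 : 0 < θ)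
    (h1 : θ ≤ 1) : (∑ i ∈ s, u i) ^ θ ≤ ∑ i ∈ s, u i ^ θ := by
  classical
  induction s using Finset.induction_on with
  | empty => simp [h0]
  | insert i s hi ih =>
    rw [Finset.sum_insert hi, Finset.sum_insert hi]
    exact (ENNReal.rpow_add_le_add_rpow _ _ h0.le h1).trans (by gcongr)

lemma lintegral_rpow_le_of_shadow {u : ℝ → ℝ≥0∞} (hu : Measurable u) {Ω : Set ℝ}
    (hΩ : MeasurableSet Ω) (h : ∀ x, x ∉ Ω → u x = 0) {θ : ℝ} (h0 : 0 < θ) (h1 : θ < 1) :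
    ∫⁻ x, u x ^ θ ≤ (∫⁻ x, u x) ^ θ * volume Ω ^ (1 - θ) := by
  have := ENNReal.lintegral_mul_norm_pow_le (μ := volume) hu.aemeasurable
    (measurable_one.indicator hΩ : Measurable (Ω.indicator (1 : ℝ → ℝ≥0∞))).aemeasurable
    h0.le (by linarith : 0 ≤ 1 - θ) (by ring)
  rw [lintegral_indicator_one hΩ] at this
  refine le_trans (lintegral_mono fun x => ?_) this
  by_cases hx : x ∈ Ω
  · simp [hx]
  · simp [h x hx, h0]

variable {J : Finset (ℤ × ℤ)}

/-- Sums over levels are bounded by the product of the quantities which exceed the levels. -/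
lemma sum_indicator_level_le {cl : ℤ × ℤ → ℤ × ℤ} {A B : ℝ → ℝ≥0∞}
    (hA : ∀ p ∈ J, ∀ x ∈ dya p.1 p.2, (2 : ℝ≥0∞) ^ (((cl p).1 - 1 : ℤ) : ℝ) < A x)
    (hB : ∀ p ∈ J, ∀ x ∈ dya p.1 p.2, (2 : ℝ≥0∞) ^ (((cl p).2 - 1 : ℤ) : ℝ) < B x)
    {θ : ℝ} (hθ : 0 < θ) (x : ℝ) :
    ∑ c ∈ J.image cl, (shadow (J.filter fun p => cl p = c)).indicator
      (fun _ => (2 : ℝ≥0∞) ^ (((c.1 + c.2 : ℤ) : ℝ) * θ)) x ≤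
      (2 ^ θ * cG θ) ^ 2 * (A x * B x) ^ θ := by
  classical
  set T := (J.image cl).filter fun c => x ∈ shadow (J.filter fun p => cl p = c) with hT
  have hmem : ∀ c ∈ T, (2 : ℝ≥0∞) ^ ((c.1 - 1 : ℤ) : ℝ) < A x ∧
      (2 : ℝ≥0∞) ^ ((c.2 - 1 : ℤ) : ℝ) < B x := fun c hc => by
    obtain ⟨p, hp, hx⟩ := mem_shadow.1 (Finset.mem_filter.1 hc).2
    obtain ⟨hpJ, rfl⟩ := Finset.mem_filter.1 hp
    exact ⟨hA p hpJ x hx, hB p hpJ x hx⟩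
  calc _ = ∑ c ∈ T, (2 : ℝ≥0∞) ^ ((c.1 : ℝ) * θ) * 2 ^ ((c.2 : ℝ) * θ) := by
        rw [hT, Finset.sum_filter]
        refine Finset.sum_congr rfl fun c _ => ?_
        rw [indicator_apply, ← ENNReal.rpow_add _ _ (by norm_num) (by norm_num)]
        push_cast
        rw [add_mul]
    _ ≤ ∑ c ∈ T.image Prod.fst ×ˢ T.image Prod.snd,
          (2 : ℝ≥0∞) ^ ((c.1 : ℝ) * θ) * 2 ^ ((c.2 : ℝ) * θ) :=
        Finset.sum_le_sum_of_subset fun c hc => Finset.mem_product.2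
          ⟨Finset.mem_image_of_mem _ hc, Finset.mem_image_of_mem _ hc⟩
    _ = (∑ j ∈ T.image Prod.fst, (2 : ℝ≥0∞) ^ ((j : ℝ) * θ)) *
          ∑ l ∈ T.image Prod.snd, (2 : ℝ≥0∞) ^ ((l : ℝ) * θ) := by
        rw [Finset.sum_product, Finset.sum_mul_sum]
    _ ≤ (2 ^ θ * cG θ * A x ^ θ) * (2 ^ θ * cG θ * B x ^ θ) := by
        refine mul_le_mul' (sum_two_rpow_le hθ _ fun j hj => ?_) (sum_two_rpow_le hθ _ fun j hj => ?_)
        · obtain ⟨c, hc, rfl⟩ := Finset.mem_image.1 hj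
          exact (hmem c hc).1
        · obtain ⟨c, hc, rfl⟩ := Finset.mem_image.1 hj
          exact (hmem c hc).2
    _ = _ := by rw [ENNReal.mul_rpow_of_nonneg _ _ hθ.le]; ring

lemma sqJ_eq_sum_fiber (cl : ℤ × ℤ → ℤ × ℤ) (a : ℤ → ℝ → ℂ) (x : ℝ) :
    sqJ J a x = ∑ c ∈ J.image cl, sqJ (J.filter fun p => cl p = c) a x := by
  classical
  exact (Finset.sum_fiberwise_of_maps_to (fun p hp => Finset.mem_image_of_mem cl hp) _).symm

/-- The square function estimate in terms of maximal functions. -/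
theorem exists_lintegral_sqJ_le {s₁ s₂ s₃ r : ℝ} (E : Exps s₁ s₂ s₃) (hr : 0 < r)
    (hws : 1 < max r 2 / (max r 2 - 1) / s₃) : ∃ C : ℝ≥0∞, C ≠ ∞ ∧
    ∀ f g Θ : 𝓢(ℝ, ℂ), (∀ ξ, 𝓕 (Θ : ℝ → ℂ) ξ ≠ 0 → 16 ≤ |ξ| ∧ |ξ| ≤ 64) →
      (0 < ∫ t, ‖f t‖ ^ s₁) → (0 < ∫ t, ‖g t‖ ^ s₂) → ∀ J : Finset (ℤ × ℤ),
      ∫⁻ x, ENNReal.ofReal (sqJ J (fun n => bt Θ (2 ^ n) f g) x) ^ (r / 2) ≤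
        (C * ENNReal.ofReal (qn Θ)) ^ r *
          ∫⁻ x, (Ms s₁ (fun t => ENNReal.ofReal ‖f t‖) x *
            Ms s₂ (fun t => ENNReal.ofReal ‖g t‖) x) ^ r := by
  have hs1 := one_pos.trans E.one_lt_f
  have hs2 := one_pos.trans E.one_lt_g
  have hlev : ∀ f g : 𝓢(ℝ, ℂ), (0 < ∫ t, ‖f t‖ ^ s₁) → (0 < ∫ t, ‖g t‖ ^ s₂) →
      ∃ cl : ℤ × ℤ → ℤ × ℤ,
      (∀ p, AvgLE p.1 p.2 (fun t => ‖f t‖ ^ s₁) (((2 : ℝ) ^ (cl p).1) ^ s₁)) ∧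
      (∀ p, AvgLE p.1 p.2 (fun t => ‖g t‖ ^ s₂) (((2 : ℝ) ^ (cl p).2) ^ s₂)) ∧
      (∀ p, ∀ x ∈ dya p.1 p.2, (2 : ℝ≥0∞) ^ (((cl p).1 - 1 : ℤ) : ℝ) <
        Ms s₁ (fun t => ENNReal.ofReal ‖f t‖) x) ∧
      (∀ p, ∀ x ∈ dya p.1 p.2, (2 : ℝ≥0∞) ^ (((cl p).2 - 1 : ℤ) : ℝ) <
        Ms s₂ (fun t => ENNReal.ofReal ‖g t‖) x) := fun f g hf hg => by
    have hif := integrable_schwartz_rpow f hs1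
    have hig := integrable_schwartz_rpow g hs2
    choose j hj hj' using fun p : ℤ × ℤ => exists_avgLE_level
      (fun t => Real.rpow_nonneg (norm_nonneg (f t)) s₁) hif hf hs1 p.1 p.2
    choose l hl hl' using fun p : ℤ × ℤ => exists_avgLE_level
      (fun t => Real.rpow_nonneg (norm_nonneg (g t)) s₂) hig hg hs2 p.1 p.2
    exact ⟨fun p => (j p, l p), hj, hl,
      fun p x hx => lt_Ms_of_not_avgLE hs1 (fun t => norm_nonneg _) hif (hj' p) hx,
      fun p x hx => lt_Ms_of_not_avgLE hs2 (fun t => norm_nonneg _) hig (hl' p) hx⟩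
  rcases le_or_gt 2 r with h2 | h2
  · rw [max_eq_left h2] at hws
    refine ⟨cD s₁ s₂ s₃ r * (2 * cG 1) ^ 2, ENNReal.mul_ne_top (cD_ne_top h2 hws)
      (ENNReal.pow_ne_top (ENNReal.mul_ne_top (by simp) (cG_ne_top one_pos))),
      fun f g Θ hΘ hf hg J => ?_⟩
    obtain ⟨cl, h1, h2', h3, h4⟩ := hlev f g hf hg
    refine (lintegral_sqJ_rpow_le hΘ E h2 hws (F := fun x => (2 * cG 1) ^ 2 *
      (Ms s₁ (fun t => ENNReal.ofReal ‖f t‖) x * Ms s₂ (fun t => ENNReal.ofReal ‖g t‖) x))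
      (fun p _ => h1 p) (fun p _ => h2' p)
      (((measurable_Ms _ _).mul (measurable_Ms _ _)).const_mul _) fun x => ?_).trans (le_of_eq ?_)
    · simpa using sum_indicator_level_le (J := J) (fun p _ => h3 p) (fun p _ => h4 p) one_pos x
    · simp_rw [ENNReal.mul_rpow_of_nonneg _ _ hr.le]
      rw [lintegral_const_mul]
      · ring
      · exact ((measurable_Ms _ _).pow_const _).mul ((measurable_Ms _ _).pow_const _)
  · rw [max_eq_right h2.le] at hws
    refine ⟨cD s₁ s₂ s₃ 2 * ((2 ^ r * cG r) ^ 2) ^ (1 / r), ENNReal.mul_ne_top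
      (cD_ne_top le_rfl hws) (ENNReal.rpow_ne_top_of_nonneg (by positivity)
      (ENNReal.pow_ne_top (ENNReal.mul_ne_top (two_rpow_ne_top _) (cG_ne_top hr)))),
      fun f g Θ hΘ hf hg J => ?_⟩
    obtain ⟨cl, h1, h2', h3, h4⟩ := hlev f g hf hg
    set a : ℤ → ℝ → ℂ := fun n => bt Θ (2 ^ n) f g with ha
    have ham : ∀ n, Measurable (a n) := fun n => (continuous_bt Θ f g _).measurable
    set Jc : ℤ × ℤ → Finset (ℤ × ℤ) := fun c => J.filter fun p => cl p = c with hJc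
    have hmeas : ∀ c, MeasurableSet (shadow (Jc c)) := fun c => measurableSet_shadow _
    have hone : ∀ c, ∫⁻ x, ENNReal.ofReal (sqJ (Jc c) a x) ^ (r / 2) ≤
        (cD s₁ s₂ s₃ 2 * ENNReal.ofReal (qn Θ)) ^ r *
          ∫⁻ x, (shadow (Jc c)).indicator (fun _ => (2 : ℝ≥0∞) ^ (((c.1 + c.2 : ℤ) : ℝ) * r)) x := by
      intro c
      have hb := lintegral_sqJ_rpow_le (J := Jc c) (cl := fun _ => c)
        (F := (shadow (Jc c)).indicator fun _ => (2 : ℝ≥0∞) ^ (((c.1 + c.2 : ℤ) : ℝ))) hΘ E le_rfl hws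
        (fun p hp => by
          have := h1 p; rwa [(Finset.mem_filter.1 hp).2] at this)
        (fun p hp => by
          have := h2' p; rwa [(Finset.mem_filter.1 hp).2] at this)
        (measurable_const.indicator (hmeas c)) (fun x => by
          refine (Finset.sum_le_sum_of_subset (t := {c}) (Finset.image_subset_iff.2 fun _ _ => by
            simp)).trans ?_
          simp)
      simp only [div_self (two_ne_zero' ℝ), ENNReal.rpow_one] at hb
      have hind : ∫⁻ x, (shadow (Jc c)).indicator
          (fun _ => (2 : ℝ≥0∞) ^ (((c.1 + c.2 : ℤ) : ℝ))) x ^ (2 : ℝ) =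
          2 ^ (((c.1 + c.2 : ℤ) : ℝ) * 2) * volume (shadow (Jc c)) := by
        rw [← lintegral_indicator_const (hmeas c)]
        congr 1; ext x
        by_cases hx : x ∈ shadow (Jc c) <;> simp [hx, ENNReal.rpow_mul]
      rw [hind] at hb
      refine (lintegral_rpow_le_of_shadow (measurable_sqJ ham).ennreal_ofReal (hmeas c)
        (fun x hx => by rw [sqJ_of_notMem hx, ENNReal.ofReal_zero]) (by positivity : 0 < r / 2)
        (by linarith)).trans ?_
      rw [lintegral_indicator_const (hmeas c)]
      calc _ ≤ ((cD s₁ s₂ s₃ 2 * ENNReal.ofReal (qn Θ)) ^ (2 : ℝ) * (2 ^ (((c.1 + c.2 : ℤ) : ℝ) * 2) *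
            volume (shadow (Jc c)))) ^ (r / 2) * volume (shadow (Jc c)) ^ (1 - r / 2) := by
            gcongr
        _ = ((cD s₁ s₂ s₃ 2 * ENNReal.ofReal (qn Θ)) ^ (2 : ℝ)) ^ (r / 2) *
            ((2 : ℝ≥0∞) ^ (((c.1 + c.2 : ℤ) : ℝ) * 2)) ^ (r / 2) *
              (volume (shadow (Jc c)) ^ (r / 2) * volume (shadow (Jc c)) ^ (1 - r / 2)) := by
            rw [ENNReal.mul_rpow_of_nonneg (_ ^ (2 : ℝ)) _ (by positivity),
              ENNReal.mul_rpow_of_nonneg _ (volume _) (by positivity)]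
            ring
        _ = _ := by
            rw [← ENNReal.rpow_mul, ← ENNReal.rpow_mul,
              ← ENNReal.rpow_add_of_nonneg _ _ (by positivity) (by linarith), mul_assoc]
            rw [show (2 : ℝ) * (r / 2) = r by ring, show r / 2 + (1 - r / 2) = 1 by ring,
              ENNReal.rpow_one, show ((c.1 + c.2 : ℤ) : ℝ) * 2 * (r / 2) =
                ((c.1 + c.2 : ℤ) : ℝ) * r by ring]
    calc _ ≤ ∫⁻ x, ∑ c ∈ J.image cl, ENNReal.ofReal (sqJ (Jc c) a x) ^ (r / 2) := by
          refine lintegral_mono fun x => ?_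
          rw [sqJ_eq_sum_fiber cl, ENNReal.ofReal_sum_of_nonneg fun c _ => sqJ_nonneg _ _ _]
          exact rpow_sum_le_sum_rpow _ _ (by positivity) (by linarith)
      _ = ∑ c ∈ J.image cl, ∫⁻ x, ENNReal.ofReal (sqJ (Jc c) a x) ^ (r / 2) :=
          lintegral_finsetSum _ fun c _ => (measurable_sqJ ham).ennreal_ofReal.pow_const _
      _ ≤ ∑ c ∈ J.image cl, _ := Finset.sum_le_sum fun c _ => hone c
      _ = (cD s₁ s₂ s₃ 2 * ENNReal.ofReal (qn Θ)) ^ r * ∫⁻ x, ∑ c ∈ J.image cl,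
            (shadow (Jc c)).indicator (fun _ => (2 : ℝ≥0∞) ^ (((c.1 + c.2 : ℤ) : ℝ) * r)) x := by
          rw [← Finset.mul_sum, lintegral_finsetSum]
          exact fun c _ => measurable_const.indicator (hmeas c)
      _ ≤ (cD s₁ s₂ s₃ 2 * ENNReal.ofReal (qn Θ)) ^ r * ∫⁻ x, (2 ^ r * cG r) ^ 2 *
            (Ms s₁ (fun t => ENNReal.ofReal ‖f t‖) x *
              Ms s₂ (fun t => ENNReal.ofReal ‖g t‖) x) ^ r := by
          gcongr with x
          exact sum_indicator_level_le (J := J) (fun p _ => h3 p) (fun p _ => h4 p) hr x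
      _ = _ := by
          have hm : Measurable fun x => (Ms s₁ (fun t => ENNReal.ofReal ‖f t‖) x *
              Ms s₂ (fun t => ENNReal.ofReal ‖g t‖) x) ^ r :=
            ((measurable_Ms _ _).mul (measurable_Ms _ _)).pow_const _
          rw [lintegral_const_mul _ hm, ENNReal.mul_rpow_of_nonneg _ _ hr.le, ENNReal.mul_rpow_of_nonneg _ _ hr.le,
            ENNReal.mul_rpow_of_nonneg _ _ hr.le, one_div, ENNReal.rpow_inv_rpow hr.ne']
          ring

end

lemma exists_exps {P Q : ℝ} (hP0 : 0 ≤ P) (hQ0 : 0 ≤ Q) (hP : P < 1) (hQ : Q < 1) (hPQ : 0 < P + Q)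
    (hPQ' : P + Q < 3 / 2) : ∃ s₁ s₂ s₃ : ℝ, Exps s₁ s₂ s₃ ∧ s₁ * P < 1 ∧ s₂ * Q < 1 ∧
      1 < max (1 / (P + Q)) 2 / (max (1 / (P + Q)) 2 - 1) / s₃ := by
  obtain ⟨a, ha, ha'⟩ : ∃ a, a = max P (1 / 2) ∧ 0 < a := ⟨_, rfl, by positivity⟩
  obtain ⟨b, hb, hb'⟩ : ∃ a, a = max Q (1 / 2) ∧ 0 < a := ⟨_, rfl, by positivity⟩
  obtain ⟨c, hc, hc'⟩ : ∃ a, a = max (1 - (P + Q)) (1 / 2) ∧ 0 < a := ⟨_, rfl, by positivity⟩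
  have ha1 : a < 1 := ha ▸ max_lt hP (by norm_num)
  have hb1 : b < 1 := hb ▸ max_lt hQ (by norm_num)
  have hc1 : c < 1 := hc ▸ max_lt (by linarith) (by norm_num)
  have hs : a + b + c < 2 := by
    rcases max_cases P (1 / 2) with h1 | h1 <;> rcases max_cases Q (1 / 2) with h2 | h2 <;>
      rcases max_cases (1 - (P + Q)) (1 / 2) with h3 | h3 <;> rw [ha, hb, hc, h1.1, h2.1, h3.1] <;>
      linarith
  obtain ⟨ε, h0, h1, h2, h3, h4⟩ : ∃ ε > 0, a + ε < 1 ∧ b + ε < 1 ∧ c + ε < 1 ∧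
      a + b + c + 3 * ε < 2 := by
    refine ⟨min (min (1 - a) (1 - b)) (min (1 - c) (2 - a - b - c)) / 4, ?_, ?_, ?_, ?_, ?_⟩
    · have := lt_min (lt_min (sub_pos.2 ha1) (sub_pos.2 hb1))
        (lt_min (sub_pos.2 hc1) (by linarith : 0 < 2 - a - b - c))
      linarith
    all_goals
      have k1 := min_le_left (min (1 - a) (1 - b)) (min (1 - c) (2 - a - b - c))
      have k2 := min_le_right (min (1 - a) (1 - b)) (min (1 - c) (2 - a - b - c))
      have k3 := min_le_left (1 - a) (1 - b)
      have k4 := min_le_right (1 - a) (1 - b)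
      have k5 := min_le_left (1 - c) (2 - a - b - c)
      have k6 := min_le_right (1 - c) (2 - a - b - c)
      linarith
  have la : 1 / 2 ≤ a := ha ▸ le_max_right _ _
  have lb : 1 / 2 ≤ b := hb ▸ le_max_right _ _
  have lc : 1 / 2 ≤ c := hc ▸ le_max_right _ _
  have pa : P ≤ a := ha ▸ le_max_left _ _
  have pb : Q ≤ b := hb ▸ le_max_left _ _
  refine ⟨1 / (a + ε), 1 / (b + ε), 1 / (c + ε), ⟨?_, ?_, ?_, ?_, ?_, ?_, ?_⟩, ?_, ?_, ?_⟩
  · rw [lt_div_iff₀ (by linarith)]; linarith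
  · rw [div_le_iff₀ (by linarith)]; linarith
  · rw [lt_div_iff₀ (by linarith)]; linarith
  · rw [div_le_iff₀ (by linarith)]; linarith
  · rw [lt_div_iff₀ (by linarith)]; linarith
  · rw [div_le_iff₀ (by linarith)]; linarith
  · rw [one_div_one_div, one_div_one_div, one_div_one_div]; linarith
  · rw [one_div_mul_eq_div, div_lt_one (by linarith)]; linarith
  · rw [one_div_mul_eq_div, div_lt_one (by linarith)]; linarith
  · have hw : max (1 / (P + Q)) 2 / (max (1 / (P + Q)) 2 - 1) = 1 / c := by
      rw [hc]
      rcases le_total (1 / (P + Q)) 2 with h | h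
      · have : 1 / 2 ≤ P + Q := by rw [div_le_iff₀ hPQ] at h; linarith
        rw [max_eq_right h, max_eq_right (by linarith)]; norm_num
      · have : P + Q ≤ 1 / 2 := by rw [le_div_iff₀ hPQ] at h; linarith
        have h3 : 1 - (P + Q) ≠ 0 := by linarith
        rw [max_eq_left h, max_eq_left (by linarith), div_sub_one hPQ.ne']
        field_simp
    rw [hw, div_div_eq_mul_div, div_one, one_div_mul_eq_div, lt_div_iff₀ hc']
    linarith

lemma exists_eLpNorm_Ms_le {s : ℝ} (hs : 0 < s) {p : ℝ≥0∞} (hp : 1 < p)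
    (hsp : s * (1 / p).toReal < 1) : ∃ C : ℝ≥0∞, C ≠ ∞ ∧ ∀ u : ℝ → ℝ≥0∞, Measurable u →
      eLpNorm (Ms s u) p volume ≤ C * eLpNorm u p volume := by
  rcases eq_or_ne p ∞ with rfl | htop
  · refine ⟨1, by simp, fun u _ => ?_⟩
    rw [one_mul, eLpNorm_exponent_top, eLpNorm_exponent_top]
    refine essSup_le_of_ae_le _ (ae_of_all _ fun x => ?_)
    change Mx (fun t => u t ^ s) x ^ (1 / s) ≤ _
    rw [one_div, ENNReal.rpow_inv_le_iff hs]
    exact Mx_le_of_le (by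
      filter_upwards [ae_le_eLpNormEssSup (f := u) (μ := volume)] with t ht
      rw [enorm_eq_self] at ht
      gcongr) x
  · have h0 : p ≠ 0 := (one_pos.trans hp).ne'
    have hp' : 0 < p.toReal := ENNReal.toReal_pos h0 htop
    have hps : 1 < p.toReal / s := by
      rw [one_div, ENNReal.toReal_inv, ← div_eq_mul_inv, div_lt_one hp'] at hsp
      rwa [one_lt_div hs]
    refine ⟨cM (p.toReal / s) ^ (1 / p.toReal),
      ENNReal.rpow_ne_top_of_nonneg (by positivity) (cM_ne_top hps), fun u hu => ?_⟩
    rw [eLpNorm_eq_lintegral_rpow_enorm_toReal h0 htop,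
      eLpNorm_eq_lintegral_rpow_enorm_toReal h0 htop, ← ENNReal.mul_rpow_of_nonneg _ _ (by positivity)]
    have := lintegral_Mx_rpow_le hps (hu.pow_const s)
    simp_rw [← ENNReal.rpow_mul, mul_div_cancel₀ _ hs.ne'] at this
    gcongr
    simpa [Ms, ← ENNReal.rpow_mul, div_eq_inv_mul] using this

lemma eLpNorm_mul_le_top {r : ℝ≥0∞} (hr0 : r ≠ 0) (hr1 : r ≠ ∞)
    {u v : ℝ → ℝ≥0∞} (hv : Measurable v) :
    eLpNorm (fun x => u x * v x) r volume ≤ eLpNorm u ∞ volume * eLpNorm v r volume := by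
  have hr := ENNReal.toReal_pos hr0 hr1
  rw [eLpNorm_exponent_top, eLpNorm_eq_lintegral_rpow_enorm_toReal hr0 hr1,
    eLpNorm_eq_lintegral_rpow_enorm_toReal hr0 hr1]
  simp only [enorm_eq_self]
  calc _ ≤ (∫⁻ x, eLpNormEssSup u volume ^ r.toReal * v x ^ r.toReal) ^ (1 / r.toReal) := by
        gcongr ?_ ^ _
        refine lintegral_mono_ae ?_
        filter_upwards [ae_le_eLpNormEssSup (f := u) (μ := volume)] with t ht
        rw [enorm_eq_self] at ht
        rw [ENNReal.mul_rpow_of_nonneg _ _ hr.le]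
        gcongr
    _ = _ := by
        rw [lintegral_const_mul _ (hv.pow_const _), ENNReal.mul_rpow_of_nonneg _ _ (by positivity),
          one_div, ENNReal.rpow_rpow_inv hr.ne']

lemma eLpNorm_mul_le {p q r : ℝ≥0∞} (hp : p ≠ 0) (hq : q ≠ 0) (hr : 1 / r = 1 / p + 1 / q)
    (hr0 : r ≠ 0) (hr1 : r ≠ ∞) {u v : ℝ → ℝ≥0∞} (hu : Measurable u) (hv : Measurable v) :
    eLpNorm (fun x => u x * v x) r volume ≤ eLpNorm u p volume * eLpNorm v q volume := by
  simp only [one_div] at hr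
  rcases eq_or_ne p ∞ with rfl | hp'
  · obtain rfl : r = q := by simpa using hr
    exact eLpNorm_mul_le_top hr0 hr1 hv
  rcases eq_or_ne q ∞ with rfl | hq'
  · obtain rfl : r = p := by simpa using hr
    simpa only [mul_comm] using eLpNorm_mul_le_top (u := v) hr0 hr1 hu
  have hP := ENNReal.toReal_pos hp hp'
  have hQ := ENNReal.toReal_pos hq hq'
  have hR := ENNReal.toReal_pos hr0 hr1
  have h : 1 / r.toReal = 1 / p.toReal + 1 / q.toReal := by
    have := congrArg ENNReal.toReal hr
    rw [ENNReal.toReal_add (by simpa) (by simpa)] at this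
    simpa [ENNReal.toReal_inv] using this
  have hlt : r.toReal < p.toReal := by
    have : 0 < 1 / q.toReal := by positivity
    exact (one_div_lt_one_div hP hR).1 (by linarith)
  have := ENNReal.lintegral_Lp_mul_le_Lq_mul_Lr hR hlt h volume hu.aemeasurable hv.aemeasurable
  rw [eLpNorm_eq_lintegral_rpow_enorm_toReal hp hp', eLpNorm_eq_lintegral_rpow_enorm_toReal hq hq',
    eLpNorm_eq_lintegral_rpow_enorm_toReal hr0 hr1]
  simpa using this

/-- The square of the dyadic square function. -/
noncomputable def sqf (Θ : ℝ → ℂ) (f g : ℝ → ℂ) (x : ℝ) : ℝ≥0∞ :=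
  ∑' n : ℤ, ‖bt Θ (2 ^ n) f g x‖ₑ ^ (2 : ℝ)

lemma sqJ_mono {J J' : Finset (ℤ × ℤ)} (h : J ⊆ J') (a : ℤ → ℝ → ℂ) (x : ℝ) :
    sqJ J a x ≤ sqJ J' a x :=
  Finset.sum_le_sum_of_subset_of_nonneg h fun _ _ _ => indicator_nonneg (fun _ _ => by positivity) _

lemma sqf_rpow_le_iSup (Θ f g : ℝ → ℂ) {θ : ℝ} (hθ : 0 < θ) (x : ℝ) :
    sqf Θ f g x ^ θ ≤ ⨆ J : Finset (ℤ × ℤ),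
      ENNReal.ofReal (sqJ J (fun n => bt Θ (2 ^ n) f g) x) ^ θ := by
  classical
  rw [← ENNReal.le_rpow_inv_iff hθ, sqf, ENNReal.tsum_eq_iSup_sum]
  refine iSup_le fun F => ?_
  rw [ENNReal.le_rpow_inv_iff hθ]
  refine le_trans ?_ (le_iSup _ (F.image fun n => (n, ⌊x / 2 ^ n⌋)))
  gcongr
  rw [sqJ, Finset.sum_image fun a _ b _ h => (Prod.ext_iff.1 h).1,
    ENNReal.ofReal_sum_of_nonneg fun _ _ => indicator_nonneg (fun _ _ => by positivity) _]
  refine Finset.sum_le_sum fun n _ => ?_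
  rw [indicator_of_mem (mem_dya.2 rfl), ← ofReal_norm, ENNReal.ofReal_pow (norm_nonneg _)]
  norm_num

lemma eq_zero_of_integral_rpow {s : ℝ} (hs : 0 < s) (f : 𝓢(ℝ, ℂ)) (h : ¬ 0 < ∫ t, ‖f t‖ ^ s) :
    f = 0 := by
  have h0 : ∫ t, ‖f t‖ ^ s = 0 := le_antisymm (not_lt.1 h) (integral_nonneg fun t => by positivity)
  have hc : Continuous fun t => ‖f t‖ ^ s :=
    f.continuous.norm.rpow_const fun _ => Or.inr hs.le
  have := (hc.ae_eq_iff_eq volume continuous_const).1 ((integral_eq_zero_iff_of_nonneg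
    (fun t => by positivity) (integrable_schwartz_rpow f hs)).1 h0)
  ext t
  exact norm_eq_zero.1 ((Real.rpow_eq_zero (norm_nonneg _) hs.ne').1 (congrFun this t))

/-- The square function estimate for a kernel with frequencies in an annulus. -/
theorem exists_lintegral_sqf_le {p q r : ℝ≥0∞} (hp : 1 < p) (hq : 1 < q)
    (hr : 1 / r = 1 / p + 1 / q) (hr0 : 0 < 1 / r) (hr1 : 1 / r < 3 / 2) :
    ∃ C : ℝ≥0∞, C ≠ ∞ ∧ ∀ f g Θ : 𝓢(ℝ, ℂ), (∀ ξ, 𝓕 (Θ : ℝ → ℂ) ξ ≠ 0 → 16 ≤ |ξ| ∧ |ξ| ≤ 64) →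
      ∫⁻ x, sqf Θ f g x ^ (r.toReal / 2) ≤ (C * ENNReal.ofReal (qn Θ) *
        (eLpNorm f p volume * eLpNorm g q volume)) ^ r.toReal := by
  have hP : 1 / p < 1 := by simpa using hp
  have hQ : 1 / q < 1 := by simpa using hq
  have hrz : r ≠ 0 := by rintro rfl; simp at hr1
  have hrt : r ≠ ∞ := by rintro rfl; simp at hr0
  have hR := ENNReal.toReal_pos hrz hrt
  have hsum : (1 / r).toReal = (1 / p).toReal + (1 / q).toReal := by
    rw [hr, ENNReal.toReal_add hP.ne_top hQ.ne_top]
  have hrr : r.toReal = 1 / ((1 / p).toReal + (1 / q).toReal) := by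
    rw [← hsum, ENNReal.toReal_div, ENNReal.toReal_one, one_div_one_div]
  obtain ⟨s₁, s₂, s₃, E, h1, h2, h3⟩ := exists_exps (P := (1 / p).toReal) (Q := (1 / q).toReal)
    ENNReal.toReal_nonneg ENNReal.toReal_nonneg
    (by simpa using (ENNReal.toReal_lt_toReal hP.ne_top (by simp)).2 hP)
    (by simpa using (ENNReal.toReal_lt_toReal hQ.ne_top (by simp)).2 hQ)
    (by rw [← hsum]; exact ENNReal.toReal_pos hr0.ne' hr1.ne_top)
    (by rw [← hsum]; simpa using (ENNReal.toReal_lt_toReal hr1.ne_top (by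
      exact ENNReal.div_ne_top (by simp) (by simp))).2 hr1)
  rw [← hrr] at h3
  have hs1 := one_pos.trans E.one_lt_f
  have hs2 := one_pos.trans E.one_lt_g
  obtain ⟨C, hC, H⟩ := exists_lintegral_sqJ_le E hR h3
  obtain ⟨C₁, hC₁, H₁⟩ := exists_eLpNorm_Ms_le hs1 hp h1
  obtain ⟨C₂, hC₂, H₂⟩ := exists_eLpNorm_Ms_le hs2 hq h2
  refine ⟨C * (C₁ * C₂), ENNReal.mul_ne_top hC (ENNReal.mul_ne_top hC₁ hC₂), fun f g Θ hΘ => ?_⟩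
  have hzero : ∀ f g : 𝓢(ℝ, ℂ), (f = 0 ∨ g = 0) → ∫⁻ x, sqf Θ f g x ^ (r.toReal / 2) = 0 := by
    intro f g h
    have : ∀ x, sqf Θ f g x = 0 := fun x => by
      rcases h with rfl | rfl <;> simp [sqf, bt]
    simp [this, hR]
  by_cases hf : 0 < ∫ t, ‖f t‖ ^ s₁
  swap
  · rw [hzero f g (Or.inl (eq_zero_of_integral_rpow hs1 f hf))]; exact zero_le
  by_cases hg : 0 < ∫ t, ‖g t‖ ^ s₂
  swap
  · rw [hzero f g (Or.inr (eq_zero_of_integral_rpow hs2 g hg))]; exact zero_le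
  have ham : ∀ n : ℤ, Measurable (bt Θ (2 ^ n) f g) := fun n => (continuous_bt Θ f g _).measurable
  refine (lintegral_mono fun x => sqf_rpow_le_iSup Θ f g (by positivity : 0 < r.toReal / 2) x).trans ?_
  rw [lintegral_iSup_directed
    (fun J => ((measurable_sqJ ham).ennreal_ofReal.pow_const _).aemeasurable)
    (Monotone.directed_le fun J J' h x => by
      have := sqJ_mono h (fun n : ℤ => bt Θ (2 ^ n) f g) x
      dsimp only
      gcongr)]
  refine iSup_le fun J => (H f g Θ hΘ hf hg J).trans ?_
  have hu : ∀ f : 𝓢(ℝ, ℂ), Measurable fun t => ENNReal.ofReal ‖f t‖ := fun f =>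
    f.continuous.norm.measurable.ennreal_ofReal
  have hn : ∀ (f : 𝓢(ℝ, ℂ)) (p : ℝ≥0∞), eLpNorm (fun t => ENNReal.ofReal ‖f t‖) p volume =
      eLpNorm f p volume := fun f p => eLpNorm_congr_enorm_ae (ae_of_all _ fun t => by simp)
  have hM : ∫⁻ x, (Ms s₁ (fun t => ENNReal.ofReal ‖f t‖) x *
      Ms s₂ (fun t => ENNReal.ofReal ‖g t‖) x) ^ r.toReal ≤
      ((C₁ * eLpNorm f p volume) * (C₂ * eLpNorm g q volume)) ^ r.toReal := by
    have := (eLpNorm_mul_le (one_pos.trans hp).ne' (one_pos.trans hq).ne' hr hrz hrt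
      (measurable_Ms s₁ fun t => ENNReal.ofReal ‖f t‖)
      (measurable_Ms s₂ fun t => ENNReal.ofReal ‖g t‖)).trans
        (mul_le_mul' (H₁ _ (hu f)) (H₂ _ (hu g)))
    rw [eLpNorm_eq_lintegral_rpow_enorm_toReal hrz hrt, one_div, ENNReal.rpow_inv_le_iff hR,
      hn, hn] at this
    simpa using this
  calc _ ≤ (C * ENNReal.ofReal (qn Θ)) ^ r.toReal *
        ((C₁ * eLpNorm f p volume) * (C₂ * eLpNorm g q volume)) ^ r.toReal := by gcongr
    _ = _ := by
      rw [← ENNReal.mul_rpow_of_nonneg _ _ hR.le]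
      congr 1
      ring

lemma integrable_of_le_inv_sq {v : ℝ → ℝ} (hv : Continuous v) (h0 : ∀ y, 0 ≤ v y) {C : ℝ}
    (h : ∀ y, (1 + |y|) ^ 2 * v y ≤ C) : Integrable v := by
  refine ((integrable_one_add_norm (μ := (volume : Measure ℝ)) (r := 2) (by simp)).const_mul C).mono'
    hv.aestronglyMeasurable (ae_of_all _ fun y => ?_)
  have := abs_nonneg y
  rw [Real.norm_of_nonneg (h0 y), Real.norm_eq_abs, Real.rpow_neg (by positivity),
    ← div_eq_mul_inv, le_div_iff₀ (by positivity), mul_comm]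
  exact_mod_cast h y

/-- A Schwartz function with integral zero has an integrable primitive. -/
lemma exists_primitive (Ψ : 𝓢(ℝ, ℂ)) (hΨ : ∫ y, Ψ y = 0) : ∃ Φ : ℝ → ℂ, Integrable Φ ∧
    (Integrable fun y => (1 + |y|) ^ 16 * ‖Φ y‖) ∧
    ∀ ξ : ℝ, 𝓕 (Ψ : ℝ → ℂ) ξ = (2 * π * Complex.I * ξ) * 𝓕 Φ ξ := by
  set Φ : ℝ → ℂ := fun x => ∫ t in Iic x, Ψ t with hΦ
  have hi := Ψ.integrable (μ := volume)
  have hd : ∀ x, HasDerivAt Φ (Ψ x) x := fun x => by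
    have h1 : Φ = fun x => (∫ t in (0 : ℝ)..x, Ψ t) + Φ 0 := by
      ext x
      rw [← intervalIntegral.integral_Iic_sub_Iic hi.integrableOn hi.integrableOn]
      simp [hΦ]
    rw [h1]
    exact (intervalIntegral.integral_hasDerivAt_right hi.intervalIntegrable
      (Ψ.continuous.stronglyMeasurableAtFilter _ _) Ψ.continuous.continuousAt).add_const _
  have hc : Continuous Φ := continuous_iff_continuousAt.2 fun x => (hd x).continuousAt
  obtain ⟨C, hC, h⟩ := exists_decay Ψ 20
  have hw : Integrable fun t => (1 + |t|) ^ 18 * ‖Ψ t‖ :=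
    integrable_of_le_inv_sq (by have := Ψ.continuous; fun_prop) (fun y => by positivity)
      fun y => by rw [← mul_assoc, ← pow_add]; exact h y
  have key : ∀ (x : ℝ) (s : Set ℝ), MeasurableSet s → (∀ t ∈ s, |x| ≤ |t|) →
      (1 + |x|) ^ 18 * ‖∫ t in s, Ψ t‖ ≤ ∫ t, (1 + |t|) ^ 18 * ‖Ψ t‖ := fun x s hs hx => by
    calc _ ≤ (1 + |x|) ^ 18 * ∫ t in s, ‖Ψ t‖ := by
          gcongr; exact norm_integral_le_integral_norm _
      _ = ∫ t in s, (1 + |x|) ^ 18 * ‖Ψ t‖ := (integral_const_mul _ _).symm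
      _ ≤ ∫ t in s, (1 + |t|) ^ 18 * ‖Ψ t‖ := by
          refine setIntegral_mono_on (hi.norm.const_mul _).integrableOn hw.integrableOn hs
            fun t ht => ?_
          have := hx t ht
          gcongr
      _ ≤ _ := setIntegral_le_integral hw (ae_of_all _ fun t => by positivity)
  have hdec : ∀ x, (1 + |x|) ^ 18 * ‖Φ x‖ ≤ ∫ t, (1 + |t|) ^ 18 * ‖Ψ t‖ := fun x => by
    rcases le_or_gt x 0 with hx | hx
    · exact key x (Iic x) measurableSet_Iic fun t ht => by
        rw [abs_of_nonpos hx, abs_of_nonpos (le_trans ht hx)]; exact neg_le_neg ht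
    · have h2 : ‖Φ x‖ = ‖∫ t in Ioi x, Ψ t‖ := by
        have := integral_add_compl (measurableSet_Iic (a := x)) hi
        rw [hΨ, compl_Iic] at this
        rw [hΦ, ← norm_neg]
        exact congrArg _ (neg_eq_of_add_eq_zero_right this)
      rw [h2]
      exact key x (Ioi x) measurableSet_Ioi fun t ht => by
        rw [abs_of_pos hx, abs_of_pos (hx.trans ht)]; exact le_of_lt ht
  have hI : Integrable fun y => (1 + |y|) ^ 16 * ‖Φ y‖ :=
    integrable_of_le_inv_sq (by fun_prop) (fun y => by positivity)
      fun y => by rw [← mul_assoc, ← pow_add]; exact hdec y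
  have hΦi : Integrable Φ := hI.mono' hc.aestronglyMeasurable (ae_of_all _ fun y =>
    le_mul_of_one_le_left (norm_nonneg _) (one_le_pow₀ (by linarith [abs_nonneg y])))
  refine ⟨Φ, hΦi, hI, fun ξ => ?_⟩
  have hde : deriv Φ = Ψ := funext fun x => (hd x).deriv
  have := congrFun (Real.fourier_deriv hΦi (fun x => (hd x).differentiableAt) (hde ▸ hi)) ξ
  rw [hde] at this
  rw [this, smul_eq_mul]

lemma exists_fourier_eq_pow_mul (Ψ : 𝓢(ℝ, ℂ)) (k : ℕ) : ∃ χ : 𝓢(ℝ, ℂ),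
    ∀ ξ : ℝ, 𝓕 (χ : ℝ → ℂ) ξ = (2 * π * Complex.I * ξ) ^ k * 𝓕 (Ψ : ℝ → ℂ) ξ := by
  induction k with
  | zero => exact ⟨Ψ, by simp⟩
  | succ k ih =>
    obtain ⟨χ, hχ⟩ := ih
    refine ⟨SchwartzMap.derivCLM ℂ ℂ χ, fun ξ => ?_⟩
    have := congrFun (Real.fourier_deriv χ.integrable χ.differentiable
      (SchwartzMap.derivCLM ℂ ℂ χ).integrable) ξ
    rw [smul_eq_mul, hχ] at this
    rw [pow_succ', mul_assoc, ← this]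
    rfl

/-- The weighted norm with values in the extended reals. -/
noncomputable def qe (Θ : ℝ → ℂ) : ℝ≥0∞ := ∫⁻ y, (1 + ‖y‖ₑ) ^ 16 * ‖Θ y‖ₑ

lemma enorm_weight (Θ : ℝ → ℂ) (y : ℝ) :
    ‖(1 + |y|) ^ 16 * ‖Θ y‖‖ₑ = (1 + ‖y‖ₑ) ^ 16 * ‖Θ y‖ₑ := by
  have := abs_nonneg y
  rw [Real.enorm_of_nonneg (by positivity), ENNReal.ofReal_mul (by positivity), ofReal_norm,
    ENNReal.ofReal_pow (by positivity), ENNReal.ofReal_add zero_le_one (by positivity),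
    ← Real.norm_eq_abs, ofReal_norm, ENNReal.ofReal_one]

lemma ofReal_qn_le (Θ : ℝ → ℂ) : ENNReal.ofReal (qn Θ) ≤ qe Θ := by
  rw [← Real.enorm_of_nonneg (qn_nonneg Θ)]
  exact (enorm_integral_le_lintegral_enorm _).trans (le_of_eq (by simp_rw [enorm_weight]; rfl))

lemma qe_ne_top {Θ : ℝ → ℂ} (h : Integrable fun y => (1 + |y|) ^ 16 * ‖Θ y‖) : qe Θ ≠ ∞ := by
  have := h.2
  simp_rw [HasFiniteIntegral, enorm_weight] at this
  exact this.ne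

/-- The weighted norm of a dilated convolution. -/
lemma qe_convolution_le {χ : ℝ → ℂ} (hχ : AEStronglyMeasurable χ volume) (γ : 𝓢(ℝ, ℂ)) {l : ℝ}
    {L : ℝ≥0∞} (h1 : 1 ≤ L) (hL : ‖l‖ₑ ≤ L) :
    qe (fun y => ∫ u, χ u * γ (y - l * u)) ≤ L ^ 16 * (qe χ * qe γ) := by
  have hγ := γ.continuous
  calc _ ≤ ∫⁻ y, ∫⁻ u, (1 + ‖y‖ₑ) ^ 16 * (‖χ u‖ₑ * ‖γ (y - l * u)‖ₑ) := by
        refine lintegral_mono fun y => ?_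
        rw [lintegral_const_mul' _ _ (by simp)]
        gcongr
        exact (enorm_integral_le_lintegral_enorm _).trans (le_of_eq (by simp_rw [enorm_mul]))
    _ = ∫⁻ u, ∫⁻ y, (1 + ‖y‖ₑ) ^ 16 * (‖χ u‖ₑ * ‖γ (y - l * u)‖ₑ) := by
        refine lintegral_lintegral_swap ?_
        refine AEMeasurable.mul (by fun_prop) (AEMeasurable.mul hχ.enorm.comp_snd
          (Continuous.measurable (by fun_prop)).aemeasurable)
    _ = ∫⁻ u, ∫⁻ y, (1 + ‖y + l * u‖ₑ) ^ 16 * (‖χ u‖ₑ * ‖γ y‖ₑ) := by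
        refine lintegral_congr fun u => ?_
        rw [← lintegral_add_right_eq_self _ (l * u)]
        simp
    _ ≤ ∫⁻ u, ∫⁻ y, (L ^ 16 * ((1 + ‖u‖ₑ) ^ 16 * ‖χ u‖ₑ)) * ((1 + ‖y‖ₑ) ^ 16 * ‖γ y‖ₑ) := by
        refine lintegral_mono fun u => lintegral_mono fun y => ?_
        have : 1 + ‖y + l * u‖ₑ ≤ L * ((1 + ‖u‖ₑ) * (1 + ‖y‖ₑ)) := by
          calc 1 + ‖y + l * u‖ₑ ≤ 1 + (‖y‖ₑ + ‖l‖ₑ * ‖u‖ₑ) := by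
                gcongr; rw [← enorm_mul]; exact enorm_add_le _ _
            _ ≤ L * 1 + (L * ‖y‖ₑ + L * ‖u‖ₑ) := by
                gcongr
                · simpa
                · exact le_mul_of_one_le_left' h1
            _ ≤ L * 1 + (L * ‖y‖ₑ + L * ‖u‖ₑ) + L * (‖u‖ₑ * ‖y‖ₑ) := le_self_add
            _ = _ := by ring
        calc _ ≤ (L * ((1 + ‖u‖ₑ) * (1 + ‖y‖ₑ))) ^ 16 * (‖χ u‖ₑ * ‖γ y‖ₑ) := by
              gcongr
          _ = _ := by ring
    _ = _ := by
        have h2 : Measurable fun y => (1 + ‖y‖ₑ) ^ 16 * ‖γ y‖ₑ := by fun_prop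
        simp_rw [lintegral_const_mul _ h2]
        change ∫⁻ u, _ * qe γ = _
        have h3 : AEMeasurable fun u => (1 + ‖u‖ₑ) ^ 16 * ‖χ u‖ₑ :=
          AEMeasurable.mul (by fun_prop) hχ.enorm
        rw [lintegral_mul_const'' _ (h3.const_mul _), lintegral_const_mul'' _ h3, mul_assoc]
        rfl

lemma ift_mul_fourier {χ : ℝ → ℂ} (hχ : Integrable χ) (γ : 𝓢(ℝ, ℂ)) (l y : ℝ) :
    ift (fun ξ => 𝓕 (γ : ℝ → ℂ) ξ * 𝓕 χ (l * ξ)) y = ∫ u, χ u * γ (y - l * u) := by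
  have hex := continuous_ex
  have h1 : ∀ u, χ u * γ (y - l * u) =
      ∫ ξ, χ u * 𝓕 (γ : ℝ → ℂ) ξ * (ex (-(u * (l * ξ))) * ex (ξ * y)) := fun u => by
    conv_lhs => rw [← ift_fourier γ]
    rw [ift, ← integral_const_mul]
    refine integral_congr_ae (ae_of_all _ fun ξ => ?_)
    simp only
    rw [← ex_add, show -(u * (l * ξ)) + ξ * y = ξ * (y - l * u) by ring, mul_assoc]
  simp_rw [h1]
  rw [integral_integral_swap]
  · refine integral_congr_ae (ae_of_all _ fun ξ => ?_)
    simp only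
    rw [fourier_eq_ex χ, ← integral_const_mul, ← integral_mul_const]
    refine integral_congr_ae (ae_of_all _ fun u => ?_)
    simp only; ring
  · exact (hχ.mul_prod (integrable_fourier γ)).mul_bdd (c := 1)
      (Continuous.aestronglyMeasurable (by fun_prop)) (ae_of_all _ fun p => by simp)

/-- A cutoff to low frequencies. -/
noncomputable def lowCut : ContDiffBump (0 : ℝ) := ⟨16, 32, by norm_num, by norm_num⟩

/-- A cutoff to an annulus of frequencies. -/
noncomputable def annCut (ξ : ℝ) : ℝ := lowCut (ξ / 2) - lowCut ξ

lemma lowCut_eq_one {ξ : ℝ} (h : |ξ| ≤ 16) : lowCut ξ = 1 :=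
  lowCut.one_of_mem_closedBall (by simpa [lowCut] using h)

lemma lowCut_eq_zero {ξ : ℝ} (h : 32 ≤ |ξ|) : lowCut ξ = 0 :=
  lowCut.zero_of_le_dist (by simpa [lowCut] using h)

lemma annCut_eq_zero_of_le {ξ : ℝ} (h : |ξ| ≤ 16) : annCut ξ = 0 := by
  rw [annCut, lowCut_eq_one h, lowCut_eq_one, sub_self]
  rw [abs_div, abs_two]; linarith [abs_nonneg ξ]

lemma annCut_eq_zero_of_ge {ξ : ℝ} (h : 64 ≤ |ξ|) : annCut ξ = 0 := by
  rw [annCut, lowCut_eq_zero (by linarith : 32 ≤ |ξ|), lowCut_eq_zero, sub_self]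
  rw [abs_div, abs_two]; linarith

lemma contDiff_annCut : ContDiff ℝ (⊤ : ℕ∞) annCut :=
  (lowCut.contDiff.comp (contDiff_id.div_const 2)).sub lowCut.contDiff

/-- Schwartz functions are obtained by localizing a symbol to an annulus. -/
lemma exists_fourier_eq_mul_annCut {m : ℝ → ℂ} (hm : ∀ ξ ≠ 0, ContDiffAt ℝ (⊤ : ℕ∞) m ξ) :
    ∃ γ : 𝓢(ℝ, ℂ), ∀ ξ, 𝓕 (γ : ℝ → ℂ) ξ = m ξ * annCut ξ := by
  have hs : HasCompactSupport fun ξ => m ξ * (annCut ξ : ℂ) := by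
    refine HasCompactSupport.of_support_subset_isCompact (isCompact_Icc (a := (-64 : ℝ)) (b := 64))
      fun ξ hξ => ?_
    rw [mem_Icc, ← abs_le]
    by_contra! h
    exact hξ (by simp only [annCut_eq_zero_of_ge h.le, Complex.ofReal_zero, mul_zero])
  have hc : ContDiff ℝ (⊤ : ℕ∞) fun ξ => m ξ * (annCut ξ : ℂ) := by
    refine contDiff_iff_contDiffAt.2 fun ξ => ?_
    rcases eq_or_ne ξ 0 with rfl | h
    · refine (contDiffAt_const (c := (0 : ℂ))).congr_of_eventuallyEq ?_
      filter_upwards [Metric.ball_mem_nhds (0 : ℝ) (by norm_num : (0 : ℝ) < 16)] with ξ hξ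
      rw [annCut_eq_zero_of_le (by simpa using (mem_ball_zero_iff.1 hξ).le), Complex.ofReal_zero,
        mul_zero]
    · exact (hm ξ h).mul (Complex.ofRealCLM.contDiff.comp contDiff_annCut).contDiffAt
  refine ⟨𝓕⁻ (hs.toSchwartzMap hc), fun ξ => ?_⟩
  have h : 𝓕 (𝓕⁻ (hs.toSchwartzMap hc)) = hs.toSchwartzMap hc :=
    FourierTransform.fourier_fourierInv_eq _
  exact congrArg (fun F : 𝓢(ℝ, ℂ) => F ξ) h

lemma qe_le_of_fourier {χ : ℝ → ℂ} (hχ : Integrable χ) (γ Θ : 𝓢(ℝ, ℂ)) {a : ℂ} {l : ℝ} {L : ℝ≥0∞}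
    (h1 : 1 ≤ L) (hL : ‖l‖ₑ ≤ L)
    (h : ∀ ξ, 𝓕 (Θ : ℝ → ℂ) ξ = a * (𝓕 (γ : ℝ → ℂ) ξ * 𝓕 χ (l * ξ))) :
    qe Θ ≤ ‖a‖ₑ * (L ^ 16 * (qe χ * qe γ)) := by
  have h2 : (Θ : ℝ → ℂ) = fun y => a * ∫ u, χ u * γ (y - l * u) := by
    ext y
    rw [← ift_mul_fourier hχ, ← ift_fourier Θ, ift, ift, ← integral_const_mul]
    simp_rw [h, mul_assoc]
  rw [h2]
  refine le_trans (le_of_eq ?_) (mul_le_mul_right (qe_convolution_le hχ.1 γ h1 hL) _)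
  rw [qe, qe, ← lintegral_const_mul' _ _ (by simp)]
  refine lintegral_congr fun y => ?_
  rw [enorm_mul]; ring

/-- The decay of the pieces of a kernel with mean zero. -/
lemma exists_qn_le (Ψ : 𝓢(ℝ, ℂ)) (hΨ : ∫ y, Ψ y = 0) : ∃ C : ℝ≥0∞, C ≠ ∞ ∧
    ∀ l : ℝ, 0 < l → ∀ Θ : 𝓢(ℝ, ℂ), (∀ ξ, 𝓕 (Θ : ℝ → ℂ) ξ = 𝓕 (Ψ : ℝ → ℂ) (l * ξ) * annCut ξ) →
      ENNReal.ofReal (qn Θ) ≤ C * ENNReal.ofReal (min l l⁻¹) := by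
  obtain ⟨Φ, hΦ, hΦ', hF⟩ := exists_primitive Ψ hΨ
  obtain ⟨χ, hχ⟩ := exists_fourier_eq_pow_mul Ψ 17
  have hs : ContDiff ℝ (⊤ : ℕ∞) fun ξ : ℝ => 2 * π * Complex.I * (ξ : ℂ) :=
    contDiff_const.mul Complex.ofRealCLM.contDiff
  have hz : ∀ ξ : ℝ, ξ ≠ 0 → 2 * π * Complex.I * (ξ : ℂ) ≠ 0 := fun ξ hξ => by
    simp [hξ, Real.pi_ne_zero]
  obtain ⟨γ, hγ⟩ := exists_fourier_eq_mul_annCut (m := fun ξ : ℝ => 2 * π * Complex.I * (ξ : ℂ))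
    fun ξ _ => hs.contDiffAt
  obtain ⟨γ', hγ'⟩ := exists_fourier_eq_mul_annCut
    (m := fun ξ : ℝ => ((2 * π * Complex.I * (ξ : ℂ)) ^ 17)⁻¹)
    fun ξ hξ => (hs.pow 17).contDiffAt.inv (pow_ne_zero _ (hz ξ hξ))
  have hq : ∀ γ : 𝓢(ℝ, ℂ), qe γ ≠ ∞ := fun γ => qe_ne_top (integrable_qn γ)
  refine ⟨qe Φ * qe γ + qe χ * qe γ', ENNReal.add_ne_top.2
    ⟨ENNReal.mul_ne_top (qe_ne_top hΦ') (hq γ), ENNReal.mul_ne_top (hq χ) (hq γ')⟩,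
    fun l hl Θ hΘ => (ofReal_qn_le Θ).trans ?_⟩
  rcases le_total l 1 with h1 | h1
  · have := qe_le_of_fourier hΦ γ Θ (a := l) (l := l) (L := 1) le_rfl
      (by rw [Real.enorm_of_nonneg hl.le]; simpa using h1) fun ξ => by
        rw [hΘ, hF, hγ]; push_cast; ring
    rw [min_eq_left (h1.trans ((one_le_inv₀ hl).2 h1))]
    refine this.trans ?_
    rw [one_pow, one_mul, mul_comm, ← Real.enorm_of_nonneg hl.le]
    gcongr
    · exact le_self_add
    · simp [enorm_eq_nnnorm]
  · have := qe_le_of_fourier χ.integrable γ' Θ (a := ((l⁻¹ ^ 17 : ℝ) : ℂ)) (l := l)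
      (L := ENNReal.ofReal l) (by simpa using h1) (Real.enorm_of_nonneg hl.le).le fun ξ => by
        rcases eq_or_ne ξ 0 with rfl | hξ
        · rw [hΘ, hγ', annCut_eq_zero_of_le (by norm_num)]; simp
        · have hl' : (l : ℂ) ≠ 0 := by exact_mod_cast hl.ne'
          have hξ' : (ξ : ℂ) ≠ 0 := by exact_mod_cast hξ
          rw [hΘ, hγ', hχ]; push_cast
          rw [show 2 * π * Complex.I * ((l : ℂ) * ξ) = l * (2 * π * Complex.I * ξ) by ring]
          field_simp
    rw [min_eq_right ((inv_le_one₀ hl).2 h1 |>.trans h1)]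
    refine this.trans ?_
    have h2 : ‖((l⁻¹ ^ 17 : ℝ) : ℂ)‖ₑ * ENNReal.ofReal l ^ 16 = ENNReal.ofReal l⁻¹ := by
      rw [← ofReal_norm, Complex.norm_real, Real.norm_of_nonneg (by positivity),
        ← ENNReal.ofReal_pow hl.le, ← ENNReal.ofReal_mul (by positivity)]
      congr 1
      field_simp
    rw [← mul_assoc, h2, mul_comm]
    gcongr
    exact le_add_self

lemma sum_annCut (v : ℝ) (N : ℕ) : ∑ j ∈ Finset.Ico (-N : ℤ) N, annCut (2 ^ j * v) =
    lowCut (2 ^ (-N - 1 : ℤ) * v) - lowCut (2 ^ (N - 1 : ℤ) * v) := by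
  have h : ∀ j : ℤ, annCut (2 ^ j * v) = lowCut (2 ^ (j - 1) * v) - lowCut (2 ^ j * v) := fun j => by
    rw [annCut, zpow_sub_one₀ two_ne_zero]
    congr 2; ring
  induction N with
  | zero => simp
  | succ N ih =>
    have h1 : Finset.Ico (-(N + 1 : ℕ) : ℤ) ((N + 1 : ℕ) : ℤ) =
        insert (-N - 1 : ℤ) (insert (N : ℤ) (Finset.Ico (-N : ℤ) N)) := by
      ext j; simp only [Finset.mem_Ico, Finset.mem_insert]; omega
    rw [h1, Finset.sum_insert (by simp), Finset.sum_insert (by simp), ih, h, h]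
    push_cast
    rw [show (-((N : ℤ) + 1) - 1) = -N - 1 - 1 by ring, show (N : ℤ) + 1 - 1 = N by ring]
    ring

lemma abs_sum_annCut_le (v : ℝ) (N : ℕ) :
    |∑ j ∈ Finset.Ico (-N : ℤ) N, annCut (2 ^ j * v)| ≤ 1 := by
  rw [sum_annCut, abs_le]
  constructor <;>
  linarith [lowCut.nonneg (x := 2 ^ (-N - 1 : ℤ) * v), lowCut.nonneg (x := 2 ^ (N - 1 : ℤ) * v),
    lowCut.le_one (x := 2 ^ (-N - 1 : ℤ) * v), lowCut.le_one (x := 2 ^ (N - 1 : ℤ) * v)]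

open Filter Topology in
lemma eventually_sum_annCut {v : ℝ} (hv : v ≠ 0) :
    ∀ᶠ N : ℕ in atTop, ∑ j ∈ Finset.Ico (-N : ℤ) N, annCut (2 ^ j * v) = 1 := by
  obtain ⟨N₀, hN₀⟩ := pow_unbounded_of_one_lt (max (|v|) (64 / |v|)) one_lt_two
  have hv' := abs_pos.2 hv
  filter_upwards [eventually_ge_atTop N₀] with N hN
  have hN' : max (|v|) (64 / |v|) < (2 : ℝ) ^ N :=
    hN₀.trans_le (pow_le_pow_right₀ one_le_two hN)
  have h1 := (le_max_left _ _).trans_lt hN'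
  have h2 := (le_max_right _ _).trans_lt hN'
  rw [div_lt_iff₀ hv'] at h2
  rw [sum_annCut, lowCut_eq_one, lowCut_eq_zero, sub_zero]
  · rw [abs_mul, abs_of_pos (by positivity), zpow_sub_one₀ two_ne_zero, zpow_natCast]
    linarith
  · rw [abs_mul, abs_of_pos (by positivity), zpow_sub_one₀ two_ne_zero, zpow_neg, zpow_natCast,
      mul_right_comm, inv_mul_eq_div]
    have := (div_lt_one (by positivity : (0 : ℝ) < 2 ^ N)).2 h1
    linarith

open Filter Topology in
/-- The decomposition of a bilinear average with mean zero kernel. -/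
lemma enorm_bt_le_tsum (Ψ : 𝓢(ℝ, ℂ)) (hΨ : ∫ y, Ψ y = 0) (Θ : ℤ → 𝓢(ℝ, ℂ))
    (hΘ : ∀ j ξ, 𝓕 (Θ j : ℝ → ℂ) ξ = 𝓕 (Ψ : ℝ → ℂ) (2 ^ (-j) * ξ) * annCut ξ)
    (f g : 𝓢(ℝ, ℂ)) (n : ℤ) (x : ℝ) :
    ‖bt Ψ (2 ^ n) f g x‖ₑ ≤ ∑' j : ℤ, ‖bt (Θ j) (2 ^ (n + j)) f g x‖ₑ := by
  have hF := integrable_fourier f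
  have hG := integrable_fourier g
  set D : ℝ × ℝ → ℂ := fun z => 𝓕 (f : ℝ → ℂ) z.1 * 𝓕 (g : ℝ → ℂ) z.2 * ex ((z.1 + z.2) * x) with hD
  have hbt : ∀ (Θ : 𝓢(ℝ, ℂ)) (l : ℝ), bt Θ l f g x =
      ∫ z : ℝ × ℝ, D z * 𝓕 (Θ : ℝ → ℂ) (l * (z.1 - z.2)) := fun Θ l => by
    rw [← bt_ift hF hG Θ.integrable, ift_fourier, ift_fourier]
  have hint : ∀ (Θ : 𝓢(ℝ, ℂ)) (l : ℝ),
      Integrable fun z : ℝ × ℝ => D z * 𝓕 (Θ : ℝ → ℂ) (l * (z.1 - z.2)) := fun Θ l =>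
    integrable_bt_ift hF hG (m := fun z => 𝓕 (Θ : ℝ → ℂ) (l * (z.1 - z.2)))
      ((continuous_fourier Θ).comp (by fun_prop)) (fun z => norm_fourier_le _ _) x
  have hsum : ∀ N : ℕ, ∑ j ∈ Finset.Ico (-N : ℤ) N, bt (Θ j) (2 ^ (n + j)) f g x =
      ∫ z : ℝ × ℝ, (D z * 𝓕 (Ψ : ℝ → ℂ) (2 ^ n * (z.1 - z.2))) *
        ((∑ j ∈ Finset.Ico (-N : ℤ) N, annCut (2 ^ j * (2 ^ n * (z.1 - z.2))) : ℝ) : ℂ) := by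
    intro N
    simp_rw [hbt]
    rw [← integral_finsetSum _ fun j _ => hint (Θ j) _]
    refine integral_congr_ae (ae_of_all _ fun z => ?_)
    simp only
    push_cast
    rw [Finset.mul_sum]
    refine Finset.sum_congr rfl fun j _ => ?_
    rw [hΘ, ← mul_assoc (2 ^ (-j)), ← zpow_add₀ two_ne_zero, ← mul_assoc (2 ^ j),
      ← zpow_add₀ two_ne_zero, neg_add_eq_sub, add_sub_cancel_right, add_comm j n]
    ring
  have hlim : Tendsto (fun N : ℕ => ∑ j ∈ Finset.Ico (-N : ℤ) N, bt (Θ j) (2 ^ (n + j)) f g x) atTop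
      (𝓝 (bt Ψ (2 ^ n) f g x)) := by
    rw [hbt]
    simp_rw [hsum]
    refine tendsto_integral_of_dominated_convergence
      (fun z => ‖D z * 𝓕 (Ψ : ℝ → ℂ) (2 ^ n * (z.1 - z.2))‖) (fun N => ?_) (hint Ψ _).norm
      (fun N => ae_of_all _ fun z => ?_) (ae_of_all _ fun z => ?_)
    · refine (hint Ψ _).1.mul (Continuous.aestronglyMeasurable ?_)
      have := contDiff_annCut.continuous
      fun_prop
    · rw [norm_mul, Complex.norm_real]
      exact mul_le_of_le_one_right (norm_nonneg _) (abs_sum_annCut_le _ _)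
    · rcases eq_or_ne (2 ^ n * (z.1 - z.2)) 0 with h | h
      · have h0 : 𝓕 (Ψ : ℝ → ℂ) 0 = 0 := by rw [fourier_eq_ex]; simpa using hΨ
        simp [h, h0]
      · refine tendsto_const_nhds.congr' ?_
        filter_upwards [eventually_sum_annCut h] with N hN
        rw [hN]; simp
  refine le_of_tendsto hlim.enorm (Eventually.of_forall fun N => ?_)
  exact (enorm_sum_le _ _).trans (ENNReal.sum_le_tsum _)

/-- Sums of powers in terms of weighted sums. -/
lemma tsum_rpow_le {ι : Type*} (w b : ι → ℝ≥0∞) (hw : ∀ i, w i ≠ 0) (hw' : ∀ i, w i ≠ ∞) {ρ : ℝ}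
    (hρ : 0 < ρ) : (∑' i, b i) ^ ρ ≤ (∑' i, (w i)⁻¹) ^ ρ * ∑' i, w i ^ ρ * b i ^ ρ := by
  have h : ∀ i, b i ≤ (w i)⁻¹ * (∑' i, w i ^ ρ * b i ^ ρ) ^ (1 / ρ) := fun i => by
    rw [mul_comm (w i)⁻¹, ← div_eq_mul_inv, ENNReal.le_div_iff_mul_le (Or.inl (hw i)) (Or.inl (hw' i)), one_div,
      ENNReal.le_rpow_inv_iff hρ, mul_comm, ENNReal.mul_rpow_of_nonneg _ _ hρ.le]
    exact ENNReal.le_tsum i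
  calc _ ≤ (∑' i, (w i)⁻¹ * (∑' i, w i ^ ρ * b i ^ ρ) ^ (1 / ρ)) ^ ρ := by
        gcongr with i; exact h i
    _ = _ := by
        rw [ENNReal.tsum_mul_right, ENNReal.mul_rpow_of_nonneg _ _ hρ.le, one_div,
          ENNReal.rpow_inv_rpow hρ.ne']

lemma tsum_two_rpow_ne_top {θ : ℝ} (hθ : 0 < θ) :
    ∑' j : ℤ, (2 : ℝ≥0∞) ^ (-(θ * |(j : ℝ)|)) ≠ ∞ := by
  have h1 : ∀ j : ℤ, (2 : ℝ≥0∞) ^ (-(θ * |(j : ℝ)|)) =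
      ENNReal.ofReal ((2 : ℝ) ^ (-(θ * |(j : ℝ)|))) := fun j => by
    rw [← ENNReal.ofReal_rpow_of_pos two_pos]; simp
  have h2 : Summable fun n : ℕ => (2 : ℝ) ^ (-(θ * |(n : ℝ)|)) := by
    have := summable_geometric_of_lt_one (r := (2 : ℝ) ^ (-θ)) (by positivity)
      (Real.rpow_lt_one_of_one_lt_of_neg one_lt_two (by linarith))
    refine this.congr fun n => ?_
    rw [← Real.rpow_mul_natCast two_pos.le, Nat.abs_cast, neg_mul]
  simp_rw [h1]
  refine Summable.tsum_ofReal_ne_top (Summable.of_nat_of_neg ?_ ?_)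
  · simpa using h2
  · simpa using h2

lemma sqf_le_tsum (Ψ : 𝓢(ℝ, ℂ)) (hΨ : ∫ y, Ψ y = 0) (Θ : ℤ → 𝓢(ℝ, ℂ))
    (hΘ : ∀ j ξ, 𝓕 (Θ j : ℝ → ℂ) ξ = 𝓕 (Ψ : ℝ → ℂ) (2 ^ (-j) * ξ) * annCut ξ)
    (f g : 𝓢(ℝ, ℂ)) (x : ℝ) :
    sqf Ψ f g x ≤ (∑' j : ℤ, (2 : ℝ≥0∞) ^ (-(1 / 4 * |(j : ℝ)|))) ^ (2 : ℝ) *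
      ∑' j : ℤ, (2 : ℝ≥0∞) ^ (1 / 2 * |(j : ℝ)|) * sqf (Θ j) f g x := by
  calc sqf Ψ f g x ≤ ∑' n : ℤ, (∑' j : ℤ, (2 : ℝ≥0∞) ^ (-(1 / 4 * |(j : ℝ)|))) ^ (2 : ℝ) *
        ∑' j : ℤ, (2 : ℝ≥0∞) ^ (1 / 2 * |(j : ℝ)|) * ‖bt (Θ j) (2 ^ (n + j)) f g x‖ₑ ^ (2 : ℝ) := by
        refine ENNReal.tsum_le_tsum fun n => ?_
        refine (ENNReal.rpow_le_rpow (enorm_bt_le_tsum Ψ hΨ Θ hΘ f g n x) two_pos.le).trans ?_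
        refine (tsum_rpow_le (fun j : ℤ => (2 : ℝ≥0∞) ^ (1 / 4 * |(j : ℝ)|)) _ (fun j => by simp)
          (fun j => by simp) two_pos).trans_eq ?_
        congr! 4 with j j
        · rw [ENNReal.rpow_neg]
        · rw [← ENNReal.rpow_mul]; congr 1; ring
    _ = _ := by
        rw [ENNReal.tsum_mul_left, ENNReal.tsum_comm]
        congr 1
        refine tsum_congr fun j => ?_
        rw [ENNReal.tsum_mul_left]
        exact congrArg _ ((Equiv.addRight j).tsum_eq fun n : ℤ => ‖bt (Θ j) (2 ^ n) f g x‖ₑ ^ (2 : ℝ))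

lemma measurable_sqf (Θ f g : 𝓢(ℝ, ℂ)) : Measurable (sqf Θ f g) :=
  Measurable.tsum fun _ => ((continuous_bt Θ f g _).measurable.enorm).pow_const _

lemma lintegral_sqf_le {r : ℝ} (hr : 0 < r) (Ψ : 𝓢(ℝ, ℂ)) (hΨ : ∫ y, Ψ y = 0) (Θ : ℤ → 𝓢(ℝ, ℂ))
    (hΘ : ∀ j ξ, 𝓕 (Θ j : ℝ → ℂ) ξ = 𝓕 (Ψ : ℝ → ℂ) (2 ^ (-j) * ξ) * annCut ξ)
    (f g : 𝓢(ℝ, ℂ)) {A : ℝ≥0∞}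
    (hA : ∀ j, ∫⁻ x, sqf (Θ j) f g x ^ (r / 2) ≤ ((2 : ℝ≥0∞) ^ (-|(j : ℝ)|) * A) ^ r) :
    ∫⁻ x, sqf Ψ f g x ^ (r / 2) ≤ ((∑' j : ℤ, (2 : ℝ≥0∞) ^ (-(1 / 4 * |(j : ℝ)|))) ^ (2 : ℝ) *
      ∑' j : ℤ, (2 : ℝ≥0∞) ^ (-(1 / 2 * |(j : ℝ)|))) ^ (r / 2) *
        (∑' j : ℤ, (2 : ℝ≥0∞) ^ (-(r / 2 * |(j : ℝ)|))) * A ^ r := by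
  have hr2 : 0 < r / 2 := by positivity
  have h1 : ∀ x, sqf Ψ f g x ^ (r / 2) ≤
      ((∑' j : ℤ, (2 : ℝ≥0∞) ^ (-(1 / 4 * |(j : ℝ)|))) ^ (2 : ℝ) *
        ∑' j : ℤ, (2 : ℝ≥0∞) ^ (-(1 / 2 * |(j : ℝ)|))) ^ (r / 2) *
      ∑' j : ℤ, (2 : ℝ≥0∞) ^ (r / 2 * |(j : ℝ)|) * sqf (Θ j) f g x ^ (r / 2) := fun x => by
    refine (ENNReal.rpow_le_rpow (sqf_le_tsum Ψ hΨ Θ hΘ f g x) hr2.le).trans ?_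
    rw [ENNReal.mul_rpow_of_nonneg _ _ hr2.le, ENNReal.mul_rpow_of_nonneg _ _ hr2.le, mul_assoc]
    gcongr
    refine (tsum_rpow_le (fun j : ℤ => (2 : ℝ≥0∞) ^ (1 / 2 * |(j : ℝ)|)) _ (fun j => by simp)
      (fun j => by simp) hr2).trans_eq ?_
    congr 1
    · simp_rw [ENNReal.rpow_neg]
    · refine tsum_congr fun j => ?_
      rw [ENNReal.mul_rpow_of_nonneg _ _ hr2.le, ← mul_assoc, ← ENNReal.rpow_mul,
        ← ENNReal.rpow_add _ _ two_ne_zero ENNReal.ofNat_ne_top]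
      congr 2; ring
  have hm : ∀ j, Measurable fun x => sqf (Θ j) f g x ^ (r / 2) := fun j =>
    (measurable_sqf (Θ j) f g).pow_const _
  refine (lintegral_mono h1).trans ?_
  rw [lintegral_const_mul _ (Measurable.tsum fun j => (hm j).const_mul _),
    lintegral_tsum fun j => ((hm j).const_mul _).aemeasurable, mul_assoc, ← ENNReal.tsum_mul_right]
  gcongr with j
  rw [lintegral_const_mul _ (hm j)]
  refine (mul_le_mul_right (hA j) _).trans_eq ?_
  rw [ENNReal.mul_rpow_of_nonneg _ _ hr.le, ← mul_assoc, ← ENNReal.rpow_mul,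
    ← ENNReal.rpow_add _ _ two_ne_zero ENNReal.ofNat_ne_top]
  congr 2; ring

/-- The square function estimate for mean zero kernels. -/
lemma exists_lintegral_sqf_rpow_le {p q r : ℝ≥0∞} (hp : 1 < p) (hq : 1 < q)
    (hr : 1 / r = 1 / p + 1 / q) (hr0 : 0 < 1 / r) (hr1 : 1 / r < 3 / 2) (Ψ : 𝓢(ℝ, ℂ))
    (hΨ : ∫ y, Ψ y = 0) (hR : 0 < r.toReal) : ∃ C : ℝ≥0∞, C ≠ ∞ ∧ ∀ f g : 𝓢(ℝ, ℂ),
      ∫⁻ x, sqf Ψ f g x ^ (r.toReal / 2) ≤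
        (C * (eLpNorm f p volume * eLpNorm g q volume)) ^ r.toReal := by
  obtain ⟨C, hC, H⟩ := exists_lintegral_sqf_le hp hq hr hr0 hr1
  obtain ⟨D, hD, HD⟩ := exists_qn_le Ψ hΨ
  have hΘ : ∀ j : ℤ, ∃ Θ : 𝓢(ℝ, ℂ),
      ∀ ξ, 𝓕 (Θ : ℝ → ℂ) ξ = 𝓕 (Ψ : ℝ → ℂ) (2 ^ (-j) * ξ) * annCut ξ := fun j => by
    refine exists_fourier_eq_mul_annCut (m := fun ξ => 𝓕 (Ψ : ℝ → ℂ) (2 ^ (-j) * ξ)) fun ξ _ => ?_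
    exact (((𝓕 Ψ).smooth _).comp (contDiff_const.mul contDiff_id)).contDiffAt
  choose Θ hΘ using hΘ
  have hmin : ∀ j : ℤ, ENNReal.ofReal (min (2 ^ (-j)) (2 ^ (-j))⁻¹) = (2 : ℝ≥0∞) ^ (-|(j : ℝ)|) :=
    fun j => by
      have h : min ((2 : ℝ) ^ (-j)) (2 ^ (-j))⁻¹ = 2 ^ (-|(j : ℝ)|) := by
        rw [← zpow_neg, ← Real.rpow_intCast, ← Real.rpow_intCast, neg_neg, Int.cast_neg]
        rcases le_total 0 (j : ℝ) with h | h
        · rw [abs_of_nonneg h, min_eq_left (Real.rpow_le_rpow_of_exponent_le one_le_two (by linarith))]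
        · rw [abs_of_nonpos h, neg_neg,
            min_eq_right (Real.rpow_le_rpow_of_exponent_le one_le_two (by linarith))]
      rw [h, ← ENNReal.ofReal_rpow_of_pos two_pos]; simp
  obtain ⟨K, hK, hKe⟩ : ∃ K : ℝ≥0∞, K ≠ ∞ ∧ K ^ r.toReal =
      ((∑' j : ℤ, (2 : ℝ≥0∞) ^ (-(1 / 4 * |(j : ℝ)|))) ^ (2 : ℝ) *
      ∑' j : ℤ, (2 : ℝ≥0∞) ^ (-(1 / 2 * |(j : ℝ)|))) ^ (r.toReal / 2) *
        (∑' j : ℤ, (2 : ℝ≥0∞) ^ (-(r.toReal / 2 * |(j : ℝ)|))) := by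
    refine ⟨_ ^ r.toReal⁻¹, ENNReal.rpow_ne_top_of_nonneg (by positivity) ?_,
      ENNReal.rpow_inv_rpow hR.ne' _⟩
    have := tsum_two_rpow_ne_top (by norm_num : (0 : ℝ) < 1 / 4)
    have := tsum_two_rpow_ne_top (by norm_num : (0 : ℝ) < 1 / 2)
    have := tsum_two_rpow_ne_top (by positivity : 0 < r.toReal / 2)
    exact ENNReal.mul_ne_top (ENNReal.rpow_ne_top_of_nonneg (by positivity) (ENNReal.mul_ne_top
      (ENNReal.rpow_ne_top_of_nonneg two_pos.le ‹_›) ‹_›)) ‹_›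
  refine ⟨K * (C * D), ENNReal.mul_ne_top hK (ENNReal.mul_ne_top hC hD), fun f g => ?_⟩
  have hA : ∀ j : ℤ, ∫⁻ x, sqf (Θ j) f g x ^ (r.toReal / 2) ≤
      ((2 : ℝ≥0∞) ^ (-|(j : ℝ)|) * (C * D * (eLpNorm f p volume * eLpNorm g q volume)))
        ^ r.toReal := fun j => by
    refine (H f g (Θ j) fun ξ hξ => ?_).trans ?_
    · rw [hΘ] at hξ
      by_contra! h
      refine hξ ?_
      rcases le_or_gt 16 |ξ| with h' | h'
      · rw [annCut_eq_zero_of_ge (h h').le]; simp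
      · rw [annCut_eq_zero_of_le h'.le]; simp
    · refine ENNReal.rpow_le_rpow ?_ hR.le
      have := HD (2 ^ (-j)) (by positivity) (Θ j) (hΘ j)
      rw [hmin] at this
      calc _ ≤ C * (D * (2 : ℝ≥0∞) ^ (-|(j : ℝ)|)) *
            (eLpNorm f p volume * eLpNorm g q volume) := by gcongr
        _ = _ := by ring
  refine (lintegral_sqf_le hR Ψ hΨ Θ hΘ f g hA).trans_eq ?_
  rw [← hKe, ← ENNReal.mul_rpow_of_nonneg _ _ hR.le]
  congr 1
  ring

lemma integral_dilate_eq_bt (Ψ f g : 𝓢(ℝ, ℂ)) (n : ℤ) (x : ℝ) :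
    ∫ y : ℝ, f (x - y) * g (x + y) * Ψ (y / 2 ^ n) * (((2 : ℝ) ^ (-n) : ℝ) : ℂ) =
      bt Ψ (2 ^ n) f g x := by
  have h := Measure.integral_comp_mul_left (fun y => f (x - y) * g (x + y) * Ψ (y / 2 ^ n))
    ((2 : ℝ) ^ n)
  have h2 : (2 : ℝ) ^ n ≠ 0 := by positivity
  simp only [mul_div_cancel_left₀ _ h2] at h
  rw [bt, h, integral_mul_const, abs_of_pos (by positivity), zpow_neg, mul_comm, Complex.real_smul]

lemma enorm_sqrt_tsum_le (a : ℤ → ℂ) :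
    ‖Real.sqrt (∑' n : ℤ, ‖a n‖ ^ 2)‖ₑ ^ (2 : ℝ) ≤ ∑' n : ℤ, ‖a n‖ₑ ^ (2 : ℝ) := by
  have h : ∀ n, ‖a n‖ₑ ^ (2 : ℝ) = ENNReal.ofReal (‖a n‖ ^ 2) := fun n => by
    rw [← ofReal_norm, ENNReal.rpow_two, ENNReal.ofReal_pow (norm_nonneg _)]
  have h0 : 0 ≤ ∑' n : ℤ, ‖a n‖ ^ 2 := tsum_nonneg fun n => by positivity
  rw [Real.enorm_of_nonneg (Real.sqrt_nonneg _), ENNReal.rpow_two,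
    ← ENNReal.ofReal_pow (Real.sqrt_nonneg _), Real.sq_sqrt h0]
  simp_rw [h]
  by_cases hs : Summable fun n => ‖a n‖ ^ 2
  · rw [ENNReal.ofReal_tsum_of_nonneg (fun n => by positivity) hs]
  · simp [tsum_eq_zero_of_not_summable hs]

end BSF

/-- **smooth dilated bilinear square function.** For `1 < p, q ≤ ∞`,
`1/r = 1/p + 1/q` with `0 < 1/r < 3/2`, and `Ψ` Schwartz with `∫ Ψ = 0`, the dyadic
smooth bilinear square function maps `L^p × L^q` into `L^r`. -/
theorem bilinear_dilated_square_function
    (p q r : ℝ≥0∞) (hp : 1 < p) (hq : 1 < q)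
    (hr : 1 / r = 1 / p + 1 / q) (hr0 : 0 < 1 / r) (hr1 : 1 / r < 3 / 2)
    (Ψ : SchwartzMap ℝ ℂ) (hΨ : (∫ y : ℝ, Ψ y) = 0) :
    ∃ c : ℝ, 0 < c ∧ ∀ f g : SchwartzMap ℝ ℂ,
      eLpNorm (fun x : ℝ =>
          Real.sqrt (∑' n : ℤ,
            ‖∫ y : ℝ, f (x - y) * g (x + y) * Ψ (y / 2 ^ n) *
                (((2 : ℝ) ^ (-n) : ℝ) : ℂ)‖ ^ 2))
          r volume ≤
        ENNReal.ofReal c * eLpNorm (⇑f) p volume * eLpNorm (⇑g) q volume := by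
  have hrt : r ≠ ∞ := by rintro rfl; simp at hr0
  have hrz : r ≠ 0 := by
    rintro rfl
    have : (3 / 2 : ℝ≥0∞) ≠ ∞ := ENNReal.div_ne_top (by simp) (by simp)
    simp at hr1
  have hR : 0 < r.toReal := ENNReal.toReal_pos hrz hrt
  obtain ⟨C, hC, H⟩ := BSF.exists_lintegral_sqf_rpow_le hp hq hr hr0 hr1 Ψ hΨ hR
  refine ⟨C.toReal + 1, by positivity, fun f g => ?_⟩
  simp_rw [BSF.integral_dilate_eq_bt]
  rw [eLpNorm_eq_lintegral_rpow_enorm_toReal hrz hrt, one_div, ENNReal.rpow_inv_le_iff hR]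
  calc _ ≤ ∫⁻ x, BSF.sqf Ψ f g x ^ (r.toReal / 2) := by
        refine lintegral_mono fun x => ?_
        have := ENNReal.rpow_le_rpow (BSF.enorm_sqrt_tsum_le fun n => BSF.bt Ψ (2 ^ n) f g x)
          (by positivity : 0 ≤ r.toReal / 2)
        rwa [← ENNReal.rpow_mul, mul_div_cancel₀ _ two_ne_zero] at this
    _ ≤ _ := H f g
    _ ≤ _ := by
        rw [mul_assoc]
        gcongr
        rw [ENNReal.le_ofReal_iff_toReal_le hC (by positivity)]
        linarith
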